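/- For every A > 0 and ε > 0 there is a constant C such that the following holds for every sufficiently large odd n and every D with 1 ≤ D ≤ n^{1/5−ε}. For D < k ≤ 2D let T(k) denote the number of admissible pairs b₁, b₂ mod k for which R₃(n) = 0 (with b₃ ≡ n − b₁ − b₂ (mod k)), and let K_D := #{ k : D < k ≤ 2D and T(k) ≥ A(k)·(log n)^{−A} }. Then K_D ≤ C · D · (log n)^{−A}. -/

import Mathlib

open Finset MeasureTheory

noncomputable section

/-- `e x = e^{2πix}`. -/
def e (x : ℝ) : ℂ := Complex.exp (2 * Real.pi * Complex.I * x)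

/-- The exponential sum `S_{b,k}(α) = ∑_{m ≤ n, m ≡ b (k)} Λ(m) e(αm)`. -/
def S (n k b : ℕ) (α : ℝ) : ℂ :=
  ∑ m ∈ Finset.Icc 1 n,
    if m % k = b % k then (ArithmeticFunction.vonMangoldt m : ℂ) * e (α * m) else 0

/-- `J₃(n) = ∑_{m₁+m₂+m₃=n, mᵢ ≡ bᵢ (k)} Λ(m₁)Λ(m₂)Λ(m₃)`. -/
def J3 (n k b1 b2 b3 : ℕ) : ℝ :=
  ∑ m1 ∈ Finset.Icc 1 n, ∑ m2 ∈ Finset.Icc 1 n, ∑ m3 ∈ Finset.Icc 1 n,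
    if m1 + m2 + m3 = n ∧ m1 % k = b1 % k ∧ m2 % k = b2 % k ∧ m3 % k = b3 % k then
      ArithmeticFunction.vonMangoldt m1 * ArithmeticFunction.vonMangoldt m2 *
        ArithmeticFunction.vonMangoldt m3
    else 0

/-- `R₃(n) = ∑_{p₁+p₂+p₃=n, pᵢ ≡ bᵢ (k), pᵢ prime} log p₁ log p₂ log p₃`. -/
def R3 (n k b1 b2 b3 : ℕ) : ℝ :=
  ∑ p1 ∈ Finset.Icc 1 n, ∑ p2 ∈ Finset.Icc 1 n, ∑ p3 ∈ Finset.Icc 1 n,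
    if p1.Prime ∧ p2.Prime ∧ p3.Prime ∧ p1 + p2 + p3 = n ∧
        p1 % k = b1 % k ∧ p2 % k = b2 % k ∧ p3 % k = b3 % k then
      Real.log p1 * Real.log p2 * Real.log p3
    else 0

/-- The singular series `𝔖(n,k)`. -/
def SingularSeries (n k : ℕ) : ℝ :=
  (if Odd k then 2 else 8)
    * ∏ p ∈ k.primeFactors.filter (fun p => p ≠ 2), (p : ℝ) ^ 3 / (((p : ℝ) - 1) ^ 3 + 1)
    * ∏ p ∈ n.primeFactors.filter (fun p => p ≠ 2 ∧ ¬ p ∣ k),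
        (((p : ℝ) - 1) * (((p : ℝ) - 1) ^ 2 - 1)) / (((p : ℝ) - 1) ^ 3 + 1)
    * ∏' p : Nat.Primes, if 2 < (p : ℕ) then 1 + 1 / (((p : ℕ) : ℝ) - 1) ^ 3 else 1

/-- The residue `b₃` with `b₃ ≡ n - b₁ - b₂ (mod k)`, `0 ≤ b₃ < k`. -/
def bthree (n k b1 b2 : ℕ) : ℕ := (((n : ℤ) - b1 - b2) % (k : ℤ)).toNat

/-- The reduced residues `0 ≤ b < k`, `(b,k) = 1`. -/
def redRes (k : ℕ) : Finset ℕ := (Finset.range k).filter (fun b => Nat.Coprime b k)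

/-- For fixed `b₁`, the admissible `b₂` mod `k`:
reduced residues with `(n - b₁ - b₂, k) = 1`. -/
def admFor (n k b1 : ℕ) : Finset ℕ :=
  (redRes k).filter (fun b2 => Int.gcd ((n : ℤ) - b1 - b2) k = 1)

/-- The admissible pairs `b₁, b₂` of reduced residues mod `k`. -/
def admPairs (n k : ℕ) : Finset (ℕ × ℕ) :=
  (redRes k ×ˢ redRes k).filter (fun b => Int.gcd ((n : ℤ) - b.1 - b.2) k = 1)

/-- The admissible triplets `b₁, b₂, b₃` of reduced residues mod `k`:
`n ≡ b₁ + b₂ + b₃ (mod k)`. -/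
def admTriplets (n k : ℕ) : Finset (ℕ × ℕ × ℕ) :=
  (Finset.range k ×ˢ Finset.range k ×ˢ Finset.range k).filter
    (fun b => Nat.Coprime b.1 k ∧ Nat.Coprime b.2.1 k ∧ Nat.Coprime b.2.2 k ∧
      n % k = (b.1 + b.2.1 + b.2.2) % k)

/-- The range `D < k ≤ 2D` of moduli. -/
def kRange (D : ℝ) : Finset ℕ :=
  (Finset.range (⌊2 * D⌋₊ + 1)).filter (fun k => D < (k : ℝ) ∧ (k : ℝ) ≤ 2 * D)

/-- The major arcs `𝔐`. -/
def majorArcs (n : ℕ) (D B : ℝ) : Set ℝ :=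
  ⋃ (q : ℕ) (_ : 1 ≤ q ∧ (q : ℝ) ≤ D * Real.log n ^ B) (a : ℕ)
      (_ : 0 < a ∧ a < q ∧ Nat.Coprime a q),
    Set.Ioo ((a : ℝ) / q - D * Real.log n ^ B / (q * n))
      ((a : ℝ) / q + D * Real.log n ^ B / (q * n))

/-- The minor arcs `𝔪`. -/
def minorArcs (n : ℕ) (D B : ℝ) : Set ℝ :=
  Set.Ioo (-(D * Real.log n ^ B / n)) (1 - D * Real.log n ^ B / n) \ majorArcs n D B

/-- `J₃^𝔐(n)`, the major-arc part of the integral. -/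
def J3M (n k b1 b2 b3 : ℕ) (D B : ℝ) : ℂ :=
  ∫ α in majorArcs n D B, S n k b1 α * S n k b2 α * S n k b3 α * e (-(n * α))

/-- `J₃^𝔪(n)`, the minor-arc part of the integral. -/
def J3m (n k b1 b2 b3 : ℕ) (D B : ℝ) : ℂ :=
  ∫ α in minorArcs n D B, S n k b1 α * S n k b2 α * S n k b3 α * e (-(n * α))

/-- `W₃`: the number of solutions of `p^l + q^j + r^m = n` in primes `p,q,r` and
positive exponents `l,j,m`, at least one exponent being `≥ 2`, with the prime powers in
the residue classes `b₁,b₂,b₃` mod `k`. -/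
def W3 (n k b1 b2 b3 : ℕ) : ℕ :=
  Set.ncard {x : (ℕ × ℕ) × (ℕ × ℕ) × (ℕ × ℕ) |
    x.1.1.Prime ∧ x.2.1.1.Prime ∧ x.2.2.1.Prime ∧
    1 ≤ x.1.2 ∧ 1 ≤ x.2.1.2 ∧ 1 ≤ x.2.2.2 ∧
    (2 ≤ x.1.2 ∨ 2 ≤ x.2.1.2 ∨ 2 ≤ x.2.2.2) ∧
    x.1.1 ^ x.1.2 + x.2.1.1 ^ x.2.1.2 + x.2.2.1 ^ x.2.2.2 = n ∧
    x.1.1 ^ x.1.2 % k = b1 % k ∧ x.2.1.1 ^ x.2.1.2 % k = b2 % k ∧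
    x.2.2.1 ^ x.2.2.2 % k = b3 % k}

/-- `n` has a representation `n = p₁ + p₂ + p₃` in primes with `pᵢ ≡ bᵢ (mod k)`. -/
def HasRep (n k b1 b2 b3 : ℕ) : Prop :=
  ∃ p1 p2 p3 : ℕ, p1.Prime ∧ p2.Prime ∧ p3.Prime ∧ p1 + p2 + p3 = n ∧
    p1 % k = b1 % k ∧ p2 % k = b2 % k ∧ p3 % k = b3 % k

open scoped Classical in
/-- The admissible triplets mod `k` without a representation of `n`. -/
def badTriplets (n k : ℕ) : Finset (ℕ × ℕ × ℕ) :=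
  (admTriplets n k).filter (fun b => ¬ HasRep n k b.1 b.2.1 b.2.2)

open scoped Classical in
/-- `T(k)`: the number of admissible pairs mod `k` with `R₃(n) = 0`. -/
def Tcount (n k : ℕ) : ℕ :=
  ((admPairs n k).filter (fun b => R3 n k b.1 b.2 (bthree n k b.1 b.2) = 0)).card

/-- `‖x‖`, the distance from `x` to the nearest integer. -/
def distNearestInt (x : ℝ) : ℝ := |x - round x|

namespace TG

/-- A bounded sequence with mean value `κ` and bounded (by `K`) error in its summatory function. -/
structure Tame (a : ℕ → ℂ) (κ : ℂ) (K : ℝ) : Prop where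
  zero : a 0 = 0
  norm_le : ∀ m, ‖a m‖ ≤ 1
  mean_le : ‖κ‖ ≤ 1
  one_le : 1 ≤ K
  sum_le : ∀ N : ℕ, ‖∑ k ∈ Icc 1 N, a k - κ * N‖ ≤ K

/-- The error term of the summatory function of `a`. -/
def sumErr (a : ℕ → ℂ) (κ : ℂ) (u : ℝ) : ℂ := ∑ k ∈ Icc 1 ⌊u⌋₊, a k - κ * u

/-- The continuation of `LSeries a s - κ / (s - 1)` to `Re s > 0`. -/
def regL (a : ℕ → ℂ) (κ : ℂ) (s : ℂ) : ℂ :=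
  s * (∫ u in Set.Ioi (1 : ℝ), sumErr a κ u * (u : ℂ) ^ (-(s + 1))) + κ

variable {a : ℕ → ℂ} {κ : ℂ} {K : ℝ}

theorem cpow_one_add' {x : ℂ} (hx : x ≠ 0) (r : ℂ) : x ^ (1 + r) = x * x ^ r := by
  rw [Complex.cpow_add _ _ hx, Complex.cpow_one]

theorem Tame.sumErr_le (h : Tame a κ K) {u : ℝ} (hu : 0 ≤ u) : ‖sumErr a κ u‖ ≤ 2 * K := by
  have h1 := h.sum_le ⌊u⌋₊
  have : sumErr a κ u = (∑ k ∈ Icc 1 ⌊u⌋₊, a k - κ * ⌊u⌋₊) + κ * ((⌊u⌋₊ - u : ℝ) : ℂ) := by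
    unfold sumErr; push_cast; ring
  rw [this]
  have h2 : ‖κ * ((⌊u⌋₊ - u : ℝ) : ℂ)‖ ≤ 1 := by
    rw [norm_mul, Complex.norm_real, Real.norm_eq_abs]
    have : |(⌊u⌋₊ : ℝ) - u| ≤ 1 := by
      rw [abs_le]; constructor <;> linarith [Nat.floor_le hu, Nat.lt_floor_add_one u]
    exact mul_le_one₀ h.mean_le (abs_nonneg _) this
  linarith [norm_add_le (∑ k ∈ Icc 1 ⌊u⌋₊, a k - κ * ⌊u⌋₊) (κ * ((⌊u⌋₊ - u : ℝ) : ℂ)), h.one_le]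

theorem measurable_sumErr : Measurable (sumErr a κ) := by
  unfold sumErr
  refine Measurable.sub ?_ (by fun_prop)
  exact (measurable_from_nat (f := fun n : ℕ => ∑ k ∈ Icc 1 n, a k)).comp Nat.measurable_floor

theorem measurable_cpow_const (s : ℂ) : Measurable (fun u : ℝ => (u : ℂ) ^ s) := by fun_prop

theorem Tame.norm_integrand_le (h : Tame a κ K) {u : ℝ} (hu : 0 < u) (s : ℂ) :
    ‖sumErr a κ u * (u : ℂ) ^ (-(s + 1))‖ ≤ 2 * K * u ^ (-(s.re + 1)) := by
  rw [norm_mul, Complex.norm_cpow_eq_rpow_re_of_pos hu]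
  simp only [Complex.neg_re, Complex.add_re, Complex.one_re]
  gcongr
  exact h.sumErr_le hu.le

theorem Tame.integrableOn (h : Tame a κ K) {s : ℂ} (hs : 0 < s.re) {c : ℝ} (hc : 0 < c) :
    IntegrableOn (fun u : ℝ => sumErr a κ u * (u : ℂ) ^ (-(s + 1))) (Set.Ioi c) := by
  refine Integrable.mono' ((integrableOn_Ioi_rpow_of_lt (a := -(s.re + 1)) (by linarith)
    hc).const_mul (2 * K)) ?_ ?_
  · exact (measurable_sumErr.mul (measurable_cpow_const _)).aestronglyMeasurable
  · filter_upwards [ae_restrict_mem measurableSet_Ioi] with u hu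
    exact h.norm_integrand_le (hc.trans hu) s

theorem Tame.differentiableAt_regL (h : Tame a κ K) {s : ℂ} (hs : 0 < s.re) :
    DifferentiableAt ℂ (regL a κ) s := by
  have key : ∀ s : ℂ, (∫ u in Set.Ioi (1 : ℝ), sumErr a κ u * (u : ℂ) ^ (-(s + 1))) =
      mellin ((Set.Ioi (1 : ℝ)).indicator (sumErr a κ)) (-s) := by
    intro s
    unfold mellin
    have h0 : Set.Ioi (0 : ℝ) ∩ Set.Ioi 1 = Set.Ioi 1 := by
      ext x; simp only [Set.mem_inter_iff, Set.mem_Ioi]; constructor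
      · exact fun h => h.2
      · exact fun h => ⟨by linarith, h⟩
    rw [← h0, ← MeasureTheory.setIntegral_indicator measurableSet_Ioi]
    congr 1
    ext u
    by_cases hu : 1 < u
    · simp [Set.indicator, hu, mul_comm, show -s - 1 = -(s + 1) by ring]
    · simp [Set.indicator, hu]
  unfold regL
  simp_rw [key]
  refine DifferentiableAt.add (differentiableAt_id.mul ?_) (differentiableAt_const _)
  refine DifferentiableAt.comp s (g := mellin _) ?_ differentiableAt_id.neg
  refine mellin_differentiableAt_of_isBigO_rpow (a := 0) (b := -s.re - 1) ?_ ?_ ?_ ?_ ?_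
  · have hm : Measurable ((Set.Ioi (1 : ℝ)).indicator (sumErr a κ)) :=
      measurable_sumErr.indicator measurableSet_Ioi
    refine (MeasureTheory.LocallyIntegrable.mono (f := fun _ : ℝ => 2 * K)
      (locallyIntegrable_const _) hm.aestronglyMeasurable
      (Filter.Eventually.of_forall fun u => ?_)).locallyIntegrableOn _
    have hK := h.one_le
    by_cases hu : 1 < u
    · simp only [Set.indicator, Set.mem_Ioi, hu, if_true]
      rw [Real.norm_of_nonneg (by linarith)]
      exact h.sumErr_le (by linarith)
    · simp [Set.indicator, hu]
  · refine Asymptotics.IsBigO.of_bound (2 * K) ?_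
    filter_upwards [Filter.eventually_gt_atTop 1] with u hu
    simp only [Set.indicator, Set.mem_Ioi, hu, if_true]
    simpa using h.sumErr_le (by linarith : (0 : ℝ) ≤ u)
  · simpa using hs
  · refine Asymptotics.IsBigO.of_bound 1 ?_
    filter_upwards [nhdsWithin_le_nhds (Iio_mem_nhds (show (0 : ℝ) < 1 by norm_num))] with u hu
    have : ¬ (1 < u) := not_lt.mpr (le_of_lt hu)
    simp [Set.indicator, this]
  · simp

theorem Tame.summable (h : Tame a κ K) {s : ℂ} (hs : 1 < s.re) : LSeriesSummable a s :=
  LSeriesSummable_of_bounded_of_one_lt_re (m := 1) (fun n _ => h.norm_le n) hs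

theorem integral_cpow_Ioi_one {s : ℂ} (hs : 1 < s.re) :
    (∫ u in Set.Ioi (1 : ℝ), (u : ℂ) * (u : ℂ) ^ (-(s + 1))) = 1 / (s - 1) := by
  have h1 : ∀ u ∈ Set.Ioi (1 : ℝ), (u : ℂ) * (u : ℂ) ^ (-(s + 1)) = (u : ℂ) ^ (-s) := by
    intro u hu
    have hu0 : (u : ℂ) ≠ 0 := by
      have : (1 : ℝ) < u := hu
      exact_mod_cast (by linarith : u ≠ 0)
    rw [← cpow_one_add' hu0]; congr 1; ring
  rw [setIntegral_congr_fun measurableSet_Ioi h1, integral_Ioi_cpow_of_lt (by simpa using hs)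
    one_pos]
  have : s - 1 ≠ 0 := by
    intro h0; have := congrArg Complex.re h0; simp at this; linarith
  have h2 : -s + 1 ≠ 0 := by
    intro h0; apply this; linear_combination -h0
  simp only [Complex.ofReal_one, Complex.one_cpow]
  field_simp
  ring

theorem Tame.regL_eq (h : Tame a κ K) {s : ℂ} (hs : 1 < s.re) :
    regL a κ s = LSeries a s - κ / (s - 1) := by
  have hO : (fun n : ℕ => ∑ k ∈ Icc 1 n, a k) =O[Filter.atTop] fun n : ℕ => (n : ℝ) ^ (1 : ℝ) := by
    refine Asymptotics.IsBigO.of_bound 1 (Filter.Eventually.of_forall fun n => ?_)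
    refine (norm_sum_le _ _).trans ?_
    refine (Finset.sum_le_sum fun i _ => h.norm_le i).trans ?_
    simp
  rw [LSeries_eq_mul_integral a zero_le_one hs (h.summable hs) hO]
  have hsne : s - 1 ≠ 0 := by
    intro h0; have := congrArg Complex.re h0; simp at this; linarith
  have hi1 : IntegrableOn (fun u : ℝ => (u : ℂ) * (u : ℂ) ^ (-(s + 1))) (Set.Ioi 1) := by
    refine Integrable.mono' (integrableOn_Ioi_rpow_of_lt (a := -s.re) (by linarith)
      one_pos) ?_ ?_
    · exact (Complex.measurable_ofReal.mul (measurable_cpow_const _)).aestronglyMeasurable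
    · filter_upwards [ae_restrict_mem measurableSet_Ioi] with u hu
      have hu : (1 : ℝ) < u := hu
      rw [norm_mul, Complex.norm_cpow_eq_rpow_re_of_pos (by linarith), Complex.norm_real,
        Real.norm_of_nonneg (by linarith)]
      nth_rewrite 1 [← Real.rpow_one u]
      rw [← Real.rpow_add (by linarith)]
      refine le_of_eq ?_
      congr 1
      simp
  have hE := h.integrableOn (s := s) (by linarith) one_pos
  have : (∫ u in Set.Ioi (1 : ℝ), (∑ k ∈ Icc 1 ⌊u⌋₊, a k) * (u : ℂ) ^ (-(s + 1))) =
      (∫ u in Set.Ioi (1 : ℝ), sumErr a κ u * (u : ℂ) ^ (-(s + 1))) + κ * (1 / (s - 1)) := by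
    rw [← integral_cpow_Ioi_one hs, ← integral_const_mul, ← integral_add hE (hi1.const_mul κ)]
    congr 1; ext u; unfold sumErr; ring
  rw [this]
  unfold regL
  field_simp
  ring

/-- Partial integration of the summatory function. -/
theorem integral_sumErr_split (h0 : a 0 = 0) (s : ℂ) {N : ℕ} (hN : 1 ≤ N) :
    s * (∫ u in Set.Ioc (1 : ℝ) N, sumErr a κ u * (u : ℂ) ^ (-(s + 1))) =
      ∑ m ∈ Icc 1 N, a m * (m : ℂ) ^ (-s) - (N : ℂ) ^ (-s) * ∑ m ∈ Icc 1 N, a m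
      - κ * ((∫ u in Set.Ioc (1 : ℝ) N, (u : ℂ) ^ (-s)) - N * (N : ℂ) ^ (-s) + 1) := by
  have hNR : (1 : ℝ) ≤ N := by exact_mod_cast hN
  have hcont : ∀ r : ℂ, ContinuousOn (fun u : ℝ => (u : ℂ) ^ r) (Set.Icc 1 N) := by
    intro r u hu
    refine ContinuousAt.continuousWithinAt ?_
    exact Complex.continuousAt_ofReal_cpow_const _ _ (Or.inr (by linarith [hu.1]))
  have hd : ∀ r : ℂ, ∀ u ∈ Set.Icc (1 : ℝ) N,
      HasDerivAt (fun u : ℝ => (u : ℂ) ^ r) (r * (u : ℂ) ^ (r - 1)) u := by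
    intro r u hu
    have hu0 : u ≠ 0 := by linarith [hu.1]
    by_cases hr : r = 0
    · subst hr; simpa using hasDerivAt_const u (1 : ℂ)
    · exact hasDerivAt_ofReal_cpow_const hu0 hr
  have habel := sum_mul_eq_sub_integral_mul₀' a (f := fun u : ℝ => (u : ℂ) ^ (-s)) h0 N
    (fun t ht => (hd _ t ht).differentiableAt) ?_
  swap
  · refine IntegrableOn.congr_fun (f := fun u : ℝ => -s * (u : ℂ) ^ (-s - 1)) ?_
      (fun u hu => (hd _ u hu).deriv.symm) measurableSet_Icc
    exact ((hcont _).const_smul (-s)).integrableOn_Icc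
  have hIcc : ∀ (g : ℕ → ℂ) (hg : g 0 = 0) (M : ℕ), ∑ k ∈ Icc 0 M, g k = ∑ k ∈ Icc 1 M, g k := by
    intro g hg M
    rw [← Finset.add_sum_Ioc_eq_sum_Icc (Nat.zero_le M), hg, zero_add]; rfl
  rw [hIcc _ (by simp [h0]), hIcc _ h0] at habel
  have h1 : (∫ t in Set.Ioc (1 : ℝ) N, deriv (fun u : ℝ => (u : ℂ) ^ (-s)) t *
      ∑ k ∈ Icc 0 ⌊t⌋₊, a k) = ∫ t in Set.Ioc (1 : ℝ) N, -s * ((∑ k ∈ Icc 1 ⌊t⌋₊, a k) *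
        (t : ℂ) ^ (-(s + 1))) := by
    refine setIntegral_congr_fun measurableSet_Ioc fun t ht => ?_
    rw [(hd _ t ⟨ht.1.le, ht.2⟩).deriv, hIcc _ h0, show -s - 1 = -(s + 1) by ring]
    ring
  rw [h1, integral_const_mul] at habel
  have hFTC : (∫ u in Set.Ioc (1 : ℝ) N, (u : ℂ) ^ (-s)) * (1 - s) = N * (N : ℂ) ^ (-s) - 1 := by
    rw [← intervalIntegral.integral_of_le hNR, ← intervalIntegral.integral_mul_const,
      intervalIntegral.integral_eq_sub_of_hasDerivAt (f := fun u : ℝ => (u : ℂ) ^ (1 - s))]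
    · have : (N : ℂ) ≠ 0 := by exact_mod_cast (by omega : N ≠ 0)
      simp only [Complex.ofReal_natCast, Complex.ofReal_one, Complex.one_cpow]
      rw [← cpow_one_add' this, sub_eq_add_neg (1 : ℂ) s]
    · intro u hu
      rw [Set.uIcc_of_le hNR] at hu
      have := hd (1 - s) u hu
      rwa [show 1 - s - 1 = -s by ring, mul_comm] at this
    · rw [intervalIntegrable_iff_integrableOn_Icc_of_le hNR]
      exact ((hcont _).mul continuousOn_const).integrableOn_Icc
  have hlin : (∫ u in Set.Ioc (1 : ℝ) N, sumErr a κ u * (u : ℂ) ^ (-(s + 1))) =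
      (∫ t in Set.Ioc (1 : ℝ) N, (∑ k ∈ Icc 1 ⌊t⌋₊, a k) * (t : ℂ) ^ (-(s + 1))) -
      κ * ∫ u in Set.Ioc (1 : ℝ) N, (u : ℂ) ^ (-s) := by
    rw [← integral_const_mul, ← integral_sub]
    · refine setIntegral_congr_fun measurableSet_Ioc fun u hu => ?_
      have hu0 : (u : ℂ) ≠ 0 := by exact_mod_cast (by linarith [hu.1] : u ≠ 0)
      have : (u : ℂ) ^ (-s) = u * (u : ℂ) ^ (-(s + 1)) := by
        rw [← cpow_one_add' hu0]; congr 1; ring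
      simp only [sumErr, this]; ring
    · have hc2 := ((hcont (-(s + 1))).integrableOn_Icc (μ := volume)).mono_set
        Set.Ioc_subset_Icc_self
      refine Integrable.bdd_mul (c := ∑ k ∈ Icc 1 N, ‖a k‖) hc2 ?_ ?_
      · exact ((measurable_from_nat (f := fun n : ℕ => ∑ k ∈ Icc 1 n, a k)).comp
          Nat.measurable_floor).aestronglyMeasurable
      · filter_upwards [ae_restrict_mem measurableSet_Ioc] with u hu
        refine (norm_sum_le _ _).trans ?_
        refine Finset.sum_le_sum_of_subset_of_nonneg ?_ fun _ _ _ => norm_nonneg _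
        exact Finset.Icc_subset_Icc_right (by
          have := Nat.floor_le_floor hu.2; simpa using this)
    · exact (((hcont _).integrableOn_Icc (μ := volume)).mono_set
        Set.Ioc_subset_Icc_self).const_mul κ
  rw [hlin]
  simp only [Complex.ofReal_natCast] at habel
  have e1 : ∑ m ∈ Icc 1 N, a m * (m : ℂ) ^ (-s) = ∑ m ∈ Icc 1 N, (m : ℂ) ^ (-s) * a m :=
    Finset.sum_congr rfl fun _ _ => mul_comm _ _
  rw [e1, habel]
  linear_combination κ * hFTC

theorem rpow_neg_le_of_ge {σ δ u : ℝ} {N : ℝ} (h : 1 - δ ≤ σ) (hu : 1 ≤ u) (huN : u ≤ N)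
    (hδ : 0 ≤ δ) : u ^ (-σ) ≤ N ^ δ * u⁻¹ := by
  have hu0 : 0 < u := by linarith
  calc u ^ (-σ) ≤ u ^ (δ - 1) := Real.rpow_le_rpow_of_exponent_le hu (by linarith)
    _ = u ^ δ * u⁻¹ := by rw [Real.rpow_sub hu0, Real.rpow_one]; rfl
    _ ≤ N ^ δ * u⁻¹ := by gcongr

theorem sum_inv_le_one_add_log (N : ℕ) : ∑ m ∈ Icc 1 N, (m : ℝ)⁻¹ ≤ 1 + Real.log N := by
  have := harmonic_le_one_add_log N
  rw [harmonic_eq_sum_Icc] at this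
  push_cast at this
  exact this

theorem Tame.norm_regL_le (h : Tame a κ K) {δ : ℝ} (hδ : 0 < δ) (hδ2 : δ ≤ 1 / 2) {s : ℂ}
    (hs : 1 - δ ≤ s.re) (hs3 : s.re ≤ 4) :
    ‖regL a κ s‖ ≤ (20 + 4 / δ) * (K * (|s.im| + 2)) ^ (2 * δ) := by
  set V := K * (|s.im| + 2) with hV
  have hK := h.one_le
  have hσ : 1 / 2 ≤ s.re := by linarith
  have hVK : K ≤ V := by rw [hV]; nlinarith [abs_nonneg s.im]
  have hV1 : 1 ≤ V := hK.trans hVK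
  set N := ⌈V⌉₊ with hN
  have hNV : V ≤ N := Nat.le_ceil V
  have hN2 : (N : ℝ) ≤ 2 * V := by linarith [Nat.ceil_lt_add_one (zero_le_one.trans hV1)]
  have hN1R : (1 : ℝ) ≤ N := hV1.trans hNV
  have hN1 : 1 ≤ N := by exact_mod_cast hN1R
  have hN0 : (0 : ℝ) < N := by linarith
  have hNpos : 0 ≤ (N : ℝ) ^ δ := by positivity
  have hlog0 : 0 ≤ Real.log N := Real.log_nonneg hN1R
  have hcn : ∀ u : ℝ, 1 ≤ u → u ≤ N → ‖(u : ℂ) ^ (-s)‖ ≤ (N : ℝ) ^ δ * u⁻¹ := by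
    intro u hu huN
    rw [Complex.norm_cpow_eq_rpow_re_of_pos (by linarith)]
    exact rpow_neg_le_of_ge hs hu huN hδ.le
  have hNs : ‖(N : ℂ) ^ (-s)‖ ≤ (N : ℝ) ^ δ * (N : ℝ)⁻¹ := by
    simpa using hcn N hN1R le_rfl
  have b1 : ‖∑ m ∈ Icc 1 N, a m * (m : ℂ) ^ (-s)‖ ≤ (N : ℝ) ^ δ * (1 + Real.log N) := by
    refine (norm_sum_le _ _).trans ?_
    refine le_trans (Finset.sum_le_sum (g := fun m : ℕ => (N : ℝ) ^ δ * (m : ℝ)⁻¹)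
      fun m hm => ?_) ?_
    · rw [Finset.mem_Icc] at hm
      rw [norm_mul]
      have := hcn m (by exact_mod_cast hm.1) (by exact_mod_cast hm.2)
      simp only [Complex.ofReal_natCast] at this
      calc _ ≤ 1 * ‖(m : ℂ) ^ (-s)‖ := by gcongr; exact h.norm_le m
        _ ≤ _ := by rw [one_mul]; exact this
    · rw [← Finset.mul_sum]
      gcongr
      exact sum_inv_le_one_add_log N
  have b2 : ‖∫ u in Set.Ioc (1 : ℝ) N, (u : ℂ) ^ (-s)‖ ≤ (N : ℝ) ^ δ * Real.log N := by
    have hval : (∫ u in Set.Ioc (1 : ℝ) N, (N : ℝ) ^ δ * u⁻¹) = (N : ℝ) ^ δ * Real.log N := by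
      rw [integral_const_mul, ← intervalIntegral.integral_of_le hN1R, integral_inv_of_pos one_pos hN0,
        div_one]
    rw [← hval]
    refine norm_integral_le_of_norm_le ?_ ?_
    · refine Integrable.const_mul ?_ _
      have : ContinuousOn (fun u : ℝ => u⁻¹) (Set.Icc 1 N) :=
        continuousOn_inv₀.mono fun u hu => by
          have := hu.1; simp; linarith
      exact this.integrableOn_Icc.mono_set Set.Ioc_subset_Icc_self
    · filter_upwards [ae_restrict_mem measurableSet_Ioc] with u hu
      exact hcn u hu.1.le hu.2
  have b3 : ‖(N : ℂ) ^ (-s) * (∑ m ∈ Icc 1 N, a m - κ * N)‖ ≤ (N : ℝ) ^ δ := by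
    rw [norm_mul]
    calc _ ≤ ((N : ℝ) ^ δ * (N : ℝ)⁻¹) * N := by
          gcongr
          exact (h.sum_le N).trans (hVK.trans hNV)
      _ = (N : ℝ) ^ δ := by field_simp
  have hsn : ‖s‖ ≤ 2 * (|s.im| + 2) := by
    refine (Complex.norm_le_abs_re_add_abs_im s).trans ?_
    rw [abs_of_nonneg (by linarith)]
    linarith [abs_nonneg s.im]
  have b4 : ‖s * ∫ u in Set.Ioi (N : ℝ), sumErr a κ u * (u : ℂ) ^ (-(s + 1))‖ ≤ 8 * (N : ℝ) ^ δ := by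
    have hval : (∫ u in Set.Ioi (N : ℝ), 2 * K * u ^ (-(s.re + 1))) =
        2 * K * ((N : ℝ) ^ (-s.re) / s.re) := by
      rw [integral_const_mul, integral_Ioi_rpow_of_lt (by linarith) hN0]
      rw [show -(s.re + 1) + 1 = -s.re by ring, neg_div_neg_eq]
    have hb : ‖∫ u in Set.Ioi (N : ℝ), sumErr a κ u * (u : ℂ) ^ (-(s + 1))‖ ≤
        2 * K * ((N : ℝ) ^ (-s.re) / s.re) := by
      rw [← hval]
      refine norm_integral_le_of_norm_le ?_ ?_
      · exact (integrableOn_Ioi_rpow_of_lt (by linarith) hN0).const_mul _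
      · filter_upwards [ae_restrict_mem measurableSet_Ioi] with u hu
        exact h.norm_integrand_le (hN0.trans hu) s
    have hNσ : (N : ℝ) ^ (-s.re) ≤ (N : ℝ) ^ δ * (N : ℝ)⁻¹ :=
      rpow_neg_le_of_ge hs hN1R le_rfl hδ.le
    have hdiv : (N : ℝ) ^ (-s.re) / s.re ≤ 2 * ((N : ℝ) ^ δ * (N : ℝ)⁻¹) := by
      rw [div_le_iff₀ (by linarith)]
      have : 0 ≤ (N : ℝ) ^ δ * (N : ℝ)⁻¹ := by positivity
      nlinarith
    rw [norm_mul]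
    calc _ ≤ (2 * (|s.im| + 2)) * (2 * K * (2 * ((N : ℝ) ^ δ * (N : ℝ)⁻¹))) := by
          gcongr
          exact hb.trans (by gcongr)
      _ = 8 * V * ((N : ℝ) ^ δ * (N : ℝ)⁻¹) := by rw [hV]; ring
      _ ≤ 8 * N * ((N : ℝ) ^ δ * (N : ℝ)⁻¹) := by gcongr
      _ = 8 * (N : ℝ) ^ δ := by field_simp
  have hsplit : regL a κ s = ∑ m ∈ Icc 1 N, a m * (m : ℂ) ^ (-s)
      - (N : ℂ) ^ (-s) * (∑ m ∈ Icc 1 N, a m - κ * N)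
      - κ * (∫ u in Set.Ioc (1 : ℝ) N, (u : ℂ) ^ (-s))
      + s * ∫ u in Set.Ioi (N : ℝ), sumErr a κ u * (u : ℂ) ^ (-(s + 1)) := by
    have hI := h.integrableOn (s := s) (by linarith) one_pos
    unfold regL
    rw [← Set.Ioc_union_Ioi_eq_Ioi hN1R, setIntegral_union (by
      rw [Set.disjoint_left]; intro x hx hx'; exact absurd hx.2 (not_le.mpr hx')) measurableSet_Ioi
      (hI.mono_set Set.Ioc_subset_Ioi_self) (hI.mono_set (Set.Ioi_subset_Ioi hN1R)), mul_add,
      integral_sumErr_split h.zero s hN1]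
    ring
  have hb2' : ‖κ * (∫ u in Set.Ioc (1 : ℝ) N, (u : ℂ) ^ (-s))‖ ≤ (N : ℝ) ^ δ * Real.log N := by
    rw [norm_mul]
    calc _ ≤ 1 * ((N : ℝ) ^ δ * Real.log N) := by gcongr; exact h.mean_le
      _ = _ := one_mul _
  have htot : ‖regL a κ s‖ ≤ (N : ℝ) ^ δ * (10 + 2 * Real.log N) := by
    rw [hsplit]
    refine (norm_add_le _ _).trans ?_
    have := norm_sub_le (∑ m ∈ Icc 1 N, a m * (m : ℂ) ^ (-s)
      - (N : ℂ) ^ (-s) * (∑ m ∈ Icc 1 N, a m - κ * N)) (κ * (∫ u in Set.Ioc (1 : ℝ) N, (u : ℂ) ^ (-s)))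
    have := norm_sub_le (∑ m ∈ Icc 1 N, a m * (m : ℂ) ^ (-s))
      ((N : ℂ) ^ (-s) * (∑ m ∈ Icc 1 N, a m - κ * N))
    linarith
  have hlog : Real.log N ≤ (N : ℝ) ^ δ / δ := Real.log_le_rpow_div hN0.le hδ
  have hN1δ : 1 ≤ (N : ℝ) ^ δ := Real.one_le_rpow hN1R hδ.le
  have h2δ : (N : ℝ) ^ (2 * δ) = (N : ℝ) ^ δ * (N : ℝ) ^ δ := by
    rw [two_mul, Real.rpow_add hN0]
  have hNV2 : (N : ℝ) ^ (2 * δ) ≤ 2 * V ^ (2 * δ) := by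
    calc (N : ℝ) ^ (2 * δ) ≤ (2 * V) ^ (2 * δ) := by gcongr
      _ = 2 ^ (2 * δ) * V ^ (2 * δ) := Real.mul_rpow (by norm_num) (by linarith)
      _ ≤ 2 ^ (1 : ℝ) * V ^ (2 * δ) := by
          gcongr
          · norm_num
          · linarith
      _ = _ := by rw [Real.rpow_one]
  calc ‖regL a κ s‖ ≤ (N : ℝ) ^ δ * (10 + 2 * Real.log N) := htot
    _ ≤ (N : ℝ) ^ δ * (10 * (N : ℝ) ^ δ + 2 * ((N : ℝ) ^ δ / δ)) := by
        gcongr; linarith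
    _ = (10 + 2 / δ) * (N : ℝ) ^ (2 * δ) := by rw [h2δ]; ring
    _ ≤ (10 + 2 / δ) * (2 * V ^ (2 * δ)) := by gcongr
    _ = _ := by ring

theorem regL_bounds {ε : ℝ} (hε : 0 < ε) : ∃ C ≥ (1 : ℝ), ∃ δ > (0 : ℝ), δ ≤ 1 / 4 ∧
    ∀ (a : ℕ → ℂ) (κ : ℂ) (K : ℝ), Tame a κ K → ∀ s : ℂ, 1 - δ ≤ s.re → s.re ≤ 2 →
      ‖regL a κ s‖ ≤ C * (K * (|s.im| + 2)) ^ ε ∧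
      ‖deriv (regL a κ) s‖ ≤ C * (K * (|s.im| + 2)) ^ ε := by
  set δ := min (ε / 2) (1 / 2) with hδ
  have hδ0 : 0 < δ := by positivity
  have hδ2 : δ ≤ 1 / 2 := min_le_right _ _
  have hδε : 2 * δ ≤ ε := by linarith [min_le_left (ε / 2) (1 / 2 : ℝ)]
  set C0 := 20 + 4 / δ with hC0
  have hC00 : 0 < C0 := by positivity
  have hd1 : 1 ≤ 1 / δ := by rw [le_div_iff₀ hδ0]; linarith
  refine ⟨C0 * 2 * (2 / δ), ?_, δ / 2, by positivity, by linarith, ?_⟩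
  · have h4 : 0 < 4 / δ := by positivity
    have : 2 / δ = 2 * (1 / δ) := by ring
    rw [this]
    nlinarith
  intro a κ K h s hs1 hs2
  have hK := h.one_le
  have hV1 : 1 ≤ K * (|s.im| + 2) := by nlinarith [abs_nonneg s.im]
  have hpow : (K * (|s.im| + 2)) ^ (2 * δ) ≤ (K * (|s.im| + 2)) ^ ε :=
    Real.rpow_le_rpow_of_exponent_le hV1 hδε
  have hbig : 2 ≤ 2 * (2 / δ) := by
    have : 2 / δ = 2 * (1 / δ) := by ring
    linarith
  have hp0 : 0 ≤ (K * (|s.im| + 2)) ^ ε := by positivity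
  constructor
  · calc _ ≤ C0 * (K * (|s.im| + 2)) ^ (2 * δ) :=
        h.norm_regL_le hδ0 hδ2 (by linarith) (by linarith)
      _ ≤ C0 * 1 * (K * (|s.im| + 2)) ^ ε := by rw [mul_one]; gcongr
      _ ≤ C0 * 2 * (2 / δ) * (K * (|s.im| + 2)) ^ ε := by
        gcongr ?_ * _
        rw [mul_assoc]
        gcongr
        linarith
  · have hball : ∀ z ∈ Metric.closedBall s (δ / 2), 1 - δ ≤ z.re ∧ z.re ≤ 3 ∧
        |z.im| + 2 ≤ 2 * (|s.im| + 2) := by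
      intro z hz
      rw [Metric.mem_closedBall, dist_eq_norm] at hz
      have h1 := (Complex.abs_re_le_norm (z - s)).trans hz
      have h2 := (Complex.abs_im_le_norm (z - s)).trans hz
      rw [Complex.sub_re] at h1
      rw [Complex.sub_im] at h2
      have h3 : |z.im| ≤ |s.im| + δ / 2 := by
        have := abs_add_le s.im (z.im - s.im)
        rw [add_sub_cancel] at this
        linarith
      rw [abs_le] at h1
      refine ⟨by linarith, by linarith, ?_⟩
      linarith [abs_nonneg s.im]
    have := Complex.norm_deriv_le_of_forall_mem_sphere_norm_le (c := s) (R := δ / 2)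
      (f := regL a κ) (C := C0 * (2 * (K * (|s.im| + 2)) ^ ε)) (by positivity) ?_ ?_
    · refine this.trans (le_of_eq ?_)
      field_simp
    · refine DifferentiableOn.diffContOnCl_ball (U := Metric.closedBall s (δ / 2)) ?_ subset_rfl
      intro z hz
      exact (h.differentiableAt_regL (by linarith [(hball z hz).1])).differentiableWithinAt
    · intro z hz
      have hz' := hball z (Metric.sphere_subset_closedBall hz)
      refine (h.norm_regL_le hδ0 hδ2 hz'.1 (by linarith [hz'.2.1])).trans ?_
      gcongr
      have hz0 : 0 ≤ K * (|z.im| + 2) := by positivity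
      calc (K * (|z.im| + 2)) ^ (2 * δ) ≤ (2 * (K * (|s.im| + 2))) ^ (2 * δ) := by
            refine Real.rpow_le_rpow hz0 ?_ (by positivity)
            nlinarith [hz'.2.2]
        _ = 2 ^ (2 * δ) * (K * (|s.im| + 2)) ^ (2 * δ) := Real.mul_rpow (by norm_num) (by linarith)
        _ ≤ 2 ^ (1 : ℝ) * (K * (|s.im| + 2)) ^ ε := by
            gcongr
            · norm_num
            · linarith
        _ = _ := by rw [Real.rpow_one]

/-- Partial sums of a mean-zero function on `ZMod q` are bounded by `q`. -/
theorem norm_sum_periodic_le {q : ℕ} [NeZero q] (g : ZMod q → ℂ) (hg : ∀ x, ‖g x‖ ≤ 1)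
    (h0 : ∑ x, g x = 0) (N : ℕ) : ‖∑ m ∈ Icc 1 N, g (m : ℕ)‖ ≤ q := by
  have hper : ∀ c : ℕ, ∑ i ∈ range q, g ((c + i : ℕ) : ZMod q) = 0 := by
    intro c
    rw [← h0]
    refine Finset.sum_bij (fun i _ => ((c + i : ℕ) : ZMod q)) (fun _ _ => Finset.mem_univ _)
      ?_ ?_ (fun _ _ => rfl)
    · intro i hi j hj hij
      rw [Finset.mem_range] at hi hj
      push_cast at hij
      have := (ZMod.natCast_eq_natCast_iff' i j q).mp (add_left_cancel hij)
      rwa [Nat.mod_eq_of_lt hi, Nat.mod_eq_of_lt hj] at this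
    · intro x _
      refine ⟨(x - c).val, Finset.mem_range.mpr (ZMod.val_lt _), ?_⟩
      push_cast
      rw [ZMod.natCast_val, ZMod.cast_id]
      ring
  have hmul : ∀ j : ℕ, ∑ i ∈ range (q * j), g ((1 + i : ℕ) : ZMod q) = 0 := by
    intro j
    induction j with
    | zero => simp
    | succ j ih =>
      rw [Nat.mul_succ, Finset.sum_range_add, ih, zero_add]
      simpa [add_assoc] using hper (1 + q * j)
  have hsh : ∑ m ∈ Icc 1 N, g (m : ℕ) = ∑ i ∈ range N, g ((1 + i : ℕ) : ZMod q) := by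
    rw [Finset.range_eq_Ico, Finset.sum_Ico_add (fun m : ℕ => g (m : ZMod q)) 0 N 1]
    rfl
  rw [hsh, ← Nat.div_add_mod N q, Finset.sum_range_add, hmul, zero_add]
  refine (norm_sum_le _ _).trans ((Finset.sum_le_sum fun i _ => hg _).trans ?_)
  simp only [sum_const, card_range, nsmul_eq_mul, mul_one]
  exact_mod_cast (Nat.mod_lt N (NeZero.pos q)).le

theorem tame_one : Tame (fun n : ℕ => if n = 0 then 0 else 1) 1 1 where
  zero := by simp
  norm_le m := by split_ifs <;> simp
  mean_le := by simp
  one_le := le_rfl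
  sum_le N := by
    have : ∑ k ∈ Icc 1 N, (if k = 0 then (0 : ℂ) else 1) = N := by
      rw [Finset.sum_congr rfl (g := fun _ => (1 : ℂ))]
      · simp
      · intro k hk
        rw [Finset.mem_Icc] at hk
        rw [if_neg (by omega)]
    rw [this]; simp

variable {q : ℕ} [NeZero q]

theorem char_zero (χ : DirichletCharacter ℂ q) (hχ : χ ≠ 1) : χ ((0 : ℕ) : ZMod q) = 0 := by
  have hq : q ≠ 1 := by
    rintro rfl
    exact hχ (Subsingleton.elim _ _)
  have : Fact (1 < q) := ⟨by have := NeZero.pos q; omega⟩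
  rw [Nat.cast_zero]
  exact MulChar.map_zero χ

theorem tame_char (χ : DirichletCharacter ℂ q) (hχ : χ ≠ 1) :
    Tame (fun n : ℕ => χ n) 0 q where
  zero := char_zero χ hχ
  norm_le m := DirichletCharacter.norm_le_one χ _
  mean_le := by simp
  one_le := by exact_mod_cast NeZero.pos q
  sum_le N := by
    simpa using norm_sum_periodic_le (fun x => χ x) (fun x => DirichletCharacter.norm_le_one χ x)
      (MulChar.sum_eq_zero_of_ne_one hχ) N

theorem tame_trivChar (hq : q ≠ 1) :
    Tame (fun n : ℕ => (1 : DirichletCharacter ℂ q) n) ((q.totient : ℂ) / q) q where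
  zero := by
    have : Fact (1 < q) := ⟨by have := NeZero.pos q; omega⟩
    rw [Nat.cast_zero]
    exact MulChar.map_zero _
  norm_le m := DirichletCharacter.norm_le_one _ _
  mean_le := by
    have hq0 : (0 : ℝ) < q := by exact_mod_cast NeZero.pos q
    rw [norm_div, Complex.norm_natCast, Complex.norm_natCast, div_le_one hq0]
    exact_mod_cast Nat.totient_le q
  one_le := by exact_mod_cast NeZero.pos q
  sum_le N := by
    have hq0 : (0 : ℝ) < q := by exact_mod_cast NeZero.pos q
    have hqc : (q : ℂ) ≠ 0 := by exact_mod_cast hq0.ne'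
    have hle : (q.totient : ℝ) / q ≤ 1 := by
      rw [div_le_one hq0]; exact_mod_cast Nat.totient_le q
    have hnn : 0 ≤ (q.totient : ℝ) / q := by positivity
    have hcast : (q.totient : ℂ) / q = (((q.totient : ℝ) / q : ℝ) : ℂ) := by push_cast; rfl
    have := norm_sum_periodic_le (q := q)
      (fun x => (1 : DirichletCharacter ℂ q) x - (q.totient : ℂ) / q) ?_ ?_ N
    · simpa [Finset.sum_sub_distrib, mul_comm] using this
    · intro x
      by_cases hx : IsUnit x
      · rw [MulChar.one_apply hx, hcast, ← Complex.ofReal_one, ← Complex.ofReal_sub,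
          Complex.norm_real, Real.norm_eq_abs, abs_le]
        constructor <;> linarith
      · rw [MulChar.map_nonunit _ hx, zero_sub, norm_neg, hcast, Complex.norm_real,
          Real.norm_of_nonneg hnn]
        exact hle
    · rw [Finset.sum_sub_distrib, MulChar.sum_one_eq_card_units, ZMod.card_units_eq_totient]
      simp [ZMod.card]
      field_simp
      ring

/-- Quantitative form of the `3-4-1` argument. -/
theorem lower_bound_of_product {G : ℂ → ℂ} {y c₀ M M' : ℝ} (hc₀ : 1 ≤ c₀) (hM : 1 ≤ M)
    (hM' : 1 ≤ M')
    (hd : ∀ u ∈ Set.Icc (0 : ℝ) 1, DifferentiableAt ℂ G (1 + u + Complex.I * y))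
    (hb : ∀ u ∈ Set.Icc (0 : ℝ) 1, ‖deriv G (1 + u + Complex.I * y)‖ ≤ M')
    (hp : ∀ u : ℝ, 0 < u → u ≤ 1 → 1 ≤ (c₀ / u) ^ 3 * ‖G (1 + u + Complex.I * y)‖ ^ 4 * M)
    {x : ℝ} (hx0 : 0 ≤ x) (hx1 : x ≤ 1) :
    1 / (16 * c₀ ^ 3 * M * M' ^ 3) ≤ ‖G (1 + x + Complex.I * y)‖ := by
  set P := c₀ ^ 3 * M with hP
  have hP1 : 1 ≤ P := one_le_mul_of_one_le_of_one_le (one_le_pow₀ hc₀) hM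
  set x₀ := 1 / (16 * P * M' ^ 4) with hx₀
  have hM0 : 0 < M' := by linarith
  have hP0 : 0 < P := by linarith
  have hx₀0 : 0 < x₀ := by positivity
  have hx₀1 : x₀ ≤ 1 := by
    rw [hx₀, div_le_one (by positivity)]
    have : 1 ≤ M' ^ 4 := one_le_pow₀ hM'
    nlinarith
  have hmain : ∀ u : ℝ, x₀ ≤ u → u ≤ 1 → 2 * M' * x₀ ≤ ‖G (1 + u + Complex.I * y)‖ := by
    intro u hu hu1
    have hu0 : 0 < u := by linarith
    have h1 := hp u hu0 hu1
    by_contra! hlt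
    have h2 : ‖G (1 + u + Complex.I * y)‖ ^ 4 < (2 * M' * x₀) ^ 4 := by gcongr
    have h3 : (c₀ / u) ^ 3 ≤ (c₀ / x₀) ^ 3 := by gcongr
    have h4 : (c₀ / u) ^ 3 * ‖G (1 + u + Complex.I * y)‖ ^ 4 * M <
        (c₀ / x₀) ^ 3 * (2 * M' * x₀) ^ 4 * M := by
      calc _ ≤ (c₀ / x₀) ^ 3 * ‖G (1 + u + Complex.I * y)‖ ^ 4 * M := by gcongr
        _ < _ := by gcongr
    have h5 : (c₀ / x₀) ^ 3 * (2 * M' * x₀) ^ 4 * M = 1 := by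
      rw [show (c₀ / x₀) ^ 3 * (2 * M' * x₀) ^ 4 * M = 16 * P * M' ^ 4 * x₀ by
        rw [hP]; field_simp; ring]
      rw [hx₀]; field_simp
    linarith
  have heq : 1 / (16 * c₀ ^ 3 * M * M' ^ 3) = M' * x₀ := by
    rw [hx₀, hP]; field_simp
  rw [heq]
  rcases le_total x₀ x with h | h
  · have := hmain x h hx1
    nlinarith
  · have hx₀mem : x₀ ∈ Set.Icc (0 : ℝ) 1 := ⟨hx₀0.le, hx₀1⟩
    have hmv := Convex.norm_image_sub_le_of_norm_hasDerivWithin_le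
      (f := fun u : ℝ => G (1 + u + Complex.I * y))
      (f' := fun u : ℝ => deriv G (1 + u + Complex.I * y)) (s := Set.Icc (0 : ℝ) 1)
      (C := M') (x := x) (y := x₀) ?_ (fun u hu => hb u hu) (convex_Icc _ _) ⟨hx0, hx1⟩ hx₀mem
    · have h1 := hmain x₀ le_rfl hx₀1
      have h2 := norm_sub_norm_le (G (1 + x₀ + Complex.I * y)) (G (1 + x + Complex.I * y))
      have h3 : ‖x₀ - x‖ ≤ x₀ := by
        rw [Real.norm_eq_abs, abs_of_nonneg (by linarith)]; linarith
      have h4 : M' * ‖x₀ - x‖ ≤ M' * x₀ := by gcongr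
      linarith
    · intro u hu
      have hG := (hd u hu).hasDerivAt
      have hin : HasDerivAt (fun u : ℝ => (1 + (u : ℂ) + Complex.I * y)) 1 u := by
        have := (Complex.ofRealCLM.hasDerivAt (x := u)).const_add (1 : ℂ)
        simpa using this.add_const (Complex.I * y)
      have := HasDerivAt.comp u hG hin
      simpa [Function.comp_def] using this.hasDerivWithinAt

theorem im_le_norm_sub_one (s : ℂ) : |s.im| ≤ ‖s - 1‖ := by
  simpa using Complex.abs_im_le_norm (s - 1)

/-- `ζ(σ) ≪ 1/(σ-1)`, uniformly for Dirichlet characters. -/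
theorem norm_LSeries_le_div : ∃ C ≥ (1 : ℝ), ∀ a : ℕ → ℂ, (∀ m, ‖a m‖ ≤ 1) →
    ∀ s : ℂ, 1 < s.re → s.re ≤ 2 → ‖LSeries a s‖ ≤ C / (s.re - 1) := by
  obtain ⟨C, hC, δ, hδ, _, hb⟩ := regL_bounds one_pos
  refine ⟨2 * C + 1, by linarith, fun a ha s hs hs2 => ?_⟩
  set σ := s.re with hσ
  set o : ℕ → ℂ := fun n : ℕ => if n = 0 then 0 else 1 with ho
  have hre : (σ : ℂ).re = σ := Complex.ofReal_re σ
  have hsum : LSeriesSummable o σ := tame_one.summable (by rw [hre]; exact hs)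
  have hterm : ∀ n, ‖LSeries.term a s n‖ ≤ ‖LSeries.term o σ n‖ := by
    intro n
    rw [LSeries.norm_term_eq, LSeries.norm_term_eq]
    by_cases hn : n = 0
    · simp [hn]
    · simp only [hn, if_false, ho, norm_one, hre]
      gcongr
      exact ha n
  have h1 : ‖LSeries a s‖ ≤ ∑' n, ‖LSeries.term o σ n‖ := by
    refine (norm_tsum_le_tsum_norm ?_).trans ?_
    · exact Summable.of_nonneg_of_le (fun _ => norm_nonneg _) hterm hsum.norm
    · exact Summable.tsum_le_tsum hterm
        (Summable.of_nonneg_of_le (fun _ => norm_nonneg _) hterm hsum.norm) hsum.norm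
  have h2 : (∑' n, ‖LSeries.term o σ n‖ : ℝ) = ‖LSeries o σ‖ := by
    have : LSeries o σ = ((∑' n, ‖LSeries.term o σ n‖ : ℝ) : ℂ) := by
      rw [Complex.ofReal_tsum]
      refine tsum_congr fun n => ?_
      rw [LSeries.norm_term_eq, LSeries.term_def]
      by_cases hn : n = 0
      · simp [hn]
      · simp only [hn, if_false, ho, norm_one, hre]
        push_cast
        rw [Complex.ofReal_cpow (Nat.cast_nonneg n)]
        simp
    rw [this, Complex.norm_real, Real.norm_of_nonneg (tsum_nonneg fun _ => norm_nonneg _)]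
  have h3 := tame_one.regL_eq (s := σ) (by rw [hre]; exact hs)
  have h4 := (hb o 1 1 tame_one σ (by rw [hre]; linarith) (by rw [hre]; exact hs2)).1
  have h5 : ‖(1 : ℂ) / ((σ : ℂ) - 1)‖ = 1 / (σ - 1) := by
    rw [norm_div, norm_one, ← Complex.ofReal_one, ← Complex.ofReal_sub, Complex.norm_real,
      Real.norm_of_nonneg (by linarith)]
  have h6 : ‖LSeries o σ‖ ≤ 2 * C + 1 / (σ - 1) := by
    have : LSeries o σ = regL o 1 σ + 1 / ((σ : ℂ) - 1) := by rw [h3]; ring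
    rw [this]
    refine (norm_add_le _ _).trans ?_
    rw [h5]
    simp at h4
    linarith
  rw [h2] at h1
  refine h1.trans (h6.trans ?_)
  have hσ1 : 0 < σ - 1 := by linarith
  rw [le_div_iff₀ hσ1, add_mul, one_div, inv_mul_cancel₀ hσ1.ne']
  nlinarith

variable {q : ℕ} [NeZero q]

/-- Upper bound for Dirichlet `L`-series to the right of `1`. -/
theorem norm_LSeries_char_le {ε : ℝ} (hε : 0 < ε) : ∃ C ≥ (1 : ℝ),
    ∀ (q : ℕ) [NeZero q] (χ : DirichletCharacter ℂ q) (η : ℝ), 0 < η → η ≤ 1 →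
      ∀ s : ℂ, 1 < s.re → s.re ≤ 2 → (χ ≠ 1 ∨ η ≤ |s.im|) →
      ‖LSeries (fun n => χ n) s‖ ≤ C / η * (q * (|s.im| + 2)) ^ ε := by
  obtain ⟨C, hC, δ, hδ, _, hb⟩ := regL_bounds hε
  refine ⟨C + 1, by linarith, fun q _ χ η hη hη1 s hs hs2 hor => ?_⟩
  have hq1 : (1 : ℝ) ≤ q := by exact_mod_cast NeZero.pos q
  have hV1 : 1 ≤ (q * (|s.im| + 2) : ℝ) := by nlinarith [abs_nonneg s.im]
  have hVε : 1 ≤ (q * (|s.im| + 2) : ℝ) ^ ε := Real.one_le_rpow hV1 hε.le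
  have hη' : 1 ≤ 1 / η := by rw [le_div_iff₀ hη]; linarith
  have key : ∀ (a : ℕ → ℂ) (κ : ℂ), Tame a κ q → (κ = 0 ∨ η ≤ |s.im|) →
      ‖LSeries a s‖ ≤ (C + 1) / η * (q * (|s.im| + 2)) ^ ε := by
    intro a κ h hκ
    have h1 : LSeries a s = regL a κ s + κ / (s - 1) := by rw [h.regL_eq hs]; ring
    have h2 := (hb a κ q h s (by linarith) hs2).1
    have h3 : ‖κ / (s - 1)‖ ≤ 1 / η := by
      rcases hκ with rfl | hκ
      · simp; positivity
      · rw [norm_div]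
        have := hκ.trans (im_le_norm_sub_one s)
        gcongr
        exact h.mean_le
    rw [h1]
    refine (norm_add_le _ _).trans ?_
    have h4 : C * (q * (|s.im| + 2)) ^ ε ≤ C * (1 / η) * (q * (|s.im| + 2)) ^ ε := by
      gcongr
      nlinarith
    calc _ ≤ C * (1 / η) * (q * (|s.im| + 2)) ^ ε + 1 / η * (q * (|s.im| + 2)) ^ ε := by
          nlinarith
      _ = _ := by ring
  by_cases hχ : χ = 1
  · subst hχ
    have him : η ≤ |s.im| := by tauto
    by_cases hq : q = 1
    · subst hq
      have : LSeries (fun n : ℕ => (1 : DirichletCharacter ℂ 1) n) s =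
          LSeries (fun n : ℕ => if n = 0 then 0 else 1) s := by
        refine LSeries_congr (fun {n} hn => ?_) s
        rw [if_neg hn, Subsingleton.elim (n : ZMod 1) 1, map_one]
      rw [this]
      exact key _ 1 (by simpa using tame_one) (Or.inr him)
    · exact key _ _ (tame_trivChar hq) (Or.inr him)
  · exact key _ 0 (tame_char χ hχ) (Or.inl rfl)

/-- Lower bound for `L(s, χ)` on `1 ≤ Re s ≤ 2`, away from the real axis if `χ` is quadratic. -/
theorem lower_bound_char {ε : ℝ} (hε : 0 < ε) : ∃ c > (0 : ℝ),
    ∀ (q : ℕ) [NeZero q] (χ : DirichletCharacter ℂ q), χ ≠ 1 → ∀ (η : ℝ), 0 < η → η ≤ 1 →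
      ∀ x y : ℝ, 0 ≤ x → x ≤ 1 → (χ ^ 2 ≠ 1 ∨ η ≤ |y|) →
      c * η * (q * (|y| + 2)) ^ (-ε) ≤
        ‖regL (fun n : ℕ => χ n) 0 (1 + x + Complex.I * y)‖ := by
  obtain ⟨C₁, hC₁, δ, hδ, _, hb⟩ := regL_bounds (show 0 < ε / 4 by positivity)
  obtain ⟨C₂, hC₂, hu⟩ := norm_LSeries_char_le (show 0 < ε / 4 by positivity)
  obtain ⟨C₃, hC₃, hz⟩ := norm_LSeries_le_div
  refine ⟨1 / (16 * C₃ ^ 3 * (2 * C₂) * C₁ ^ 3 * 2 ^ (ε / 4)), by positivity, ?_⟩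
  intro q _ χ hχ η hη hη1 x y hx0 hx1 hor
  have hq1 : (1 : ℝ) ≤ q := by exact_mod_cast NeZero.pos q
  set V : ℝ := q * (|y| + 2) with hV
  have hV1 : 1 ≤ V := by nlinarith [abs_nonneg y]
  have hVε : 1 ≤ V ^ (ε / 4) := Real.one_le_rpow hV1 (by positivity)
  have hη' : 1 ≤ 1 / η := by rw [le_div_iff₀ hη]; linarith
  have h2ε : (1 : ℝ) ≤ 2 ^ (ε / 4) := Real.one_le_rpow (by norm_num) (by positivity)
  have hre : ∀ u : ℝ, (1 + (u : ℂ) + Complex.I * y).re = 1 + u := by intro u; simp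
  have him : ∀ u : ℝ, (1 + (u : ℂ) + Complex.I * y).im = y := by intro u; simp
  have hT := tame_char χ hχ
  have hM1 : 1 ≤ 2 * C₂ / η * (2 ^ (ε / 4) * V ^ (ε / 4)) := by
    refine one_le_mul_of_one_le_of_one_le ?_ (one_le_mul_of_one_le_of_one_le h2ε hVε)
    rw [le_div_iff₀ hη]; linarith
  have hM1' : 1 ≤ C₁ * V ^ (ε / 4) := one_le_mul_of_one_le_of_one_le hC₁ hVε
  have main := lower_bound_of_product (G := regL (fun n : ℕ => χ n) 0) (y := y)
    (c₀ := C₃) (M := 2 * C₂ / η * (2 ^ (ε / 4) * V ^ (ε / 4))) (M' := C₁ * V ^ (ε / 4))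
    hC₃ hM1 hM1' ?_ ?_ ?_ hx0 hx1
  · refine le_trans (le_of_eq ?_) main
    have h4 : V ^ (-ε) = 1 / (V ^ (ε / 4)) ^ 4 := by
      rw [← Real.rpow_natCast, ← Real.rpow_mul (by linarith), Real.rpow_neg (by linarith), one_div]
      congr 2
      push_cast; ring
    rw [h4]
    field_simp
  · intro u hu
    exact hT.differentiableAt_regL (by rw [hre]; linarith [hu.1])
  · intro u hu
    have := (hb _ 0 q hT (1 + u + Complex.I * y) (by rw [hre]; linarith [hu.1])
      (by rw [hre]; linarith [hu.2])).2
    rwa [him] at this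
  · intro u hu0 hu1
    have h := DirichletCharacter.norm_LSeries_product_ge_one χ hu0 y
    have e1 : regL (fun n : ℕ => χ n) 0 (1 + u + Complex.I * y) =
        LSeries (fun n : ℕ => χ n) (1 + u + Complex.I * y) := by
      rw [hT.regL_eq (by rw [hre]; linarith)]; simp
    rw [e1]
    have h1 : ‖LSeries (fun n : ℕ => (1 : DirichletCharacter ℂ q) n) (1 + u)‖ ≤ C₃ / u := by
      have := hz (fun n : ℕ => (1 : DirichletCharacter ℂ q) n)
        (fun m => DirichletCharacter.norm_le_one _ _) (1 + u) (by simpa using hu0)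
        (by simp; linarith)
      simpa using this
    have h2 : ‖LSeries (fun n : ℕ => (χ ^ 2) n) (1 + u + 2 * Complex.I * y)‖ ≤
        2 * C₂ / η * (2 ^ (ε / 4) * V ^ (ε / 4)) := by
      have him2 : (1 + (u : ℂ) + 2 * Complex.I * y).im = 2 * y := by simp
      have hre2 : (1 + (u : ℂ) + 2 * Complex.I * y).re = 1 + u := by simp
      have := hu q (χ ^ 2) η hη hη1 (1 + u + 2 * Complex.I * y) (by rw [hre2]; linarith)
        (by rw [hre2]; linarith) (by
          rw [him2, abs_mul]
          refine hor.imp_right fun h => ?_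
          rw [abs_of_pos (two_pos : (0 : ℝ) < 2)]
          linarith [abs_nonneg y])
      refine this.trans ?_
      rw [← Real.mul_rpow (by norm_num) (by linarith)]
      gcongr ?_ * ?_
      · gcongr; linarith
      · refine Real.rpow_le_rpow (by positivity) ?_ (by positivity)
        rw [him2, hV, abs_mul, abs_of_pos (two_pos : (0 : ℝ) < 2)]
        nlinarith [abs_nonneg y]
    rw [norm_mul, norm_mul, norm_pow, norm_pow] at h
    refine le_trans h ?_
    gcongr

theorem prod_one_sub_inv_ge (s : Finset ℕ) (hs : ∀ p ∈ s, 2 ≤ p) :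
    1 / ((s.card : ℝ) + 1) ≤ ∏ p ∈ s, (1 - (p : ℝ)⁻¹) := by
  induction s using Finset.induction_on_max with
  | empty => simp
  | insert a s ha ih =>
    have has : a ∉ s := fun h => lt_irrefl _ (ha a h)
    rw [Finset.prod_insert has, Finset.card_insert_of_notMem has]
    have ih' := ih fun p hp => hs p (Finset.mem_insert_of_mem hp)
    have ha2 : 2 ≤ a := hs a (Finset.mem_insert_self _ _)
    have hcard : s.card + 2 ≤ a := by
      have hsub : s ⊆ Finset.Ico 2 a := fun p hp =>
        Finset.mem_Ico.mpr ⟨hs p (Finset.mem_insert_of_mem hp), ha p hp⟩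
      have := Finset.card_le_card hsub
      rw [Nat.card_Ico] at this
      omega
    have hcR : (s.card : ℝ) + 2 ≤ a := by exact_mod_cast hcard
    have hc0 : (0 : ℝ) ≤ s.card := Nat.cast_nonneg _
    have h1 : ((s.card : ℝ) + 1) / (s.card + 2) ≤ 1 - (a : ℝ)⁻¹ := by
      have : (a : ℝ)⁻¹ ≤ ((s.card : ℝ) + 2)⁻¹ := by gcongr
      have h2 : ((s.card : ℝ) + 1) / (s.card + 2) = 1 - ((s.card : ℝ) + 2)⁻¹ := by
        field_simp; ring
      linarith
    calc 1 / (((s.card + 1 : ℕ) : ℝ) + 1) =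
        ((s.card : ℝ) + 1) / (s.card + 2) * (1 / ((s.card : ℝ) + 1)) := by
          push_cast; field_simp; ring
      _ ≤ _ := mul_le_mul h1 ih' (by positivity) (le_trans (by positivity) h1)

theorem two_pow_card_primeFactors_le {k : ℕ} (hk : k ≠ 0) : 2 ^ k.primeFactors.card ≤ k := by
  calc 2 ^ k.primeFactors.card = ∏ _p ∈ k.primeFactors, 2 := by simp
    _ ≤ ∏ p ∈ k.primeFactors, p :=
        Finset.prod_le_prod' fun p hp => (Nat.prime_of_mem_primeFactors hp).two_le
    _ ≤ k := Nat.le_of_dvd (Nat.pos_of_ne_zero hk) (Nat.prod_primeFactors_dvd k)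

theorem card_primeFactors_le_log {k : ℕ} (hk : k ≠ 0) :
    (k.primeFactors.card : ℝ) ≤ 2 * Real.log k := by
  have h := two_pow_card_primeFactors_le hk
  have h2 : ((2 : ℝ) ^ k.primeFactors.card) ≤ k := by exact_mod_cast h
  have h3 := Real.log_le_log (by positivity) h2
  rw [Real.log_pow] at h3
  have := Real.log_two_gt_d9
  have h0 : (0 : ℝ) ≤ k.primeFactors.card := Nat.cast_nonneg _
  nlinarith

theorem prod_primeFactors_ge_log {k : ℕ} (hk : k ≠ 0) :
    1 / (2 * Real.log k + 1) ≤ ∏ p ∈ k.primeFactors, (1 - (p : ℝ)⁻¹) := by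
  refine le_trans ?_ (prod_one_sub_inv_ge _ fun p hp => (Nat.prime_of_mem_primeFactors hp).two_le)
  have := card_primeFactors_le_log hk
  gcongr

/-- `φ(k)/k ≫ k^{-ε}` with a convenient constant. -/
theorem prod_primeFactors_ge_rpow {ε : ℝ} (hε : 0 < ε) {k : ℕ} (hk : k ≠ 0) :
    1 / (2 / ε + 1) * (k : ℝ) ^ (-ε) ≤ ∏ p ∈ k.primeFactors, (1 - (p : ℝ)⁻¹) := by
  refine le_trans ?_ (prod_primeFactors_ge_log hk)
  have hk1 : (1 : ℝ) ≤ k := by exact_mod_cast Nat.one_le_iff_ne_zero.mpr hk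
  have h1 : Real.log k ≤ (k : ℝ) ^ ε / ε := Real.log_le_rpow_div (by linarith) hε
  have h2 : 1 ≤ (k : ℝ) ^ ε := Real.one_le_rpow hk1 hε.le
  have h3 : 0 ≤ Real.log k := Real.log_nonneg hk1
  rw [Real.rpow_neg (by linarith), ← one_div, div_mul_div_comm, one_mul]
  refine one_div_le_one_div_of_le (by positivity) ?_
  have : 2 / ε * (k : ℝ) ^ ε = 2 * ((k : ℝ) ^ ε / ε) := by ring
  nlinarith

variable {q : ℕ} [NeZero q]

theorem isOpen_re_pos : IsOpen {s : ℂ | 0 < s.re} := isOpen_lt continuous_const Complex.continuous_re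

theorem regL_char_eq_LFunction {χ : DirichletCharacter ℂ q} (hχ : χ ≠ 1) {s : ℂ} (hs : 0 < s.re) :
    regL (fun n : ℕ => χ n) 0 s = DirichletCharacter.LFunction χ s := by
  have hT := tame_char χ hχ
  have h1 : AnalyticOnNhd ℂ (regL (fun n : ℕ => χ n) 0) {s : ℂ | 0 < s.re} :=
    DifferentiableOn.analyticOnNhd
      (fun z hz => (hT.differentiableAt_regL hz).differentiableWithinAt) isOpen_re_pos
  have h2 : AnalyticOnNhd ℂ (DirichletCharacter.LFunction χ) {s : ℂ | 0 < s.re} :=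
    DifferentiableOn.analyticOnNhd
      (DirichletCharacter.differentiable_LFunction hχ).differentiableOn isOpen_re_pos
  have hconv : Convex ℝ {s : ℂ | 0 < s.re} := convex_halfSpace_re_gt 0
  refine AnalyticOnNhd.eqOn_of_preconnected_of_eventuallyEq h1 h2 hconv.isPreconnected
    (z₀ := 2) (by simp) ?_ hs
  have hopen : IsOpen {s : ℂ | 1 < s.re} := isOpen_lt continuous_const Complex.continuous_re
  filter_upwards [hopen.mem_nhds (show (2 : ℂ) ∈ {s : ℂ | 1 < s.re} by simp)] with z hz
  rw [hT.regL_eq hz, DirichletCharacter.LFunction_eq_LSeries χ hz]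
  simp

theorem regL_eq_LFunction_eventually {χ : DirichletCharacter ℂ q} (hχ : χ ≠ 1) {s : ℂ}
    (hs : 0 < s.re) :
    regL (fun n : ℕ => χ n) 0 =ᶠ[nhds s] DirichletCharacter.LFunction χ := by
  filter_upwards [isOpen_re_pos.mem_nhds hs] with z hz
  exact regL_char_eq_LFunction hχ hz

end TG

namespace TG
open scoped ComplexOrder

theorem quadratic_values {q : ℕ} {χ : DirichletCharacter ℂ q} (hχ : χ ^ 2 = 1) (x : ZMod q) :
    χ x = 0 ∨ χ x = 1 ∨ χ x = -1 := by
  by_cases hx : IsUnit x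
  · right
    have h : χ x ^ 2 = 1 := by
      rw [← MulChar.pow_apply' χ two_ne_zero, hχ, MulChar.one_apply hx]
    have h2 : (χ x - 1) * (χ x + 1) = 0 := by linear_combination h
    rcases mul_eq_zero.mp h2 with h3 | h3
    · left; linear_combination h3
    · right; linear_combination h3
  · left; exact MulChar.map_nonunit _ hx

/-- The constant function one as a coefficient sequence. -/
def oneSeq : ℕ → ℂ := fun n => if n = 0 then 0 else 1

theorem LSeries_two_pos {a : ℕ → ℂ} (ha : ∀ n, a n = 0 ∨ a n = 1 ∨ a n = -1) (h1 : a 1 = 1) :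
    ∃ r : ℝ, 1 / 3 ≤ r ∧ LSeries a 2 = r := by
  have hre : ∀ n, a n = ((a n).re : ℂ) := by
    intro n; rcases ha n with h | h | h <;> simp [h]
  have hge : ∀ n, -1 ≤ (a n).re := by
    intro n; rcases ha n with h | h | h <;> simp [h]
  have hle : ∀ n, |(a n).re| ≤ 1 := by
    intro n; rcases ha n with h | h | h <;> simp [h]
  have hz := hasSum_zeta_two
  have hs : Summable fun n : ℕ => (a n).re / (n : ℝ) ^ 2 := by
    refine Summable.of_norm_bounded hz.summable fun n => ?_
    rw [norm_div, Real.norm_eq_abs, Real.norm_of_nonneg (by positivity : (0 : ℝ) ≤ (n : ℝ) ^ 2)]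
    gcongr
    exact hle n
  refine ⟨∑' n : ℕ, (a n).re / (n : ℝ) ^ 2, ?_, ?_⟩
  · have h2 := (hs.hasSum.add hz)
    have h3 := h2.tsum_eq
    have h4 : (a 1).re / ((1 : ℕ) : ℝ) ^ 2 + 1 / ((1 : ℕ) : ℝ) ^ 2 ≤
        ∑' n : ℕ, ((a n).re / (n : ℝ) ^ 2 + 1 / (n : ℝ) ^ 2) := by
      refine h2.summable.le_tsum 1 fun n _ => ?_
      rw [← add_div]
      have := hge n
      exact div_nonneg (by linarith) (by positivity)
    rw [h3, h1] at h4
    have hpi : Real.pi ^ 2 / 6 ≤ 5 / 3 := by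
      have := Real.pi_lt_d2
      have := Real.pi_pos
      nlinarith
    norm_num at h4
    linarith
  · rw [LSeries, Complex.ofReal_tsum]
    refine tsum_congr fun n => ?_
    rw [LSeries.term_def]
    split_ifs with hn
    · simp [hn]
    · rw [hre n]
      push_cast
      norm_cast

/-- Alternating derivatives are inherited from the logarithmic derivative. -/
theorem alternating_of_logDeriv {F G : ℂ → ℂ} {x : ℂ} (hF : AnalyticAt ℂ F x)
    (hG : AnalyticAt ℂ G x) (h0 : 0 ≤ F x) (hd : deriv F =ᶠ[nhds x] fun s => -(G s * F s))
    (hGalt : ∀ n : ℕ, 0 ≤ (-1) ^ n * iteratedDeriv n G x) (n : ℕ) :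
    0 ≤ (-1) ^ n * iteratedDeriv n F x := by
  induction n using Nat.strong_induction_on with
  | _ n ih =>
    rcases n with _ | n
    · simpa using h0
    · rw [iteratedDeriv_succ', hd.iteratedDeriv_eq, iteratedDeriv_fun_neg,
        iteratedDeriv_fun_mul hG.contDiffAt hF.contDiffAt]
      have : (-1 : ℂ) ^ (n + 1) * -∑ i ∈ range (n + 1), (n.choose i : ℂ) * iteratedDeriv i G x *
          iteratedDeriv (n - i) F x = ∑ i ∈ range (n + 1), (n.choose i : ℂ) *
            ((-1) ^ i * iteratedDeriv i G x) * ((-1) ^ (n - i) * iteratedDeriv (n - i) F x) := by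
        rw [pow_succ, mul_neg_one, neg_mul_neg, Finset.mul_sum]
        refine Finset.sum_congr rfl fun i hi => ?_
        rw [Finset.mem_range] at hi
        have : (-1 : ℂ) ^ n = (-1) ^ i * (-1) ^ (n - i) := by
          rw [← pow_add]; congr 1; omega
        rw [this]; ring
      rw [this]
      refine Finset.sum_nonneg fun i hi => ?_
      refine mul_nonneg (mul_nonneg ?_ (hGalt i)) (ih _ (by omega))
      exact_mod_cast Nat.zero_le _

/-- The Taylor expansion argument of Estermann. -/
theorem estermann_real {F H : ℂ → ℂ} {lam : ℂ} {M b σ : ℝ} (hM : 1 ≤ M) (hb : 1 / 81 ≤ b)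
    (hσ : 3 / 4 ≤ σ) (hσ1 : σ < 1)
    (hH : DifferentiableOn ℂ H {s | 0 < s.re})
    (hFH : ∀ s : ℂ, 0 < s.re → s ≠ 1 → H s = F s - lam / (s - 1))
    (hF0 : F 2 = b)
    (hFalt : ∀ n : ℕ, 0 ≤ (-1) ^ n * iteratedDeriv n F 2)
    (hHM : ∀ z ∈ Metric.sphere (2 : ℂ) (3 / 2), ‖H z‖ ≤ M)
    (hneg : (F σ).re ≤ 0) :
    (1 - σ) / (1000 * (1000 * M) ^ (6 * (1 - σ))) ≤ ‖lam‖ := by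
  have hsub : Metric.closedBall (2 : ℂ) (3 / 2) ⊆ {s | 0 < s.re} := by
    intro z hz
    rw [Metric.mem_closedBall, dist_eq_norm] at hz
    have h1 := (Complex.abs_re_le_norm (z - 2)).trans hz
    simp only [Complex.sub_re, Complex.re_ofNat, abs_le] at h1
    simp only [Set.mem_ofPred_eq]; linarith
  set u : ℝ := 2 - σ with hu
  have hu1 : 1 < u := by rw [hu]; linarith
  have hu2 : u ≤ 5 / 4 := by rw [hu]; linarith
  have hmem : (σ : ℂ) ∈ Metric.ball (2 : ℂ) (3 / 2) := by
    rw [Metric.mem_ball, dist_eq_norm, ← Complex.ofReal_ofNat, ← Complex.ofReal_sub,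
      Complex.norm_real, Real.norm_eq_abs, abs_lt]
    constructor <;> linarith
  have hsum := Complex.hasSum_taylorSeries_on_ball
    (hH.mono (Metric.ball_subset_closedBall.trans hsub)) hmem
  have hsumre := Complex.hasSum_re hsum
  set h : ℕ → ℝ := fun n => (((n.factorial : ℂ)⁻¹ • ((σ : ℂ) - 2) ^ n • iteratedDeriv n H 2)).re
    with hh
  have hu' : (σ : ℂ) - 2 = -(u : ℂ) := by rw [hu]; push_cast; ring
  have hcauchy : ∀ n, |h n| ≤ M * (5 / 6) ^ n := by
    intro n
    refine (Complex.abs_re_le_norm _).trans ?_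
    have hc := Complex.norm_iteratedDeriv_le_of_forall_mem_sphere_norm_le (c := (2 : ℂ))
      (R := 3 / 2) (f := H) n (by norm_num) (hH.diffContOnCl_ball hsub) hHM
    rw [norm_smul, norm_smul, norm_inv, Complex.norm_natCast, norm_pow, hu', norm_neg,
      Complex.norm_real, Real.norm_of_nonneg (by linarith : 0 ≤ u)]
    have hf : (0 : ℝ) < n.factorial := by exact_mod_cast n.factorial_pos
    calc (n.factorial : ℝ)⁻¹ * (u ^ n * ‖iteratedDeriv n H 2‖) ≤
        (n.factorial : ℝ)⁻¹ * ((5 / 4) ^ n * (n.factorial * M / (3 / 2) ^ n)) := by gcongr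
      _ = M * ((5 / 4) ^ n / (3 / 2) ^ n) := by field_simp
      _ = M * (5 / 6) ^ n := by rw [← div_pow]; norm_num
  have hopen : IsOpen {s : ℂ | 1 < s.re} := isOpen_lt continuous_const Complex.continuous_re
  have hiter : ∀ n, iteratedDeriv n H 2 =
      iteratedDeriv n F 2 - lam * ((-1) ^ n * n.factorial) := by
    intro n
    have hev : H + (fun s => lam * (s - 1)⁻¹) =ᶠ[nhds 2] F := by
      filter_upwards [hopen.mem_nhds (show (2 : ℂ) ∈ {s : ℂ | 1 < s.re} by simp)] with z hz
      have hz : 1 < z.re := hz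
      have hz1 : z ≠ 1 := by rintro rfl; simp at hz
      simp only [Pi.add_apply]
      rw [hFH z (by linarith) hz1]; ring
    have hHa : AnalyticAt ℂ H 2 := (hH.analyticOnNhd isOpen_re_pos) 2 (by simp)
    have hinv : AnalyticAt ℂ (fun s : ℂ => lam * (s - 1)⁻¹) 2 := by
      have h1 : AnalyticAt ℂ (fun s : ℂ => s - 1) 2 := by fun_prop
      exact analyticAt_const.mul (h1.inv (by norm_num))
    rw [← hev.iteratedDeriv_eq, iteratedDeriv_add hHa.contDiffAt hinv.contDiffAt]
    have hi : iteratedDeriv n (fun s : ℂ => lam * (s - 1)⁻¹) 2 =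
        lam * ((-1) ^ n * n.factorial) := by
      have := congrFun (iteratedDeriv_comp_sub_const n (fun z : ℂ => lam * z⁻¹) 1) 2
      rw [this, iteratedDeriv_const_mul_field]
      congr 1
      have h3 := iter_deriv_inv n (2 - 1 : ℂ)
      rw [← iteratedDeriv_eq_iterate] at h3
      refine Eq.trans h3 ?_
      norm_num
    rw [hi]; ring
  have hlow : ∀ n, -(‖lam‖ * u ^ n) ≤ h n := by
    intro n
    have hf : (n.factorial : ℂ) ≠ 0 := by exact_mod_cast n.factorial_ne_zero
    have hfR : (0 : ℝ) < n.factorial := by exact_mod_cast n.factorial_pos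
    have hval : (n.factorial : ℂ)⁻¹ • ((σ : ℂ) - 2) ^ n • iteratedDeriv n H 2 =
        (((n.factorial : ℝ)⁻¹ * u ^ n : ℝ) : ℂ) * ((-1) ^ n * iteratedDeriv n F 2) -
          ((u ^ n : ℝ) : ℂ) * lam := by
      rw [hu', hiter, smul_eq_mul, smul_eq_mul, neg_pow]
      have h1 : ((-1 : ℂ) ^ n) * (-1) ^ n = 1 := by rw [← mul_pow]; simp
      push_cast
      rw [mul_sub, mul_sub]
      congr 1
      · ring
      · field_simp
        linear_combination lam * h1
    have h2 := (Complex.nonneg_iff.mp (hFalt n)).1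
    simp only [hh]
    rw [hval, Complex.sub_re, Complex.re_ofReal_mul, Complex.re_ofReal_mul]
    have h3 := Complex.re_le_norm lam
    have h4 : 0 ≤ u ^ n := by positivity
    have h5 : 0 ≤ (n.factorial : ℝ)⁻¹ * u ^ n * ((-1) ^ n * iteratedDeriv n F 2).re := by
      positivity
    nlinarith
  have hzero : b - ‖lam‖ ≤ h 0 := by
    simp only [hh]
    rw [hiter]
    simp only [Nat.factorial_zero, Nat.cast_one, inv_one, pow_zero, one_smul, iteratedDeriv_zero,
      mul_one, hF0, Complex.sub_re, Complex.ofReal_re]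
    linarith [Complex.re_le_norm lam]
  -- choice of the truncation point
  set J := ⌈6 * Real.log (1000 * M)⌉₊ with hJ
  have hL0 : 0 < Real.log (1000 * M) := Real.log_pos (by linarith)
  have hJ0 : 0 < J := Nat.ceil_pos.mpr (by positivity)
  have hJle : 6 * Real.log (1000 * M) ≤ J := Nat.le_ceil _
  have hJlt : (J : ℝ) < 6 * Real.log (1000 * M) + 1 := Nat.ceil_lt_add_one (by positivity)
  have hpow : (5 / 6 : ℝ) ^ J ≤ 1 / (1000 * M) := by
    have h1 : (5 / 6 : ℝ) ≤ Real.exp (-(1 / 6)) := by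
      have := Real.add_one_le_exp (-(1 / 6) : ℝ); linarith
    calc (5 / 6 : ℝ) ^ J ≤ Real.exp (-(1 / 6)) ^ J := by gcongr
      _ = Real.exp (-(J / 6)) := by rw [← Real.exp_nat_mul]; congr 1; ring
      _ ≤ Real.exp (-Real.log (1000 * M)) := by
          apply Real.exp_le_exp.mpr; linarith
      _ = 1 / (1000 * M) := by rw [Real.exp_neg, Real.exp_log (by linarith), one_div]
  have htail : -(6 * M * (5 / 6) ^ J) ≤ ∑' n, h (n + J) := by
    have hg : HasSum (fun n : ℕ => M * (5 / 6) ^ J * (5 / 6 : ℝ) ^ n) (M * (5 / 6) ^ J * 6) := by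
      have := (hasSum_geometric_of_lt_one (r := (5 / 6 : ℝ)) (by norm_num) (by norm_num)).mul_left
        (M * (5 / 6) ^ J)
      norm_num at this ⊢
      exact this
    have := tsum_of_norm_bounded (f := fun n => h (n + J)) hg fun n => by
      rw [Real.norm_eq_abs]
      refine (hcauchy _).trans (le_of_eq ?_)
      rw [pow_add]; ring
    rw [Real.norm_eq_abs, abs_le] at this
    linarith [this.1]
  have hgeom : ∑ n ∈ range J, u ^ n ≤ u ^ J / (1 - σ) := by
    rw [geom_sum_eq (by linarith)]
    rw [show u - 1 = 1 - σ by rw [hu]; ring]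
    have : 0 < 1 - σ := by linarith
    gcongr; linarith
  have hhead : b - ‖lam‖ * (u ^ J / (1 - σ)) ≤ ∑ n ∈ range J, h n := by
    obtain ⟨J', hJ'⟩ : ∃ J', J = J' + 1 := ⟨J - 1, by omega⟩
    have h1 : ∑ n ∈ range J, h n = ∑ n ∈ range J', h (n + 1) + h 0 := by
      rw [hJ', Finset.sum_range_succ']
    have h2 : ∑ n ∈ range J, u ^ n = ∑ n ∈ range J', u ^ (n + 1) + 1 := by
      rw [hJ', Finset.sum_range_succ', pow_zero]
    have h3 : -(‖lam‖ * ∑ n ∈ range J', u ^ (n + 1)) ≤ ∑ n ∈ range J', h (n + 1) := by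
      rw [Finset.mul_sum, ← Finset.sum_neg_distrib]
      exact Finset.sum_le_sum fun n _ => hlow _
    have h4 : ‖lam‖ * ∑ n ∈ range J, u ^ n ≤ ‖lam‖ * (u ^ J / (1 - σ)) := by gcongr
    rw [h2, mul_add, mul_one] at h4
    rw [h1]
    linarith
  have hHσ : (H σ).re = ∑ n ∈ range J, h n + ∑' n, h (n + J) := by
    rw [← hsumre.tsum_eq]
    exact (hsumre.summable.sum_add_tsum_nat_add J).symm
  have hσ1' : (σ : ℂ) ≠ 1 := by exact_mod_cast hσ1.ne
  have hFσ := hFH σ (by simp; linarith) hσ1'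
  have h1σ : 0 < 1 - σ := by linarith
  have huJ1 : 1 ≤ u ^ J := one_le_pow₀ hu1.le
  have hpole : (H σ).re ≤ ‖lam‖ * (u ^ J / (1 - σ)) := by
    have h1 : (H σ).re = (F σ).re - (lam / ((σ : ℂ) - 1)).re := by rw [hFσ, Complex.sub_re]
    have h2 : ‖lam / ((σ : ℂ) - 1)‖ = ‖lam‖ * (1 / (1 - σ)) := by
      rw [norm_div, ← Complex.ofReal_one, ← Complex.ofReal_sub, Complex.norm_real,
        Real.norm_eq_abs, abs_of_neg (by linarith)]
      rw [neg_sub]; ring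
    have h3 := (abs_le.mp (Complex.abs_re_le_norm (lam / ((σ : ℂ) - 1)))).1
    have h4 : ‖lam‖ * (1 / (1 - σ)) ≤ ‖lam‖ * (u ^ J / (1 - σ)) := by gcongr
    linarith
  have h6 : 6 * M * (5 / 6) ^ J ≤ 6 / 1000 := by
    calc 6 * M * (5 / 6) ^ J ≤ 6 * M * (1 / (1000 * M)) := by gcongr
      _ = 6 / 1000 := by field_simp
  have hmain : 1 / 324 ≤ ‖lam‖ * (u ^ J / (1 - σ)) := by linarith
  have huJ : u ^ J ≤ Real.exp 1 * (1000 * M) ^ (6 * (1 - σ)) := by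
    have h1 : u ≤ Real.exp (1 - σ) := by
      have := Real.add_one_le_exp (1 - σ); rw [hu]; linarith
    calc u ^ J ≤ Real.exp (1 - σ) ^ J := by gcongr
      _ = Real.exp (J * (1 - σ)) := by rw [← Real.exp_nat_mul]
      _ ≤ Real.exp (1 + Real.log (1000 * M) * (6 * (1 - σ))) := by
          apply Real.exp_le_exp.mpr
          nlinarith
      _ = _ := by rw [Real.exp_add, Real.rpow_def_of_pos (by linarith)]
  have hE := Real.exp_one_lt_d9
  have hX : 0 < (1000 * M) ^ (6 * (1 - σ)) := by positivity
  rw [div_le_iff₀ (by positivity)]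
  have h7 : 1 / 324 ≤ ‖lam‖ * (Real.exp 1 * (1000 * M) ^ (6 * (1 - σ)) / (1 - σ)) :=
    hmain.trans (by gcongr)
  rw [mul_div_assoc', le_div_iff₀ h1σ] at h7
  have h8 : ‖lam‖ * (Real.exp 1 * (1000 * M) ^ (6 * (1 - σ))) ≤
      ‖lam‖ * (3 * (1000 * M) ^ (6 * (1 - σ))) := by
    gcongr; linarith
  nlinarith [mul_nonneg (norm_nonneg lam) hX.le]

theorem isOpen_one_lt_re : IsOpen {s : ℂ | 1 < s.re} :=
  isOpen_lt continuous_const Complex.continuous_re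

theorem two_mem_one_lt_re : {s : ℂ | 1 < s.re} ∈ nhds (2 : ℂ) :=
  isOpen_one_lt_re.mem_nhds (by simp)

/-- The Riemann zeta function, continued to the right half plane through `regL`. -/
def zetaR (s : ℂ) : ℂ := regL oneSeq 1 s + 1 / (s - 1)

theorem zetaR_eq_LSeries {s : ℂ} (hs : 1 < s.re) : zetaR s = LSeries oneSeq s := by
  rw [zetaR, (show Tame oneSeq 1 1 from tame_one).regL_eq hs]; ring

theorem zetaR_eq_zeta {s : ℂ} (hs : 1 < s.re) : zetaR s = riemannZeta s := by
  rw [zetaR_eq_LSeries hs, ← LSeries_one_eq_riemannZeta hs]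
  exact LSeries_congr (fun {n} hn => by simp [oneSeq, hn]) s

variable {q : ℕ} [NeZero q]

theorem norm_LFunction_le {χ : DirichletCharacter ℂ q} (hχ : χ ≠ 1) {s : ℂ} (hs : 1 / 2 ≤ s.re)
    (hs2 : s.re ≤ 4) (hi : |s.im| ≤ 3 / 2) : ‖DirichletCharacter.LFunction χ s‖ ≤ 98 * q := by
  rw [← regL_char_eq_LFunction hχ (by linarith)]
  refine ((tame_char χ hχ).norm_regL_le (δ := 1 / 2) (by norm_num) le_rfl (by linarith) hs2).trans ?_
  rw [show (2 * (1 / 2) : ℝ) = 1 by norm_num, Real.rpow_one]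
  have : (1 : ℝ) ≤ q := by exact_mod_cast NeZero.one_le
  nlinarith

theorem norm_regL_one_le {s : ℂ} (hs : 1 / 2 ≤ s.re)
    (hs2 : s.re ≤ 4) (hi : |s.im| ≤ 3 / 2) : ‖regL oneSeq 1 s‖ ≤ 98 := by
  refine ((show Tame oneSeq 1 1 from tame_one).norm_regL_le (δ := 1 / 2) (by norm_num) le_rfl
    (by linarith) hs2).trans ?_
  rw [show (2 * (1 / 2) : ℝ) = 1 by norm_num, Real.rpow_one]
  nlinarith

theorem LFunction_two_pos {χ : DirichletCharacter ℂ q} (hχ : χ ^ 2 = 1) :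
    ∃ r : ℝ, 1 / 3 ≤ r ∧ DirichletCharacter.LFunction χ 2 = r := by
  rw [DirichletCharacter.LFunction_eq_LSeries χ (by simp)]
  exact LSeries_two_pos (fun n => quadratic_values hχ n) (by simp)

theorem hasDerivAt_LFunction (χ : DirichletCharacter ℂ q) (hχ : χ ≠ 1) {s : ℂ} (hs : 1 < s.re) :
    HasDerivAt (DirichletCharacter.LFunction χ)
      (-(LSeries ((fun n : ℕ => χ n) * fun n => (ArithmeticFunction.vonMangoldt n : ℂ)) s *
        DirichletCharacter.LFunction χ s)) s := by
  have h := DirichletCharacter.LSeries_twist_vonMangoldt_eq χ hs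
  have h0 := DirichletCharacter.LSeries_ne_zero_of_one_lt_re χ hs
  have hev : DirichletCharacter.LFunction χ =ᶠ[nhds s] LSeries (fun n => χ n) := by
    filter_upwards [isOpen_one_lt_re.mem_nhds hs] with z hz
    exact DirichletCharacter.LFunction_eq_LSeries χ hz
  rw [h, hev.eq_of_nhds, ← hev.deriv_eq]
  rw [div_mul_cancel₀ _ h0, neg_neg]
  exact (DirichletCharacter.differentiable_LFunction hχ s).hasDerivAt

theorem hasDerivAt_zetaR {s : ℂ} (hs : 1 < s.re) :
    HasDerivAt zetaR
      (-(LSeries (fun n => (ArithmeticFunction.vonMangoldt n : ℂ)) s * zetaR s)) s := by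
  have h := ArithmeticFunction.LSeries_vonMangoldt_eq_deriv_riemannZeta_div hs
  have h0 := riemannZeta_ne_zero_of_one_lt_re hs
  have hev : zetaR =ᶠ[nhds s] riemannZeta := by
    filter_upwards [isOpen_one_lt_re.mem_nhds hs] with z hz
    exact zetaR_eq_zeta hz
  rw [h, hev.eq_of_nhds, div_mul_cancel₀ _ h0, neg_neg]
  have hs1 : s ≠ 1 := by rintro rfl; simp at hs
  exact (differentiableAt_riemannZeta hs1).hasDerivAt.congr_of_eventuallyEq hev

theorem siegel_same_level {χ₁ χ₂ : DirichletCharacter ℂ q} (h1 : χ₁ ^ 2 = 1) (h2 : χ₂ ^ 2 = 1)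
    (h1' : χ₁ ≠ 1) (h2' : χ₂ ≠ 1) (h12 : χ₁ * χ₂ ≠ 1) {σ : ℝ} (hσ : 3 / 4 ≤ σ) (hσ1 : σ < 1)
    (hneg : (DirichletCharacter.LFunction χ₁ σ * DirichletCharacter.LFunction χ₂ σ *
      DirichletCharacter.LFunction (χ₁ * χ₂) σ * zetaR σ).re ≤ 0) :
    (1 - σ) / (1000 * (1000 * (10 ^ 8 * (q : ℝ) ^ 3)) ^ (6 * (1 - σ))) ≤
      ‖DirichletCharacter.LFunction χ₁ 1 * DirichletCharacter.LFunction χ₂ 1 *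
      DirichletCharacter.LFunction (χ₁ * χ₂) 1‖ := by
  have hq : (1 : ℝ) ≤ q := by exact_mod_cast NeZero.one_le
  set P : ℂ → ℂ := fun s => DirichletCharacter.LFunction χ₁ s * DirichletCharacter.LFunction χ₂ s *
      DirichletCharacter.LFunction (χ₁ * χ₂) s with hP
  have hPd : Differentiable ℂ P :=
    ((DirichletCharacter.differentiable_LFunction h1').mul
      (DirichletCharacter.differentiable_LFunction h2')).mul
      (DirichletCharacter.differentiable_LFunction h12)
  have hPb : ∀ s : ℂ, 1 / 2 ≤ s.re → s.re ≤ 4 → |s.im| ≤ 3 / 2 → ‖P s‖ ≤ 98 ^ 3 * (q : ℝ) ^ 3 := by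
    intro s hs hs4 hi
    simp only [hP, norm_mul]
    calc _ ≤ (98 * q) * (98 * q) * (98 * (q : ℝ)) := by
          gcongr
          · exact norm_LFunction_le h1' hs hs4 hi
          · exact norm_LFunction_le h2' hs hs4 hi
          · exact norm_LFunction_le h12 hs hs4 hi
      _ = _ := by ring
  have h12s : (χ₁ * χ₂) ^ 2 = 1 := by rw [mul_pow, h1, h2, one_mul]
  have hT : Tame oneSeq 1 1 := tame_one
  obtain ⟨r1, hr1, e1⟩ := LFunction_two_pos h1
  obtain ⟨r2, hr2, e2⟩ := LFunction_two_pos h2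
  obtain ⟨r3, hr3, e3⟩ := LFunction_two_pos h12s
  obtain ⟨r4, hr4, e4⟩ := LSeries_two_pos (a := oneSeq)
    (fun n => by by_cases h : n = 0 <;> simp [oneSeq, h]) (by simp [oneSeq])
  have hb : 1 / 81 ≤ r1 * r2 * r3 * r4 := by
    calc (1 / 81 : ℝ) = 1 / 3 * (1 / 3) * (1 / 3) * (1 / 3) := by norm_num
      _ ≤ _ := by gcongr
  set F : ℂ → ℂ := fun s => P s * zetaR s with hF
  have hF2 : F 2 = (r1 * r2 * r3 * r4 : ℝ) := by
    simp only [hF, hP]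
    rw [zetaR_eq_LSeries (by simp), e1, e2, e3, e4]; push_cast; ring
  set g : ℕ → ℂ := fun n => (ArithmeticFunction.vonMangoldt n : ℂ) * ((1 + χ₁ n) * (1 + χ₂ n))
    with hg
  set G := LSeries g with hG
  have hgsum : ∀ s : ℂ, 1 < s.re → LSeriesSummable g s ∧
      G s = LSeries ((fun n : ℕ => χ₁ n) * fun n => (ArithmeticFunction.vonMangoldt n : ℂ)) s +
      LSeries ((fun n : ℕ => χ₂ n) * fun n => (ArithmeticFunction.vonMangoldt n : ℂ)) s +
      LSeries ((fun n : ℕ => (χ₁ * χ₂) n) * fun n => (ArithmeticFunction.vonMangoldt n : ℂ)) s +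
      LSeries (fun n => (ArithmeticFunction.vonMangoldt n : ℂ)) s := by
    intro s hs
    have a1 := DirichletCharacter.LSeriesSummable_twist_vonMangoldt χ₁ hs
    have a2 := DirichletCharacter.LSeriesSummable_twist_vonMangoldt χ₂ hs
    have a3 := DirichletCharacter.LSeriesSummable_twist_vonMangoldt (χ₁ * χ₂) hs
    have a4 := ArithmeticFunction.LSeriesSummable_vonMangoldt hs
    have hge : g = (fun n : ℕ => χ₁ n) * (fun n => (ArithmeticFunction.vonMangoldt n : ℂ)) +
      (fun n : ℕ => χ₂ n) * (fun n => (ArithmeticFunction.vonMangoldt n : ℂ)) +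
      (fun n : ℕ => (χ₁ * χ₂) n) * (fun n => (ArithmeticFunction.vonMangoldt n : ℂ)) +
      (fun n => (ArithmeticFunction.vonMangoldt n : ℂ)) := by
      funext n
      simp only [hg, Pi.add_apply, Pi.mul_apply, MulChar.mul_apply]; ring
    rw [hG, hge]
    refine ⟨((a1.add a2).add a3).add a4, ?_⟩
    rw [LSeries_add ((a1.add a2).add a3) a4, LSeries_add (a1.add a2) a3, LSeries_add a1 a2]
  have hgnn : ∀ n, 0 ≤ g n := by
    intro n
    have hL : (0 : ℂ) ≤ (ArithmeticFunction.vonMangoldt n : ℂ) := by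
      exact_mod_cast ArithmeticFunction.vonMangoldt_nonneg
    have hz : ∀ z : ℂ, z = 0 ∨ z = 1 ∨ z = -1 → 0 ≤ 1 + z := by
      rintro z (h | h | h) <;> simp [h]
      norm_num
    exact mul_nonneg hL (mul_nonneg (hz _ (quadratic_values h1 _)) (hz _ (quadratic_values h2 _)))
  have habs : LSeries.abscissaOfAbsConv g < ((2 : ℝ) : EReal) := by
    have := (hgsum ((3 / 2 : ℝ) : ℂ) (by rw [Complex.ofReal_re]; norm_num)).1.abscissaOfAbsConv_le
    refine this.trans_lt ?_
    rw [Complex.ofReal_re]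
    exact_mod_cast (by norm_num : (3 / 2 : ℝ) < 2)
  have hderiv : ∀ s : ℂ, 1 < s.re → HasDerivAt F (-(G s * F s)) s := by
    intro s hs
    have d1 := hasDerivAt_LFunction χ₁ h1' hs
    have d2 := hasDerivAt_LFunction χ₂ h2' hs
    have d3 := hasDerivAt_LFunction (χ₁ * χ₂) h12 hs
    have d4 := hasDerivAt_zetaR hs
    have := ((d1.mul d2).mul d3).mul d4
    refine (HasDerivAt.congr_deriv this ?_)
    rw [(hgsum s hs).2]
    simp only [hF, hP, Pi.mul_apply]
    ring
  have hFan : AnalyticAt ℂ F 2 := by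
    refine DifferentiableOn.analyticAt (s := {s : ℂ | 1 < s.re})
      (fun s hs => (hderiv s hs).differentiableAt.differentiableWithinAt) two_mem_one_lt_re
  have hGan : AnalyticAt ℂ G 2 := LSeries_analyticOnNhd g 2 (by simpa using habs)
  have hFalt := alternating_of_logDeriv hFan hGan
    (by rw [hF2]; exact_mod_cast (by linarith : (0 : ℝ) ≤ r1 * r2 * r3 * r4))
    (by filter_upwards [two_mem_one_lt_re] with s hs using (hderiv s hs).deriv)
    (fun n => by
      have := LSeries.iteratedDeriv_alternating (a := g) (fun n => hgnn n) habs n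
      simpa using this)
  have hTd : DifferentiableOn ℂ (regL oneSeq 1) {s | 0 < s.re} :=
    fun s hs => (hT.differentiableAt_regL hs).differentiableWithinAt
  refine estermann_real (F := F) (H := fun s => P s * regL oneSeq 1 s + dslope P 1 s)
    (lam := P 1) (M := 10 ^ 8 * (q : ℝ) ^ 3) (b := r1 * r2 * r3 * r4) ?_ hb hσ hσ1 ?_ ?_ hF2 hFalt ?_ hneg
  · nlinarith [one_le_pow₀ hq (n := 3)]
  · refine (hPd.differentiableOn.mul hTd).add ?_
    exact (Complex.differentiableOn_dslope (isOpen_re_pos.mem_nhds (by simp))).mpr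
      hPd.differentiableOn
  · intro s _ hs1
    have : s - 1 ≠ 0 := sub_ne_zero.mpr hs1
    simp only [hF, zetaR]
    rw [dslope_of_ne _ hs1, slope_def_field]
    field_simp
    ring
  · intro z hz
    rw [mem_sphere_iff_norm] at hz
    have hre := Complex.abs_re_le_norm (z - 2)
    have him := Complex.abs_im_le_norm (z - 2)
    rw [hz] at hre him
    simp only [Complex.sub_re, Complex.sub_im, Complex.re_ofNat, Complex.im_ofNat, sub_zero] at hre him
    rw [abs_le] at hre
    have hz1 : 1 / 2 ≤ ‖z - 1‖ := by
      have := norm_sub_norm_le (z - 2) (-1)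
      rw [hz] at this
      simp only [norm_neg, norm_one, sub_neg_eq_add] at this
      rw [show z - 2 + 1 = z - 1 by ring] at this
      linarith
    have hne : z ≠ 1 := by rintro rfl; norm_num at hz1
    have b1 := hPb z (by linarith) (by linarith) him
    have b2 := hPb 1 (by norm_num) (by norm_num) (by norm_num)
    have b3 := norm_regL_one_le (s := z) (by linarith) (by linarith) him
    rw [dslope_of_ne _ hne, slope_def_field]
    have b4 : ‖(P z - P 1) / (z - 1)‖ ≤ 2 * (98 ^ 3 * (q : ℝ) ^ 3 + 98 ^ 3 * (q : ℝ) ^ 3) := by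
      rw [norm_div, div_le_iff₀ (by linarith)]
      have := norm_sub_le (P z) (P 1)
      have : (0 : ℝ) ≤ (q : ℝ) ^ 3 := by positivity
      nlinarith
    calc _ ≤ ‖P z‖ * ‖regL oneSeq 1 z‖ + ‖(P z - P 1) / (z - 1)‖ := by
          rw [← norm_mul]; exact norm_add_le _ _
      _ ≤ 98 ^ 3 * (q : ℝ) ^ 3 * 98 + 2 * (98 ^ 3 * (q : ℝ) ^ 3 + 98 ^ 3 * (q : ℝ) ^ 3) := by
          gcongr
      _ ≤ _ := by have : (0 : ℝ) ≤ (q : ℝ) ^ 3 := by positivity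
                  nlinarith

end TG

namespace TG
open DirichletCharacter

theorem norm_LFunction_one_changeLevel {M N : ℕ} [NeZero M] [NeZero N] (h : M ∣ N)
    {χ : DirichletCharacter ℂ M} (hχ : χ ≠ 1) :
    (∏ p ∈ N.primeFactors, (1 - (p : ℝ)⁻¹)) * ‖LFunction χ 1‖ ≤ ‖LFunction (changeLevel h χ) 1‖ ∧
    (∏ p ∈ N.primeFactors, (1 - (p : ℝ)⁻¹)) * ‖LFunction (changeLevel h χ) 1‖ ≤ ‖LFunction χ 1‖ := by
  have hp : ∀ p ∈ N.primeFactors, (0 : ℝ) < (p : ℝ)⁻¹ ∧ (p : ℝ)⁻¹ ≤ 1 / 2 ∧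
      ‖χ p * (p : ℂ) ^ (-1 : ℂ)‖ ≤ (p : ℝ)⁻¹ := by
    intro p hp
    have h2 := (Nat.prime_of_mem_primeFactors hp).two_le
    have h2' : (2 : ℝ) ≤ p := by exact_mod_cast h2
    refine ⟨by positivity, ?_, ?_⟩
    · rw [one_div]; exact inv_anti₀ (by norm_num) h2'
    · rw [Complex.cpow_neg_one, norm_mul, norm_inv, Complex.norm_natCast]
      exact mul_le_of_le_one_left (by positivity) (norm_le_one χ _)
  rw [LFunction_changeLevel h χ (Or.inl hχ), norm_mul, norm_prod]
  constructor
  · rw [mul_comm]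
    refine mul_le_mul_of_nonneg_left (prod_le_prod (fun p hpp => ?_) fun p hpp => ?_) (norm_nonneg _)
    · linarith [(hp p hpp).2.1]
    · have := norm_sub_norm_le (1 : ℂ) (χ p * (p : ℂ) ^ (-1 : ℂ))
      rw [norm_one] at this
      linarith [(hp p hpp).2.2]
  · rw [mul_left_comm, ← prod_mul_distrib]
    refine mul_le_of_le_one_right (norm_nonneg _) (prod_le_one (fun p hpp => ?_) fun p hpp => ?_)
    · have := hp p hpp
      exact mul_nonneg (by linarith) (norm_nonneg _)
    · obtain ⟨h1, h2, h3⟩ := hp p hpp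
      have := norm_sub_le (1 : ℂ) (χ p * (p : ℂ) ^ (-1 : ℂ))
      rw [norm_one] at this
      nlinarith

variable {q : ℕ} [NeZero q]

theorem LFunction_real {χ : DirichletCharacter ℂ q} (hχ : χ ≠ 1) (h2 : χ ^ 2 = 1) {σ : ℝ}
    (hσ : 0 < σ) : LFunction χ σ = ((LFunction χ σ).re : ℂ) := by
  suffices h : ∃ r : ℝ, LFunction χ σ = r by
    obtain ⟨r, hr⟩ := h; rw [hr, Complex.ofReal_re]
  rw [← regL_char_eq_LFunction hχ (by simpa using hσ), regL]
  have hre : ∀ n : ℕ, χ n = ((χ n).re : ℂ) := by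
    intro n; rcases quadratic_values h2 (n : ZMod q) with h | h | h <;> simp [h]
  refine ⟨σ * ∫ u in Set.Ioi (1 : ℝ), (∑ k ∈ Icc 1 ⌊u⌋₊, (χ k).re) * u ^ (-(σ + 1)), ?_⟩
  rw [Complex.ofReal_mul, ← integral_complex_ofReal, add_zero]
  congr 1
  refine setIntegral_congr_fun measurableSet_Ioi fun u hu => ?_
  have hu0 : (0 : ℝ) ≤ u := by linarith [Set.mem_Ioi.mp hu]
  simp only [sumErr]
  rw [Complex.ofReal_mul, Complex.ofReal_cpow hu0, Complex.ofReal_sum]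
  simp_rw [← hre]
  push_cast; simp

theorem LFunction_pos_of_no_zero {χ : DirichletCharacter ℂ q} (hχ : χ ≠ 1) (h2 : χ ^ 2 = 1) {σ : ℝ}
    (hσ : 0 < σ) (hσ1 : σ < 1) (hz : ∀ x : ℝ, σ ≤ x → x < 1 → LFunction χ x ≠ 0) :
    0 < (LFunction χ σ).re := by
  by_contra! hneg
  have hc : ContinuousOn (fun x : ℝ => (LFunction χ x).re) (Set.Icc σ 2) := by
    exact (Complex.continuous_re.comp ((differentiable_LFunction hχ).continuous.comp
      Complex.continuous_ofReal)).continuousOn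
  obtain ⟨r, hr, hr2⟩ := LFunction_two_pos h2
  have h0 : (0 : ℝ) ∈ Set.Icc ((LFunction χ σ).re) ((LFunction χ ((2 : ℝ) : ℂ)).re) := by
    refine ⟨hneg, ?_⟩
    rw [Complex.ofReal_ofNat, hr2, Complex.ofReal_re]; linarith
  obtain ⟨x, hx, hx0⟩ := intermediate_value_Icc (by linarith : σ ≤ 2) hc h0
  have hzero : LFunction χ x = 0 := by
    rw [LFunction_real hχ h2 (by linarith [hx.1])]
    simp only at hx0
    rw [hx0]; simp
  rcases lt_trichotomy x 1 with h | h | h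
  · exact hz x hx.1 h hzero
  · rw [h, Complex.ofReal_one] at hzero
    exact LFunction_apply_one_ne_zero hχ hzero
  · exact LFunction_ne_zero_of_one_le_re χ (Or.inl hχ) (by simpa using h.le) hzero

/-- There is a fixed quadratic character and a fixed point close to `1` at which all products
used in Estermann's argument are nonpositive. -/
theorem exists_siegel_witness {τ : ℝ} (hτ : 0 < τ) (hτ1 : τ ≤ 1 / 100)
    (hex : ∃ (q : ℕ) (_ : NeZero q) (χ : DirichletCharacter ℂ q), χ ≠ 1 ∧ χ ^ 2 = 1) :
    ∃ (q₁ : ℕ) (_ : NeZero q₁) (χ₁ : DirichletCharacter ℂ q₁) (σ : ℝ), χ₁ ≠ 1 ∧ χ₁ ^ 2 = 1 ∧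
      1 - τ < σ ∧ σ < 1 ∧ ∀ (N : ℕ) [NeZero N] (h : q₁ ∣ N) (ψ : DirichletCharacter ℂ N),
      ψ ≠ 1 → ψ ^ 2 = 1 → changeLevel h χ₁ * ψ ≠ 1 →
      (LFunction (changeLevel h χ₁) σ * LFunction ψ σ *
        LFunction (changeLevel h χ₁ * ψ) σ * zetaR σ).re ≤ 0 := by
  by_cases hz : ∃ (q₁ : ℕ) (_ : NeZero q₁) (χ₁ : DirichletCharacter ℂ q₁) (σ : ℝ), χ₁ ≠ 1 ∧
      χ₁ ^ 2 = 1 ∧ 1 - τ < σ ∧ σ < 1 ∧ LFunction χ₁ σ = 0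
  · obtain ⟨q₁, i, χ₁, σ, h1, h2, h3, h4, h5⟩ := hz
    refine ⟨q₁, i, χ₁, σ, h1, h2, h3, h4, fun N _ h ψ _ _ _ => ?_⟩
    rw [LFunction_changeLevel h χ₁ (Or.inl h1), h5]
    simp
  · push Not at hz
    obtain ⟨q₁, i, χ₁, h1, h2⟩ := hex
    refine ⟨q₁, i, χ₁, 1 - τ / 2, h1, h2, by linarith, by linarith, fun N _ h ψ h3 h4 h5 => ?_⟩
    have hpos : ∀ χ : DirichletCharacter ℂ N, χ ≠ 1 → χ ^ 2 = 1 →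
        ∃ r : ℝ, 0 < r ∧ LFunction χ ((1 - τ / 2 : ℝ) : ℂ) = r := by
      intro χ c1 c2
      exact ⟨_, LFunction_pos_of_no_zero c1 c2 (by linarith) (by linarith) fun x hx hx1 =>
        hz N _ χ x c1 c2 (by linarith) hx1, LFunction_real c1 c2 (by linarith)⟩
    have h1' : changeLevel h χ₁ ≠ 1 := fun hh => h1 ((changeLevel_eq_one_iff h).mp hh)
    have h2' : changeLevel h χ₁ ^ 2 = 1 := by rw [← map_pow, h2, map_one]
    obtain ⟨r1, p1, e1⟩ := hpos _ h1' h2'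
    obtain ⟨r2, p2, e2⟩ := hpos _ h3 h4
    obtain ⟨r3, p3, e3⟩ := hpos _ h5 (by rw [mul_pow, h2', h4, one_mul])
    rw [e1, e2, e3, ← Complex.ofReal_mul, ← Complex.ofReal_mul, Complex.re_ofReal_mul]
    refine mul_nonpos_of_nonneg_of_nonpos (by positivity) ?_
    have hb := norm_regL_one_le (s := ((1 - τ / 2 : ℝ) : ℂ)) (by rw [Complex.ofReal_re]; linarith)
      (by rw [Complex.ofReal_re]; linarith) (by rw [Complex.ofReal_im]; norm_num)
    have hr := (Complex.re_le_norm (regL oneSeq 1 ((1 - τ / 2 : ℝ) : ℂ))).trans hb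
    have he : (1 : ℂ) / (((1 - τ / 2 : ℝ) : ℂ) - 1) = ((-(2 / τ) : ℝ) : ℂ) := by
      have : (τ : ℂ) ≠ 0 := by exact_mod_cast hτ.ne'
      push_cast; rw [show (1 : ℂ) - τ / 2 - 1 = -(τ / 2) by ring]; field_simp
    rw [zetaR, Complex.add_re, he, Complex.ofReal_re]
    have : 100 ≤ 2 / τ := by rw [le_div_iff₀ hτ]; linarith
    linarith

theorem siegel {ε : ℝ} (hε : 0 < ε) : ∃ c > (0 : ℝ), ∀ (q : ℕ) [NeZero q]
    (χ : DirichletCharacter ℂ q), χ ≠ 1 → χ ^ 2 = 1 → c * (q : ℝ) ^ (-ε) ≤ ‖LFunction χ 1‖ := by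
  by_cases hex : ∃ (q : ℕ) (_ : NeZero q) (χ : DirichletCharacter ℂ q), χ ≠ 1 ∧ χ ^ 2 = 1
  swap
  · push Not at hex
    exact ⟨1, one_pos, fun q _ χ h1 h2 => absurd h2 (hex q inferInstance χ h1)⟩
  set τ := min (ε / 100) (1 / 100) with hτ
  have hτ0 : 0 < τ := lt_min (by positivity) (by norm_num)
  have hτ1 : τ ≤ 1 / 100 := min_le_right _ _
  have hτε : τ ≤ ε / 100 := min_le_left _ _
  set η := ε / 10 with hη
  have hη0 : 0 < η := by positivity
  obtain ⟨C, hC, δ, hδ, -, hbd⟩ := regL_bounds hη0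
  obtain ⟨q₁, i, χ₁, σ, h1, h2, hσ, hσ1, hneg⟩ := exists_siegel_witness hτ0 hτ1 hex
  have hup : ∀ (N : ℕ) [NeZero N] (ψ : DirichletCharacter ℂ N), ψ ≠ 1 →
      ‖LFunction ψ 1‖ ≤ C * (N * 2) ^ η := by
    intro N _ ψ hψ
    have := (hbd _ _ _ (tame_char ψ hψ) 1 (by rw [Complex.one_re]; linarith) (by simp)).1
    rw [regL_char_eq_LFunction hψ (by simp)] at this
    simpa using this
  set w₀ := 1 / (2 / η + 1) with hw₀
  have hw0 : 0 < w₀ := by positivity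
  set c₁ := (1 - σ) / (1000 * ((10 : ℝ) ^ 11) ^ (6 * (1 - σ))) with hc₁
  have hc1 : 0 < c₁ := by have : 0 < 1 - σ := by linarith
                          positivity
  have hL1 : 0 < ‖LFunction χ₁ 1‖ := norm_pos_iff.mpr (LFunction_apply_one_ne_zero h1)
  have hq1 : (1 : ℝ) ≤ q₁ := by exact_mod_cast NeZero.one_le
  set c₂ := min (w₀ * w₀ * ‖LFunction χ₁ 1‖) (w₀ * c₁ / (C ^ 2 * 2 ^ (2 * η))) with hc₂
  have hc2 : 0 < c₂ := by
    refine lt_min (by positivity) (by positivity)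
  refine ⟨c₂ * (q₁ : ℝ) ^ (-ε), by positivity, fun q _ χ hχ hχ2 => ?_⟩
  have hq : (1 : ℝ) ≤ q := by exact_mod_cast NeZero.one_le
  have hN : (1 : ℝ) ≤ ((q₁ * q : ℕ) : ℝ) := by exact_mod_cast NeZero.one_le
  have hNe : (q₁ : ℝ) ^ (-ε) * (q : ℝ) ^ (-ε) = ((q₁ * q : ℕ) : ℝ) ^ (-ε) := by
    push_cast; rw [Real.mul_rpow (by positivity) (by positivity)]
  rw [mul_assoc, hNe]
  have hd1 : q₁ ∣ q₁ * q := dvd_mul_right _ _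
  have hd2 : q ∣ q₁ * q := dvd_mul_left _ _
  set N := q₁ * q with hNdef
  have hNpos : (0 : ℝ) < N := by linarith
  set ψ₁ := changeLevel hd1 χ₁ with hψ₁
  set ψ := changeLevel hd2 χ with hψ
  have g1 : ψ₁ ≠ 1 := fun hh => h1 ((changeLevel_eq_one_iff hd1).mp hh)
  have g2 : ψ ≠ 1 := fun hh => hχ ((changeLevel_eq_one_iff hd2).mp hh)
  have g3 : ψ₁ ^ 2 = 1 := by rw [hψ₁, ← map_pow, h2, map_one]
  have g4 : ψ ^ 2 = 1 := by rw [hψ, ← map_pow, hχ2, map_one]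
  set w := ∏ p ∈ N.primeFactors, (1 - (p : ℝ)⁻¹) with hw
  have hwge : w₀ * (N : ℝ) ^ (-η) ≤ w := prod_primeFactors_ge_rpow hη0 (NeZero.ne N)
  have hw0' : 0 ≤ w := le_trans (by positivity) hwge
  have l1 := (norm_LFunction_one_changeLevel hd1 h1).1
  have l2 := (norm_LFunction_one_changeLevel hd2 hχ).2
  rw [← hψ₁] at l1
  rw [← hψ] at l2
  have hpw : ∀ a b : ℝ, (N : ℝ) ^ a * (N : ℝ) ^ b = (N : ℝ) ^ (a + b) := fun a b =>
    (Real.rpow_add hNpos a b).symm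
  by_cases h12 : ψ₁ * ψ = 1
  · have : ψ = ψ₁ := by
      calc ψ = ψ₁ ^ 2 * ψ := by rw [g3, one_mul]
        _ = ψ₁ * (ψ₁ * ψ) := by rw [pow_two, mul_assoc]
        _ = ψ₁ := by rw [h12, mul_one]
    rw [this] at l2
    calc c₂ * (N : ℝ) ^ (-ε) ≤ (w₀ * w₀ * ‖LFunction χ₁ 1‖) * (N : ℝ) ^ (-η + -η) := by
          refine mul_le_mul (min_le_left _ _) ?_ (by positivity) (by positivity)
          exact Real.rpow_le_rpow_of_exponent_le hN (by rw [hη]; linarith)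
      _ = (w₀ * (N : ℝ) ^ (-η)) * ((w₀ * (N : ℝ) ^ (-η)) * ‖LFunction χ₁ 1‖) := by
          rw [← hpw]; ring
      _ ≤ w * (w * ‖LFunction χ₁ 1‖) := by gcongr
      _ ≤ w * ‖LFunction ψ₁ 1‖ := by gcongr
      _ ≤ _ := l2
  · have hs := siegel_same_level g3 g4 g1 g2 h12 (by linarith) hσ1 (hneg N hd1 ψ g2 g4 h12)
    rw [norm_mul, norm_mul] at hs
    have u1 := hup N ψ₁ g1
    have u3 := hup N (ψ₁ * ψ) h12
    have hk : c₁ * (N : ℝ) ^ (-(18 * τ)) ≤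
        (1 - σ) / (1000 * (1000 * (10 ^ 8 * (N : ℝ) ^ 3)) ^ (6 * (1 - σ))) := by
      have hX : (1000 * (10 ^ 8 * (N : ℝ) ^ 3)) ^ (6 * (1 - σ)) ≤
          ((10 : ℝ) ^ 11) ^ (6 * (1 - σ)) * (N : ℝ) ^ (18 * τ) := by
        rw [show 1000 * (10 ^ 8 * (N : ℝ) ^ 3) = (10 : ℝ) ^ 11 * (N : ℝ) ^ 3 by ring,
          Real.mul_rpow (by positivity) (by positivity), ← Real.rpow_natCast (N : ℝ) 3,
          ← Real.rpow_mul hNpos.le]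
        gcongr ?_ * ?_
        refine Real.rpow_le_rpow_of_exponent_le hN ?_
        push_cast; linarith
      rw [Real.rpow_neg hNpos.le, hc₁, ← div_eq_mul_inv, div_div]
      rw [mul_assoc 1000 _ ((N : ℝ) ^ (18 * τ))]
      have : 0 ≤ 1 - σ := by linarith
      gcongr
    have hbound : c₁ * (N : ℝ) ^ (-(18 * τ)) ≤
        C * (N * 2) ^ η * ‖LFunction ψ 1‖ * (C * (N * 2) ^ η) := by
      refine hk.trans (hs.trans ?_)
      gcongr
    rw [Real.mul_rpow hNpos.le (by norm_num)] at hbound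
    have hexp : (N : ℝ) ^ (-ε) ≤ (N : ℝ) ^ (-(18 * τ) + (-η + -η) + -η) :=
      Real.rpow_le_rpow_of_exponent_le hN (by rw [hη]; linarith)
    have h2η : (2 : ℝ) ^ (2 * η) = 2 ^ η * 2 ^ η := by
      rw [← Real.rpow_add (by norm_num)]; ring_nf
    have hNη : (N : ℝ) ^ η * (N : ℝ) ^ (-η) = 1 := by rw [hpw]; simp
    calc c₂ * (N : ℝ) ^ (-ε) ≤ (w₀ * c₁ / (C ^ 2 * 2 ^ (2 * η))) *
          (N : ℝ) ^ (-(18 * τ) + (-η + -η) + -η) := by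
          refine mul_le_mul (min_le_right _ _) hexp (by positivity) (by positivity)
      _ = w₀ * (N : ℝ) ^ (-η) * ((c₁ * (N : ℝ) ^ (-(18 * τ))) *
          ((N : ℝ) ^ (-η) * (N : ℝ) ^ (-η)) / (C ^ 2 * (2 ^ η * 2 ^ η))) := by
          rw [← hpw, ← hpw, ← hpw, h2η]; ring
      _ ≤ w₀ * (N : ℝ) ^ (-η) * ((C * ((N : ℝ) ^ η * 2 ^ η) * ‖LFunction ψ 1‖ *
          (C * ((N : ℝ) ^ η * 2 ^ η))) *
          ((N : ℝ) ^ (-η) * (N : ℝ) ^ (-η)) / (C ^ 2 * (2 ^ η * 2 ^ η))) := by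
          gcongr
      _ = w₀ * (N : ℝ) ^ (-η) * (((N : ℝ) ^ η * (N : ℝ) ^ (-η)) * ((N : ℝ) ^ η * (N : ℝ) ^ (-η)) *
          ‖LFunction ψ 1‖) := by
          have : (2 : ℝ) ^ η ≠ 0 := by positivity
          field_simp
      _ = w₀ * (N : ℝ) ^ (-η) * ‖LFunction ψ 1‖ := by rw [hNη]; ring
      _ ≤ w * ‖LFunction ψ 1‖ := by gcongr
      _ ≤ _ := l2

theorem logDeriv_bound_of_lower {L : ℂ → ℂ} {s : ℂ} {r M m : ℝ} (hr : 0 ≤ r) (hm : 0 < m)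
    (hd : ∀ z ∈ Metric.closedBall s r, DifferentiableAt ℂ L z)
    (hb : ∀ z ∈ Metric.closedBall s r, ‖deriv L z‖ ≤ M) (hL : m ≤ ‖L s‖) (hrM : r * M ≤ m / 2) :
    ∀ z ∈ Metric.closedBall s r, L z ≠ 0 ∧ ‖deriv L z / L z‖ ≤ 2 * M / m := by
  intro z hz
  have hs : s ∈ Metric.closedBall s r := Metric.mem_closedBall_self hr
  have h := (convex_closedBall s r).norm_image_sub_le_of_norm_deriv_le hd hb hs hz
  have hM : 0 ≤ M := (norm_nonneg _).trans (hb s hs)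
  have h1 : ‖z - s‖ ≤ r := by simpa [dist_eq_norm] using hz
  have h2 : ‖L s‖ - ‖L z‖ ≤ ‖L z - L s‖ := by rw [norm_sub_rev]; exact norm_sub_norm_le _ _
  have h3 : m / 2 ≤ ‖L z‖ := by nlinarith
  refine ⟨norm_pos_iff.mp (by linarith), ?_⟩
  rw [norm_div, div_le_div_iff₀ (by linarith) hm]
  have := hb z hz
  nlinarith [norm_nonneg (deriv L z)]

theorem norm_LSeries_char_ge : ∃ c > (0 : ℝ), ∀ (q : ℕ) [NeZero q] (χ : DirichletCharacter ℂ q)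
    (s : ℂ), 1 < s.re → s.re ≤ 2 → c * (s.re - 1) ≤ ‖LSeries (fun n => χ n) s‖ := by
  obtain ⟨C, hC, hz⟩ := norm_LSeries_le_div
  refine ⟨1 / C, by positivity, fun q _ χ s h1 h2 => ?_⟩
  have h := DirichletCharacter.LSeries.mul_mu_eq_one χ h1
  have hb := hz ((fun n : ℕ => χ n) * fun n : ℕ => ((ArithmeticFunction.moebius n : ℤ) : ℂ))
    (fun m => by
      rw [Pi.mul_apply, norm_mul]
      refine mul_le_one₀ (norm_le_one χ _) (norm_nonneg _) ?_
      rw [Complex.norm_intCast]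
      exact_mod_cast ArithmeticFunction.abs_moebius_le_one) s h1 h2
  have h3 := congrArg norm h
  rw [norm_mul, norm_one] at h3
  have h4 : 0 < s.re - 1 := by linarith
  rw [le_div_iff₀ h4] at hb
  rw [div_mul_eq_mul_div, one_mul, div_le_iff₀ (by linarith)]
  have h5 : 1 * (s.re - 1) ≤ ‖LSeries (fun n => χ n) s‖ * C := by
    calc _ = ‖LSeries (fun n => χ n) s‖ * (‖LSeries ((fun n : ℕ => χ n) *
          fun n : ℕ => ((ArithmeticFunction.moebius n : ℤ) : ℂ)) s‖ * (s.re - 1)) := by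
          rw [← mul_assoc]; exact congrArg (· * (s.re - 1)) h3.symm
      _ ≤ _ := mul_le_mul_of_nonneg_left hb (norm_nonneg _)
  linarith

theorem char_lower {ε : ℝ} (hε : 0 < ε) : ∃ c > (0 : ℝ),
    ∀ (q : ℕ) [NeZero q] (χ : DirichletCharacter ℂ q), χ ≠ 1 →
      ∀ x y : ℝ, 0 ≤ x → x ≤ 1 →
      c * (q * (|y| + 2)) ^ (-ε) ≤ ‖regL (fun n : ℕ => χ n) 0 (1 + x + Complex.I * y)‖ := by
  obtain ⟨cS, hcS, hS⟩ := siegel (show 0 < ε / 4 by positivity)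
  obtain ⟨C, hC, δ, hδ, _, hb⟩ := regL_bounds (show 0 < ε / 4 by positivity)
  obtain ⟨c₁, hc₁, hl⟩ := lower_bound_char (show 0 < ε / 4 by positivity)
  obtain ⟨c₃, hc₃, hg⟩ := norm_LSeries_char_ge
  set κ := min 1 (cS / (4 * C)) with hκ
  have hκ0 : 0 < κ := lt_min one_pos (by positivity)
  have hκ1 : κ ≤ 1 := min_le_left _ _
  have hκS : κ * (4 * C) ≤ cS := by
    rw [← le_div_iff₀ (by positivity)]; exact min_le_right _ _
  refine ⟨κ * min c₁ (min c₃ (cS / 2)), by positivity, fun q _ χ hχ x y hx0 hx1 => ?_⟩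
  have hq1 : (1 : ℝ) ≤ q := by exact_mod_cast NeZero.pos q
  set V : ℝ := q * (|y| + 2) with hV
  have hV1 : 1 ≤ V := by nlinarith [abs_nonneg y]
  have hqV : (q : ℝ) ≤ V := by nlinarith [abs_nonneg y]
  set η := κ * V ^ (-(ε / 2)) with hη
  have hVm : ∀ a : ℝ, 0 ≤ a → V ^ (-a) ≤ 1 := fun a ha =>
    Real.rpow_le_one_of_one_le_of_nonpos hV1 (by linarith)
  have hη0 : 0 < η := by positivity
  have hη1 : η ≤ 1 := mul_le_one₀ hκ1 (by positivity) (hVm _ (by positivity))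
  have hexp : ∀ a : ℝ, a ≤ ε → V ^ (-ε) ≤ V ^ (-a) := fun a ha =>
    Real.rpow_le_rpow_of_exponent_le hV1 (by linarith)
  have hre : ∀ u v : ℝ, (1 + (u : ℂ) + Complex.I * v).re = 1 + u := by intro u v; simp
  have him : ∀ u v : ℝ, (1 + (u : ℂ) + Complex.I * v).im = v := by intro u v; simp
  have hT := tame_char χ hχ
  by_cases hor : χ ^ 2 ≠ 1 ∨ η ≤ |y|
  · refine le_trans ?_ (hl q χ hχ η hη0 hη1 x y hx0 hx1 hor)
    rw [← hV, hη, mul_comm κ, mul_assoc, mul_comm κ, ← mul_assoc, ← mul_assoc, mul_assoc _ _ κ,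
      mul_comm _ κ, ← mul_assoc, mul_assoc, mul_assoc, mul_comm κ]
    have h1 : V ^ (-ε) ≤ V ^ (-(ε / 2)) * V ^ (-(ε / 4)) := by
      rw [← Real.rpow_add (by linarith), ← neg_add]; exact hexp _ (by linarith)
    calc _ ≤ c₁ * (V ^ (-(ε / 2)) * V ^ (-(ε / 4))) * κ := by
          rw [← mul_assoc, mul_comm _ κ, mul_comm _ κ]
          gcongr
          exact min_le_left _ _
      _ = _ := by ring
  push Not at hor
  obtain ⟨h2, hy⟩ := hor
  by_cases hxη : η ≤ x
  · have e1 : regL (fun n : ℕ => χ n) 0 (1 + x + Complex.I * y) =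
        LSeries (fun n : ℕ => χ n) (1 + x + Complex.I * y) := by
      rw [hT.regL_eq (by rw [hre]; linarith)]; simp
    rw [e1]
    have := hg q χ (1 + x + Complex.I * y) (by rw [hre]; linarith) (by rw [hre]; linarith)
    rw [hre] at this
    refine le_trans ?_ this
    calc _ ≤ κ * c₃ * V ^ (-(ε / 2)) := by
          gcongr ?_ * ?_ * ?_
          · exact (min_le_right _ _).trans (min_le_left _ _)
          · exact hexp _ (by linarith)
      _ = c₃ * η := by rw [hη]; ring
      _ ≤ c₃ * (1 + x - 1) := by gcongr; linarith
  · push Not at hxη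
    have hs1 := hS q χ hχ h2
    rw [← regL_char_eq_LFunction hχ (by simp)] at hs1
    set f := regL (fun n : ℕ => χ n) 0 with hf
    have hconv : Convex ℝ ({z : ℂ | 1 ≤ z.re ∧ z.re ≤ 2} ∩ {z : ℂ | -|y| ≤ z.im ∧ z.im ≤ |y|}) := by
      refine Convex.inter ((convex_halfSpace_re_ge 1).inter (convex_halfSpace_re_le 2))
        ((convex_halfSpace_im_ge _).inter (convex_halfSpace_im_le _))
    have hdiff := hconv.norm_image_sub_le_of_norm_deriv_le (f := f) (C := C * V ^ (ε / 4))
      (x := 1) (y := 1 + x + Complex.I * y)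
      (fun z hz => hT.differentiableAt_regL (by linarith [hz.1.1]))
      (fun z hz => by
        refine (hb _ 0 q hT z (by linarith [hz.1.1]) hz.1.2).2.trans ?_
        have : |z.im| ≤ |y| := abs_le.mpr hz.2
        rw [hV]
        gcongr)
      (by simp) (by
        refine ⟨⟨?_, ?_⟩, ?_, ?_⟩
        · rw [hre]; linarith
        · rw [hre]; linarith
        · rw [him]; exact neg_abs_le y
        · rw [him]; exact le_abs_self y)
    have hn : ‖(1 + (x : ℂ) + Complex.I * y) - 1‖ ≤ 2 * η := by
      rw [show (1 + (x : ℂ) + Complex.I * y) - 1 = x + Complex.I * y by ring]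
      refine (norm_add_le _ _).trans ?_
      rw [norm_mul, Complex.norm_I, Complex.norm_real, Complex.norm_real, Real.norm_eq_abs,
        Real.norm_eq_abs, abs_of_nonneg hx0]
      linarith
    have hVq : cS * V ^ (-(ε / 4)) ≤ ‖f 1‖ := by
      refine le_trans ?_ hs1
      gcongr ?_ * ?_
      exact Real.rpow_le_rpow_of_nonpos (by linarith) hqV (by linarith)
    have hd2 : ‖f (1 + x + Complex.I * y) - f 1‖ ≤ cS / 2 * V ^ (-(ε / 4)) := by
      refine hdiff.trans ?_
      calc C * V ^ (ε / 4) * ‖(1 + (x : ℂ) + Complex.I * y) - 1‖ ≤ C * V ^ (ε / 4) * (2 * η) := by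
            gcongr
        _ = (κ * (4 * C)) / 2 * (V ^ (ε / 4) * V ^ (-(ε / 2))) := by rw [hη]; ring
        _ = (κ * (4 * C)) / 2 * V ^ (-(ε / 4)) := by
            rw [← Real.rpow_add (by linarith)]; congr 2; ring
        _ ≤ _ := by gcongr
    have h3 := norm_sub_norm_le (f 1) (f (1 + x + Complex.I * y))
    rw [norm_sub_rev] at h3
    calc _ ≤ 1 * (cS / 2) * V ^ (-(ε / 4)) := by
          gcongr ?_ * ?_ * ?_
          · exact (min_le_right _ _).trans (min_le_right _ _)
          · exact hexp _ (by linarith)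
      _ ≤ _ := by linarith

/-- Non-vanishing of `L(s, χ)` and bound for its logarithmic derivative in small discs around
points with real part at least `1`. -/
theorem char_disc {ε : ℝ} (hε : 0 < ε) : ∃ M ≥ (1 : ℝ),
    ∀ (q : ℕ) [NeZero q] (χ : DirichletCharacter ℂ q), χ ≠ 1 →
      ∀ s : ℂ, 1 ≤ s.re → s.re ≤ 3 / 2 →
      ∀ z ∈ Metric.closedBall s (M⁻¹ * (q * (|s.im| + 2)) ^ (-ε)),
      LFunction χ z ≠ 0 ∧ ‖deriv (LFunction χ) z / LFunction χ z‖ ≤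
        M * (q * (|s.im| + 2)) ^ ε := by
  obtain ⟨c, hc, hl⟩ := char_lower (show 0 < ε / 2 by positivity)
  obtain ⟨C, hC, δ, hδ, hδ4, hb⟩ := regL_bounds (show 0 < ε / 2 by positivity)
  set C' := C * 2 ^ (ε / 2) with hC'
  have hC'0 : 0 < C' := by positivity
  set M := max (1 / δ) (max 4 (2 * C' / c)) with hM
  have hM4 : 4 ≤ M := (le_max_left _ _).trans (le_max_right _ _)
  have hMδ : 1 / δ ≤ M := le_max_left _ _
  have hMC : 2 * C' / c ≤ M := (le_max_right _ _).trans (le_max_right _ _)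
  refine ⟨M, by linarith, fun q _ χ hχ s hs1 hs2 z hz => ?_⟩
  have hq1 : (1 : ℝ) ≤ q := by exact_mod_cast NeZero.pos q
  set V : ℝ := q * (|s.im| + 2) with hV
  have hV1 : 1 ≤ V := by nlinarith [abs_nonneg s.im]
  have hM0 : 0 < M := by linarith
  set r := M⁻¹ * V ^ (-ε) with hr
  have hr0 : 0 ≤ r := by positivity
  have hrM : r ≤ M⁻¹ := mul_le_of_le_one_right (by positivity)
    (Real.rpow_le_one_of_one_le_of_nonpos hV1 (by linarith))
  have hr4 : r ≤ 1 / 4 := hrM.trans (by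
    rw [one_div]; exact inv_anti₀ (by norm_num) hM4)
  have hrδ : r ≤ δ := hrM.trans (by
    rw [inv_le_comm₀ hM0 hδ, ← one_div]; exact hMδ)
  have hT := tame_char χ hχ
  have hball : ∀ w ∈ Metric.closedBall s r, 1 - δ ≤ w.re ∧ w.re ≤ 2 ∧ |w.im| + 2 ≤ 2 * (|s.im| + 2)
      ∧ 0 < w.re := by
    intro w hw
    have h1 : ‖w - s‖ ≤ r := by simpa [dist_eq_norm] using hw
    have h2 := abs_le.mp ((Complex.abs_re_le_norm (w - s)).trans h1)
    have h3 := (Complex.abs_im_le_norm (w - s)).trans h1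
    rw [Complex.sub_re] at h2
    rw [Complex.sub_im] at h3
    have h4 := abs_sub_abs_le_abs_sub w.im s.im
    have := abs_nonneg s.im
    refine ⟨by linarith [h2.1], by linarith [h2.2], by linarith, by linarith [h2.1]⟩
  have hlow := hl q χ hχ (s.re - 1) s.im (by linarith) (by linarith)
  rw [show (1 : ℂ) + ((s.re - 1 : ℝ) : ℂ) + Complex.I * s.im = s by
    push_cast; rw [mul_comm]; ring_nf; exact Complex.re_add_im s] at hlow
  rw [← hV, regL_char_eq_LFunction hχ (by linarith)] at hlow
  have hVp : V ^ (ε / 2) * V ^ (-ε) = V ^ (-(ε / 2)) := by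
    rw [← Real.rpow_add (by linarith)]; congr 1; ring
  have hVp2 : V ^ (ε / 2) = V ^ ε * V ^ (-(ε / 2)) := by
    rw [← Real.rpow_add (by linarith)]; congr 1; ring
  have := logDeriv_bound_of_lower (L := LFunction χ) (s := s) (r := r) (M := C' * V ^ (ε / 2))
    (m := c * V ^ (-(ε / 2))) hr0 (by positivity)
    (fun w _ => differentiable_LFunction hχ w)
    (fun w hw => by
      obtain ⟨h1, h2, h3, h4⟩ := hball w hw
      rw [← (regL_eq_LFunction_eventually hχ h4).deriv_eq]
      refine (hb _ 0 q hT w h1 h2).2.trans ?_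
      rw [hC', mul_assoc, ← Real.mul_rpow (by norm_num) (by linarith)]
      refine mul_le_mul_of_nonneg_left (Real.rpow_le_rpow (by positivity) ?_ (by positivity))
        (by linarith)
      rw [hV]
      nlinarith) hlow (by
      have h1 : M⁻¹ * C' ≤ c / 2 := by
        rw [inv_mul_le_iff₀ hM0]
        rw [div_le_iff₀ hc] at hMC
        linarith
      calc r * (C' * V ^ (ε / 2)) = M⁻¹ * C' * (V ^ (ε / 2) * V ^ (-ε)) := by rw [hr]; ring
        _ ≤ c / 2 * V ^ (-(ε / 2)) := by rw [hVp]; gcongr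
        _ = _ := by ring) z hz
  refine ⟨this.1, this.2.trans ?_⟩
  rw [div_le_iff₀ (by positivity)]
  calc 2 * (C' * V ^ (ε / 2)) = (2 * C') * (V ^ ε * V ^ (-(ε / 2))) := by rw [← hVp2]; ring
    _ ≤ (M * c) * (V ^ ε * V ^ (-(ε / 2))) := by
        rw [div_le_iff₀ hc] at hMC
        exact mul_le_mul_of_nonneg_right hMC (by positivity)
    _ = _ := by ring

theorem tame_oneSeq : Tame oneSeq 1 1 := tame_one

theorem differentiableAt_zetaR {s : ℂ} (hs : 0 < s.re) (h1 : s ≠ 1) : DifferentiableAt ℂ zetaR s :=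
  (tame_oneSeq.differentiableAt_regL hs).add
    ((differentiableAt_const _).div (by fun_prop) (sub_ne_zero.mpr h1))

theorem deriv_zetaR {s : ℂ} (hs : 0 < s.re) (h1 : s ≠ 1) :
    deriv zetaR s = deriv (regL oneSeq 1) s - 1 / (s - 1) ^ 2 := by
  have h2 : HasDerivAt (fun z : ℂ => 1 / (z - 1)) (-1 / (s - 1) ^ 2) s := by
    have := ((hasDerivAt_id s).sub_const 1).fun_inv (sub_ne_zero.mpr h1)
    simpa only [one_div, id] using this
  have := (tame_oneSeq.differentiableAt_regL hs).hasDerivAt.add h2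
  have h3 : deriv zetaR s = _ := this.deriv
  rw [h3]; ring

theorem zeta_lower {ε : ℝ} (hε : 0 < ε) : ∃ c > (0 : ℝ),
    ∀ x y : ℝ, 0 ≤ x → x ≤ 1 → 1 ≤ |y| →
      c * (|y| + 2) ^ (-ε) ≤ ‖zetaR (1 + x + Complex.I * y)‖ := by
  obtain ⟨C₁, hC₁, δ, hδ, _, hb⟩ := regL_bounds (show 0 < ε / 4 by positivity)
  obtain ⟨C₂, hC₂, hu⟩ := norm_LSeries_char_le (show 0 < ε / 4 by positivity)
  obtain ⟨C₃, hC₃, hz⟩ := norm_LSeries_le_div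
  refine ⟨1 / (16 * C₃ ^ 3 * C₂ * (2 * C₁) ^ 3 * 2 ^ (ε / 4)), by positivity, ?_⟩
  intro x y hx0 hx1 hy
  set V : ℝ := |y| + 2 with hV
  have hV1 : 1 ≤ V := by linarith
  have hVε : 1 ≤ V ^ (ε / 4) := Real.one_le_rpow hV1 (by positivity)
  have h2ε : (1 : ℝ) ≤ 2 ^ (ε / 4) := Real.one_le_rpow (by norm_num) (by positivity)
  have hre : ∀ u : ℝ, (1 + (u : ℂ) + Complex.I * y).re = 1 + u := by intro u; simp
  have him : ∀ u : ℝ, (1 + (u : ℂ) + Complex.I * y).im = y := by intro u; simp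
  have hne : ∀ u : ℝ, (1 + (u : ℂ) + Complex.I * y) ≠ 1 := by
    intro u h
    have := congrArg Complex.im h
    rw [him] at this
    simp only [Complex.one_im] at this
    rw [this] at hy; norm_num at hy
  have hL1 : ∀ s : ℂ, LSeries (fun n : ℕ => (1 : DirichletCharacter ℂ 1) n) s =
      LSeries oneSeq s := fun s => LSeries_congr (fun {n} hn => by
        rw [Subsingleton.elim (n : ZMod 1) 1, map_one]; simp [oneSeq, hn]) s
  have main := lower_bound_of_product (G := zetaR) (y := y)
    (c₀ := C₃) (M := C₂ * (2 ^ (ε / 4) * V ^ (ε / 4))) (M' := 2 * C₁ * V ^ (ε / 4))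
    hC₃ (one_le_mul_of_one_le_of_one_le hC₂ (one_le_mul_of_one_le_of_one_le h2ε hVε))
    (one_le_mul_of_one_le_of_one_le (by linarith) hVε) ?_ ?_ ?_ hx0 hx1
  · refine le_trans (le_of_eq ?_) main
    have h4 : V ^ (-ε) = 1 / (V ^ (ε / 4)) ^ 4 := by
      rw [← Real.rpow_natCast, ← Real.rpow_mul (by linarith), Real.rpow_neg (by linarith), one_div]
      congr 2
      push_cast; ring
    rw [h4]
    field_simp
  · intro u hu
    exact differentiableAt_zetaR (by rw [hre]; linarith [hu.1]) (hne u)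
  · intro u hu
    have := (hb _ 1 1 tame_oneSeq (1 + u + Complex.I * y) (by rw [hre]; linarith [hu.1])
      (by rw [hre]; linarith [hu.2])).2
    rw [him, one_mul] at this
    rw [deriv_zetaR (by rw [hre]; linarith [hu.1]) (hne u)]
    refine (norm_sub_le _ _).trans ?_
    have h1 : ‖1 / ((1 + (u : ℂ) + Complex.I * y) - 1) ^ 2‖ ≤ 1 := by
      rw [norm_div, norm_one, norm_pow]
      have := im_le_norm_sub_one (1 + (u : ℂ) + Complex.I * y)
      rw [him] at this
      exact div_le_one_of_le₀ (one_le_pow₀ (hy.trans this)) (by positivity)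
    have h2 : 1 ≤ C₁ * V ^ (ε / 4) := one_le_mul_of_one_le_of_one_le hC₁ hVε
    linarith
  · intro u hu0 hu1
    have h := DirichletCharacter.norm_LSeries_product_ge_one (1 : DirichletCharacter ℂ 1) hu0 y
    rw [one_pow] at h
    simp only [] at h
    rw [zetaR_eq_LSeries (by rw [hre]; linarith), ← hL1]
    have h1 : ‖LSeries (fun n : ℕ => (1 : DirichletCharacter ℂ 1) n) (1 + u)‖ ≤ C₃ / u := by
      have := hz (fun n : ℕ => (1 : DirichletCharacter ℂ 1) n)
        (fun m => DirichletCharacter.norm_le_one _ _) (1 + u) (by simpa using hu0)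
        (by simp; linarith)
      simpa using this
    have h2 : ‖LSeries (fun n : ℕ => (1 : DirichletCharacter ℂ 1) n) (1 + u + 2 * Complex.I * y)‖ ≤
        C₂ * (2 ^ (ε / 4) * V ^ (ε / 4)) := by
      have him2 : (1 + (u : ℂ) + 2 * Complex.I * y).im = 2 * y := by simp
      have hre2 : (1 + (u : ℂ) + 2 * Complex.I * y).re = 1 + u := by simp
      have := hu 1 1 1 one_pos le_rfl (1 + u + 2 * Complex.I * y) (by rw [hre2]; linarith)
        (by rw [hre2]; linarith) (by
          rw [him2, abs_mul, abs_of_pos (two_pos : (0 : ℝ) < 2)]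
          right; linarith)
      refine this.trans ?_
      rw [← Real.mul_rpow (by norm_num) (by linarith), div_one]
      gcongr ?_ * ?_
      refine Real.rpow_le_rpow (by positivity) ?_ (by positivity)
      rw [him2, hV, abs_mul, abs_of_pos (two_pos : (0 : ℝ) < 2)]
      push_cast
      linarith [abs_nonneg y]
    rw [norm_mul, norm_mul, norm_pow, norm_pow] at h
    refine le_trans h ?_
    gcongr

/-- The function `(s - 1) ζ(s)`. -/
def zetaZ (s : ℂ) : ℂ := (s - 1) * regL oneSeq 1 s + 1

/-- The continuation of the Dirichlet series with coefficients `Λ(n) - 1`. -/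
def zetaA (s : ℂ) : ℂ := -(deriv zetaZ s / zetaZ s) - regL oneSeq 1 s

theorem differentiableAt_zetaZ {s : ℂ} (hs : 0 < s.re) : DifferentiableAt ℂ zetaZ s := by
  have := tame_oneSeq.differentiableAt_regL hs
  unfold zetaZ
  fun_prop

theorem deriv_zetaZ {s : ℂ} (hs : 0 < s.re) :
    deriv zetaZ s = regL oneSeq 1 s + (s - 1) * deriv (regL oneSeq 1) s := by
  have h := (tame_oneSeq.differentiableAt_regL hs).hasDerivAt
  have h2 := (((hasDerivAt_id s).sub_const 1).mul h).add_const 1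
  have h3 : deriv zetaZ s = _ := h2.deriv
  rw [h3]; simp

theorem zetaZ_eq {s : ℂ} (h1 : s ≠ 1) : zetaZ s = (s - 1) * zetaR s := by
  have := sub_ne_zero.mpr h1
  rw [zetaZ, zetaR]; field_simp

theorem zetaA_eq {s : ℂ} (hs : 0 < s.re) (h1 : s ≠ 1) (h0 : zetaR s ≠ 0) :
    zetaA s = -(deriv zetaR s / zetaR s) - 1 / (s - 1) - regL oneSeq 1 s := by
  have h2 := sub_ne_zero.mpr h1
  rw [zetaA, zetaZ_eq h1, deriv_zetaZ hs, deriv_zetaR hs h1]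
  have h3 : regL oneSeq 1 s = zetaR s - 1 / (s - 1) := by rw [zetaR]; ring
  rw [h3]
  field_simp
  ring

theorem LSeries_vonMangoldt_sub_one {s : ℂ} (hs : 1 < s.re) :
    LSeries (fun n => (ArithmeticFunction.vonMangoldt n : ℂ) - oneSeq n) s = zetaA s := by
  have hs1 : s ≠ 1 := by rintro rfl; simp at hs
  have h0 : zetaR s ≠ 0 := by rw [zetaR_eq_zeta hs]; exact riemannZeta_ne_zero_of_one_lt_re hs
  have h := LSeries_sub (ArithmeticFunction.LSeriesSummable_vonMangoldt hs) (tame_oneSeq.summable hs)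
  rw [show (fun n => (ArithmeticFunction.vonMangoldt n : ℂ) - oneSeq n) =
    (fun n => (ArithmeticFunction.vonMangoldt n : ℂ)) - oneSeq from rfl, h,
    zetaA_eq (by linarith) hs1 h0, (hasDerivAt_zetaR hs).deriv, tame_oneSeq.regL_eq hs]
  field_simp
  ring

theorem differentiableAt_zetaA {s : ℂ} (hs : 0 < s.re) (h0 : zetaZ s ≠ 0) :
    DifferentiableAt ℂ zetaA s := by
  have h1 : AnalyticAt ℂ zetaZ s := DifferentiableOn.analyticAt
    (fun z hz => (differentiableAt_zetaZ hz).differentiableWithinAt) (isOpen_re_pos.mem_nhds hs)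
  exact (h1.deriv.differentiableAt.div h1.differentiableAt h0).neg.sub
    (tame_oneSeq.differentiableAt_regL hs)

theorem zetaZ_ne_zero {s : ℂ} (hs : 1 ≤ s.re) : zetaZ s ≠ 0 := by
  by_cases h1 : s = 1
  · simp [h1, zetaZ]
  have heq : Set.EqOn zetaZ (fun z => Function.update (fun z => (z - 1) * riemannZeta z) 1 1 z)
      {s : ℂ | 0 < s.re} := by
    have hd : DifferentiableOn ℂ (Function.update (fun z => (z - 1) * riemannZeta z) 1 1)
        Set.univ := by
      rw [← Complex.differentiableOn_compl_singleton_and_continuousAt_iff (c := 1) Filter.univ_mem]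
      constructor
      · intro z hz
        have hz1 : z ≠ 1 := by simpa using hz
        refine DifferentiableAt.differentiableWithinAt ?_
        refine DifferentiableAt.congr_of_eventuallyEq
          (f := fun z => (z - 1) * riemannZeta z) ?_ ?_
        · exact (by fun_prop : DifferentiableAt ℂ (fun z : ℂ => z - 1) z).mul
            (differentiableAt_riemannZeta hz1)
        · filter_upwards [isOpen_ne.mem_nhds hz1] with w hw
          simp [Function.update_of_ne hw]
      · rw [continuousAt_update_same]
        exact riemannZeta_residue_one
    refine AnalyticOnNhd.eqOn_of_preconnected_of_eventuallyEq (z₀ := 2)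
      (DifferentiableOn.analyticOnNhd
        (fun z hz => (differentiableAt_zetaZ hz).differentiableWithinAt) isOpen_re_pos)
      (DifferentiableOn.analyticOnNhd (hd.mono (Set.subset_univ _)) isOpen_re_pos)
      (convex_halfSpace_re_gt 0).isPreconnected (by simp) ?_
    filter_upwards [two_mem_one_lt_re] with z hz
    have hz1 : z ≠ 1 := by rintro rfl; simp at hz
    rw [Function.update_of_ne hz1, zetaZ_eq hz1, zetaR_eq_zeta hz]
  rw [heq (show (0 : ℝ) < s.re by linarith)]
  simp only [Function.update_of_ne h1]
  exact mul_ne_zero (sub_ne_zero.mpr h1) (riemannZeta_ne_zero_of_one_le_re hs)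

theorem zeta_disc {ε : ℝ} (hε : 0 < ε) : ∃ M ≥ (1 : ℝ),
    ∀ s : ℂ, 1 ≤ s.re → s.re ≤ 3 / 2 →
      ∀ z ∈ Metric.closedBall s (M⁻¹ * (|s.im| + 2) ^ (-ε)),
      zetaZ z ≠ 0 ∧ 0 < z.re ∧ ‖zetaA z‖ ≤ M * (|s.im| + 2) ^ ε := by
  obtain ⟨c, hc, hl⟩ := zeta_lower (show 0 < ε / 2 by positivity)
  obtain ⟨C, hC, δ, hδ, hδ4, hb⟩ := regL_bounds (show 0 < ε / 2 by positivity)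
  obtain ⟨m, hm, hmin⟩ : ∃ m > (0 : ℝ), ∀ s : ℂ, 1 ≤ s.re → s.re ≤ 3 / 2 → |s.im| ≤ 1 →
      m ≤ ‖zetaZ s‖ := by
    have hK : IsCompact (Set.Icc (1 : ℝ) (3 / 2) ×ℂ Set.Icc (-1 : ℝ) 1) :=
      isCompact_Icc.reProdIm isCompact_Icc
    have hcont : ContinuousOn (fun s => ‖zetaZ s‖)
        (Set.Icc (1 : ℝ) (3 / 2) ×ℂ Set.Icc (-1 : ℝ) 1) := by
      intro s hs
      have h1 : (1 : ℝ) ≤ s.re := hs.1.1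
      exact (differentiableAt_zetaZ (by linarith)).continuousAt.norm.continuousWithinAt
    obtain ⟨s₀, hs₀, hmin⟩ := hK.exists_isMinOn ⟨1, by constructor <;> constructor <;> norm_num⟩
      hcont
    refine ⟨‖zetaZ s₀‖, norm_pos_iff.mpr (zetaZ_ne_zero hs₀.1.1), fun s h1 h2 h3 => ?_⟩
    exact hmin ⟨⟨h1, h2⟩, abs_le.mp h3⟩
  set Q := C * 2 ^ (ε / 2) + 2 with hQ
  set D := 4 * (C * 6 ^ (ε / 2)) with hD
  have hQ0 : 2 ≤ Q := by have : 0 ≤ C * 2 ^ (ε / 2) := by positivity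
                         linarith
  have hD0 : 0 < D := by positivity
  set M := max (1 / δ) (max 4 (max (2 * Q / c + 2 + Q) (2 * D / m + D))) with hM
  have hMδ : 1 / δ ≤ M := le_max_left _ _
  have hM4 : 4 ≤ M := (le_max_left _ _).trans (le_max_right _ _)
  have hMQ : 2 * Q / c + 2 + Q ≤ M :=
    (le_max_left _ _).trans ((le_max_right _ _).trans (le_max_right _ _))
  have hMD : 2 * D / m + D ≤ M :=
    (le_max_right _ _).trans ((le_max_right _ _).trans (le_max_right _ _))
  have hMQ1 : 2 * Q / c ≤ M := by linarith
  have hMD1 : 2 * D / m ≤ M := by linarith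
  refine ⟨M, by linarith, fun s hs1 hs2 z hz => ?_⟩
  set V : ℝ := |s.im| + 2 with hV
  have hV1 : 1 ≤ V := by linarith [abs_nonneg s.im]
  have hM0 : 0 < M := by linarith
  set r := M⁻¹ * V ^ (-ε) with hr
  have hr0 : 0 ≤ r := by positivity
  have hrM : r ≤ M⁻¹ := mul_le_of_le_one_right (by positivity)
    (Real.rpow_le_one_of_one_le_of_nonpos hV1 (by linarith))
  have hr4 : r ≤ 1 / 4 := hrM.trans (by
    rw [one_div]; exact inv_anti₀ (by norm_num) hM4)
  have hrδ : r ≤ δ := hrM.trans (by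
    rw [inv_le_comm₀ hM0 hδ, ← one_div]; exact hMδ)
  have hball : ∀ w ∈ Metric.closedBall s r, 1 - δ ≤ w.re ∧ w.re ≤ 7 / 4 ∧
      |w.im| ≤ |s.im| + 1 / 4 ∧ |s.im| - 1 / 4 ≤ |w.im| ∧ 0 < w.re := by
    intro w hw
    have h1 : ‖w - s‖ ≤ r := by simpa [dist_eq_norm] using hw
    have h2 := abs_le.mp ((Complex.abs_re_le_norm (w - s)).trans h1)
    have h3 := (Complex.abs_im_le_norm (w - s)).trans h1
    rw [Complex.sub_re] at h2
    rw [Complex.sub_im] at h3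
    have h4 := abs_sub_abs_le_abs_sub w.im s.im
    have h5 := abs_sub_abs_le_abs_sub s.im w.im
    rw [abs_sub_comm] at h5
    refine ⟨by linarith [h2.1], by linarith [h2.2], by linarith, by linarith, by linarith [h2.1]⟩
  have hVε : 1 ≤ V ^ ε := Real.one_le_rpow hV1 hε.le
  have hVε2 : 1 ≤ V ^ (ε / 2) := Real.one_le_rpow hV1 (by linarith)
  have hVle : V ^ (ε / 2) ≤ V ^ ε := Real.rpow_le_rpow_of_exponent_le hV1 (by linarith)
  have hbw : ∀ w ∈ Metric.closedBall s r, ‖regL oneSeq 1 w‖ ≤ C * 2 ^ (ε / 2) * V ^ (ε / 2) ∧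
      ‖deriv (regL oneSeq 1) w‖ ≤ C * 2 ^ (ε / 2) * V ^ (ε / 2) := by
    intro w hw
    obtain ⟨h1, h2, h3, h4, h5⟩ := hball w hw
    have h6 := hb _ 1 1 tame_oneSeq w h1 (by linarith)
    have h7 : C * (1 * (|w.im| + 2)) ^ (ε / 2) ≤ C * 2 ^ (ε / 2) * V ^ (ε / 2) := by
      rw [mul_assoc, ← Real.mul_rpow (by norm_num) (by linarith)]
      refine mul_le_mul_of_nonneg_left (Real.rpow_le_rpow (by positivity) ?_ (by positivity))
        (by linarith)
      rw [hV]
      linarith [abs_nonneg s.im]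
    exact ⟨h6.1.trans h7, h6.2.trans h7⟩
  obtain ⟨hz1, hz2, hz3, hz4, hz5⟩ := hball z hz
  rcases le_total 1 |s.im| with hy | hy
  · have hwne : ∀ w ∈ Metric.closedBall s r, w ≠ 1 := by
      rintro w hw rfl
      have := (hball _ hw).2.2.2.1
      simp at this; linarith
    have hinv : ∀ w ∈ Metric.closedBall s r, ‖1 / (w - 1)‖ ≤ 4 / 3 := by
      intro w hw
      have h1 := im_le_norm_sub_one w
      have h2 := (hball w hw).2.2.2.1
      rw [norm_div, norm_one, div_le_iff₀ (by linarith)]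
      linarith
    have hlow := hl (s.re - 1) s.im (by linarith) (by linarith) hy
    rw [show (1 : ℂ) + ((s.re - 1 : ℝ) : ℂ) + Complex.I * s.im = s by
      push_cast; rw [mul_comm]; ring_nf; exact Complex.re_add_im s] at hlow
    have hVp : V ^ (ε / 2) * V ^ (-ε) = V ^ (-(ε / 2)) := by
      rw [← Real.rpow_add (by linarith)]; congr 1; ring
    have hVp2 : V ^ (ε / 2) = V ^ ε * V ^ (-(ε / 2)) := by
      rw [← Real.rpow_add (by linarith)]; congr 1; ring
    have key := logDeriv_bound_of_lower (L := zetaR) (s := s) (r := r) (M := Q * V ^ (ε / 2))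
      (m := c * V ^ (-(ε / 2))) hr0 (by positivity)
      (fun w hw => differentiableAt_zetaR (hball w hw).2.2.2.2 (hwne w hw))
      (fun w hw => by
        rw [deriv_zetaR (hball w hw).2.2.2.2 (hwne w hw)]
        refine (norm_sub_le _ _).trans ?_
        have h1 := (hbw w hw).2
        have h2 : ‖1 / (w - 1) ^ 2‖ ≤ 2 := by
          have h3 := hinv w hw
          rw [show 1 / (w - 1) ^ 2 = (1 / (w - 1)) ^ 2 by rw [div_pow, one_pow], norm_pow]
          nlinarith [norm_nonneg (1 / (w - 1))]
        rw [hQ, add_mul]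
        linarith) hlow (by
        have h1 : M⁻¹ * Q ≤ c / 2 := by
          rw [inv_mul_le_iff₀ hM0]
          rw [div_le_iff₀ hc] at hMQ1
          linarith
        calc r * (Q * V ^ (ε / 2)) = M⁻¹ * Q * (V ^ (ε / 2) * V ^ (-ε)) := by rw [hr]; ring
          _ ≤ c / 2 * V ^ (-(ε / 2)) := by rw [hVp]; gcongr
          _ = _ := by ring) z hz
    have hlog : ‖deriv zetaR z / zetaR z‖ ≤ 2 * Q / c * V ^ ε := by
      refine key.2.trans ?_
      rw [hVp2]
      apply le_of_eq
      field_simp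
    refine ⟨?_, hz5, ?_⟩
    · rw [zetaZ_eq (hwne z hz)]
      exact mul_ne_zero (sub_ne_zero.mpr (hwne z hz)) key.1
    · rw [zetaA_eq hz5 (hwne z hz) key.1]
      refine (norm_sub_le _ _).trans ((add_le_add_left (norm_sub_le _ _) _).trans ?_)
      rw [norm_neg]
      have h1 := (hbw z hz).1
      have h2 := hinv z hz
      calc _ ≤ 2 * Q / c * V ^ ε + 2 * V ^ ε + Q * V ^ ε := by
            have h3 : C * 2 ^ (ε / 2) * V ^ (ε / 2) ≤ Q * V ^ ε := by
              have : C * 2 ^ (ε / 2) ≤ Q := by linarith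
              gcongr ?_ * ?_
            linarith
        _ ≤ M * V ^ ε := by rw [← add_mul, ← add_mul]; gcongr
  · have hV4 : C * 2 ^ (ε / 2) * V ^ (ε / 2) ≤ D / 4 := by
      rw [mul_assoc, ← Real.mul_rpow (by norm_num) (by linarith), hD,
        mul_div_cancel_left₀ _ (by norm_num : (4 : ℝ) ≠ 0)]
      refine mul_le_mul_of_nonneg_left (Real.rpow_le_rpow (by positivity) ?_ (by positivity))
        (by linarith)
      linarith
    have hlow := hmin s hs1 hs2 hy
    have hns : ∀ w ∈ Metric.closedBall s r, ‖w - 1‖ ≤ 3 := by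
      intro w hw
      obtain ⟨h1, h2, h3, h4, h5⟩ := hball w hw
      have h6 := Complex.norm_le_abs_re_add_abs_im (w - 1)
      have h7 : |(w - 1).re| ≤ 1 := by
        rw [Complex.sub_re, Complex.one_re, abs_le]; constructor <;> linarith
      rw [Complex.sub_im, Complex.one_im, sub_zero] at h6
      linarith
    have key := logDeriv_bound_of_lower (L := zetaZ) (s := s) (r := r) (M := D)
      (m := m) hr0 hm (fun w hw => differentiableAt_zetaZ (hball w hw).2.2.2.2)
      (fun w hw => by
        rw [deriv_zetaZ (hball w hw).2.2.2.2]
        refine (norm_add_le _ _).trans ?_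
        rw [norm_mul]
        obtain ⟨h1, h2⟩ := hbw w hw
        have h3 := hns w hw
        nlinarith [norm_nonneg (deriv (regL oneSeq 1) w)]) hlow (by
        have h1 : M⁻¹ * D ≤ m / 2 := by
          rw [inv_mul_le_iff₀ hM0]
          rw [div_le_iff₀ hm] at hMD1
          linarith
        exact (mul_le_mul_of_nonneg_right hrM hD0.le).trans h1) z hz
    refine ⟨key.1, hz5, ?_⟩
    rw [zetaA]
    refine (norm_sub_le _ _).trans ?_
    rw [norm_neg]
    have h1 := (hbw z hz).1
    calc _ ≤ 2 * D / m + D := by linarith [key.2]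
      _ ≤ M := hMD
      _ ≤ M * V ^ ε := le_mul_of_one_le_right hM0.le hVε

end TG

namespace TG

/-- The Mellin transform of `max (1 - u) 0`. -/
def perronKer (s : ℂ) : ℂ := 1 / s - 1 / (s + 1)

theorem half_le_norm {s : ℂ} (hs : 1 ≤ s.re) : (1 + |s.im|) / 2 ≤ ‖s‖ := by
  have h1 := Complex.abs_re_le_norm s
  have h2 := Complex.abs_im_le_norm s
  have h3 := le_abs_self s.re
  linarith

theorem norm_perronKer_le {s : ℂ} (hs : 1 ≤ s.re) :
    ‖perronKer s‖ ≤ 4 * (1 + |s.im|) ^ (-2 : ℝ) := by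
  have h1 := half_le_norm hs
  have h2 : (1 + |s.im|) / 2 ≤ ‖s + 1‖ := by
    have := half_le_norm (s := s + 1) (by simp; linarith)
    simpa using this
  have h0 : 0 < 1 + |s.im| := by positivity
  have hs0 : s ≠ 0 := by rintro rfl; simp at hs; linarith
  have hs1 : s + 1 ≠ 0 := by
    intro h
    rw [h] at h2
    simp at h2; linarith
  have : perronKer s = 1 / (s * (s + 1)) := by
    rw [perronKer]; field_simp; ring
  rw [this, norm_div, norm_one, norm_mul, Real.rpow_neg h0.le, ← div_eq_mul_inv,
    Real.rpow_two]
  rw [div_le_div_iff₀ (by positivity) (by positivity)]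
  nlinarith

theorem continuous_perronKer {σ : ℝ} (hσ : 1 ≤ σ) :
    Continuous fun t : ℝ => perronKer (σ + t * Complex.I) := by
  have h1 : ∀ t : ℝ, (σ + t * Complex.I : ℂ) ≠ 0 := by
    intro t h
    have := congrArg Complex.re h
    simp at this; linarith
  have h2 : ∀ t : ℝ, (σ + t * Complex.I + 1 : ℂ) ≠ 0 := by
    intro t h
    have := congrArg Complex.re h
    simp at this; linarith
  unfold perronKer
  refine Continuous.sub (Continuous.div (by fun_prop) (by fun_prop) h1)
    (Continuous.div (by fun_prop) (by fun_prop) h2)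

theorem integrable_one_add_abs {r : ℝ} (hr : 1 < r) :
    Integrable fun t : ℝ => (1 + |t|) ^ (-r) := by
  have := integrable_one_add_norm (E := ℝ) (μ := volume) (r := r) (by simpa using hr)
  simpa using this

theorem integrable_perronKer {σ : ℝ} (hσ : 1 ≤ σ) :
    Integrable fun t : ℝ => perronKer (σ + t * Complex.I) := by
  refine Integrable.mono' ((integrable_one_add_abs (r := 2) (by norm_num)).const_mul 4)
    (continuous_perronKer hσ).aestronglyMeasurable (Filter.Eventually.of_forall fun t => ?_)
  have := norm_perronKer_le (s := σ + t * Complex.I) (by simpa using hσ)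
  simpa using this

theorem perronKer_integral {σ u : ℝ} (hσ : 1 ≤ σ) (hu : 0 < u) :
    ∫ t : ℝ, (u : ℂ) ^ (-(σ + t * Complex.I)) * perronKer (σ + t * Complex.I) =
      2 * Real.pi * ((max (1 - u) 0 : ℝ) : ℂ) := by
  set f : ℝ → ℂ := fun t => (Set.Ioc 0 1).indicator (fun _ => (1 : ℂ)) t -
    (Set.Ioc 0 1).indicator (fun t : ℝ => (t : ℂ) ^ (1 : ℂ)) t with hf
  have hm : ∀ s : ℂ, 1 ≤ s.re → HasMellin f s (perronKer s) := by
    intro s hs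
    have h1 := hasMellin_one_Ioc (s := s) (by linarith)
    have h2 := hasMellin_cpow_Ioc 1 (s := s) (by simp; linarith)
    have h3 := hasMellin_sub h1.1 h2.1
    rw [h1.2, h2.2] at h3
    exact h3
  have hre : ∀ t : ℝ, 1 ≤ (σ + t * Complex.I : ℂ).re := by intro t; simpa using hσ
  have hfv : ∀ v : ℝ, 0 < v → f v = ((max (1 - v) 0 : ℝ) : ℂ) := by
    intro v hv
    by_cases h1 : v ≤ 1
    · have : v ∈ Set.Ioc (0 : ℝ) 1 := ⟨hv, h1⟩
      simp only [hf, Set.indicator_of_mem this, Complex.cpow_one]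
      rw [max_eq_left (by linarith)]; push_cast; ring
    · have : v ∉ Set.Ioc (0 : ℝ) 1 := fun h => h1 h.2
      simp only [hf, Set.indicator_of_notMem this]
      rw [max_eq_right (by linarith)]; simp
  have hcont : ContinuousAt f u := by
    have : ContinuousAt (fun v : ℝ => ((max (1 - v) 0 : ℝ) : ℂ)) u := by fun_prop
    refine this.congr ?_
    filter_upwards [lt_mem_nhds hu] with v hv
    exact (hfv v hv).symm
  have h := mellinInv_mellin_eq σ f hu (hm σ (by simpa using hσ)).1 (by
    rw [Complex.VerticalIntegrable]
    refine (integrable_perronKer hσ).congr (Filter.Eventually.of_forall fun t => ?_)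
    exact (hm _ (hre t)).2.symm) hcont
  rw [hfv u hu, mellinInv] at h
  have h2 : (∫ y : ℝ, (u : ℂ) ^ (-(σ + y * Complex.I)) • mellin f (σ + y * Complex.I)) =
      ∫ t : ℝ, (u : ℂ) ^ (-(σ + t * Complex.I)) * perronKer (σ + t * Complex.I) := by
    refine integral_congr_ae (Filter.Eventually.of_forall fun t => ?_)
    simp only [smul_eq_mul, (hm _ (hre t)).2]
  rw [h2] at h
  rw [← h, Complex.real_smul]
  generalize (∫ t : ℝ, (u : ℂ) ^ (-(σ + t * Complex.I)) * perronKer (σ + t * Complex.I)) = J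
  push_cast
  have := Real.pi_ne_zero
  have h4 : (Real.pi : ℂ) ≠ 0 := by exact_mod_cast this
  field_simp

theorem cpow_div_neg {m : ℕ} (hm : m ≠ 0) {x : ℝ} (hx : 0 < x) (s : ℂ) :
    ((m / x : ℝ) : ℂ) ^ (-s) = (x : ℂ) ^ s / (m : ℂ) ^ s := by
  have h1 : (0 : ℝ) < m := by positivity
  rw [Complex.cpow_neg, div_eq_mul_inv (m : ℝ) x, Complex.ofReal_mul,
    Complex.mul_cpow_ofReal_nonneg h1.le (by positivity), Complex.ofReal_inv,
    Complex.inv_cpow _ _ (by rw [Complex.arg_ofReal_of_nonneg hx.le]; exact Real.pi_pos.ne)]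
  have h2 : (x : ℂ) ^ s ≠ 0 := by
    rw [Complex.cpow_ne_zero_iff]; left; exact_mod_cast hx.ne'
  have h3 : (m : ℂ) ^ s ≠ 0 := by
    rw [Complex.cpow_ne_zero_iff]; left; exact_mod_cast hm
  rw [Complex.ofReal_natCast]
  field_simp

theorem perron_sum {b : ℕ → ℂ} {σ x : ℝ} (hσ : 1 ≤ σ) (hb : LSeriesSummable b σ) (hx : 0 < x) :
    2 * Real.pi * ∑ m ∈ Icc 1 ⌊x⌋₊, b m * ((1 - m / x : ℝ) : ℂ) =
      ∫ t : ℝ, LSeries b (σ + t * Complex.I) *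
        ((x : ℂ) ^ (σ + t * Complex.I : ℂ) * perronKer (σ + t * Complex.I)) := by
  set F : ℕ → ℝ → ℂ := fun m t => LSeries.term b (σ + t * Complex.I) m *
        ((x : ℂ) ^ (σ + t * Complex.I : ℂ) * perronKer (σ + t * Complex.I)) with hF
  have hFm : ∀ m, m ≠ 0 → F m = fun t : ℝ => b m * (((m / x : ℝ) : ℂ) ^ (-(σ + t * Complex.I)) *
      perronKer (σ + t * Complex.I)) := by
    intro m hm
    funext t
    simp only [hF]
    rw [cpow_div_neg hm hx, LSeries.term_of_ne_zero hm]; ring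
  have hnorm : ∀ m, (fun t => ‖F m t‖) = fun t : ℝ => ‖LSeries.term b σ m‖ * x ^ σ *
      ‖perronKer (σ + t * Complex.I)‖ := by
    intro m
    funext t
    simp only [hF]
    rw [norm_mul, norm_mul, Complex.norm_cpow_eq_rpow_re_of_pos hx, LSeries.norm_term_eq,
      LSeries.norm_term_eq]
    simp [mul_assoc]
  have hI : ∀ m, Integrable (F m) := by
    intro m
    by_cases hm : m = 0
    · simp [hF, hm]
    rw [hFm m hm]
    refine Integrable.const_mul ?_ _
    have hmx : (0 : ℝ) < m / x := by positivity
    have hmx' : ((m / x : ℝ) : ℂ) ≠ 0 := by exact_mod_cast hmx.ne'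
    refine Integrable.bdd_mul (c := (m / x) ^ (-σ)) (integrable_perronKer hσ) ?_ ?_
    · refine Continuous.aestronglyMeasurable ?_
      exact Continuous.const_cpow (by fun_prop) (Or.inl hmx')
    · refine Filter.Eventually.of_forall fun t => ?_
      rw [Complex.norm_cpow_eq_rpow_re_of_pos hmx]
      simp
  have hS : Summable fun m => ∫ t, ‖F m t‖ := by
    simp_rw [hnorm]
    simp_rw [integral_const_mul]
    exact (hb.norm.mul_right _).mul_right _
  have h := hasSum_integral_of_summable_integral_norm hI hS
  have h1 : (∫ t : ℝ, ∑' m, F m t) = ∫ t : ℝ, LSeries b (σ + t * Complex.I) *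
        ((x : ℂ) ^ (σ + t * Complex.I : ℂ) * perronKer (σ + t * Complex.I)) := by
    refine integral_congr_ae (Filter.Eventually.of_forall fun t => ?_)
    simp only [hF]
    rw [tsum_mul_right]
    rfl
  rw [← h1, ← h.tsum_eq, tsum_eq_sum (s := Icc 1 ⌊x⌋₊), mul_sum]
  · refine sum_congr rfl fun m hm => ?_
    rw [mem_Icc] at hm
    have hm0 : m ≠ 0 := by omega
    have hmx : (m : ℝ) ≤ x := (Nat.le_floor_iff hx.le).mp hm.2
    rw [hFm m hm0, integral_const_mul, perronKer_integral hσ (by positivity),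
      max_eq_left (by rw [sub_nonneg]; exact div_le_one_of_le₀ hmx hx.le)]
    ring
  · intro m hm
    by_cases hm0 : m = 0
    · simp [hF, hm0]
    have hmx : x < m := by
      rw [mem_Icc, not_and, not_le] at hm
      exact (Nat.floor_lt hx.le).mp (hm (by omega))
    rw [hFm m hm0, integral_const_mul, perronKer_integral hσ (by positivity),
      max_eq_right (by rw [sub_nonpos]; exact ((one_le_div hx).mpr hmx.le))]
    simp

theorem LSeries_logMul_eq {a : ℕ → ℂ} {𝔄 : ℂ → ℂ} (hsum : ∀ s : ℂ, 1 < s.re → LSeriesSummable a s)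
    (h𝔄 : ∀ s : ℂ, 1 < s.re → LSeries a s = 𝔄 s) (k : ℕ) {s : ℂ} (hs : 1 < s.re) :
    LSeriesSummable (fun m => a m * (Real.log m : ℂ) ^ k) s ∧
    LSeries (fun m => a m * (Real.log m : ℂ) ^ k) s = (-1) ^ k * iteratedDeriv k 𝔄 s := by
  have hit : LSeries.logMul^[k] a = fun m => a m * (Real.log m : ℂ) ^ k := by
    induction k with
    | zero => simp
    | succ k ih =>
      rw [Function.iterate_succ_apply', ih]
      funext m
      rw [LSeries.logMul, Complex.natCast_log]; ring
  have habs : LSeries.abscissaOfAbsConv a ≤ (1 : ℝ) :=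
    LSeries.abscissaOfAbsConv_le_of_forall_lt_LSeriesSummable fun y hy => hsum y (by simpa using hy)
  have hlt : LSeries.abscissaOfAbsConv a < s.re :=
    habs.trans_lt (by exact_mod_cast hs)
  rw [← hit]
  constructor
  · refine LSeriesSummable_of_abscissaOfAbsConv_lt_re ?_
    rwa [LSeries.absicssaOfAbsConv_logPowMul]
  · have h1 := LSeries_iteratedDeriv k hlt
    have h2 : iteratedDeriv k (LSeries a) s = iteratedDeriv k 𝔄 s := by
      refine Filter.EventuallyEq.iteratedDeriv_eq k ?_
      filter_upwards [(isOpen_one_lt_re).mem_nhds hs] with z hz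
      exact h𝔄 z hz
    rw [← h2, h1, ← mul_assoc, ← mul_pow]
    simp

/-- Smoothed sums of Dirichlet coefficients from bounds for the Dirichlet series in small discs
around the points of the line of absolute convergence. -/
theorem perron_bound (k : ℕ) : ∃ C ≥ (1 : ℝ), ∀ (a : ℕ → ℂ) (𝔄 : ℂ → ℂ) (M Q ε : ℝ),
    1 ≤ M → 1 ≤ Q → 0 < ε → ε * (k + 1) ≤ 1 / 2 →
    (∀ s : ℂ, 1 < s.re → LSeriesSummable a s) → (∀ s : ℂ, 1 < s.re → LSeries a s = 𝔄 s) →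
    (∀ s : ℂ, 1 ≤ s.re → s.re ≤ 3 / 2 →
      ∀ z ∈ Metric.closedBall s (M⁻¹ * (Q * (|s.im| + 2)) ^ (-ε)),
        DifferentiableAt ℂ 𝔄 z ∧ ‖𝔄 z‖ ≤ M * (Q * (|s.im| + 2)) ^ ε) →
    ∀ x : ℝ, Real.exp 2 ≤ x →
      ‖∑ m ∈ Icc 1 ⌊x⌋₊, a m * (Real.log m : ℂ) ^ k * ((1 - m / x : ℝ) : ℂ)‖ ≤
        C * M ^ (k + 1) * Q ^ (ε * (k + 1)) * x := by
  set J : ℝ := ∫ t : ℝ, (1 + |t|) ^ (-(3 / 2 : ℝ)) with hJ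
  have hJ0 : 0 ≤ J := integral_nonneg fun t => by positivity
  refine ⟨1 + k.factorial * 8 * J * Real.exp 1, by
    have : 0 ≤ k.factorial * 8 * J * Real.exp 1 := by positivity
    linarith, ?_⟩
  intro a 𝔄 M Q ε hM hQ hε hεk hsum h𝔄 hdisc x hx
  have hx0 : 0 < x := (Real.exp_pos 2).trans_le hx
  have hlog : 2 ≤ Real.log x := by rwa [Real.le_log_iff_exp_le hx0]
  set σ := 1 + 1 / Real.log x with hσ
  have hσ1 : 1 < σ := by rw [hσ]; have : 0 < 1 / Real.log x := by positivity
                         linarith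
  have hσ2 : σ ≤ 3 / 2 := by
    rw [hσ]; have : 1 / Real.log x ≤ 1 / 2 := one_div_le_one_div_of_le two_pos hlog
    linarith
  have hxσ : x ^ σ = x * Real.exp 1 := by
    rw [hσ, Real.rpow_add hx0, Real.rpow_one, Real.rpow_def_of_pos hx0]
    congr 2
    field_simp
  set η := ε * (k + 1) with hη
  have hη0 : 0 < η := by positivity
  have hp := perron_sum (b := fun m => a m * (Real.log m : ℂ) ^ k) (x := x) hσ1.le
    (LSeries_logMul_eq hsum h𝔄 k (by simpa using hσ1)).1 hx0
  have hbound : ∀ t : ℝ, ‖LSeries (fun m => a m * (Real.log m : ℂ) ^ k) (σ + t * Complex.I) *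
        ((x : ℂ) ^ (σ + t * Complex.I : ℂ) * perronKer (σ + t * Complex.I))‖ ≤
      k.factorial * 8 * M ^ (k + 1) * Q ^ η * (x * Real.exp 1) * (1 + |t|) ^ (-(3 / 2 : ℝ)) := by
    intro t
    set s : ℂ := σ + t * Complex.I with hs
    have hre : s.re = σ := by simp [hs]
    have him : s.im = t := by simp [hs]
    rw [(LSeries_logMul_eq hsum h𝔄 k (by rw [hre]; exact hσ1)).2, norm_mul, norm_mul, norm_mul,
      Complex.norm_cpow_eq_rpow_re_of_pos hx0, hre, hxσ]
    have h1 : ‖((-1 : ℂ)) ^ k‖ = 1 := by simp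
    rw [h1, one_mul]
    have hV0 : 0 < Q * (|t| + 2) := by positivity
    set V := Q * (|t| + 2) with hV
    have hr : 0 < M⁻¹ * V ^ (-ε) := by positivity
    have hd := hdisc s (by rw [hre]; exact hσ1.le) (by rw [hre]; exact hσ2)
    rw [him, ← hV] at hd
    have h2 : ‖iteratedDeriv k 𝔄 s‖ ≤ k.factorial * (M ^ (k + 1) * V ^ η) := by
      refine (Complex.norm_iteratedDeriv_le_of_forall_mem_sphere_norm_le k hr
        (DifferentiableOn.diffContOnCl fun z hz => ?_) fun z hz =>
          (hd z (Metric.sphere_subset_closedBall hz)).2).trans ?_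
      · rw [closure_ball _ hr.ne'] at hz
        exact (hd z hz).1.differentiableWithinAt
      · apply le_of_eq
        rw [mul_div_assoc]
        congr 1
        have h3 : V ^ η = V ^ ε * (V ^ ε) ^ k := by
          rw [← Real.rpow_natCast, ← Real.rpow_mul hV0.le, ← Real.rpow_add hV0, hη]
          congr 1; ring
        rw [h3, Real.rpow_neg hV0.le, mul_pow, inv_pow, inv_pow]
        have : V ^ ε ≠ 0 := by positivity
        field_simp
        ring
    have h3 : V ^ η ≤ 2 * Q ^ η * (1 + |t|) ^ (1 / 2 : ℝ) := by
      have h4 : V ≤ 2 * (Q * (1 + |t|)) := by rw [hV]; nlinarith [abs_nonneg t]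
      calc V ^ η ≤ (2 * (Q * (1 + |t|))) ^ η := Real.rpow_le_rpow hV0.le h4 hη0.le
        _ = 2 ^ η * (Q ^ η * (1 + |t|) ^ η) := by
          rw [Real.mul_rpow (by norm_num) (by positivity), Real.mul_rpow (by positivity)
            (by positivity)]
        _ ≤ 2 ^ (1 : ℝ) * (Q ^ η * (1 + |t|) ^ (1 / 2 : ℝ)) := by
          gcongr ?_ * (_ * ?_)
          · exact Real.rpow_le_rpow_of_exponent_le (by norm_num) (by linarith)
          · exact Real.rpow_le_rpow_of_exponent_le (by linarith [abs_nonneg t]) (by linarith)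
        _ = _ := by rw [Real.rpow_one]; ring
    have h4 := norm_perronKer_le (s := s) (by rw [hre]; exact hσ1.le)
    rw [him] at h4
    have h5 : (1 + |t|) ^ (-(3 / 2 : ℝ)) = (1 + |t|) ^ (1 / 2 : ℝ) * (1 + |t|) ^ (-2 : ℝ) := by
      rw [← Real.rpow_add (by positivity)]; norm_num
    rw [h5]
    calc _ ≤ (k.factorial * (M ^ (k + 1) * (2 * Q ^ η * (1 + |t|) ^ (1 / 2 : ℝ)))) *
          (x * Real.exp 1 * (4 * (1 + |t|) ^ (-2 : ℝ))) := by
            gcongr ?_ * (_ * ?_)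
            refine h2.trans ?_
            gcongr
      _ = _ := by ring
  have hval := norm_integral_le_of_norm_le
    ((integrable_one_add_abs (r := 3 / 2) (by norm_num)).const_mul _)
    (Filter.Eventually.of_forall hbound)
  rw [← hp, integral_const_mul, ← hJ, norm_mul] at hval
  have hpi : (1 : ℝ) ≤ ‖(2 * Real.pi : ℂ)‖ := by
    rw [norm_mul, Complex.norm_real, Real.norm_of_nonneg Real.pi_pos.le]
    simp
    linarith [Real.pi_gt_three]
  have h9 : 0 ≤ M ^ (k + 1) * Q ^ η * x := by positivity
  calc _ ≤ ‖(2 * Real.pi : ℂ)‖ * _ := le_mul_of_one_le_left (norm_nonneg _) hpi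
    _ ≤ _ := hval
    _ ≤ (1 + k.factorial * 8 * J * Real.exp 1) * (M ^ (k + 1) * Q ^ η * x) := by
        rw [add_mul, one_mul]
        refine le_add_of_nonneg_of_le h9 (le_of_eq (by ring))
    _ = _ := by ring

theorem norm_sum_mul_antitone_le {w : ℕ → ℝ} {b : ℕ → ℂ} {n : ℕ} {B : ℝ}
    (hw : ∀ i, 0 ≤ w i) (hanti : Antitone w)
    (hB : ∀ j ≤ n, ‖∑ i ∈ range j, b i‖ ≤ B) :
    ‖∑ i ∈ range n, (w i : ℂ) * b i‖ ≤ B * w 0 := by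
  rcases Nat.eq_zero_or_pos n with rfl | hn
  · have := hB 0 le_rfl
    simp at this ⊢
    exact mul_nonneg this (hw 0)
  have h := sum_range_by_parts (R := ℂ) (fun i => (w i : ℂ)) b n
  simp only [smul_eq_mul] at h
  rw [h]
  have h1 : ∀ i ∈ range (n - 1), ‖((w (i + 1) : ℂ) - w i) * ∑ l ∈ range (i + 1), b l‖ ≤
      (w i - w (i + 1)) * B := by
    intro i hi
    rw [mem_range] at hi
    rw [norm_mul, ← Complex.ofReal_sub, Complex.norm_real, Real.norm_eq_abs, abs_sub_comm,
      abs_of_nonneg (sub_nonneg.mpr (hanti (Nat.le_succ i)))]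
    exact mul_le_mul_of_nonneg_left (hB _ (by omega)) (sub_nonneg.mpr (hanti (Nat.le_succ i)))
  refine (norm_sub_le _ _).trans ?_
  have h2 := (norm_sum_le _ _).trans (sum_le_sum h1)
  rw [← sum_mul, sum_range_sub'] at h2
  have h3 : ‖(w (n - 1) : ℂ) * ∑ i ∈ range n, b i‖ ≤ w (n - 1) * B := by
    rw [norm_mul, Complex.norm_real, Real.norm_of_nonneg (hw _)]
    exact mul_le_mul_of_nonneg_left (hB _ le_rfl) (hw _)
  nlinarith

theorem smooth_difference (b : ℕ → ℂ) {x h : ℝ} (hx : 0 < x) (hh : 0 < h) :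
    (h : ℂ) * ∑ m ∈ Icc 1 ⌊x⌋₊, b m =
      ((x + h : ℝ) : ℂ) * (∑ m ∈ Icc 1 ⌊x + h⌋₊, b m * ((1 - m / (x + h) : ℝ) : ℂ)) -
      (x : ℂ) * (∑ m ∈ Icc 1 ⌊x⌋₊, b m * ((1 - m / x : ℝ) : ℂ)) -
      ∑ m ∈ Ioc ⌊x⌋₊ ⌊x + h⌋₊, b m * ((x + h - m : ℝ) : ℂ) := by
  have hd : Icc 1 ⌊x + h⌋₊ = Icc 1 ⌊x⌋₊ ∪ Ioc ⌊x⌋₊ ⌊x + h⌋₊ := by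
    have : ⌊x⌋₊ ≤ ⌊x + h⌋₊ := Nat.floor_mono (by linarith)
    ext m; simp only [mem_Icc, mem_union, mem_Ioc]; omega
  have hdj : Disjoint (Icc 1 ⌊x⌋₊) (Ioc ⌊x⌋₊ ⌊x + h⌋₊) := by
    rw [Finset.disjoint_left]; intro m; simp only [mem_Icc, mem_Ioc]; omega
  rw [hd, sum_union hdj, mul_add]
  have hc : ∀ y : ℝ, 0 < y → ∀ m : ℕ, ∀ z : ℂ, (y : ℂ) * (z * ((1 - m / y : ℝ) : ℂ)) =
      z * ((y - m : ℝ) : ℂ) := by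
    intro y hy m z
    have : (y : ℂ) ≠ 0 := by exact_mod_cast hy.ne'
    push_cast; field_simp
  simp only [mul_sum, hc _ (add_pos hx hh), hc x hx]
  rw [add_sub_right_comm, add_sub_assoc, sub_self, add_zero, ← sum_sub_distrib]
  refine sum_congr rfl fun m _ => ?_
  push_cast; ring

theorem desmooth (j : ℕ) : ∃ C ≥ (1 : ℝ), ∀ (a : ℕ → ℂ) (E : ℝ), 1 ≤ E →
    (∀ m : ℕ, ‖a m‖ ≤ Real.log m + 1) →
    (∀ x : ℝ, Real.exp 2 ≤ x →
      ‖∑ m ∈ Icc 1 ⌊x⌋₊, a m * (Real.log m : ℂ) ^ (2 * j) * ((1 - m / x : ℝ) : ℂ)‖ ≤ E * x) →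
    ∀ x : ℝ, Real.exp 2 ≤ x →
      ‖∑ m ∈ Icc 1 ⌊x⌋₊, a m * (Real.log m : ℂ) ^ (2 * j)‖ ≤ C * E * x * Real.log x ^ (j + 1) := by
  refine ⟨5 + 3 * (1 + j.factorial) * 4 ^ j, by
    have : 0 ≤ 3 * (1 + j.factorial) * (4 : ℝ) ^ j := by positivity
    linarith, ?_⟩
  intro a E hE ha hT x hx
  have hx0 : 0 < x := (Real.exp_pos 2).trans_le hx
  have hL2 : 2 ≤ Real.log x := by rwa [Real.le_log_iff_exp_le hx0]
  have hx1 : 1 ≤ x := le_trans (by norm_num) (Real.add_one_le_exp 2 |>.trans hx)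
  set L := Real.log x with hL
  have hLj : 1 ≤ L ^ j := one_le_pow₀ (by linarith)
  set h := x / L ^ j with hh
  have hh0 : 0 < h := by positivity
  have hhx : h ≤ x := div_le_self hx0.le hLj
  set b : ℕ → ℂ := fun m => a m * (Real.log m : ℂ) ^ (2 * j) with hb
  have hid := smooth_difference b hx0 hh0
  have h1 : ‖((x + h : ℝ) : ℂ) * (∑ m ∈ Icc 1 ⌊x + h⌋₊, b m * ((1 - m / (x + h) : ℝ) : ℂ))‖ ≤
      4 * E * x ^ 2 := by
    rw [norm_mul, Complex.norm_real, Real.norm_of_nonneg (by positivity)]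
    calc _ ≤ (x + h) * (E * (x + h)) := by
          exact mul_le_mul_of_nonneg_left (hT (x + h) (by linarith)) (by positivity)
      _ ≤ (2 * x) * (E * (2 * x)) := by gcongr <;> linarith
      _ = _ := by ring
  have h2 : ‖(x : ℂ) * (∑ m ∈ Icc 1 ⌊x⌋₊, b m * ((1 - m / x : ℝ) : ℂ))‖ ≤ E * x ^ 2 := by
    rw [norm_mul, Complex.norm_real, Real.norm_of_nonneg hx0.le]
    calc _ ≤ x * (E * x) := mul_le_mul_of_nonneg_left (hT x hx) hx0.le
      _ = _ := by ring
  have hlog2x : Real.log (2 * x) ≤ 2 * L := by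
    rw [Real.log_mul two_ne_zero hx0.ne']
    linarith [Real.log_two_lt_d9]
  have h3 : ‖∑ m ∈ Ioc ⌊x⌋₊ ⌊x + h⌋₊, b m * ((x + h - m : ℝ) : ℂ)‖ ≤
      (h + 1) * (3 * L * (2 * L) ^ (2 * j) * h) := by
    refine (norm_sum_le_of_le (f := fun m => b m * ((x + h - m : ℝ) : ℂ))
      (n := fun _ => 3 * L * (2 * L) ^ (2 * j) * h) _ ?_).trans ?_
    · intro m hm
      rw [mem_Ioc] at hm
      have hm1 : x < m := (Nat.floor_lt hx0.le).mp hm.1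
      have hm2 : (m : ℝ) ≤ x + h := (Nat.le_floor_iff (by positivity)).mp hm.2
      have hm0 : (0 : ℝ) < m := hx0.trans hm1
      have hlm : Real.log m ≤ 2 * L :=
        (Real.log_le_log hm0 (by linarith)).trans hlog2x
      have hlm0 : 0 ≤ Real.log m := Real.log_nonneg (by linarith)
      rw [norm_mul, hb, norm_mul, norm_pow, Complex.norm_real, Complex.norm_real,
        Real.norm_of_nonneg hlm0, Real.norm_of_nonneg (by linarith)]
      gcongr
      · exact (ha m).trans (by linarith)
      · linarith
    · rw [sum_const, nsmul_eq_mul, Nat.card_Ioc]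
      refine mul_le_mul_of_nonneg_right ?_ (by positivity)
      rw [Nat.cast_sub (Nat.floor_mono (by linarith))]
      have := Nat.floor_le (show 0 ≤ x + h by positivity)
      have := Nat.lt_floor_add_one x
      linarith
  have h4 : h + 1 ≤ (1 + j.factorial) * h := by
    have h5 := Real.pow_div_factorial_le_exp L (by linarith) j
    rw [hL, Real.exp_log hx0, ← hL, div_le_iff₀ (by positivity)] at h5
    have : 1 ≤ j.factorial * h := by
      rw [hh, ← mul_div_assoc, one_le_div (by positivity)]; linarith
    linarith
  have h5 : h * ‖∑ m ∈ Icc 1 ⌊x⌋₊, b m‖ ≤ 5 * E * x ^ 2 +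
      ((1 + j.factorial) * h) * (3 * L * (2 * L) ^ (2 * j) * h) := by
    have h6 : ‖(h : ℂ) * ∑ m ∈ Icc 1 ⌊x⌋₊, b m‖ = h * ‖∑ m ∈ Icc 1 ⌊x⌋₊, b m‖ := by
      rw [norm_mul, Complex.norm_real, Real.norm_of_nonneg hh0.le]
    rw [← h6, hid]
    refine (norm_sub_le _ _).trans ((add_le_add_left (norm_sub_le _ _) _).trans ?_)
    have h7 := mul_le_mul_of_nonneg_right h4 (show 0 ≤ 3 * L * (2 * L) ^ (2 * j) * h by positivity)
    linarith
  have hLh : h * L ^ j = x := by rw [hh]; field_simp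
  have h6 : h * ‖∑ m ∈ Icc 1 ⌊x⌋₊, b m‖ ≤
      h * (5 * E * x * L ^ j + 3 * (1 + j.factorial) * 4 ^ j * x * L ^ (j + 1)) := by
    refine h5.trans (le_of_eq ?_)
    rw [mul_pow 2 L (2 * j), pow_mul 2 2 j, show (2 : ℝ) ^ 2 = 4 by norm_num]
    rw [← hLh]; ring
  have h7 := le_of_mul_le_mul_left h6 hh0
  refine h7.trans ?_
  have h8 : L ^ j ≤ L ^ (j + 1) := pow_le_pow_right₀ (by linarith) (by omega)
  calc 5 * E * x * L ^ j + 3 * (1 + j.factorial) * 4 ^ j * x * L ^ (j + 1)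
      ≤ 5 * E * x * L ^ (j + 1) + 3 * (1 + j.factorial) * 4 ^ j * x * L ^ (j + 1) * E := by
        refine add_le_add (by gcongr) (le_mul_of_one_le_right (by positivity) hE)
    _ = _ := by ring

theorem remove_log (j : ℕ) : ∃ C ≥ (1 : ℝ), ∀ (a : ℕ → ℂ) (E : ℝ), 1 ≤ E →
    (∀ m : ℕ, ‖a m‖ ≤ Real.log m + 1) →
    (∀ x : ℝ, Real.exp 2 ≤ x →
      ‖∑ m ∈ Icc 1 ⌊x⌋₊, a m * (Real.log m : ℂ) ^ (2 * j) * ((1 - m / x : ℝ) : ℂ)‖ ≤ E * x) →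
    ∀ x : ℝ, Real.exp 4 ≤ x →
      ‖∑ m ∈ Icc 1 ⌊x⌋₊, a m‖ * Real.log x ^ j ≤ C * E * x * Real.log x := by
  obtain ⟨C₁, hC₁, hU⟩ := desmooth j
  refine ⟨2 * 2 ^ j * j.factorial + 2 * 4 ^ j * C₁, ?_, ?_⟩
  · have h1 : (1 : ℝ) ≤ 4 ^ j := one_le_pow₀ (by norm_num)
    have h2 : 0 ≤ 2 * 2 ^ j * (j.factorial : ℝ) := by positivity
    nlinarith
  intro a E hE ha hT x hx
  have hx0 : 0 < x := (Real.exp_pos 4).trans_le hx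
  have hL4 : 4 ≤ Real.log x := by rwa [Real.le_log_iff_exp_le hx0]
  set L := Real.log x with hL
  set y := Real.exp (L / 2) with hy
  have hyy : y * y = x := by
    rw [hy, ← Real.exp_add, add_halves, hL, Real.exp_log hx0]
  have hy2 : Real.exp 2 ≤ y := Real.exp_le_exp.mpr (by linarith)
  have hy1 : 1 ≤ y := Real.one_le_exp (by linarith)
  have hyx : y ≤ x := by nlinarith
  set N := ⌊y⌋₊ with hN
  set X := ⌊x⌋₊ with hX
  have hNX : N ≤ X := Nat.floor_mono hyx
  set b : ℕ → ℂ := fun m => a m * (Real.log m : ℂ) ^ (2 * j) with hb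
  have hsplit : ∑ m ∈ Icc 1 X, a m = ∑ m ∈ Icc 1 N, a m + ∑ m ∈ Ioc N X, a m := by
    rw [show Icc 1 X = Icc 1 N ∪ Ioc N X by
      ext m; simp only [mem_Icc, mem_union, mem_Ioc]; omega]
    refine sum_union ?_
    rw [Finset.disjoint_left]; intro m; simp only [mem_Icc, mem_Ioc]; omega
  have hhead : ‖∑ m ∈ Icc 1 N, a m‖ ≤ y * (2 * L) := by
    refine (norm_sum_le_of_le (n := fun _ => 2 * L) _ ?_).trans ?_
    · intro m hm
      rw [mem_Icc] at hm
      have hm1 : (1 : ℝ) ≤ m := by exact_mod_cast hm.1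
      have hm2 : (m : ℝ) ≤ y := (Nat.le_floor_iff (by positivity)).mp hm.2
      have := Real.log_le_log (by linarith) (hm2.trans hyx)
      exact (ha m).trans (by linarith)
    · rw [sum_const, nsmul_eq_mul, Nat.card_Icc, Nat.add_sub_cancel]
      exact mul_le_mul_of_nonneg_right (Nat.floor_le (by positivity)) (by linarith)
  set w : ℕ → ℝ := fun m => ((Real.log (max m (N + 1) : ℕ)) ^ (2 * j))⁻¹ with hw
  set b' : ℕ → ℂ := fun m => if N < m then b m else 0 with hb'
  have hlogN : L / 2 ≤ Real.log (N + 1 : ℕ) := by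
    rw [Real.le_log_iff_exp_le (by positivity)]
    exact (Nat.lt_floor_add_one y).le.trans (by push_cast; exact le_rfl)
  have htail : ∑ m ∈ Ioc N X, a m = ∑ m ∈ range (X + 1), (w m : ℂ) * b' m := by
    symm
    rw [← sum_subset (s₁ := Ioc N X)]
    · refine sum_congr rfl fun m hm => ?_
      rw [mem_Ioc] at hm
      simp only [hw, hb', hb, if_pos hm.1]
      rw [max_eq_left (by omega)]
      have hlm : L / 2 ≤ Real.log m := hlogN.trans
        (Real.log_le_log (by positivity) (by exact_mod_cast hm.1))
      have : (Real.log m : ℂ) ≠ 0 := by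
        have : (0 : ℝ) < Real.log m := by linarith
        exact_mod_cast this.ne'
      rw [Complex.ofReal_inv, Complex.ofReal_pow]
      field_simp
    · intro m hm; simp only [mem_Ioc, mem_range] at hm ⊢; omega
    · intro m hm hm'
      have : ¬ N < m := by simp only [mem_Ioc, mem_range] at hm hm'; omega
      simp [hb', this]
  have hUmax : ∀ t : ℕ, N ≤ t → t ≤ X → ‖∑ m ∈ Icc 1 t, b m‖ ≤ C₁ * E * x * L ^ (j + 1) := by
    intro t h1 h2
    set u := max (t : ℝ) y with hu
    have hut : ⌊u⌋₊ = t := by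
      rw [Nat.floor_eq_iff (by positivity)]
      refine ⟨le_max_left _ _, max_lt (by linarith) ?_⟩
      exact (Nat.lt_floor_add_one y).trans_le (by exact_mod_cast Nat.add_le_add_right h1 1)
    have hux : u ≤ x := max_le ((Nat.le_floor_iff hx0.le).mp h2) hyx
    have hu2 : Real.exp 2 ≤ u := hy2.trans (le_max_right _ _)
    have hu0 : 0 < u := (Real.exp_pos 2).trans_le hu2
    have hlu : 0 ≤ Real.log u := Real.log_nonneg (hy1.trans (le_max_right _ _))
    have := hU a E hE ha hT u hu2
    rw [hut] at this
    refine this.trans ?_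
    have hlx : Real.log u ≤ L := Real.log_le_log hu0 hux
    gcongr
  have hB : ∀ t ≤ X + 1, ‖∑ m ∈ range t, b' m‖ ≤ 2 * (C₁ * E * x * L ^ (j + 1)) := by
    intro t ht
    have h0 : 0 ≤ C₁ * E * x * L ^ (j + 1) := by positivity
    by_cases htN : t ≤ N
    · rw [sum_eq_zero]
      · simpa using h0
      · intro m hm
        rw [mem_range] at hm
        simp only [hb']; rw [if_neg (by omega)]
    · have : ∑ m ∈ range t, b' m = ∑ m ∈ Icc 1 (t - 1), b m - ∑ m ∈ Icc 1 N, b m := by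
        rw [show Icc 1 (t - 1) = Icc 1 N ∪ Ioc N (t - 1) by
          ext m; simp only [mem_Icc, mem_union, mem_Ioc]; omega, sum_union (by
          rw [Finset.disjoint_left]; intro m; simp only [mem_Icc, mem_Ioc]; omega),
          add_sub_cancel_left, ← sum_subset (s₁ := Ioc N (t - 1)) (s₂ := range t)]
        · refine sum_congr rfl fun m hm => ?_
          rw [mem_Ioc] at hm
          simp only [hb']; rw [if_pos hm.1]
        · intro m hm; simp only [mem_Ioc, mem_range] at hm ⊢; omega
        · intro m hm hm'
          have : ¬ N < m := by simp only [mem_Ioc, mem_range] at hm hm'; omega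
          simp [hb', this]
      rw [this]
      refine (norm_sub_le _ _).trans ?_
      have h1 := hUmax (t - 1) (by omega) (by omega)
      have h2 := hUmax N le_rfl hNX
      linarith
  have hab := norm_sum_mul_antitone_le (w := w) (b := b') (n := X + 1) (fun i => by positivity)
    (by
      intro i i' hi
      simp only [hw]
      have h1 : Real.log (max i (N + 1) : ℕ) ≤ Real.log (max i' (N + 1) : ℕ) :=
        Real.log_le_log (by positivity) (by exact_mod_cast max_le_max_right _ hi)
      have h2 : 0 < Real.log (max i (N + 1) : ℕ) := by
        refine lt_of_lt_of_le (by linarith) (hlogN.trans (Real.log_le_log (by positivity) ?_))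
        exact_mod_cast le_max_right _ _
      gcongr) hB
  rw [← htail] at hab
  have hw0 : w 0 ≤ 4 ^ j * (L ^ (2 * j))⁻¹ := by
    simp only [hw]
    rw [max_eq_right (by omega)]
    calc (Real.log (N + 1 : ℕ) ^ (2 * j))⁻¹ ≤ ((L / 2) ^ (2 * j))⁻¹ := by gcongr
      _ = _ := by
        rw [div_pow, inv_div, pow_mul 2 2 j, show (2 : ℝ) ^ 2 = 4 by norm_num, div_eq_mul_inv]
  have h1 : ‖∑ m ∈ Ioc N X, a m‖ * L ^ j ≤ 2 * 4 ^ j * C₁ * E * x * L := by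
    have hLne : L ≠ 0 := by positivity
    calc _ ≤ (2 * (C₁ * E * x * L ^ (j + 1)) * (4 ^ j * (L ^ (2 * j))⁻¹)) * L ^ j := by
          refine mul_le_mul_of_nonneg_right (hab.trans ?_) (by positivity)
          exact mul_le_mul_of_nonneg_left hw0 (by positivity)
      _ = _ := by
        rw [show 2 * j = j + j by ring, pow_add, pow_succ]
        field_simp
        ring
  have h2 : ‖∑ m ∈ Icc 1 N, a m‖ * L ^ j ≤ 2 * 2 ^ j * j.factorial * E * x * L := by
    have h5 := Real.pow_div_factorial_le_exp (L / 2) (by linarith) j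
    rw [← hy, div_pow, div_div, div_le_iff₀ (by positivity)] at h5
    calc _ ≤ y * (2 * L) * (y * (2 ^ j * j.factorial)) := by gcongr
      _ = 2 * 2 ^ j * j.factorial * (y * y) * L := by ring
      _ = 2 * 2 ^ j * j.factorial * 1 * x * L := by rw [hyy]; ring
      _ ≤ _ := by gcongr
  calc _ ≤ (‖∑ m ∈ Icc 1 N, a m‖ + ‖∑ m ∈ Ioc N X, a m‖) * L ^ j := by
        rw [hsplit]; gcongr; exact norm_add_le _ _
    _ ≤ _ := by rw [add_mul]; linarith

theorem norm_char_vonMangoldt_le {q : ℕ} (χ : DirichletCharacter ℂ q) (m : ℕ) :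
    ‖χ m * (ArithmeticFunction.vonMangoldt m : ℂ)‖ ≤ Real.log m := by
  rw [norm_mul, Complex.norm_real, Real.norm_of_nonneg ArithmeticFunction.vonMangoldt_nonneg]
  exact (mul_le_of_le_one_left ArithmeticFunction.vonMangoldt_nonneg
    (DirichletCharacter.norm_le_one _ _)).trans ArithmeticFunction.vonMangoldt_le_log

theorem perron_exponent (k : ℕ) {B : ℝ} (hB : 0 ≤ B) : ∃ ε > (0 : ℝ),
    ε * (k + 1) ≤ 1 / 2 ∧ B * (ε * (k + 1)) ≤ 1 := by
  refine ⟨1 / (2 * (k + 1) * (1 + B)), by positivity, ?_, ?_⟩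
  · rw [div_mul_eq_mul_div, div_le_div_iff₀ (by positivity) (by positivity)]
    have : (0 : ℝ) ≤ (k + 1) * B := by positivity
    nlinarith
  · rw [div_mul_eq_mul_div, ← mul_div_assoc, div_le_one (by positivity)]
    have : (0 : ℝ) ≤ (k + 1) * B := by positivity
    have : (0 : ℝ) ≤ k := by positivity
    nlinarith

/-- The Siegel–Walfisz theorem for nonprincipal characters. -/
theorem sum_char_vonMangoldt_le (j : ℕ) {B : ℝ} (hB : 0 ≤ B) : ∃ C ≥ (1 : ℝ),
    ∀ (q : ℕ) [NeZero q] (χ : DirichletCharacter ℂ q), χ ≠ 1 →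
    ∀ x : ℝ, Real.exp 4 ≤ x → (q : ℝ) ≤ Real.log x ^ B →
      ‖∑ m ∈ Icc 1 ⌊x⌋₊, χ m * (ArithmeticFunction.vonMangoldt m : ℂ)‖ * Real.log x ^ j ≤
        C * x * Real.log x ^ 2 := by
  obtain ⟨ε, hε, hε1, hε2⟩ := perron_exponent (2 * j) hB
  obtain ⟨M, hM, hdisc⟩ := char_disc hε
  obtain ⟨C₁, hC₁, hp⟩ := perron_bound (2 * j)
  obtain ⟨C₂, hC₂, hr⟩ := remove_log j
  refine ⟨C₂ * (C₁ * M ^ (2 * j + 1)), one_le_mul_of_one_le_of_one_le hC₂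
    (one_le_mul_of_one_le_of_one_le hC₁ (one_le_pow₀ hM)), ?_⟩
  intro q _ χ hχ x hx hq
  have hq1 : (1 : ℝ) ≤ q := by exact_mod_cast NeZero.pos q
  have hx0 : 0 < x := (Real.exp_pos 4).trans_le hx
  have hL4 : 4 ≤ Real.log x := by rwa [Real.le_log_iff_exp_le hx0]
  have h1 := hp (fun m : ℕ => χ m * (ArithmeticFunction.vonMangoldt m : ℂ))
    (fun s => -(deriv (DirichletCharacter.LFunction χ) s / DirichletCharacter.LFunction χ s))
    M q ε hM hq1 hε (by exact_mod_cast hε1)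
    (fun s hs => DirichletCharacter.LSeriesSummable_twist_vonMangoldt χ hs)
    (fun s hs => by
      have h2 := (hasDerivAt_LFunction χ hχ hs).deriv
      have h3 : DirichletCharacter.LFunction χ s ≠ 0 :=
        DirichletCharacter.LFunction_ne_zero_of_one_le_re χ (Or.inl hχ) hs.le
      rw [h2]
      have h4 : LSeries (fun m : ℕ => χ m * (ArithmeticFunction.vonMangoldt m : ℂ)) s =
        LSeries ((fun n : ℕ => χ n) * fun n => (ArithmeticFunction.vonMangoldt n : ℂ)) s := rfl
      rw [h4]
      field_simp)
    (fun s hs1 hs2 z hz => by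
      obtain ⟨h2, h3⟩ := hdisc q χ hχ s hs1 hs2 z hz
      refine ⟨?_, by rwa [norm_neg]⟩
      have hd := DirichletCharacter.differentiable_LFunction hχ
      exact ((hd.deriv z).div (hd z) h2).neg)
  have hqη : (q : ℝ) ^ (ε * ((2 * j : ℕ) + 1)) ≤ Real.log x := by
    calc (q : ℝ) ^ (ε * ((2 * j : ℕ) + 1)) ≤ (Real.log x ^ B) ^ (ε * ((2 * j : ℕ) + 1)) :=
          Real.rpow_le_rpow (by positivity) hq (by positivity)
      _ = Real.log x ^ (B * (ε * ((2 * j : ℕ) + 1))) := by rw [← Real.rpow_mul (by linarith)]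
      _ ≤ Real.log x ^ (1 : ℝ) := Real.rpow_le_rpow_of_exponent_le (by linarith) hε2
      _ = _ := Real.rpow_one _
  have hq2 : 1 ≤ (q : ℝ) ^ (ε * ((2 * j : ℕ) + 1)) := Real.one_le_rpow hq1 (by positivity)
  have h2 := hr _ (C₁ * M ^ (2 * j + 1) * (q : ℝ) ^ (ε * ((2 * j : ℕ) + 1)))
    (one_le_mul_of_one_le_of_one_le (one_le_mul_of_one_le_of_one_le hC₁ (one_le_pow₀ hM)) hq2)
    (fun m => (norm_char_vonMangoldt_le χ m).trans (by linarith)) h1 x hx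
  refine h2.trans ?_
  calc _ = C₂ * (C₁ * M ^ (2 * j + 1)) * x * ((q : ℝ) ^ (ε * ((2 * j : ℕ) + 1)) * Real.log x) := by
        ring
    _ ≤ C₂ * (C₁ * M ^ (2 * j + 1)) * x * (Real.log x * Real.log x) := by gcongr
    _ = _ := by ring

/-- The prime number theorem with a saving of powers of the logarithm. -/
theorem sum_vonMangoldt_sub_one_le (j : ℕ) : ∃ C ≥ (1 : ℝ), ∀ x : ℝ, Real.exp 4 ≤ x →
      ‖∑ m ∈ Icc 1 ⌊x⌋₊, ((ArithmeticFunction.vonMangoldt m : ℂ) - oneSeq m)‖ * Real.log x ^ j ≤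
        C * x * Real.log x ^ 2 := by
  obtain ⟨ε, hε, hε1, hε2⟩ := perron_exponent (2 * j) le_rfl
  obtain ⟨M, hM, hdisc⟩ := zeta_disc hε
  obtain ⟨C₁, hC₁, hp⟩ := perron_bound (2 * j)
  obtain ⟨C₂, hC₂, hr⟩ := remove_log j
  refine ⟨C₂ * (C₁ * M ^ (2 * j + 1)), one_le_mul_of_one_le_of_one_le hC₂
    (one_le_mul_of_one_le_of_one_le hC₁ (one_le_pow₀ hM)), ?_⟩
  intro x hx
  have hx0 : 0 < x := (Real.exp_pos 4).trans_le hx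
  have hL4 : 4 ≤ Real.log x := by rwa [Real.le_log_iff_exp_le hx0]
  have h1 := hp (fun m : ℕ => (ArithmeticFunction.vonMangoldt m : ℂ) - oneSeq m) zetaA
    M 1 ε hM le_rfl hε (by exact_mod_cast hε1)
    (fun s hs => (ArithmeticFunction.LSeriesSummable_vonMangoldt hs).sub (tame_oneSeq.summable hs))
    (fun s hs => LSeries_vonMangoldt_sub_one hs)
    (fun s hs1 hs2 z hz => by
      rw [one_mul] at hz ⊢
      obtain ⟨h2, h3, h4⟩ := hdisc s hs1 hs2 z hz
      exact ⟨differentiableAt_zetaA h3 h2, h4⟩)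
  simp only [Real.one_rpow, mul_one] at h1
  have h2 := hr _ (C₁ * M ^ (2 * j + 1))
    (one_le_mul_of_one_le_of_one_le hC₁ (one_le_pow₀ hM))
    (fun m => by
      refine (norm_sub_le _ _).trans (add_le_add ?_ ?_)
      · rw [Complex.norm_real, Real.norm_of_nonneg ArithmeticFunction.vonMangoldt_nonneg]
        exact ArithmeticFunction.vonMangoldt_le_log
      · exact tame_oneSeq.norm_le m) h1 x hx
  refine h2.trans ?_
  have h3 : Real.log x ≤ Real.log x ^ 2 := by nlinarith
  have h4 : 0 ≤ C₂ * (C₁ * M ^ (2 * j + 1)) * x := by positivity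
  exact mul_le_mul_of_nonneg_left h3 h4

end TG

namespace TG
open DirichletCharacter

/-- The weight `log m` on the primes. -/
def primeLog (m : ℕ) : ℝ := if m.Prime then Real.log m else 0

theorem primeLog_nonneg (m : ℕ) : 0 ≤ primeLog m := by
  unfold primeLog
  split_ifs
  · positivity
  · exact le_rfl

theorem primeLog_le_log (m : ℕ) : primeLog m ≤ Real.log m := by
  unfold primeLog
  split_ifs
  · exact le_rfl
  · positivity

theorem sum_primeLog_eq_theta (y : ℕ) : ∑ m ∈ Icc 1 y, primeLog m = Chebyshev.theta y := by
  rw [Chebyshev.theta_eq_sum_Icc, Nat.floor_natCast, sum_filter,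
    ← Finset.sum_subset (Icc_subset_Icc_left (Nat.zero_le 1))]
  · rfl
  · intro x hx hx'
    have : x = 0 := by
      simp at hx hx'
      omega
    simp [this, Nat.not_prime_zero]

theorem sum_primeLog_le (y : ℕ) : ∑ m ∈ Icc 1 y, primeLog m ≤ 2 * y := by
  rw [sum_primeLog_eq_theta]
  have h := Chebyshev.theta_le_log4_mul_x (x := (y : ℝ)) (by positivity)
  have h4 : Real.log 4 ≤ 2 := by
    rw [show (4 : ℝ) = 2 ^ 2 by norm_num, Real.log_pow]
    have := Real.log_two_lt_d9
    push_cast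
    linarith
  nlinarith [(Nat.cast_nonneg y : (0 : ℝ) ≤ y)]

theorem sum_vonMangoldt_sub_primeLog_le {y : ℕ} (hy : 1 ≤ y) :
    ∑ m ∈ Icc 1 y, |ArithmeticFunction.vonMangoldt m - primeLog m| ≤
      2 * √(y : ℝ) * Real.log y := by
  have h := Chebyshev.psi_sub_theta_le (x := (y : ℝ)) (by exact_mod_cast hy)
  rw [Chebyshev.psi_sub_theta_eq_sum_not_prime, Nat.floor_natCast, sum_filter] at h
  refine le_trans (le_of_eq ?_) h
  refine sum_congr rfl fun m _ => ?_
  unfold primeLog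
  by_cases hm : m.Prime
  · simp [hm, ArithmeticFunction.vonMangoldt_apply_prime hm]
  · simp [hm, abs_of_nonneg ArithmeticFunction.vonMangoldt_nonneg]

theorem log_pow_le_mul_rpow (j : ℕ) {δ : ℝ} (hδ : 0 < δ) :
    ∃ C : ℝ, 1 ≤ C ∧ ∀ x : ℝ, 1 ≤ x → Real.log x ^ j ≤ C * x ^ δ := by
  refine ⟨max 1 ((j / δ) ^ j), le_max_left _ _, fun x hx => ?_⟩
  have hx0 : 0 < x := by linarith
  rcases Nat.eq_zero_or_pos j with rfl | hj
  · have := Real.one_le_rpow hx hδ.le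
    simp
    exact this
  have hj' : (0 : ℝ) < j := by exact_mod_cast hj
  have h1 : Real.log x ≤ x ^ (δ / j) / (δ / j) :=
    Real.log_le_rpow_div hx0.le (by positivity)
  calc Real.log x ^ j ≤ (x ^ (δ / j) / (δ / j)) ^ j :=
        pow_le_pow_left₀ (Real.log_nonneg hx) h1 j
    _ = (j / δ) ^ j * x ^ δ := by
        rw [div_pow, ← Real.rpow_natCast (x ^ (δ / j)), ← Real.rpow_mul hx0.le,
          div_mul_cancel₀ _ hj'.ne', div_pow, div_pow]
        field_simp
    _ ≤ _ := by gcongr; exact le_max_right _ _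

theorem log_pow_le_mul_sqrt (j : ℕ) :
    ∃ C : ℝ, 1 ≤ C ∧ ∀ x : ℝ, 1 ≤ x → Real.log x ^ j ≤ C * √x := by
  simpa only [Real.sqrt_eq_rpow] using log_pow_le_mul_rpow j (δ := 1 / 2) (by norm_num)

theorem sum_primeLog_not_coprime_le {q : ℕ} (hq : q ≠ 0) (y : ℕ) :
    ∑ m ∈ (Icc 1 y).filter (fun m => ¬ m.Coprime q), primeLog m ≤ q := by
  calc ∑ m ∈ (Icc 1 y).filter (fun m => ¬ m.Coprime q), primeLog m
      ≤ ∑ m ∈ q.primeFactors, primeLog m := by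
        rw [← sum_filter_add_sum_filter_not _ (fun m : ℕ => m.Prime)]
        rw [sum_eq_zero (s := filter (fun m : ℕ => ¬ m.Prime) _)]
        · rw [add_zero]
          refine sum_le_sum_of_subset_of_nonneg ?_ fun i _ _ => primeLog_nonneg i
          intro m hm
          simp only [mem_filter] at hm
          exact Nat.mem_primeFactors.2
            ⟨hm.2, by_contra fun h => hm.1.2 ((Nat.Prime.coprime_iff_not_dvd hm.2).2 h), hq⟩
        · intro m hm
          simp only [mem_filter] at hm
          simp [primeLog, hm.2]
    _ = Real.log (∏ p ∈ q.primeFactors, (p : ℝ)) := by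
        rw [Real.log_prod]
        · exact sum_congr rfl fun p hp => by simp [primeLog, Nat.prime_of_mem_primeFactors hp]
        · intro p hp
          exact_mod_cast (Nat.prime_of_mem_primeFactors hp).ne_zero
    _ ≤ Real.log q := by
        have hd := Nat.prod_primeFactors_dvd q
        have h1 : (∏ p ∈ q.primeFactors, p) ≤ q := Nat.le_of_dvd (Nat.pos_of_ne_zero hq) hd
        have h2 : 0 < ∏ p ∈ q.primeFactors, p :=
          prod_pos fun p hp => (Nat.prime_of_mem_primeFactors hp).pos
        apply Real.log_le_log
        · rw [← Nat.cast_prod]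
          exact_mod_cast h2
        · rw [← Nat.cast_prod]
          exact_mod_cast h1
    _ ≤ q := (Real.log_le_sub_one_of_pos (by exact_mod_cast Nat.pos_of_ne_zero hq)).trans
        (by linarith)

theorem norm_char_sum_le_of_bound {q : ℕ} [NeZero q] (χ : DirichletCharacter ℂ q) {y : ℕ}
    (hy : 1 ≤ y) :
    ‖∑ m ∈ Icc 1 y, χ m * (primeLog m : ℂ)‖ ≤
      ‖∑ m ∈ Icc 1 y, χ m * (ArithmeticFunction.vonMangoldt m : ℂ)‖ +
        2 * √(y : ℝ) * Real.log y := by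
  have h : ∑ m ∈ Icc 1 y, χ m * (primeLog m : ℂ) =
      ∑ m ∈ Icc 1 y, χ m * (ArithmeticFunction.vonMangoldt m : ℂ) -
        ∑ m ∈ Icc 1 y, χ m * ((ArithmeticFunction.vonMangoldt m - primeLog m : ℝ) : ℂ) := by
    rw [← sum_sub_distrib]
    refine sum_congr rfl fun m _ => ?_
    push_cast
    ring
  rw [h]
  refine (norm_sub_le _ _).trans (add_le_add le_rfl ?_)
  refine le_trans (norm_sum_le _ _) (le_trans (sum_le_sum fun m _ => ?_)
    (sum_vonMangoldt_sub_primeLog_le hy))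
  rw [norm_mul, Complex.norm_real, Real.norm_eq_abs]
  exact mul_le_of_le_one_left (abs_nonneg _) (χ.norm_le_one _)

theorem totient_mul_sum_residue {q : ℕ} [NeZero q] {a : ℕ} (ha : a.Coprime q) (y : ℕ) :
    (q.totient : ℂ) * ((∑ m ∈ Icc 1 y with m % q = a % q, primeLog m : ℝ) : ℂ) =
      ∑ χ : DirichletCharacter ℂ q, χ ((a : ZMod q)⁻¹) * ∑ m ∈ Icc 1 y, χ m * (primeLog m : ℂ) := by
  have hu : IsUnit (a : ZMod q) := (ZMod.isUnit_iff_coprime a q).2 ha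
  simp_rw [mul_sum]
  rw [sum_comm]
  simp_rw [← mul_assoc, ← sum_mul, sum_char_inv_mul_char_eq ℂ hu]
  rw [sum_filter, Complex.ofReal_sum, mul_sum]
  refine sum_congr rfl fun m _ => ?_
  have : (a : ZMod q) = m ↔ m % q = a % q := by
    rw [ZMod.natCast_eq_natCast_iff]
    exact eq_comm
  by_cases h : m % q = a % q
  · simp [h, this.2 h]
  · simp [h, this]

theorem abs_sum_residue_sub_le {q : ℕ} [NeZero q] {a : ℕ} (ha : a.Coprime q) {y : ℕ} {E : ℝ}
    (hE : ∀ χ : DirichletCharacter ℂ q, χ ≠ 1 → ‖∑ m ∈ Icc 1 y, χ m * (primeLog m : ℂ)‖ ≤ E)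
    (hE1 : |∑ m ∈ Icc 1 y, primeLog m - y| ≤ E) :
    |∑ m ∈ Icc 1 y with m % q = a % q, primeLog m - y / q.totient| ≤ E + q := by
  have hq : q ≠ 0 := NeZero.ne q
  have hφ : (0 : ℝ) < q.totient := by exact_mod_cast Nat.totient_pos.2 (Nat.pos_of_ne_zero hq)
  have hE0 : 0 ≤ E := (abs_nonneg _).trans hE1
  have hu : IsUnit (a : ZMod q) := (ZMod.isUnit_iff_coprime a q).2 ha
  have h1 : ‖∑ m ∈ Icc 1 y, (1 : DirichletCharacter ℂ q) m * (primeLog m : ℂ) - y‖ ≤ E + q := by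
    have : ∑ m ∈ Icc 1 y, (1 : DirichletCharacter ℂ q) m * (primeLog m : ℂ) =
        ((∑ m ∈ Icc 1 y, primeLog m -
          ∑ m ∈ (Icc 1 y).filter (fun m => ¬ m.Coprime q), primeLog m : ℝ) : ℂ) := by
      rw [← sum_filter_add_sum_filter_not (Icc 1 y) (fun m : ℕ => m.Coprime q) primeLog,
        add_sub_cancel_right, sum_filter, Complex.ofReal_sum]
      refine sum_congr rfl fun m _ => ?_
      by_cases h : m.Coprime q
      · rw [MulChar.one_apply ((ZMod.isUnit_iff_coprime m q).2 h)]
        simp [h]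
      · rw [MulChar.map_nonunit _ (fun h' => h ((ZMod.isUnit_iff_coprime m q).1 h'))]
        simp [h]
    rw [this, ← Complex.ofReal_natCast, ← Complex.ofReal_sub, Complex.norm_real,
      Real.norm_eq_abs, sub_right_comm]
    refine (abs_sub _ _).trans (add_le_add hE1 ?_)
    rw [abs_of_nonneg (sum_nonneg fun i _ => primeLog_nonneg i)]
    exact sum_primeLog_not_coprime_le hq y
  have h2 := totient_mul_sum_residue ha y
  rw [← add_sum_erase _ _ (mem_univ (1 : DirichletCharacter ℂ q)),
    MulChar.one_apply (IsUnit.of_mul_eq_one_right _ (ZMod.mul_inv_of_unit _ hu)), one_mul] at h2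
  have h3 : ‖(q.totient : ℂ) * ((∑ m ∈ Icc 1 y with m % q = a % q, primeLog m : ℝ) : ℂ) - y‖ ≤
      q.totient * (E + q) := by
    rw [h2, add_sub_right_comm]
    refine (norm_add_le _ _).trans ?_
    have h4 : ‖∑ χ ∈ univ.erase (1 : DirichletCharacter ℂ q),
        χ ((a : ZMod q)⁻¹) * ∑ m ∈ Icc 1 y, χ m * (primeLog m : ℂ)‖ ≤ (q.totient - 1) * (E + q) := by
      refine (norm_sum_le _ _).trans ((sum_le_card_nsmul _ _ (E + q) fun χ hχ => ?_).trans ?_)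
      · rw [norm_mul]
        have h5 := hE χ (ne_of_mem_erase hχ)
        have h6 := χ.norm_le_one ((a : ZMod q)⁻¹)
        have h7 : (0 : ℝ) ≤ q := Nat.cast_nonneg q
        calc _ ≤ 1 * E := mul_le_mul h6 h5 (norm_nonneg _) zero_le_one
          _ ≤ _ := by linarith
      · rw [card_erase_of_mem (mem_univ _), nsmul_eq_mul, card_univ, ← Nat.card_eq_fintype_card,
          DirichletCharacter.card_eq_totient_of_hasEnoughRootsOfUnity,
          Nat.cast_pred (by exact_mod_cast hφ)]
    linarith
  have h8 : ‖((q.totient * (∑ m ∈ Icc 1 y with m % q = a % q, primeLog m) - y : ℝ) : ℂ)‖ ≤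
      q.totient * (E + q) := by
    convert h3 using 2
    push_cast
    ring
  rw [Complex.norm_real, Real.norm_eq_abs] at h8
  have h9 : (q.totient * (∑ m ∈ Icc 1 y with m % q = a % q, primeLog m) - y : ℝ) =
      q.totient * (∑ m ∈ Icc 1 y with m % q = a % q, primeLog m - y / q.totient) := by
    field_simp
  rw [h9, abs_mul, abs_of_pos hφ] at h8
  exact le_of_mul_le_mul_left h8 hφ

theorem exp_four_le : Real.exp 4 ≤ 64 := by
  rw [show (4 : ℝ) = (4 : ℕ) * 1 by norm_num, Real.exp_nat_mul]
  have h := Real.exp_one_lt_d9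
  have h0 := Real.exp_pos 1
  have : Real.exp 1 ^ 4 ≤ 2.8 ^ 4 := pow_le_pow_left₀ h0.le (by linarith) 4
  norm_num at this ⊢
  linarith

/-- Siegel–Walfisz for primes in arithmetic progressions, uniformly for `y ≤ n`. -/
theorem primes_residue (j B : ℕ) :
    ∃ C : ℝ, 1 ≤ C ∧ ∀ n : ℕ, 4096 ≤ n → ∀ q : ℕ, q ≠ 0 → (q : ℝ) ≤ Real.log n ^ B →
      ∀ a : ℕ, a.Coprime q → ∀ y ≤ n,
        |∑ m ∈ Icc 1 y with m % q = a % q, primeLog m - y / q.totient| * Real.log n ^ j ≤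
          C * n := by
  obtain ⟨C1, hC1, h1⟩ := sum_char_vonMangoldt_le (j + 2) (B := (2 * B : ℕ)) (by positivity)
  obtain ⟨C2, hC2, h2⟩ := sum_vonMangoldt_sub_one_le (j + 2)
  obtain ⟨C3, hC3, h3⟩ := log_pow_le_mul_sqrt (j + 1)
  obtain ⟨C4, hC4, h4⟩ := log_pow_le_mul_sqrt (j + B)
  refine ⟨2 ^ j * (C1 + C2) + 4 * C3 + C4, by
    have : (1 : ℝ) ≤ 2 ^ j := one_le_pow₀ (by norm_num)
    nlinarith, fun n hn q hq hqB a ha y hy => ?_⟩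
  have : NeZero q := ⟨hq⟩
  have hn' : (4096 : ℝ) ≤ n := by exact_mod_cast hn
  have hn0 : (0 : ℝ) < n := by linarith
  set L := Real.log n with hL
  have hL8 : 8 ≤ L := by
    rw [hL, Real.le_log_iff_exp_le hn0]
    have : Real.exp 8 = Real.exp 4 * Real.exp 4 := by rw [← Real.exp_add]; norm_num
    rw [this]
    nlinarith [exp_four_le, Real.exp_pos 4]
  have hsq : √(n : ℝ) ≤ n := by
    rw [Real.sqrt_le_left hn0.le]
    nlinarith
  have hss : √(n : ℝ) * √n = n := Real.mul_self_sqrt hn0.le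
  have hs0 : 0 ≤ √(n : ℝ) := Real.sqrt_nonneg _
  have hLj : 0 ≤ L ^ j := by positivity
  have hLL : L ^ j ≤ L ^ (j + 1) := pow_le_pow_right₀ (by linarith) (by omega)
  have h3n := h3 n (by linarith)
  have h4n := h4 n (by linarith)
  rw [← hL] at h3n h4n
  have hmain0 : (0 : ℝ) ≤ 2 ^ j * (C1 + C2) := by positivity
  by_cases hys : (y : ℝ) < √n
  · have hφ : (1 : ℝ) ≤ q.totient := by
      exact_mod_cast Nat.totient_pos.2 (Nat.pos_of_ne_zero hq)
    have hS0 : 0 ≤ ∑ m ∈ Icc 1 y with m % q = a % q, primeLog m :=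
      sum_nonneg fun i _ => primeLog_nonneg i
    have hS : ∑ m ∈ Icc 1 y with m % q = a % q, primeLog m ≤ 2 * y :=
      (sum_le_sum_of_subset_of_nonneg (filter_subset _ _)
        fun i _ _ => primeLog_nonneg i).trans (sum_primeLog_le y)
    have hd : (y : ℝ) / q.totient ≤ y := div_le_self (by positivity) hφ
    have hd0 : 0 ≤ (y : ℝ) / q.totient := by positivity
    have : |∑ m ∈ Icc 1 y with m % q = a % q, primeLog m - y / q.totient| ≤ 2 * √n := by
      rw [abs_le]
      constructor <;> linarith
    calc _ ≤ (2 * √n) * (C3 * √n) := by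
          exact mul_le_mul this (hLL.trans h3n) hLj (by positivity)
      _ = 2 * C3 * (√n * √n) := by ring
      _ = 2 * C3 * n := by rw [hss]
      _ ≤ _ := by nlinarith
  push Not at hys
  have hy0 : (0 : ℝ) < y := lt_of_lt_of_le (Real.sqrt_pos.2 hn0) hys
  have hy1 : 1 ≤ y := by exact_mod_cast hy0
  have hyn : (y : ℝ) ≤ n := by exact_mod_cast hy
  have hly : L / 2 ≤ Real.log y := by
    have := Real.log_le_log (Real.sqrt_pos.2 hn0) hys
    rwa [Real.log_sqrt hn0.le] at this
  have hlyn : Real.log y ≤ L := Real.log_le_log hy0 hyn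
  have hy4 : Real.exp 4 ≤ y := by
    rw [← Real.le_log_iff_exp_le hy0]
    linarith
  set l := Real.log y with hl
  have hl2 : 2 ≤ l := by linarith
  have hqB' : (q : ℝ) ≤ l ^ ((2 * B : ℕ) : ℝ) := by
    rw [Real.rpow_natCast]
    calc (q : ℝ) ≤ L ^ B := hqB
      _ ≤ (l * l) ^ B := pow_le_pow_left₀ (by linarith) (by nlinarith) B
      _ = l ^ (2 * B) := by rw [← pow_two, ← pow_mul]
  have key : ∀ (e C : ℝ), e * l ^ (j + 2) ≤ C * y * l ^ 2 → 0 ≤ e → e * L ^ j ≤ 2 ^ j * C * n := by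
    intro e C he he0
    have h5 : e * l ^ j ≤ C * y := by
      have hp : 0 < l ^ 2 := by positivity
      rw [pow_add, ← mul_assoc] at he
      exact le_of_mul_le_mul_right he hp
    have hC0 : 0 ≤ C := by
      by_contra hC
      push Not at hC
      have : 0 ≤ e * l ^ j := by positivity
      nlinarith
    calc e * L ^ j ≤ e * (2 * l) ^ j := by
          gcongr
          linarith
      _ = 2 ^ j * (e * l ^ j) := by rw [mul_pow]; ring
      _ ≤ 2 ^ j * (C * y) := by gcongr
      _ ≤ 2 ^ j * (C * n) := by gcongr
      _ = _ := by ring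
  have hLpos : 0 < L ^ j := by positivity
  set E := (2 ^ j * (C1 + C2) * n) / L ^ j + 2 * √(y : ℝ) * l with hE
  have hb := abs_sum_residue_sub_le (q := q) ha (y := y) (E := E) ?_ ?_
  · calc _ ≤ (E + q) * L ^ j := by gcongr
      _ = 2 ^ j * (C1 + C2) * n + 2 * √y * l * L ^ j + q * L ^ j := by
          rw [hE]
          field_simp
      _ ≤ 2 ^ j * (C1 + C2) * n + 2 * √n * L * L ^ j + L ^ B * L ^ j := by gcongr
      _ = 2 ^ j * (C1 + C2) * n + 2 * √n * L ^ (j + 1) + L ^ (j + B) := by ring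
      _ ≤ 2 ^ j * (C1 + C2) * n + 2 * √n * (C3 * √n) + C4 * n := by
          gcongr
          exact h4n.trans (by gcongr)
      _ = 2 ^ j * (C1 + C2) * n + 2 * C3 * (√n * √n) + C4 * n := by ring
      _ ≤ _ := by
          rw [hss]
          nlinarith
  · intro χ hχ
    refine (norm_char_sum_le_of_bound χ hy1).trans ?_
    rw [hE]
    refine add_le_add ?_ le_rfl
    have := h1 q χ hχ y hy4 hqB'
    rw [Nat.floor_natCast] at this
    rw [le_div_iff₀ hLpos]
    refine (key _ _ this (norm_nonneg _)).trans ?_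
    gcongr
    linarith
  · have h5 : ∑ m ∈ Icc 1 y, primeLog m - y = ∑ m ∈ Icc 1 y, (ArithmeticFunction.vonMangoldt m - 1) -
        ∑ m ∈ Icc 1 y, (ArithmeticFunction.vonMangoldt m - primeLog m) := by
      simp only [sum_sub_distrib]
      simp
    rw [h5]
    refine (abs_sub _ _).trans ?_
    rw [hE]
    refine add_le_add ?_ ((abs_sum_le_sum_abs _ _).trans (sum_vonMangoldt_sub_primeLog_le hy1))
    have := h2 y hy4
    rw [Nat.floor_natCast] at this
    have h6 : ‖∑ m ∈ Icc 1 y, ((ArithmeticFunction.vonMangoldt m : ℂ) - oneSeq m)‖ =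
        |∑ m ∈ Icc 1 y, (ArithmeticFunction.vonMangoldt m - 1)| := by
      rw [← Real.norm_eq_abs, ← Complex.norm_real]
      congr 1
      push_cast
      refine sum_congr rfl fun m hm => ?_
      have : m ≠ 0 := by
        have := (mem_Icc.1 hm).1
        omega
      simp [oneSeq, this]
    rw [h6] at this
    rw [le_div_iff₀ hLpos]
    refine (key _ _ this (abs_nonneg _)).trans ?_
    gcongr
    linarith

end TG

namespace TG

/-- Distance to the nearest integer. -/
def nd (x : ℝ) : ℝ := |x - round x|

theorem nd_le_abs_sub_intCast (x : ℝ) (z : ℤ) : nd x ≤ |x - z| := round_le x z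

theorem nd_neg (x : ℝ) : nd (-x) = nd x := by
  apply le_antisymm
  · have := nd_le_abs_sub_intCast (-x) (-round x)
    rw [Int.cast_neg, ← neg_sub', abs_neg] at this
    exact this
  · have := nd_le_abs_sub_intCast x (-round (-x))
    rw [Int.cast_neg, ← abs_neg, neg_sub', neg_neg] at this
    exact this

theorem nd_le_abs_fract_sub (x y : ℝ) : nd (x - y) ≤ |Int.fract x - Int.fract y| := by
  have := nd_le_abs_sub_intCast (x - y) (⌊x⌋ - ⌊y⌋)
  refine this.trans (le_of_eq ?_)
  congr 1
  simp only [Int.fract]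
  push_cast
  ring

theorem nd_eq_min (x : ℝ) : nd x = min (Int.fract x) (1 - Int.fract x) :=
  abs_sub_round_eq_min x

theorem nd_add_le (x y : ℝ) : nd x ≤ nd (x + y) + |y| := by
  have := nd_le_abs_sub_intCast x (round (x + y))
  refine this.trans ?_
  have h : x - round (x + y) = (x + y - round (x + y)) - y := by ring
  rw [h]
  exact abs_sub _ _

/-- Multiples of a fraction with denominator `q`. -/
theorem one_div_le_nd_mul_div {a : ℤ} {q : ℕ} (hq : q ≠ 0) (ha : IsCoprime a (q : ℤ)) {d : ℤ}
    (hd : ¬ (q : ℤ) ∣ d) : 1 / (q : ℝ) ≤ nd (d * (a / q)) := by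
  have hq0 : (0 : ℝ) < q := by exact_mod_cast Nat.pos_of_ne_zero hq
  unfold nd
  set z := round ((d : ℝ) * (a / q))
  have h1 : (d : ℝ) * (a / q) - z = ((d * a - z * q : ℤ) : ℝ) / q := by
    push_cast
    field_simp
  rw [h1, abs_div, abs_of_pos hq0]
  gcongr
  rw [← Int.cast_abs]
  have : d * a - z * q ≠ 0 := by
    intro h
    apply hd
    have h2 : (q : ℤ) ∣ d * a := ⟨z, by linarith⟩
    exact ha.symm.dvd_of_dvd_mul_right h2
  exact_mod_cast Int.one_le_abs this

theorem one_div_two_mul_le_nd {α : ℝ} {a : ℤ} {q : ℕ} (hq : q ≠ 0) (ha : IsCoprime a (q : ℤ))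
    (hα : |α - a / q| ≤ 1 / (q : ℝ) ^ 2) {d : ℤ} (hd0 : d ≠ 0) (hd : 2 * |d| ≤ q) :
    1 / (2 * (q : ℝ)) ≤ nd (d * α) := by
  have hq0 : (0 : ℝ) < q := by exact_mod_cast Nat.pos_of_ne_zero hq
  have hnd : ¬ (q : ℤ) ∣ d := by
    intro h
    have := Int.le_of_dvd (abs_pos.2 hd0) ((dvd_abs _ _).2 h)
    have := abs_pos.2 hd0
    omega
  have h1 := one_div_le_nd_mul_div hq ha hnd
  have h2 := nd_add_le (d * (a / q)) (d * (α - a / q))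
  rw [show (d : ℝ) * (a / q) + d * (α - a / q) = d * α by ring] at h2
  have h3 : |(d : ℝ) * (α - a / q)| ≤ 1 / (2 * q) := by
    rw [abs_mul]
    have hd' : 2 * |(d : ℝ)| ≤ q := by exact_mod_cast hd
    calc |(d : ℝ)| * |α - a / q| ≤ (q / 2) * (1 / (q : ℝ) ^ 2) := by
          gcongr
          linarith
      _ = 1 / (2 * q) := by field_simp
  have h4 : 1 / (q : ℝ) = 1 / (2 * q) + 1 / (2 * q) := by field_simp; norm_num
  linarith

theorem sum_inv_range_le (n : ℕ) (hn : 1 ≤ n) :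
    ∑ i ∈ range (n - 1), ((i : ℝ) + 1)⁻¹ ≤ 1 + Real.log n := by
  refine le_trans ?_ (sum_inv_le_one_add_log n)
  calc ∑ i ∈ range (n - 1), ((i : ℝ) + 1)⁻¹ = ∑ i ∈ Ico (0 + 1) (n - 1 + 1), (i : ℝ)⁻¹ := by
        rw [range_eq_Ico, ← sum_Ico_add' (fun i : ℕ => ((i : ℝ))⁻¹) 0 (n - 1) 1]
        simp
    _ ≤ _ := by
        apply sum_le_sum_of_subset_of_nonneg
        · intro i hi
          simp at hi ⊢
          omega
        · intros
          positivity

theorem sum_le_of_spaced {ι : Type*} {I : Finset ι} {x φ : ι → ℝ} {q : ℕ} (hq : 1 ≤ q) {M : ℝ}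
    (hM : 0 ≤ M) (hφM : ∀ i ∈ I, φ i ≤ M) (hφ : ∀ i ∈ I, φ i * nd (x i) ≤ 1)
    (hx : ∀ i ∈ I, ∀ j ∈ I, i ≠ j → 1 / (2 * (q : ℝ)) ≤ nd (x i - x j)) :
    ∑ i ∈ I, φ i ≤ 2 * M + 8 * q * (1 + Real.log q) := by
  classical
  have hq0 : (0 : ℝ) < q := by exact_mod_cast hq
  have hq1 : (1 : ℝ) ≤ q := by exact_mod_cast hq
  let key : ι → ℕ := fun i => ⌊2 * q * Int.fract (x i)⌋₊
  have hkey0 : ∀ i, 0 ≤ 2 * q * Int.fract (x i) := fun i => by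
    have := Int.fract_nonneg (x i); positivity
  have hk1 : ∀ i, (key i : ℝ) ≤ 2 * q * Int.fract (x i) := fun i => Nat.floor_le (hkey0 i)
  have hk2 : ∀ i, 2 * q * Int.fract (x i) < key i + 1 := fun i => Nat.lt_floor_add_one _
  have hklt : ∀ i, key i < 2 * q := fun i => by
    have h1 := hk1 i
    have h2 := Int.fract_lt_one (x i)
    have : (key i : ℝ) < 2 * q := by nlinarith
    exact_mod_cast this
  have hinj : Set.InjOn key I := by
    intro i hi j hj hij
    by_contra hne
    have h1 := (hx i hi j hj hne).trans (nd_le_abs_fract_sub _ _)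
    have h2 := hk1 i; have h3 := hk1 j; have h4 := hk2 i; have h5 := hk2 j
    rw [hij] at h2 h4
    have h6 : |Int.fract (x i) - Int.fract (x j)| < 1 / (2 * q) := by
      rw [lt_div_iff₀ (by positivity), ← abs_of_pos (show (0 : ℝ) < 2 * q by positivity),
        ← abs_mul, abs_lt]
      constructor <;> nlinarith
    linarith
  let h : ℕ → ℝ := fun j => if j = 0 ∨ j = 2 * q - 1 then M else
    2 * q * ((j : ℝ)⁻¹ + ((2 * q - 1 - j : ℕ) : ℝ)⁻¹)
  have hh0 : ∀ j, 0 ≤ h j := fun j => by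
    simp only [h]
    split_ifs
    · exact hM
    · positivity
  have hφh : ∀ i ∈ I, φ i ≤ h (key i) := by
    intro i hi
    simp only [h]
    split_ifs with hc
    · exact hφM i hi
    · push Not at hc
      have hlt := hklt i
      have ha : (0 : ℝ) < key i := by
        exact_mod_cast Nat.pos_of_ne_zero hc.1
      have hb' : 0 < 2 * q - 1 - key i := by omega
      have hb : (0 : ℝ) < ((2 * q - 1 - key i : ℕ) : ℝ) := by exact_mod_cast hb'
      have hb2 : ((2 * q - 1 - key i : ℕ) : ℝ) = 2 * q - 1 - key i := by
        rw [Nat.cast_sub (by omega), Nat.cast_sub (by omega)]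
        push_cast
        ring
      have h1 := hφ i hi
      rw [nd_eq_min] at h1
      have h2 := hk1 i
      have h3 := hk2 i
      rcases min_choice (Int.fract (x i)) (1 - Int.fract (x i)) with hm | hm
      · rw [hm] at h1
        have h4 : φ i * (key i / (2 * q)) ≤ 1 := by
          rcases le_or_gt (φ i) 0 with h0 | h0
          · have : φ i * (key i / (2 * q)) ≤ 0 :=
              mul_nonpos_of_nonpos_of_nonneg h0 (by positivity)
            linarith
          · refine le_trans ?_ h1
            gcongr
            rw [div_le_iff₀ (by positivity)]
            linarith
        have h5 : φ i ≤ 2 * q * (key i : ℝ)⁻¹ := by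
          rw [← div_eq_mul_inv, le_div_iff₀ ha]
          rw [← mul_div_assoc, div_le_iff₀ (by positivity)] at h4
          linarith
        refine h5.trans ?_
        gcongr
        have : 0 ≤ ((2 * q - 1 - key i : ℕ) : ℝ)⁻¹ := by positivity
        linarith
      · rw [hm] at h1
        have h4 : φ i * (((2 * q - 1 - key i : ℕ) : ℝ) / (2 * q)) ≤ 1 := by
          rcases le_or_gt (φ i) 0 with h0 | h0
          · have : φ i * (((2 * q - 1 - key i : ℕ) : ℝ) / (2 * q)) ≤ 0 :=
              mul_nonpos_of_nonpos_of_nonneg h0 (by positivity)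
            linarith
          · refine le_trans ?_ h1
            gcongr
            rw [div_le_iff₀ (by positivity), hb2]
            linarith
        have h5 : φ i ≤ 2 * q * (((2 * q - 1 - key i : ℕ) : ℝ))⁻¹ := by
          rw [← div_eq_mul_inv, le_div_iff₀ hb]
          rw [← mul_div_assoc, div_le_iff₀ (by positivity)] at h4
          linarith
        refine h5.trans ?_
        gcongr
        have : 0 ≤ ((key i : ℕ) : ℝ)⁻¹ := by positivity
        linarith
  have hS : ∑ i ∈ I, φ i ≤ ∑ j ∈ range (2 * q), h j := by
    calc ∑ i ∈ I, φ i ≤ ∑ i ∈ I, h (key i) := sum_le_sum hφh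
      _ = ∑ j ∈ I.image key, h j := (sum_image hinj).symm
      _ ≤ _ := sum_le_sum_of_subset_of_nonneg (fun j hj => by
          obtain ⟨i, _, rfl⟩ := mem_image.1 hj
          exact mem_range.2 (hklt i)) fun j _ _ => hh0 j
  refine hS.trans ?_
  obtain ⟨r, hr⟩ : ∃ r, 2 * q = r + 2 := ⟨2 * q - 2, by omega⟩
  have hmid : ∀ j ∈ range r, h (j + 1) = 2 * q * (((j : ℝ) + 1)⁻¹ + ((r - 1 - j : ℕ) + 1 : ℝ)⁻¹) := by
    intro j hj
    have hj' := mem_range.1 hj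
    have h1 : ¬ (j + 1 = 0 ∨ j + 1 = 2 * q - 1) := by omega
    have h2 : 2 * q - 1 - (j + 1) = (r - 1 - j) + 1 := by omega
    simp only [h, if_neg h1]
    rw [h2]
    push_cast
    rfl
  have hrr : ∑ j ∈ range r, ((j : ℝ) + 1)⁻¹ ≤ 2 + Real.log q := by
    have hq2 : r ≤ (2 * q - 1) - 1 := by omega
    have h1 := sum_inv_range_le (2 * q - 1) (by omega)
    have h2 : r = 2 * q - 1 - 1 := by omega
    rw [← h2] at h1
    refine h1.trans ?_
    have h3 : Real.log ((2 * q - 1 : ℕ) : ℝ) ≤ Real.log 2 + Real.log q := by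
      rw [← Real.log_mul (by norm_num) hq0.ne']
      apply Real.log_le_log
      · have : 0 < 2 * q - 1 := by omega
        exact_mod_cast this
      · have : 2 * q - 1 ≤ 2 * q := by omega
        exact_mod_cast this
    have := Real.log_two_lt_d9
    linarith
  have hsum : ∑ j ∈ range r, h (j + 1) ≤ 2 * q * (2 * (2 + Real.log q)) := by
    rw [sum_congr rfl hmid, ← mul_sum, sum_add_distrib,
      sum_range_reflect (fun j : ℕ => ((j : ℝ) + 1)⁻¹) r]
    gcongr
    linarith
  have h0 : h 0 = M := by simp [h]
  have hl : h (r + 1) = M := by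
    have : r + 1 = 2 * q - 1 := by omega
    simp [h, this]
  rw [hr, sum_range_succ, hl, sum_range_succ', h0]
  have := Real.log_nonneg hq1
  nlinarith [mul_nonneg hq0.le this]

theorem sum_block_le {α β : ℝ} {a : ℤ} {q : ℕ} (hq : 1 ≤ q) (ha : IsCoprime a (q : ℤ))
    (hα : |α - a / q| ≤ 1 / (q : ℝ) ^ 2) {φ : ℕ → ℝ} {I : Finset ℕ} {M : ℝ} (hM : 0 ≤ M)
    (hI : ∀ i ∈ I, ∀ j ∈ I, 2 * |(i : ℤ) - j| ≤ q)
    (hφM : ∀ i ∈ I, φ i ≤ M) (hφ : ∀ i ∈ I, φ i * nd (i * α + β) ≤ 1) :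
    ∑ i ∈ I, φ i ≤ 2 * M + 8 * q * (1 + Real.log q) := by
  refine sum_le_of_spaced (x := fun i : ℕ => i * α + β) hq hM hφM hφ fun i hi j hj hij => ?_
  have := one_div_two_mul_le_nd (by omega) ha hα (d := (i : ℤ) - j)
    (sub_ne_zero.2 (by exact_mod_cast hij)) (hI i hi j hj)
  convert this using 2
  push_cast
  ring

theorem abs_sub_le_of_div_eq {q i j s : ℕ}
    (hi : s ≤ i) (hj : s ≤ j)
    (h : (i - s) / (q / 2 + 1) = (j - s) / (q / 2 + 1)) : 2 * |(i : ℤ) - j| ≤ q := by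
  have h1 := Nat.div_add_mod (i - s) (q / 2 + 1)
  have h2 := Nat.div_add_mod (j - s) (q / 2 + 1)
  have h3 := Nat.mod_lt (i - s) (show q / 2 + 1 > 0 by omega)
  have h4 := Nat.mod_lt (j - s) (show q / 2 + 1 > 0 by omega)
  rw [h] at h1
  set t := (q / 2 + 1) * ((j - s) / (q / 2 + 1))
  rcases abs_cases ((i : ℤ) - j) with ⟨h5, _⟩ | ⟨h5, _⟩ <;> rw [h5] <;> omega

theorem sum_interval_le {α β : ℝ} {a : ℤ} {q : ℕ} (hq : 1 ≤ q) (ha : IsCoprime a (q : ℤ))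
    (hα : |α - a / q| ≤ 1 / (q : ℝ) ^ 2) {φ : ℕ → ℝ} {K : ℕ} {M : ℝ} (hM : 0 ≤ M)
    (hφM : ∀ i ∈ Icc 1 K, φ i ≤ M) (hφ : ∀ i ∈ Icc 1 K, φ i * nd (i * α + β) ≤ 1) :
    ∑ i ∈ Icc 1 K, φ i ≤ (2 * K / q + 1) * (2 * M + 8 * q * (1 + Real.log q)) := by
  have hq0 : (0 : ℝ) < q := by exact_mod_cast hq
  have hq1 : (1 : ℝ) ≤ q := by exact_mod_cast hq
  have hlog := Real.log_nonneg hq1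
  have hmap : ∀ i ∈ Icc 1 K, (i - 1) / (q / 2 + 1) ∈ range ((K - 1) / (q / 2 + 1) + 1) := by
    intro i hi
    have := (mem_Icc.1 hi).2
    exact mem_range.2 (Nat.lt_succ_of_le (Nat.div_le_div_right (by omega)))
  rw [← sum_fiberwise_of_maps_to hmap]
  refine (sum_le_card_nsmul _ _ (2 * M + 8 * q * (1 + Real.log q)) fun b _ => ?_).trans ?_
  · refine sum_block_le (β := β) hq ha hα hM (fun i hi j hj => ?_)
      (fun i hi => hφM i (mem_filter.1 hi).1) fun i hi => hφ i (mem_filter.1 hi).1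
    simp only [mem_filter, mem_Icc] at hi hj
    exact abs_sub_le_of_div_eq hi.1.1 hj.1.1 (hi.2.trans hj.2.symm)
  · rw [nsmul_eq_mul, card_range]
    gcongr
    push_cast
    gcongr
    refine Nat.cast_div_le.trans ?_
    rw [div_le_div_iff₀ (by positivity) hq0]
    have h1 : (q : ℝ) ≤ 2 * ((q / 2 + 1 : ℕ) : ℝ) := by
      have : q ≤ 2 * (q / 2 + 1) := by omega
      exact_mod_cast this
    have h2 : ((K - 1 : ℕ) : ℝ) ≤ K := by exact_mod_cast Nat.sub_le K 1
    have h3 : (0 : ℝ) ≤ K := by positivity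
    calc ((K - 1 : ℕ) : ℝ) * q ≤ K * (2 * ((q / 2 + 1 : ℕ) : ℝ)) := by gcongr
      _ = _ := by ring

/-- The sum over divisors `d ≤ D` of the bounds for the linear exponential sums. -/
theorem sum_typeI_le {α : ℝ} {a : ℤ} {q : ℕ} (hq : 1 ≤ q) (ha : IsCoprime a (q : ℤ))
    (hα : |α - a / q| ≤ 1 / (q : ℝ) ^ 2) {φ : ℕ → ℝ} {K : ℕ} {X : ℝ} (hX : 0 ≤ X)
    (hφM : ∀ i ∈ Icc 1 K, φ i ≤ X / i) (hφ : ∀ i ∈ Icc 1 K, φ i * nd (i * α) ≤ 1) :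
    ∑ i ∈ Icc 1 K, φ i ≤
      4 * X / q * (2 + Real.log K) + (2 * K / q + 2) * (12 * q * (1 + Real.log q)) := by
  have hq0 : (0 : ℝ) < q := by exact_mod_cast hq
  have hq1 : (1 : ℝ) ≤ q := by exact_mod_cast hq
  have hlog := Real.log_nonneg hq1
  have hlogK := Real.log_natCast_nonneg K
  rcases Nat.eq_zero_or_pos K with rfl | hK
  · simp
    positivity
  set l := q / 2 + 1 with hl
  have hlq : (q : ℝ) ≤ 2 * (l : ℝ) := by
    have : q ≤ 2 * l := by omega
    exact_mod_cast this
  have hl0 : (0 : ℝ) < l := by exact_mod_cast (show 0 < l by omega)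
  set R := (K - 1) / l with hR
  have hRK : (R : ℝ) ≤ 2 * K / q := by
    refine Nat.cast_div_le.trans ?_
    rw [div_le_div_iff₀ hl0 hq0]
    have h2 : ((K - 1 : ℕ) : ℝ) ≤ K := by exact_mod_cast Nat.sub_le K 1
    have h3 : (0 : ℝ) ≤ K := by positivity
    calc ((K - 1 : ℕ) : ℝ) * q ≤ K * (2 * (l : ℝ)) := by gcongr
      _ = _ := by ring
  have hmap : ∀ i ∈ Icc 1 K, (i - 1) / l ∈ range (R + 1) := by
    intro i hi
    have := (mem_Icc.1 hi).2
    exact mem_range.2 (Nat.lt_succ_of_le (Nat.div_le_div_right (by omega)))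
  rw [← sum_fiberwise_of_maps_to hmap, sum_range_succ']
  have hspace : ∀ b, ∀ i ∈ (Icc 1 K).filter (fun i => (i - 1) / l = b),
      ∀ j ∈ (Icc 1 K).filter (fun i => (i - 1) / l = b), 2 * |(i : ℤ) - j| ≤ q := by
    intro b i hi j hj
    simp only [mem_filter, mem_Icc] at hi hj
    exact abs_sub_le_of_div_eq hi.1.1 hj.1.1 (hi.2.trans hj.2.symm)
  have hfirst : ∑ i ∈ (Icc 1 K).filter (fun i => (i - 1) / l = 0), φ i ≤
      12 * q * (1 + Real.log q) + 2 * X / q := by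
    have hsub : ∑ i ∈ ((Icc 1 K).filter (fun i => (i - 1) / l = 0)).filter (fun i => i < l), φ i ≤
        2 * (2 * q) + 8 * q * (1 + Real.log q) := by
      refine sum_block_le (β := 0) hq ha hα (by positivity)
        (fun i hi j hj => hspace 0 i (mem_filter.1 hi).1 j (mem_filter.1 hj).1) (fun i hi => ?_)
        fun i hi => ?_
      · simp only [mem_filter] at hi
        have h1 := hφ i hi.1.1
        have hi1 := (mem_Icc.1 hi.1.1).1
        have h2 := one_div_two_mul_le_nd (by omega) ha hα (d := (i : ℤ)) (by omega)
          (by rw [abs_of_nonneg (by omega)]; omega)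
        rw [Int.cast_natCast] at h2
        by_contra hc
        push Not at hc
        have : 1 < φ i * nd (i * α) := by
          calc 1 = 2 * q * (1 / (2 * (q : ℝ))) := by field_simp
            _ < φ i * (1 / (2 * (q : ℝ))) := by gcongr
            _ ≤ _ := by
              gcongr
              exact (by positivity : (0 : ℝ) ≤ 2 * q).trans hc.le
        linarith
      · rw [add_zero]
        exact hφ i (mem_filter.1 (mem_filter.1 hi).1).1
    have hlast : ∑ i ∈ ((Icc 1 K).filter (fun i => (i - 1) / l = 0)).filter (fun i => ¬ i < l),
        φ i ≤ 2 * X / q := by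
      have hs : ((Icc 1 K).filter (fun i => (i - 1) / l = 0)).filter (fun i => ¬ i < l) ⊆ {l} := by
        intro i hi
        simp only [mem_filter, mem_Icc, Nat.div_eq_zero_iff] at hi
        simp only [mem_singleton]
        omega
      have hXq : X / l ≤ 2 * X / q := by
        rw [div_le_div_iff₀ hl0 hq0]
        nlinarith
      have hXq0 : 0 ≤ 2 * X / q := by positivity
      rcases subset_singleton_iff.1 hs with h | h
      · rw [h]
        simpa using hXq0
      · rw [h, sum_singleton]
        refine le_trans (hφM l ?_) hXq
        have : l ∈ ((Icc 1 K).filter (fun i => (i - 1) / l = 0)).filter (fun i => ¬ i < l) := by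
          rw [h]
          exact mem_singleton_self l
        exact (mem_filter.1 (mem_filter.1 this).1).1
    rw [← sum_filter_add_sum_filter_not _ (fun i => i < l)]
    nlinarith
  have hblock : ∀ b ∈ range R, ∑ i ∈ (Icc 1 K).filter (fun i => (i - 1) / l = b + 1), φ i ≤
      4 * X / q * ((b : ℝ) + 1)⁻¹ + 8 * q * (1 + Real.log q) := by
    intro b _
    have h := sum_block_le (β := 0) (φ := φ) (M := 2 * X / q * ((b : ℝ) + 1)⁻¹)
      hq ha hα (by positivity) (hspace (b + 1)) (fun i hi => ?_) fun i hi => ?_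
    · refine h.trans (le_of_eq ?_)
      ring
    · simp only [mem_filter] at hi
      refine (hφM i hi.1).trans ?_
      have h1 : (b + 1) * l ≤ i := by
        have := Nat.div_mul_le_self (i - 1) l
        rw [hi.2] at this
        omega
      have h2 : ((b : ℝ) + 1) * l ≤ i := by exact_mod_cast h1
      have hb : (0 : ℝ) < (b : ℝ) + 1 := by positivity
      calc X / i ≤ X / (((b : ℝ) + 1) * l) := by gcongr
        _ ≤ X / (((b : ℝ) + 1) * (q / 2)) := by
            gcongr
            linarith
        _ = _ := by field_simp
    · rw [add_zero]
      exact hφ i (mem_filter.1 hi).1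
  have hRsum : ∑ b ∈ range R, ((b : ℝ) + 1)⁻¹ ≤ 1 + Real.log K := by
    have h1 := sum_inv_range_le K hK
    refine le_trans (sum_le_sum_of_subset_of_nonneg ?_ fun i _ _ => by positivity) h1
    exact range_subset_range.2 (Nat.div_le_self _ _)
  have h2 : ∑ b ∈ range R, ∑ i ∈ (Icc 1 K).filter (fun i => (i - 1) / l = b + 1), φ i ≤
      4 * X / q * (1 + Real.log K) + 2 * K / q * (8 * q * (1 + Real.log q)) := by
    refine (sum_le_sum hblock).trans ?_
    rw [sum_add_distrib, ← mul_sum, sum_const, card_range, nsmul_eq_mul]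
    gcongr
  have h3 : 0 ≤ X / q := by positivity
  have h4 : 0 ≤ 2 * K / q * (q * (1 + Real.log q)) := by positivity
  have h5 : 0 ≤ q * (1 + Real.log q) := by positivity
  have e1 : 4 * X / q = 4 * (X / q) := by ring
  have e2 : 2 * X / q = 2 * (X / q) := by ring
  rw [e1] at h2 ⊢
  rw [e2] at hfirst
  nlinarith

theorem e_add (x y : ℝ) : e (x + y) = e x * e y := by
  unfold e
  rw [← Complex.exp_add]
  congr 1
  push_cast
  ring

theorem e_zero : e 0 = 1 := by simp [e]

theorem e_neg (x : ℝ) : e (-x) = starRingEnd ℂ (e x) := by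
  unfold e
  rw [← Complex.exp_conj]
  congr 1
  simp only [map_mul, Complex.conj_I, Complex.conj_ofReal, map_ofNat]
  push_cast
  ring

theorem e_intCast (z : ℤ) : e z = 1 := by
  unfold e
  rw [Complex.exp_eq_one_iff]
  exact ⟨z, by push_cast; ring⟩

theorem e_eq_exp_I_mul (x : ℝ) : e x = Complex.exp (Complex.I * ((2 * Real.pi * x : ℝ) : ℂ)) := by
  unfold e
  congr 1
  push_cast
  ring

theorem norm_e (x : ℝ) : ‖e x‖ = 1 := by
  rw [e_eq_exp_I_mul, mul_comm, Complex.norm_exp_ofReal_mul_I]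

theorem e_add_intCast (x : ℝ) (z : ℤ) : e (x + z) = e x := by
  rw [e_add, e_intCast, mul_one]

theorem four_mul_nd_le (x : ℝ) : 4 * nd x ≤ ‖e x - 1‖ := by
  have h : e x = e (x - round x) := by
    have := e_add_intCast (x - round x) (round x)
    rw [sub_add_cancel] at this
    exact this
  have h1 : |x - round x| ≤ 1 / 2 := abs_sub_round x
  rw [h, e_eq_exp_I_mul, Complex.norm_exp_I_mul_ofReal_sub_one]
  unfold nd
  set y := x - round x
  have hp := Real.pi_pos
  have h2 := Real.mul_abs_le_abs_sin (x := Real.pi * y) (by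
    rw [abs_mul, abs_of_pos hp]
    nlinarith)
  rw [show 2 * Real.pi * y / 2 = Real.pi * y by ring, Real.norm_eq_abs, abs_mul, abs_two]
  rw [abs_mul, abs_of_pos hp] at h2
  have : 2 / Real.pi * (Real.pi * |y|) = 2 * |y| := by field_simp
  linarith

theorem norm_sum_e_mul_nd_le (α : ℝ) (s t : ℕ) :
    ‖∑ k ∈ Icc s t, e (k * α)‖ * nd α ≤ 1 / 2 := by
  rcases lt_or_ge t s with hts | hst
  · rw [Icc_eq_empty (by omega)]
    simp
  have h : (∑ k ∈ Icc s t, e (k * α)) * (e α - 1) = e ((t + 1 : ℕ) * α) - e (s * α) := by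
    rw [sum_mul, ← sum_Ico_sub (fun k : ℕ => e (k * α)) (show s ≤ t + 1 by omega)]
    refine sum_congr (by ext; simp) fun k _ => ?_
    rw [show ((k + 1 : ℕ) : ℝ) * α = k * α + α by push_cast; ring, e_add]
    ring
  have h2 : ‖(∑ k ∈ Icc s t, e (k * α)) * (e α - 1)‖ ≤ 2 := by
    rw [h]
    refine (norm_sub_le _ _).trans ?_
    rw [norm_e, norm_e]
    norm_num
  rw [norm_mul] at h2
  have h3 := four_mul_nd_le α
  nlinarith [norm_nonneg (∑ k ∈ Icc s t, e (k * α))]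

theorem norm_sum_e_le (α : ℝ) (s t : ℕ) : ‖∑ k ∈ Icc s t, e (k * α)‖ ≤ ((t + 1 - s : ℕ) : ℝ) := by
  refine (norm_sum_le _ _).trans ?_
  simp [norm_e]

/-- The bound for type I sums. -/
theorem norm_typeI_le {α : ℝ} {a : ℤ} {q : ℕ} (hq : 1 ≤ q) (ha : IsCoprime a (q : ℤ))
    (hα : |α - a / q| ≤ 1 / (q : ℝ) ^ 2) {c : ℕ → ℂ} {A : ℝ} {K : ℕ} (hA : 0 ≤ A)
    (hc : ∀ d ∈ Icc 1 K, ‖c d‖ ≤ A) (n : ℕ) :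
    ‖∑ d ∈ Icc 1 K, c d * ∑ k ∈ Icc 1 (n / d), e (α * (d * k))‖ ≤
      A * (4 * n / q * (2 + Real.log K) + (2 * K / q + 2) * (12 * q * (1 + Real.log q))) := by
  refine (norm_sum_le _ _).trans ?_
  have h := sum_typeI_le hq ha hα (φ := fun d => ‖∑ k ∈ Icc 1 (n / d), e (k * (d * α))‖) (K := K)
    (X := n) (Nat.cast_nonneg n) (fun d _ => ?_) fun d _ => ?_
  · refine le_trans ?_ (mul_le_mul_of_nonneg_left h hA)
    rw [mul_sum]
    refine sum_le_sum fun d hd => ?_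
    rw [norm_mul]
    refine mul_le_mul (hc d hd) (le_of_eq ?_) (norm_nonneg _) hA
    congr 1
    exact sum_congr rfl fun k _ => by congr 1; ring
  · refine (norm_sum_e_le _ _ _).trans ?_
    rw [Nat.add_sub_cancel]
    exact Nat.cast_div_le
  · exact (norm_sum_e_mul_nd_le _ _ _).trans (by norm_num)

theorem norm_sum_log_mul_e_le {β : ℝ} {N n : ℕ} (hN : N ≤ n) {B : ℝ}
    (hB : ∀ t ≤ N, ‖∑ k ∈ Icc 1 t, e (k * β)‖ ≤ B) :
    ‖∑ k ∈ Icc 1 N, (Real.log k : ℂ) * e (k * β)‖ ≤ 2 * Real.log n * B := by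
  have hB0 : 0 ≤ B := (norm_nonneg _).trans (hB 0 (Nat.zero_le _))
  have hshift : ∀ (t : ℕ) (f : ℕ → ℂ), ∑ k ∈ Icc 1 t, f k = ∑ i ∈ range t, f (i + 1) := by
    intro t f
    rw [range_eq_Ico, sum_Ico_add' f 0 t 1]
    exact sum_congr (by ext; simp) fun _ _ => rfl
  have h1 := norm_sum_mul_antitone_le (w := fun i => max 0 (Real.log n - Real.log ((i + 1 : ℕ) : ℝ)))
    (b := fun i => e ((i + 1 : ℕ) * β)) (n := N) (B := B) (fun i => le_max_left _ _)
    (fun i j hij => by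
      have : Real.log ((i + 1 : ℕ) : ℝ) ≤ Real.log ((j + 1 : ℕ) : ℝ) := by
        apply Real.log_le_log
        · positivity
        · exact_mod_cast Nat.succ_le_succ hij
      exact max_le_max le_rfl (by linarith))
    (fun t ht => by
      have := hB t ht
      rwa [hshift] at this)
  have hw0 : max 0 (Real.log n - Real.log ((0 + 1 : ℕ) : ℝ)) = Real.log n := by
    simp [Real.log_natCast_nonneg]
  rw [hw0] at h1
  have h2 : ∑ k ∈ Icc 1 N, (Real.log k : ℂ) * e (k * β) =
      (Real.log n : ℂ) * ∑ k ∈ Icc 1 N, e (k * β) - ∑ i ∈ range N,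
        ((max 0 (Real.log n - Real.log ((i + 1 : ℕ) : ℝ)) : ℝ) : ℂ) * e ((i + 1 : ℕ) * β) := by
    rw [hshift, hshift, mul_sum, ← sum_sub_distrib]
    refine sum_congr rfl fun i hi => ?_
    have hi' : i + 1 ≤ n := by
      have := mem_range.1 hi
      omega
    rw [max_eq_right]
    · push_cast
      ring
    · rw [sub_nonneg]
      apply Real.log_le_log
      · positivity
      · exact_mod_cast hi'
  rw [h2]
  refine (norm_sub_le _ _).trans ?_
  rw [norm_mul, Complex.norm_real, Real.norm_of_nonneg (Real.log_natCast_nonneg n)]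
  have := mul_le_mul_of_nonneg_left (hB N le_rfl) (Real.log_natCast_nonneg n)
  linarith

theorem norm_typeI_log_le {α : ℝ} {a : ℤ} {q : ℕ} (hq : 1 ≤ q) (ha : IsCoprime a (q : ℤ))
    (hα : |α - a / q| ≤ 1 / (q : ℝ) ^ 2) {c : ℕ → ℂ} {K : ℕ}
    (hc : ∀ d ∈ Icc 1 K, ‖c d‖ ≤ 1) {n : ℕ} :
    ‖∑ d ∈ Icc 1 K, c d * ∑ k ∈ Icc 1 (n / d), (Real.log k : ℂ) * e (α * (d * k))‖ ≤
      2 * Real.log n *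
        (4 * n / q * (2 + Real.log K) + (2 * K / q + 2) * (12 * q * (1 + Real.log q))) := by
  classical
  have hL := Real.log_natCast_nonneg n
  refine (norm_sum_le _ _).trans ?_
  let φ : ℕ → ℝ := fun d => ((range (n / d + 1)).sup' nonempty_range_add_one
    fun t => ‖∑ k ∈ Icc 1 t, e (k * (d * α))‖)
  have h := sum_typeI_le hq ha hα (φ := φ) (K := K)
    (X := n) (Nat.cast_nonneg n) (fun d _ => ?_) fun d _ => ?_
  · refine le_trans ?_ (mul_le_mul_of_nonneg_left h (by positivity))
    rw [mul_sum]
    refine sum_le_sum fun d hd => ?_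
    rw [norm_mul]
    refine (mul_le_of_le_one_left (norm_nonneg _) (hc d hd)).trans ?_
    have h1 := norm_sum_log_mul_e_le (β := d * α) (N := n / d) (n := n) (B := φ d)
      (Nat.div_le_self _ _)
      (fun t ht => le_sup' (fun t : ℕ => ‖∑ k ∈ Icc 1 t, e (k * (d * α))‖)
        (mem_range.2 (Nat.lt_succ_of_le ht)))
    refine le_trans (le_of_eq ?_) h1
    congr 1
    exact sum_congr rfl fun k _ => by rw [show α * ((d : ℝ) * k) = k * (d * α) by ring]
  · refine sup'_le _ _ fun t ht => (norm_sum_e_le _ _ _).trans ?_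
    rw [Nat.add_sub_cancel]
    refine le_trans ?_ (Nat.cast_div_le (m := n) (n := d))
    exact_mod_cast Nat.lt_succ_iff.1 (mem_range.1 ht)
  · obtain ⟨t, _, ht⟩ := exists_mem_eq_sup' (nonempty_range_add_one (n := n / d))
      fun t => ‖∑ k ∈ Icc 1 t, e (k * (d * α))‖
    simp only [φ]
    rw [ht]
    exact (norm_sum_e_mul_nd_le _ _ _).trans (by norm_num)

theorem card_divisors_mul_le (a b : ℕ) :
    (a * b).divisors.card ≤ a.divisors.card * b.divisors.card := by
  rw [Nat.divisors_mul]
  exact card_mul_le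

theorem sum_Icc_divisors {R : Type*} [AddCommMonoid R] (N : ℕ) (f : ℕ → ℕ → R) :
    ∑ m ∈ Icc 1 N, ∑ d ∈ m.divisors, f d (m / d) =
      ∑ d ∈ Icc 1 N, ∑ k ∈ Icc 1 (N / d), f d k := by
  rw [sum_sigma', sum_sigma']
  refine sum_nbij' (fun x => ⟨x.2, x.1 / x.2⟩) (fun x => ⟨x.1 * x.2, x.1⟩) ?_ ?_ ?_ ?_ ?_
  · rintro ⟨m, d⟩ h
    simp only [mem_sigma, mem_Icc, Nat.mem_divisors] at h ⊢
    obtain ⟨⟨h1, h2⟩, h3, h4⟩ := h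
    have hd : 0 < d := Nat.pos_of_dvd_of_pos h3 (by omega)
    have := Nat.le_of_dvd (by omega) h3
    exact ⟨⟨hd, by omega⟩, Nat.div_pos this hd, Nat.div_le_div_right h2⟩
  · rintro ⟨d, k⟩ h
    simp only [mem_sigma, mem_Icc, Nat.mem_divisors] at h ⊢
    obtain ⟨⟨h1, h2⟩, h3, h4⟩ := h
    have h5 : d * k ≤ N := (Nat.mul_le_mul_left d h4).trans (Nat.mul_div_le N d)
    have h6 : 0 < d * k := Nat.mul_pos h1 h3
    exact ⟨⟨h6, h5⟩, dvd_mul_right _ _, by omega⟩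
  · rintro ⟨m, d⟩ h
    simp only [mem_sigma, mem_Icc, Nat.mem_divisors] at h
    simp [Nat.mul_div_cancel' h.2.1]
  · rintro ⟨d, k⟩ h
    simp only [mem_sigma, mem_Icc] at h
    simp [Nat.mul_div_cancel_left k h.1.1]
  · rintro ⟨m, d⟩ _
    rfl

theorem sum_card_divisors_div_le (N : ℕ) :
    ∑ m ∈ Icc 1 N, (m.divisors.card : ℝ) / m ≤ (1 + Real.log N) ^ 2 := by
  have h := sum_Icc_divisors N (fun d k => ((d : ℝ) * k)⁻¹)
  have h1 : ∑ m ∈ Icc 1 N, (m.divisors.card : ℝ) / m =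
      ∑ m ∈ Icc 1 N, ∑ d ∈ m.divisors, ((d : ℝ) * (m / d : ℕ))⁻¹ := by
    refine sum_congr rfl fun m hm => ?_
    rw [div_eq_mul_inv, ← nsmul_eq_mul, ← sum_const]
    refine sum_congr rfl fun d hd => ?_
    rw [← Nat.cast_mul, Nat.mul_div_cancel' (Nat.dvd_of_mem_divisors hd)]
  rw [h1, h, pow_two]
  have hl := sum_inv_le_one_add_log N
  have hN := Real.log_natCast_nonneg N
  calc _ ≤ ∑ d ∈ Icc 1 N, (d : ℝ)⁻¹ * (1 + Real.log N) := by
        refine sum_le_sum fun d _ => ?_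
        simp_rw [mul_inv, ← mul_sum]
        gcongr
        refine le_trans (sum_le_sum_of_subset_of_nonneg
          (Icc_subset_Icc_right (Nat.div_le_self N d)) fun i _ _ => by positivity) hl
    _ = (∑ d ∈ Icc 1 N, (d : ℝ)⁻¹) * (1 + Real.log N) := by rw [sum_mul]
    _ ≤ _ := by gcongr

theorem sum_card_divisors_le (N : ℕ) :
    ∑ m ∈ Icc 1 N, (m.divisors.card : ℝ) ≤ N * (1 + Real.log N) := by
  have h := sum_Icc_divisors N (fun _ _ => (1 : ℝ))
  simp only [sum_const, nsmul_eq_mul, mul_one, Nat.card_Icc, Nat.add_sub_cancel] at h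
  rw [h]
  calc _ ≤ ∑ d ∈ Icc 1 N, (N : ℝ) * (d : ℝ)⁻¹ :=
        sum_le_sum fun d _ => by
          rw [← div_eq_mul_inv]
          exact Nat.cast_div_le
    _ ≤ _ := by
        rw [← mul_sum]
        gcongr
        exact sum_inv_le_one_add_log N

theorem sum_card_divisors_sq_le (N : ℕ) :
    ∑ m ∈ Icc 1 N, (m.divisors.card : ℝ) ^ 2 ≤ N * (1 + Real.log N) ^ 3 := by
  have h := sum_Icc_divisors N (fun d k => (d.divisors.card : ℝ) * k.divisors.card)
  have hN := Real.log_natCast_nonneg N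
  calc _ ≤ ∑ m ∈ Icc 1 N, ∑ d ∈ m.divisors, (d.divisors.card : ℝ) * (m / d).divisors.card := by
        refine sum_le_sum fun m _ => ?_
        rw [pow_two, ← nsmul_eq_mul, ← sum_const]
        refine sum_le_sum fun d hd => ?_
        have := card_divisors_mul_le d (m / d)
        rw [Nat.mul_div_cancel' (Nat.dvd_of_mem_divisors hd)] at this
        exact_mod_cast this
    _ ≤ ∑ d ∈ Icc 1 N, (d.divisors.card : ℝ) * ((N / d) * (1 + Real.log N)) := by
        rw [h]
        refine sum_le_sum fun d hd => ?_
        rw [← mul_sum]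
        gcongr
        refine (sum_card_divisors_le (N / d)).trans ?_
        have h1 : Real.log ((N / d : ℕ) : ℝ) ≤ Real.log N := by
          rcases Nat.eq_zero_or_pos (N / d) with h0 | h0
          · rw [h0]
            simpa using hN
          · apply Real.log_le_log
            · exact_mod_cast h0
            · exact_mod_cast Nat.div_le_self N d
        have h2 := Real.log_natCast_nonneg (N / d)
        gcongr
        exact Nat.cast_div_le
    _ = (∑ d ∈ Icc 1 N, (d.divisors.card : ℝ) / d) * (N * (1 + Real.log N)) := by
        rw [sum_mul]
        exact sum_congr rfl fun d _ => by ring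
    _ ≤ (1 + Real.log N) ^ 2 * (N * (1 + Real.log N)) := by
        gcongr
        exact sum_card_divisors_div_le N
    _ = _ := by ring

theorem sum_card_divisors_sq_le' {B : ℕ → ℂ} (hB : ∀ k, ‖B k‖ ≤ k.divisors.card) (N : ℕ) :
    ∑ k ∈ Icc 1 N, ‖B k‖ ^ 2 ≤ N * (1 + Real.log N) ^ 3 :=
  (sum_le_sum fun k _ => pow_le_pow_left₀ (norm_nonneg _) (hB k) 2).trans
    (sum_card_divisors_sq_le N)

/-- The bound for type II sums over a dyadic range. -/
theorem norm_typeII_le {α : ℝ} {a : ℤ} {q : ℕ} (hq : 1 ≤ q) (ha : IsCoprime a (q : ℤ))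
    (hα : |α - a / q| ≤ 1 / (q : ℝ) ^ 2) (A B : ℕ → ℂ) {M n : ℕ} (hM : 1 ≤ M) :
    ‖∑ m ∈ Ioc M (2 * M), A m * ∑ k ∈ Icc 1 (n / m), B k * e (α * (m * k))‖ ^ 2 ≤
      (∑ m ∈ Ioc M (2 * M), ‖A m‖ ^ 2) * ((∑ k ∈ Icc 1 (n / M), ‖B k‖ ^ 2) *
        ((2 * (n / M : ℕ) / q + 1) * (2 * M + 8 * q * (1 + Real.log q)))) := by
  set K := n / M with hK
  set T : ℝ := (2 * K / q + 1) * (2 * M + 8 * q * (1 + Real.log q)) with hT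
  set c : ℕ → ℕ → ℂ := fun k m => if m * k ≤ n then B k * e (α * (m * k)) else 0 with hc
  have hinner : ∀ m ∈ Ioc M (2 * M), ∑ k ∈ Icc 1 (n / m), B k * e (α * (m * k)) =
      ∑ k ∈ Icc 1 K, c k m := by
    intro m hm
    have hm' := mem_Ioc.1 hm
    have hm0 : 0 < m := by omega
    simp only [hc]
    rw [← sum_filter]
    refine sum_congr ?_ fun _ _ => rfl
    ext k
    simp only [mem_filter, mem_Icc, Nat.le_div_iff_mul_le hm0, hK, Nat.le_div_iff_mul_le hM]
    constructor
    · rintro ⟨h1, h2⟩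
      refine ⟨⟨h1, le_trans (Nat.mul_le_mul_left k hm'.1.le) h2⟩, by rwa [mul_comm]⟩
    · rintro ⟨⟨h1, _⟩, h2⟩
      exact ⟨h1, by rwa [mul_comm]⟩
  have hfirst : ‖∑ m ∈ Ioc M (2 * M), A m * ∑ k ∈ Icc 1 (n / m), B k * e (α * (m * k))‖ ^ 2 ≤
      (∑ m ∈ Ioc M (2 * M), ‖A m‖ ^ 2) * ∑ m ∈ Ioc M (2 * M), ‖∑ k ∈ Icc 1 K, c k m‖ ^ 2 := by
    refine le_trans ?_ (sum_mul_sq_le_sq_mul_sq _ (fun m => ‖A m‖) fun m => ‖∑ k ∈ Icc 1 K, c k m‖)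
    refine pow_le_pow_left₀ (norm_nonneg _) ((norm_sum_le _ _).trans (le_of_eq ?_)) 2
    exact sum_congr rfl fun m hm => by rw [norm_mul, hinner m hm]
  refine hfirst.trans (mul_le_mul_of_nonneg_left ?_ (sum_nonneg fun _ _ => by positivity))
  set ψ : ℕ → ℕ → ℝ := fun k k' =>
    ‖∑ m ∈ (Ioc M (2 * M)).filter (fun m => m * k ≤ n ∧ m * k' ≤ n),
      e (m * (k * α - k' * α))‖ with hψ
  have hset : ∀ k ∈ Icc 1 K, ∀ k' ∈ Icc 1 K,
      (Ioc M (2 * M)).filter (fun m => m * k ≤ n ∧ m * k' ≤ n) =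
        Icc (M + 1) (min (2 * M) (min (n / k) (n / k'))) := by
    intro k hk k' hk'
    have h1 : 0 < k := (mem_Icc.1 hk).1
    have h2 : 0 < k' := (mem_Icc.1 hk').1
    ext m
    simp only [mem_filter, mem_Ioc, mem_Icc, le_min_iff, Nat.le_div_iff_mul_le h1,
      Nat.le_div_iff_mul_le h2]
    tauto
  have hψM : ∀ k ∈ Icc 1 K, ∀ k' ∈ Icc 1 K, ψ k k' ≤ M := by
    intro k hk k' hk'
    simp only [hψ]
    rw [hset k hk k' hk']
    refine (norm_sum_e_le _ _ _).trans ?_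
    have : min (2 * M) (min (n / k) (n / k')) + 1 - (M + 1) ≤ M := by omega
    exact_mod_cast this
  have hψnd : ∀ k ∈ Icc 1 K, ∀ k' ∈ Icc 1 K, ψ k k' * nd (k * α - k' * α) ≤ 1 := by
    intro k hk k' hk'
    simp only [hψ]
    rw [hset k hk k' hk']
    exact (norm_sum_e_mul_nd_le _ _ _).trans (by norm_num)
  have hs1 : ∀ k' ∈ Icc 1 K, ∑ k ∈ Icc 1 K, ψ k k' ≤ T := fun k' hk' =>
    sum_interval_le (β := -(k' * α)) hq ha hα (Nat.cast_nonneg M) (fun k hk => hψM k hk k' hk')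
      fun k hk => by
        have := hψnd k hk k' hk'
        rwa [sub_eq_add_neg] at this
  have hs2 : ∀ k ∈ Icc 1 K, ∑ k' ∈ Icc 1 K, ψ k k' ≤ T := fun k hk =>
    sum_interval_le (β := -(k * α)) hq ha hα (Nat.cast_nonneg M) (fun k' hk' => hψM k hk k' hk')
      fun k' hk' => by
        have := hψnd k hk k' hk'
        rwa [← nd_neg, neg_sub, sub_eq_add_neg] at this
  have hexp : ((∑ m ∈ Ioc M (2 * M), ‖∑ k ∈ Icc 1 K, c k m‖ ^ 2 : ℝ) : ℂ) =
      ∑ k ∈ Icc 1 K, ∑ k' ∈ Icc 1 K, B k * starRingEnd ℂ (B k') *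
        ∑ m ∈ (Ioc M (2 * M)).filter (fun m => m * k ≤ n ∧ m * k' ≤ n),
          e (m * (k * α - k' * α)) := by
    have h1 : ∀ m, ((‖∑ k ∈ Icc 1 K, c k m‖ ^ 2 : ℝ) : ℂ) =
        ∑ k ∈ Icc 1 K, ∑ k' ∈ Icc 1 K, c k m * starRingEnd ℂ (c k' m) := by
      intro m
      rw [← sum_mul_sum, ← map_sum, Complex.mul_conj, Complex.normSq_eq_norm_sq]
    rw [Complex.ofReal_sum, sum_congr rfl fun m _ => h1 m, sum_comm]
    refine sum_congr rfl fun k _ => ?_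
    rw [sum_comm]
    refine sum_congr rfl fun k' _ => ?_
    rw [mul_sum, sum_filter]
    refine sum_congr rfl fun m _ => ?_
    simp only [hc]
    by_cases h2 : m * k ≤ n
    · by_cases h3 : m * k' ≤ n
      · rw [if_pos h2, if_pos h3, if_pos ⟨h2, h3⟩, map_mul, ← e_neg,
          show (m : ℝ) * (k * α - k' * α) = α * (m * k) + -(α * (m * k')) by ring, e_add]
        ring
      · simp [h3]
    · simp [h2]
  have hnorm : ∑ m ∈ Ioc M (2 * M), ‖∑ k ∈ Icc 1 K, c k m‖ ^ 2 ≤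
      ∑ k ∈ Icc 1 K, ∑ k' ∈ Icc 1 K, ‖B k‖ * ‖B k'‖ * ψ k k' := by
    have h0 : (0 : ℝ) ≤ ∑ m ∈ Ioc M (2 * M), ‖∑ k ∈ Icc 1 K, c k m‖ ^ 2 :=
      sum_nonneg fun _ _ => by positivity
    rw [← Real.norm_of_nonneg h0, ← Complex.norm_real, hexp]
    refine (norm_sum_le _ _).trans (sum_le_sum fun k _ => (norm_sum_le _ _).trans
      (sum_le_sum fun k' _ => ?_))
    rw [norm_mul, norm_mul, RCLike.norm_conj]
  refine hnorm.trans ?_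
  have hψ0 : ∀ k k', 0 ≤ ψ k k' := fun _ _ => norm_nonneg _
  calc ∑ k ∈ Icc 1 K, ∑ k' ∈ Icc 1 K, ‖B k‖ * ‖B k'‖ * ψ k k'
      ≤ ∑ k ∈ Icc 1 K, ∑ k' ∈ Icc 1 K, (‖B k‖ ^ 2 * ψ k k' / 2 + ‖B k'‖ ^ 2 * ψ k k' / 2) := by
        refine sum_le_sum fun k _ => sum_le_sum fun k' _ => ?_
        have := two_mul_le_add_sq ‖B k‖ ‖B k'‖
        nlinarith [hψ0 k k']
    _ = (∑ k ∈ Icc 1 K, ‖B k‖ ^ 2 * ∑ k' ∈ Icc 1 K, ψ k k') / 2 +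
        (∑ k' ∈ Icc 1 K, ‖B k'‖ ^ 2 * ∑ k ∈ Icc 1 K, ψ k k') / 2 := by
        simp_rw [sum_add_distrib, ← sum_div, mul_sum]
        congr 2
        exact sum_comm
    _ ≤ (∑ k ∈ Icc 1 K, ‖B k‖ ^ 2 * T) / 2 + (∑ k' ∈ Icc 1 K, ‖B k'‖ ^ 2 * T) / 2 := by
        gcongr with k hk k' hk'
        · exact hs2 k hk
        · exact hs1 k' hk'
    _ = _ := by
        rw [← sum_mul]
        ring

end TG

namespace TG
open ArithmeticFunction
open scoped ArithmeticFunction.zeta ArithmeticFunction.Moebius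

/-- The arithmetic function `f` restricted to `m ≤ u`. -/
def cut {R : Type*} [Zero R] (u : ℕ) (f : ArithmeticFunction R) : ArithmeticFunction R :=
  ⟨fun m => if m ≤ u then f m else 0, by simp⟩

theorem cut_apply {R : Type*} [Zero R] (u : ℕ) (f : ArithmeticFunction R) (m : ℕ) :
    cut u f m = if m ≤ u then f m else 0 := rfl

theorem arith_sub_apply (f g : ArithmeticFunction ℝ) (m : ℕ) : (f - g) m = f m - g m := by
  rw [eq_sub_iff_add_eq, ← ArithmeticFunction.add_apply, sub_add_cancel]

/-- The exponential sum of an arithmetic function. -/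
def expSum (n : ℕ) (α : ℝ) (f : ArithmeticFunction ℝ) : ℂ := ∑ m ∈ Icc 1 n, (f m : ℂ) * e (α * m)

theorem expSum_add (n : ℕ) (α : ℝ) (f g : ArithmeticFunction ℝ) :
    expSum n α (f + g) = expSum n α f + expSum n α g := by
  simp only [expSum, ← sum_add_distrib]
  exact sum_congr rfl fun m _ => by rw [ArithmeticFunction.add_apply]; push_cast; ring

theorem expSum_sub (n : ℕ) (α : ℝ) (f g : ArithmeticFunction ℝ) :
    expSum n α (f - g) = expSum n α f - expSum n α g := by
  rw [eq_sub_iff_add_eq, ← expSum_add, sub_add_cancel]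

theorem expSum_mul (n : ℕ) (α : ℝ) (f g : ArithmeticFunction ℝ) :
    expSum n α (f * g) =
      ∑ d ∈ Icc 1 n, (f d : ℂ) * ∑ k ∈ Icc 1 (n / d), (g k : ℂ) * e (α * (d * k)) := by
  have h := sum_Icc_divisors n (fun d k => (f d : ℂ) * ((g k : ℂ) * e (α * (d * k))))
  simp_rw [mul_sum]
  rw [← h, expSum]
  refine sum_congr rfl fun m _ => ?_
  rw [mul_apply, Nat.sum_divisorsAntidiagonal (fun i j => f i * g j), Complex.ofReal_sum, sum_mul]
  refine sum_congr rfl fun d hd => ?_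
  rw [← Nat.cast_mul, Nat.mul_div_cancel' (Nat.dvd_of_mem_divisors hd)]
  push_cast
  ring

theorem vaughan (u : ℕ) (ζ' : ArithmeticFunction ℝ) (hζ : ζ' = ((ζ : ArithmeticFunction ℕ) : ArithmeticFunction ℝ)) (G : ArithmeticFunction ℝ) :
    Λ = cut u Λ - cut u Λ * G * ζ' + G * log + (Λ - cut u Λ) * (1 - G * ζ') := by
  have h : Λ * ζ' = log := by rw [hζ]; exact vonMangoldt_mul_zeta
  rw [← h]
  ring

theorem mul_cut_support {u v : ℕ} (f g : ArithmeticFunction ℝ) {d : ℕ} (hd : u * v < d) :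
    (cut u f * cut v g) d = 0 := by
  rw [mul_apply]
  refine sum_eq_zero fun x hx => ?_
  have hx' := (Nat.mem_divisorsAntidiagonal.1 hx).1
  rw [cut_apply, cut_apply]
  split_ifs with h1 h2
  · have := Nat.mul_le_mul h1 h2
    omega
  all_goals simp

theorem abs_cut_vonMangoldt_mul_le (u v d : ℕ) :
    |(cut u Λ * cut v (μ : ArithmeticFunction ℝ)) d| ≤ Real.log d := by
  have h : (Λ * (ζ : ArithmeticFunction ℝ)) d = Real.log d := by
    rw [vonMangoldt_mul_zeta, log_apply]
  rw [← h, mul_apply, mul_apply]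
  refine (abs_sum_le_sum_abs _ _).trans (sum_le_sum fun x hx => ?_)
  have hx2 : x.2 ≠ 0 := (Nat.ne_zero_of_mem_divisorsAntidiagonal hx).2
  rw [abs_mul, natCoe_apply, zeta_apply_ne hx2, cut_apply, cut_apply]
  have h1 := vonMangoldt_nonneg (n := x.1)
  have h2 : |((μ x.2 : ℤ) : ℝ)| ≤ 1 := by exact_mod_cast abs_moebius_le_one
  split_ifs
  · rw [abs_of_nonneg h1, intCoe_apply]
    push_cast
    gcongr
  all_goals simp [h1]

theorem one_sub_cut_moebius_mul_zeta {u k : ℕ} :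
    |(1 - cut u (μ : ArithmeticFunction ℝ) * (ζ : ArithmeticFunction ℝ)) k| ≤ k.divisors.card ∧
      (k ≤ u → (1 - cut u (μ : ArithmeticFunction ℝ) * (ζ : ArithmeticFunction ℝ)) k = 0) := by
  have h0 : (1 - cut u (μ : ArithmeticFunction ℝ) * (ζ : ArithmeticFunction ℝ)) =
      ((μ : ArithmeticFunction ℝ) - cut u (μ : ArithmeticFunction ℝ)) * (ζ : ArithmeticFunction ℝ) := by
    rw [sub_mul, coe_moebius_mul_coe_zeta]
  rw [h0]
  constructor
  · rw [mul_apply, Nat.sum_divisorsAntidiagonal (fun i j =>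
      ((μ : ArithmeticFunction ℝ) - cut u (μ : ArithmeticFunction ℝ)) i * (ζ : ArithmeticFunction ℝ) j)]
    refine (abs_sum_le_sum_abs _ _).trans ?_
    rw [card_eq_sum_ones, Nat.cast_sum]
    refine sum_le_sum fun x hx => ?_
    have h2 : |((μ x : ℤ) : ℝ)| ≤ 1 := by exact_mod_cast abs_moebius_le_one
    have h3 : |(ζ : ArithmeticFunction ℝ) (k / x)| ≤ 1 := by
      rw [natCoe_apply, zeta_apply]
      split_ifs <;> simp
    have h4 : |((μ : ArithmeticFunction ℝ) - cut u (μ : ArithmeticFunction ℝ)) x| ≤ 1 := by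
      rw [arith_sub_apply, cut_apply, intCoe_apply]
      split_ifs
      · simp
      · simpa using h2
    rw [abs_mul]
    push_cast
    exact mul_le_one₀ h4 (abs_nonneg _) h3
  · intro hk
    rw [mul_apply]
    refine sum_eq_zero fun x hx => ?_
    have hx1 : x.1 ≤ u := by
      have := Nat.mem_divisorsAntidiagonal.1 hx
      exact (Nat.le_of_dvd (Nat.pos_of_ne_zero this.2) ⟨_, this.1.symm⟩).trans hk
    rw [arith_sub_apply, cut_apply, if_pos hx1, sub_self, zero_mul]

theorem log_natCast_le_log {K n : ℕ} (h : K ≤ n) : Real.log K ≤ Real.log n := by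
  rcases Nat.eq_zero_or_pos K with rfl | hK
  · simpa using Real.log_natCast_nonneg n
  · exact Real.log_le_log (by exact_mod_cast hK) (by exact_mod_cast h)

theorem typeI_factor_le {n q K : ℕ} {R : ℝ} (hL : 1 ≤ Real.log n) (hR : 1 ≤ R) (hRq : R ≤ q)
    (hqn : q * R ≤ n) (hRn : R ^ 2 ≤ n) (hK : K ^ 2 ≤ n) :
    4 * (n : ℝ) / q * (2 + Real.log K) + (2 * K / q + 2) * (12 * q * (1 + Real.log q)) ≤
      108 * Real.log n * (n / R) := by
  have hq : (0 : ℝ) < q := by linarith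
  have hR0 : 0 < R := by linarith
  have h1 : (n : ℝ) / q ≤ n / R := by gcongr
  have hqn' : q ≤ n := by
    have : (q : ℝ) * 1 ≤ q * R := by gcongr
    exact_mod_cast (by linarith : (q : ℝ) ≤ n)
  have hKn : K ≤ n := (Nat.le_self_pow two_ne_zero K).trans hK
  have h2 : (q : ℝ) ≤ n / R := by rwa [le_div_iff₀ hR0]
  have h3 : (K : ℝ) ≤ n / R := by
    rw [le_div_iff₀ hR0]
    have : (K : ℝ) ^ 2 ≤ n := by exact_mod_cast hK
    refine abs_le_of_sq_le_sq' ?_ (Nat.cast_nonneg n) |>.2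
    rw [mul_pow, pow_two (n : ℝ)]
    gcongr
  have h4 := log_natCast_le_log hKn
  have h5 := log_natCast_le_log hqn'
  have h6 := Real.log_natCast_nonneg q
  have hx : 0 ≤ (n : ℝ) / R := by positivity
  calc _ = 4 * (n / q) * (2 + Real.log K) + 24 * (K + q) * (1 + Real.log q) := by
        field_simp
        ring
    _ ≤ 4 * (n / R) * (3 * Real.log n) + 24 * (n / R + n / R) * (2 * Real.log n) := by
        have := Real.log_natCast_nonneg K
        gcongr <;> linarith
    _ = _ := by ring

theorem sum_Icc_eq_of_support {N K : ℕ} (hKN : K ≤ N) {f : ℕ → ℂ} (hf : ∀ d, K < d → f d = 0) :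
    ∑ d ∈ Icc 1 N, f d = ∑ d ∈ Icc 1 K, f d := by
  refine (sum_subset (Icc_subset_Icc_right hKN) fun d _ hd => hf d ?_).symm
  simp only [mem_Icc] at *
  omega

theorem sum_Ioc_two_pow {M : Type*} [AddCommMonoid M] (u J : ℕ) (f : ℕ → M) :
    ∑ d ∈ Ioc u (u * 2 ^ J), f d =
      ∑ i ∈ range J, ∑ d ∈ Ioc (u * 2 ^ i) (2 * (u * 2 ^ i)), f d := by
  induction J with
  | zero => simp
  | succ J ih =>
    rw [sum_range_succ, ← ih, show u * 2 ^ (J + 1) = 2 * (u * 2 ^ J) by ring,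
      sum_Ioc_consecutive]
    · exact Nat.le_mul_of_pos_right u (by positivity)
    · omega

/-- The type II contribution of a dyadic block. -/
theorem typeII_block_le {α : ℝ} {a : ℤ} {q : ℕ} (ha : IsCoprime a (q : ℤ))
    (hα : |α - a / q| ≤ 1 / (q : ℝ) ^ 2) {n u M : ℕ} {R : ℝ} (hL : 1 ≤ Real.log n) (hR : 1 ≤ R)
    (hRq : R ≤ q) (hqn : q * R ≤ n) (hRu : R ≤ 2 * u) (huM : u ≤ M) {A B : ℕ → ℂ}
    (hA : ∀ m, ‖A m‖ ≤ Real.log m) (hB : ∀ k, ‖B k‖ ≤ k.divisors.card)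
    (hB0 : ∀ k ≤ u, B k = 0) :
    ‖∑ m ∈ Ioc M (2 * M), A m * ∑ k ∈ Icc 1 (n / m), B k * e (α * (m * k))‖ ≤
      54 * n * Real.log n ^ 3 / √R := by
  set L := Real.log n with hLdef
  have hR0 : 0 < R := by linarith
  have hq : (0 : ℝ) < q := by linarith
  have hu0 : (0 : ℝ) < u := by linarith
  have hu : 1 ≤ u := by exact_mod_cast hu0
  have hM : 1 ≤ M := hu.trans huM
  have hM0 : (0 : ℝ) < M := by exact_mod_cast hM
  have hn0 : (0 : ℝ) < n := by nlinarith
  by_cases hcase : n / M ≤ u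
  · rw [sum_eq_zero fun m hm => ?_]
    · simp only [norm_zero]
      positivity
    · rw [sum_eq_zero fun k hk => ?_, mul_zero]
      rw [hB0 k, zero_mul]
      have h1 := (mem_Icc.1 hk).2
      have h2 : n / m ≤ n / M := Nat.div_le_div_left (mem_Ioc.1 hm).1.le hM
      omega
  have hMu : (M : ℝ) * u ≤ n := by
    have h2 : u * M ≤ n := (Nat.le_div_iff_mul_le hM).1 (by omega)
    rw [mul_comm]
    exact_mod_cast h2
  have hMn : (M : ℝ) ≤ n := by
    have : (M : ℝ) * 1 ≤ M * u := by
      gcongr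
      exact_mod_cast hu
    linarith
  have h := norm_typeII_le (by exact_mod_cast hq : 1 ≤ q) ha hα A B hM (n := n)
  have hs1 : ∑ m ∈ Ioc M (2 * M), ‖A m‖ ^ 2 ≤ M * (2 * L) ^ 2 := by
    have h1 : ∀ m ∈ Ioc M (2 * M), ‖A m‖ ^ 2 ≤ (2 * L) ^ 2 := by
      intro m hm
      refine pow_le_pow_left₀ (norm_nonneg _) ((hA m).trans ?_) 2
      have hm1 := mem_Ioc.1 hm
      calc Real.log m ≤ Real.log (n ^ 2) := by
            refine Real.log_le_log (by exact_mod_cast (by omega : 0 < m)) ?_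
            have h2 : (m : ℝ) ≤ 2 * M := by exact_mod_cast hm1.2
            have h3 : (2 : ℝ) ≤ n := by
              have := Real.log_le_sub_one_of_pos hn0
              linarith
            nlinarith
        _ = _ := by rw [Real.log_pow, ← hLdef]; norm_num
    refine (sum_le_sum h1).trans (le_of_eq ?_)
    rw [sum_const, Nat.card_Ioc, nsmul_eq_mul]
    congr 2
    omega
  have hNn : ((n / M : ℕ) : ℝ) ≤ n / M := Nat.cast_div_le
  have hs2 : ∑ k ∈ Icc 1 (n / M), ‖B k‖ ^ 2 ≤ n / M * (2 * L) ^ 3 := by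
    refine (sum_card_divisors_sq_le' hB _).trans ?_
    have := log_natCast_le_log (Nat.div_le_self n M)
    have := Real.log_natCast_nonneg (n / M)
    gcongr
    linarith
  have hlogq : Real.log q ≤ L := by
    refine log_natCast_le_log ?_
    have : (q : ℝ) * 1 ≤ q * R := by gcongr
    exact_mod_cast (by linarith : (q : ℝ) ≤ n)
  have hlogq0 := Real.log_natCast_nonneg q
  have hs3 : (2 * ((n / M : ℕ) : ℝ) / q + 1) * (2 * M + 8 * q * (1 + Real.log q)) ≤
      88 * L * (n / R) := by
    have e1 : (n : ℝ) / q ≤ n / R := by gcongr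
    have e2 : (q : ℝ) ≤ n / R := by rwa [le_div_iff₀ hR0]
    have e3 : (n : ℝ) / M ≤ 2 * (n / R) := by
      rw [div_le_iff₀ hM0]
      have : (u : ℝ) ≤ M := by exact_mod_cast huM
      calc (n : ℝ) = n / R * R := by field_simp
        _ ≤ n / R * (2 * M) := by gcongr; linarith
        _ = _ := by ring
    have e4 : (M : ℝ) ≤ 2 * (n / R) := by
      rw [← mul_div_assoc, le_div_iff₀ hR0]
      calc (M : ℝ) * R ≤ M * (2 * u) := by gcongr
        _ ≤ _ := by linarith
    have hx : 0 ≤ (n : ℝ) / R := by positivity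
    calc _ ≤ (2 * (n / M) / q + 1) * (2 * M + 8 * q * (2 * L)) := by
          gcongr
          linarith
      _ = 4 * (n / q) + 32 * L * (n / M) + 2 * M + 16 * L * q := by
          field_simp
          ring
      _ ≤ 4 * (n / R) + 32 * L * (2 * (n / R)) + 2 * (2 * (n / R)) + 16 * L * (n / R) := by
          gcongr
      _ ≤ _ := by nlinarith
  have hfin : ‖∑ m ∈ Ioc M (2 * M), A m * ∑ k ∈ Icc 1 (n / m), B k * e (α * (m * k))‖ ^ 2 ≤
      (54 * n * L ^ 3 / √R) ^ 2 := by
    refine h.trans ?_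
    calc _ ≤ (M * (2 * L) ^ 2) * ((n / M * (2 * L) ^ 3) * (88 * L * (n / R))) := by
          gcongr
      _ = 2816 * n ^ 2 * L ^ 6 / R := by
          field_simp
          ring
      _ ≤ 2916 * n ^ 2 * L ^ 6 / R := by gcongr; norm_num
      _ = _ := by
          rw [div_pow, Real.sq_sqrt hR0.le]
          ring
  exact abs_le_of_sq_le_sq' hfin (by positivity) |>.2

theorem norm_expSum_primeLog_le {α : ℝ} {a : ℤ} {q : ℕ} (ha : IsCoprime a (q : ℤ))
    (hα : |α - a / q| ≤ 1 / (q : ℝ) ^ 2) {n : ℕ} {R : ℝ} (hL : 1 ≤ Real.log n) (hR : 1 ≤ R)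
    (hRq : R ≤ q) (hqn : q * R ≤ n) (hRn : R ^ 4 ≤ n) :
    ‖∑ m ∈ Icc 1 n, (primeLog m : ℂ) * e (α * m)‖ * √R ≤ 500 * n * Real.log n ^ 4 := by
  set L := Real.log n with hLdef
  set u := Nat.sqrt (Nat.sqrt n) with hu
  have hR0 : 0 < R := by linarith
  have hq : (0 : ℝ) < q := by linarith
  have hq1 : 1 ≤ q := by exact_mod_cast hq
  have hn0 : (0 : ℝ) < n := by nlinarith
  have hn1 : 1 ≤ n := by exact_mod_cast hn0
  have hu1 : 1 ≤ u := Nat.sqrt_pos.2 (Nat.sqrt_pos.2 hn1)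
  have hu1' : (1 : ℝ) ≤ u := by exact_mod_cast hu1
  have huu : u * u ≤ Nat.sqrt n := Nat.sqrt_le _
  have hss : Nat.sqrt n * Nat.sqrt n ≤ n := Nat.sqrt_le _
  have hK : (u * u) ^ 2 ≤ n := by
    rw [pow_two]
    exact (Nat.mul_le_mul huu huu).trans hss
  have huun : u * u ≤ n := (Nat.le_self_pow two_ne_zero _).trans hK
  have hK' : u ^ 2 ≤ n := by rwa [pow_two]
  have hun : u ≤ n := (Nat.le_mul_self u).trans huun
  have hRu : R ≤ 2 * u := by
    have h1 : n < (u + 1) ^ 4 := by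
      have h2 : Nat.sqrt n < (u + 1) * (u + 1) := Nat.lt_succ_sqrt _
      have h3 : n < (Nat.sqrt n + 1) * (Nat.sqrt n + 1) := Nat.lt_succ_sqrt _
      calc n < (Nat.sqrt n + 1) * (Nat.sqrt n + 1) := h3
        _ ≤ ((u + 1) * (u + 1)) * ((u + 1) * (u + 1)) := Nat.mul_le_mul h2 h2
        _ = _ := by ring
    have h2 : R ^ 4 ≤ ((u : ℝ) + 1) ^ 4 := hRn.trans (by exact_mod_cast h1.le)
    have := (pow_le_pow_iff_left₀ hR0.le (by positivity) (by norm_num : (4 : ℕ) ≠ 0)).1 h2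
    linarith
  have hRn2 : R ^ 2 ≤ n := (pow_le_pow_right₀ hR (by norm_num)).trans hRn
  set s := √R with hs
  have hs1 : 1 ≤ s := Real.one_le_sqrt.2 hR
  have hsR : s ≤ R := by
    have : s ^ 2 = R := Real.sq_sqrt hR0.le
    nlinarith
  have hdiv : (n : ℝ) / R ≤ n / s := by gcongr
  set G : ArithmeticFunction ℝ := cut u (μ : ArithmeticFunction ℝ) with hG
  set F : ArithmeticFunction ℝ := cut u Λ with hF
  set z : ArithmeticFunction ℝ := ((ζ : ArithmeticFunction ℕ) : ArithmeticFunction ℝ) with hz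
  have hX : 0 ≤ (n : ℝ) / s := by positivity
  have p1 : ‖expSum n α F‖ ≤ 2 * L * (n / s) := by
    have h1 : ‖expSum n α F‖ ≤ u * L := by
      rw [expSum, sum_Icc_eq_of_support hun fun d hd => by
        rw [hF, cut_apply, if_neg (by omega)]; simp]
      refine (norm_sum_le _ _).trans ((sum_le_card_nsmul _ _ L fun m hm => ?_).trans_eq ?_)
      · rw [norm_mul, norm_e, mul_one, Complex.norm_real, hF, cut_apply, if_pos (mem_Icc.1 hm).2,
          Real.norm_of_nonneg vonMangoldt_nonneg]
        exact vonMangoldt_le_log.trans (log_natCast_le_log ((mem_Icc.1 hm).2.trans hun))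
      · simp
    refine h1.trans ?_
    have h2 : (u : ℝ) ≤ 2 * (n / s) := by
      rw [← mul_div_assoc, le_div_iff₀ (by linarith)]
      have : (u : ℝ) * u ≤ n := by exact_mod_cast huun
      nlinarith
    nlinarith
  have p2 : ‖expSum n α (F * G * z)‖ ≤ L * (108 * L * (n / s)) := by
    rw [expSum_mul, sum_Icc_eq_of_support huun fun d hd => by
      rw [mul_cut_support _ _ hd]; simp]
    have h1 := norm_typeI_le hq1 ha hα (c := fun d => (((F * G) d : ℝ) : ℂ)) (K := u * u)
      (A := L) (by linarith) (fun d hd => ?_) n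
    · have h2 := typeI_factor_le hL hR hRq hqn hRn2 hK
      refine le_trans (le_of_eq ?_) (h1.trans (mul_le_mul_of_nonneg_left (h2.trans (by gcongr))
        (by linarith)))
      congr 1
      refine sum_congr rfl fun d _ => ?_
      congr 1
      refine sum_congr rfl fun k hk => ?_
      rw [hz, natCoe_apply, zeta_apply_ne (by have := (mem_Icc.1 hk).1; omega)]
      simp
    · rw [Complex.norm_real]
      exact (abs_cut_vonMangoldt_mul_le _ _ _).trans
        (log_natCast_le_log ((mem_Icc.1 hd).2.trans huun))
  have p3 : ‖expSum n α (G * ArithmeticFunction.log)‖ ≤ 2 * L * (108 * L * (n / s)) := by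
    rw [expSum_mul, sum_Icc_eq_of_support hun fun d hd => by
      rw [hG, cut_apply, if_neg (by omega)]; simp]
    have h1 := norm_typeI_log_le hq1 ha hα (c := fun d => ((G d : ℝ) : ℂ)) (K := u) (n := n)
      (fun d hd => ?_)
    · have h2 := typeI_factor_le hL hR hRq hqn hRn2 hK'
      exact h1.trans (mul_le_mul_of_nonneg_left (h2.trans (by gcongr)) (by linarith))
    · rw [Complex.norm_real, hG, cut_apply, if_pos (mem_Icc.1 hd).2, intCoe_apply]
      have : |((μ d : ℤ) : ℝ)| ≤ 1 := by exact_mod_cast abs_moebius_le_one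
      exact this
  have p4 : ‖expSum n α ((Λ - F) * (1 - G * z))‖ ≤ 3 * L * (54 * n * L ^ 3 / s) := by
    set J := Nat.log 2 n + 1 with hJ
    have hJn : n ≤ u * 2 ^ J := by
      have h1 : n < 2 ^ J := Nat.lt_pow_succ_log_self (by norm_num) n
      exact h1.le.trans (Nat.le_mul_of_pos_left _ hu1)
    have hJL : (J : ℝ) ≤ 3 * L := by
      have h1 : (Nat.log 2 n : ℝ) * Real.log 2 ≤ L := by
        rw [← Real.log_pow]
        refine Real.log_le_log (by positivity) ?_
        exact_mod_cast Nat.pow_log_le_self 2 (by omega)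
      have := Real.log_two_gt_d9
      have h2 : (0 : ℝ) ≤ Nat.log 2 n := Nat.cast_nonneg _
      rw [hJ]
      push_cast
      nlinarith
    rw [expSum_mul]
    have hsum : ∑ d ∈ Icc 1 n, (((Λ - F) d : ℝ) : ℂ) * ∑ k ∈ Icc 1 (n / d),
        (((1 - G * z) k : ℝ) : ℂ) * e (α * (d * k)) = ∑ d ∈ Ioc u (u * 2 ^ J),
          (((Λ - F) d : ℝ) : ℂ) * ∑ k ∈ Icc 1 (n / d),
            (((1 - G * z) k : ℝ) : ℂ) * e (α * (d * k)) := by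
      have hsub : Ioc u n ⊆ Ioc u (u * 2 ^ J) := Ioc_subset_Ioc_right hJn
      rw [← sum_subset hsub fun d h1 h2 => ?_]
      · refine (sum_subset (fun d hd => ?_) fun d h1 h2 => ?_).symm
        · simp only [mem_Ioc, mem_Icc] at *
          omega
        · have hd : d ≤ u := by
            simp only [mem_Ioc, mem_Icc] at *
            omega
          rw [arith_sub_apply, hF, cut_apply, if_pos hd]
          simp
      · have hd : n / d = 0 := by
          simp only [mem_Ioc] at *
          exact Nat.div_eq_of_lt (by omega)
        simp [hd]
    rw [hsum, sum_Ioc_two_pow]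
    refine (norm_sum_le _ _).trans ((sum_le_card_nsmul _ _ (54 * n * L ^ 3 / s)
      fun i _ => ?_).trans ?_)
    · refine typeII_block_le ha hα hL hR hRq hqn hRu (Nat.le_mul_of_pos_right u (by positivity))
        (A := fun d => (((Λ - F) d : ℝ) : ℂ)) (B := fun k => (((1 - G * z) k : ℝ) : ℂ))
        (fun m => ?_) (fun k => ?_) fun k hk => ?_
      · rw [Complex.norm_real, arith_sub_apply, hF, cut_apply]
        split_ifs
        · simpa using Real.log_natCast_nonneg m
        · rw [sub_zero, Real.norm_of_nonneg vonMangoldt_nonneg]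
          exact vonMangoldt_le_log
      · rw [Complex.norm_real]
        exact one_sub_cut_moebius_mul_zeta.1
      · simpa using one_sub_cut_moebius_mul_zeta.2 hk
    · rw [card_range, nsmul_eq_mul]
      gcongr
  have hΛ : ‖expSum n α Λ‖ ≤ 490 * L ^ 4 * (n / s) := by
    rw [vaughan u z hz G, expSum_add, expSum_add, expSum_sub, ← hF]
    have t1 := norm_add_le (expSum n α F - expSum n α (F * G * z) +
      expSum n α (G * ArithmeticFunction.log)) (expSum n α ((Λ - F) * (1 - G * z)))
    have t2 := norm_add_le (expSum n α F - expSum n α (F * G * z))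
      (expSum n α (G * ArithmeticFunction.log))
    have t3 := norm_sub_le (expSum n α F) (expSum n α (F * G * z))
    have hL2 : L ^ 2 ≤ L ^ 4 := pow_le_pow_right₀ hL (by norm_num)
    have hL1 : L ≤ L ^ 4 := le_self_pow₀ hL (by norm_num)
    have q1 := mul_le_mul_of_nonneg_right hL2 hX
    have q2 := mul_le_mul_of_nonneg_right hL1 hX
    have p4' : ‖expSum n α ((Λ - F) * (1 - G * z))‖ ≤ 162 * (L ^ 4 * (n / s)) :=
      p4.trans (le_of_eq (by ring))
    have p2' : ‖expSum n α (F * G * z)‖ ≤ 108 * (L ^ 2 * (n / s)) :=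
      p2.trans (le_of_eq (by ring))
    have p3' : ‖expSum n α (G * ArithmeticFunction.log)‖ ≤ 216 * (L ^ 2 * (n / s)) :=
      p3.trans (le_of_eq (by ring))
    have q3 : 0 ≤ L ^ 4 * (n / s) := by positivity
    linarith
  have hdiff : ‖∑ m ∈ Icc 1 n, (primeLog m : ℂ) * e (α * m) - expSum n α Λ‖ ≤
      2 * L * (n / s) := by
    rw [expSum, ← sum_sub_distrib]
    refine (norm_sum_le _ _).trans (le_trans (le_of_eq (sum_congr rfl fun m _ => ?_))
      ((sum_vonMangoldt_sub_primeLog_le hn1).trans ?_))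
    · rw [← sub_mul, norm_mul, norm_e, mul_one, ← Complex.ofReal_sub, Complex.norm_real,
        Real.norm_eq_abs, abs_sub_comm]
    · have : √(n : ℝ) ≤ n / s := by
        rw [le_div_iff₀ (by linarith)]
        have h1 : √(n : ℝ) ^ 2 = n := Real.sq_sqrt hn0.le
        have h2 : s ≤ √(n : ℝ) := Real.sqrt_le_sqrt (by nlinarith)
        nlinarith [Real.sqrt_nonneg (n : ℝ)]
      calc 2 * √(n : ℝ) * Real.log n ≤ 2 * (n / s) * L := by gcongr
        _ = _ := by ring
  have htot : ‖∑ m ∈ Icc 1 n, (primeLog m : ℂ) * e (α * m)‖ ≤ 500 * L ^ 4 * (n / s) := by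
    have t := norm_add_le (∑ m ∈ Icc 1 n, (primeLog m : ℂ) * e (α * m) - expSum n α Λ)
      (expSum n α Λ)
    rw [sub_add_cancel] at t
    have hL1 : L ≤ L ^ 4 := le_self_pow₀ hL (by norm_num)
    have q2 := mul_le_mul_of_nonneg_right hL1 hX
    have q3 : 0 ≤ L ^ 4 * (n / s) := by positivity
    linarith
  calc _ ≤ 500 * L ^ 4 * (n / s) * s := by gcongr
    _ = _ := by
      field_simp

end TG

namespace TG

/-! ### A combinatorial sieve -/

/-- The truncated inclusion-exclusion principle. -/
theorem abs_bonferroni_le {ι : Type*} [DecidableEq ι] (B : Finset ι) {R : ℕ} (hR : 1 ≤ R) :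
    |(if B = ∅ then (1 : ℝ) else 0) -
      ∑ S ∈ B.powerset.filter (fun S => S.card < R), (-1 : ℝ) ^ S.card| ≤
      ((B.powerset.filter (fun S => S.card = R)).card : ℝ) := by
  have h1 : ∑ S ∈ B.powerset.filter (fun S => S.card < R), (-1 : ℝ) ^ S.card =
      ((∑ i ∈ range R, (-1 : ℤ) ^ i * (B.card.choose i : ℤ) : ℤ) : ℝ) := by
    rw [sum_filter, sum_powerset_apply_card (fun j => if j < R then (-1 : ℝ) ^ j else 0)]
    push_cast
    have h2 : ∀ i, B.card.choose i • (if i < R then (-1 : ℝ) ^ i else 0) =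
        if i < R then (-1 : ℝ) ^ i * B.card.choose i else 0 := fun i => by
      split_ifs
      · rw [nsmul_eq_mul, mul_comm]
      · simp
    simp_rw [h2]
    rw [← sum_filter]
    refine sum_subset (fun i hi => ?_) fun i hi1 hi2 => ?_
    · exact mem_range.2 (mem_filter.1 hi).2
    · simp only [mem_filter, mem_range, not_and_or] at hi1 hi2
      rw [Nat.choose_eq_zero_of_lt (by omega)]
      simp
  have h3 : (B.powerset.filter (fun S => S.card = R)).card = B.card.choose R := by
    rw [← powersetCard_eq_filter, card_powersetCard]
  obtain ⟨r, rfl⟩ : ∃ r, R = r + 1 := ⟨R - 1, by omega⟩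
  rw [h1, h3]
  rcases B.eq_empty_or_nonempty with rfl | hB
  · have : ∑ i ∈ range (r + 1), (-1 : ℤ) ^ i * ((0 : ℕ).choose i : ℤ) = 1 := by
      rw [sum_range_succ']
      simp
    simp [this]
  · have hc : 1 ≤ B.card := hB.card_pos
    obtain ⟨m, hm⟩ : ∃ m, B.card = m + 1 := ⟨B.card - 1, by omega⟩
    rw [if_neg hB.ne_empty, zero_sub, abs_neg, hm]
    rw [show (∑ i ∈ range (r + 1), (-1 : ℤ) ^ i * ((m + 1).choose i : ℤ)) =
      (-1) ^ r * (m.choose r : ℤ) from Int.alternating_sum_range_choose_eq_choose]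
    push_cast
    rw [abs_mul, abs_pow, abs_neg, abs_one, one_pow, one_mul, Nat.abs_cast]
    exact_mod_cast (by rw [Nat.choose_succ_succ]; omega : m.choose r ≤ (m + 1).choose (r + 1))

theorem abs_card_modEq_sub_le (H : ℕ) {m : ℕ} (hm : 1 ≤ m) (v : ℕ) :
    |(((range H).filter (fun y => y ≡ v [MOD m])).card : ℝ) - H / m| ≤ 1 := by
  rw [← Nat.count_eq_card_filter_range, Nat.count_modEq_card _ (by omega)]
  have hm0 : (0 : ℝ) < m := by exact_mod_cast hm
  have h1 : ((H / m : ℕ) : ℝ) ≤ H / m := Nat.cast_div_le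
  have h2 : (H : ℝ) / m ≤ (H / m : ℕ) + 1 := by
    rw [div_le_iff₀ hm0]
    exact_mod_cast (Nat.lt_mul_of_div_lt (Nat.lt_succ_self _) hm).le
  push_cast
  rw [abs_le]
  split_ifs <;> constructor <;> linarith

open scoped Classical in
/-- The residues modulo `p` satisfying the periodic condition `E p`. -/
def omegaSet (E : ℕ → ℕ → Prop) (p : ℕ) : Finset ℕ := (range p).filter (E p)

open scoped Classical in
theorem abs_card_crt_sub_le {E : ℕ → ℕ → Prop} (H : ℕ) (S : Finset ℕ)
    (hS : ∀ p ∈ S, p.Prime ∧ ∀ y, E p y ↔ E p (y % p)) :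
    ∀ m v : ℕ, 1 ≤ m → (∀ p ∈ S, m.Coprime p) →
    |(((range H).filter (fun y => y ≡ v [MOD m] ∧ ∀ p ∈ S, E p y)).card : ℝ) -
      H / m * ∏ p ∈ S, ((omegaSet E p).card : ℝ) / p| ≤ ∏ p ∈ S, ((omegaSet E p).card : ℝ) := by
  induction S using Finset.induction_on with
  | empty =>
    intro m v hm _
    simpa using abs_card_modEq_sub_le H hm v
  | insert p S hp ih =>
    intro m v hm hmS
    have ih' := ih fun q hq => hS q (mem_insert_of_mem hq)
    have hpp := (hS p (mem_insert_self p S)).1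
    have hper := (hS p (mem_insert_self p S)).2
    have hco : m.Coprime p := hmS p (mem_insert_self p S)
    have hp0 : (p : ℝ) ≠ 0 := by exact_mod_cast hpp.ne_zero
    let v' : ℕ → ℕ := fun r => (Nat.chineseRemainder hco v r : ℕ)
    have hsplit : (range H).filter (fun y => y ≡ v [MOD m] ∧ ∀ q ∈ insert p S, E q y) =
        (omegaSet E p).biUnion fun r => (range H).filter
          (fun y => y ≡ v' r [MOD m * p] ∧ ∀ q ∈ S, E q y) := by
      ext y
      simp only [mem_filter, mem_biUnion, omegaSet, mem_range, forall_mem_insert]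
      constructor
      · rintro ⟨hy, hv, hE, hES⟩
        refine ⟨y % p, ⟨Nat.mod_lt _ hpp.pos, (hper y).1 hE⟩, hy, ?_, hES⟩
        exact Nat.chineseRemainder_modEq_unique hco hv (Nat.mod_modEq y p).symm
      · rintro ⟨r, ⟨hr, hE⟩, hy, hv, hES⟩
        have h1 := (Nat.chineseRemainder hco v r).2
        refine ⟨hy, (hv.of_mul_right p).trans h1.1, ?_, hES⟩
        rw [hper, show y % p = r from ?_]
        · exact hE
        · have := (hv.of_mul_left m).trans h1.2
          rwa [Nat.ModEq, Nat.mod_eq_of_lt hr] at this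
    rw [hsplit, card_biUnion, prod_insert hp, prod_insert hp]
    · push_cast
      have hterm : ∀ r ∈ omegaSet E p, |(((range H).filter
          (fun y => y ≡ v' r [MOD m * p] ∧ ∀ q ∈ S, E q y)).card : ℝ) -
          H / ((m * p : ℕ) : ℝ) * ∏ q ∈ S, ((omegaSet E q).card : ℝ) / q| ≤
          ∏ q ∈ S, ((omegaSet E q).card : ℝ) := by
        intro r _
        refine ih' (m * p) (v' r) (Nat.mul_pos hm hpp.pos) fun q hq => ?_
        refine Nat.Coprime.mul_left (hmS q (mem_insert_of_mem hq)) ?_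
        refine (Nat.coprime_primes hpp (hS q (mem_insert_of_mem hq)).1).2 ?_
        rintro rfl
        exact hp hq
      refine le_trans (le_of_eq ?_) ((abs_sum_le_sum_abs _ _).trans
        ((sum_le_card_nsmul _ _ _ hterm).trans_eq (nsmul_eq_mul _ _)))
      rw [sum_sub_distrib, sum_const, nsmul_eq_mul]
      congr 2
      generalize ∏ q ∈ S, ((omegaSet E q).card : ℝ) / q = π
      generalize ((omegaSet E p).card : ℝ) = c
      have hm0 : (m : ℝ) ≠ 0 := by exact_mod_cast (by omega : m ≠ 0)
      rw [Nat.cast_mul]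
      field_simp
    · intro r hr r' hr' hne
      rw [Function.onFun, disjoint_left]
      intro y hy hy'
      have h1 := (mem_filter.1 hy).2.1.of_mul_left m
      have h2 := (mem_filter.1 hy').2.1.of_mul_left m
      have h3 := (Nat.chineseRemainder hco v r).2.2
      have h4 := (Nat.chineseRemainder hco v r').2.2
      have h5 : r ≡ r' [MOD p] := h3.symm.trans (h1.symm.trans (h2.trans h4))
      rw [Nat.ModEq, Nat.mod_eq_of_lt (mem_range.1 (mem_filter.1 hr).1),
        Nat.mod_eq_of_lt (mem_range.1 (mem_filter.1 hr').1)] at h5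
      exact hne h5

/-- Rankin's trick for sums over large sets. -/
theorem sum_prod_card_ge_le {P : Finset ℕ} {g : ℕ → ℝ} (hg : ∀ p ∈ P, 0 ≤ g p) (R : ℕ) :
    ∑ S ∈ P.powerset.filter (fun S => R ≤ S.card), ∏ p ∈ S, g p ≤
      Real.exp (3 * ∑ p ∈ P, g p - R) := by
  have h1 : ∑ S ∈ P.powerset.filter (fun S => R ≤ S.card), ∏ p ∈ S, g p ≤
      Real.exp (-R) * ∏ p ∈ P, (1 + Real.exp 1 * g p) := by
    rw [prod_one_add, mul_sum]
    refine le_trans (sum_le_sum fun S hS => ?_) (sum_le_sum_of_subset_of_nonneg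
      (filter_subset _ _) fun S hS _ => ?_)
    · have hSP := mem_powerset.1 (mem_filter.1 hS).1
      rw [prod_mul_distrib, prod_const, ← Real.exp_nat_mul, mul_one, ← mul_assoc, ← Real.exp_add]
      refine le_mul_of_one_le_left (prod_nonneg fun p hp => hg p (hSP hp)) (Real.one_le_exp ?_)
      have : (R : ℝ) ≤ S.card := by exact_mod_cast (mem_filter.1 hS).2
      linarith
    · refine mul_nonneg (Real.exp_pos _).le (prod_nonneg fun p hp => ?_)
      have := hg p (mem_powerset.1 hS hp)
      positivity
  refine h1.trans ?_
  have h2 : ∏ p ∈ P, (1 + Real.exp 1 * g p) ≤ Real.exp (3 * ∑ p ∈ P, g p) := by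
    rw [mul_sum, Real.exp_sum]
    refine prod_le_prod (fun p hp => ?_) fun p hp => ?_
    · have := hg p hp
      positivity
    · have h3 := Real.add_one_le_exp (3 * g p)
      have h4 := Real.exp_one_lt_d9
      have := hg p hp
      nlinarith
  calc _ ≤ Real.exp (-R) * Real.exp (3 * ∑ p ∈ P, g p) := by gcongr
    _ = _ := by
      rw [← Real.exp_add]
      ring_nf

/-- Rankin's trick for sums over small sets. -/
theorem sum_prod_card_le_le {P : Finset ℕ} {c : ℕ → ℝ} (hc : ∀ p ∈ P, 0 ≤ c p ∧ c p ≤ 2) (R : ℕ)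
    {Y : ℝ} (hY : 1 ≤ Y) (hPY : (P.card : ℝ) ≤ Y) :
    ∑ S ∈ P.powerset.filter (fun S => S.card ≤ R), ∏ p ∈ S, c p ≤ Real.exp 2 * Y ^ R := by
  have hY0 : 0 < Y := by linarith
  have h1 : ∑ S ∈ P.powerset.filter (fun S => S.card ≤ R), ∏ p ∈ S, c p ≤
      Y ^ R * ∏ p ∈ P, (1 + c p / Y) := by
    rw [prod_one_add, mul_sum]
    refine le_trans (sum_le_sum fun S hS => ?_) (sum_le_sum_of_subset_of_nonneg
      (filter_subset _ _) fun S hS _ => ?_)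
    · have hSP := mem_powerset.1 (mem_filter.1 hS).1
      rw [prod_div_distrib, prod_const, mul_div_assoc', le_div_iff₀ (by positivity), mul_comm]
      have := prod_nonneg fun p hp => (hc p (hSP hp)).1
      have := (mem_filter.1 hS).2
      gcongr
    · refine mul_nonneg (by positivity) (prod_nonneg fun p hp => ?_)
      exact div_nonneg (hc p (mem_powerset.1 hS hp)).1 hY0.le
  refine h1.trans ?_
  rw [mul_comm]
  gcongr
  calc ∏ p ∈ P, (1 + c p / Y) ≤ ∏ p ∈ P, Real.exp (2 / Y) := by
        refine prod_le_prod (fun p hp => ?_) fun p hp => ?_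
        · have := div_nonneg (hc p hp).1 hY0.le
          linarith
        · have h3 := Real.add_one_le_exp (2 / Y)
          have : c p / Y ≤ 2 / Y := by
            gcongr
            exact (hc p hp).2
          linarith
    _ = Real.exp (P.card * (2 / Y)) := by rw [prod_const, ← Real.exp_nat_mul]
    _ ≤ _ := by
        gcongr
        rw [mul_div_assoc', div_le_iff₀ hY0]
        linarith

open scoped Classical in
theorem abs_sieve_sub_le {E : ℕ → ℕ → Prop} (H : ℕ) {P : Finset ℕ}
    (hP : ∀ p ∈ P, p.Prime ∧ ∀ y, E p y ↔ E p (y % p))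
    (hΩ : ∀ p ∈ P, (omegaSet E p).card ≤ 2) {R : ℕ} (hR : 1 ≤ R) {Y : ℝ} (hY : 1 ≤ Y)
    (hPY : (P.card : ℝ) ≤ Y) :
    |(((range H).filter (fun y => ∀ p ∈ P, ¬ E p y)).card : ℝ) -
      H * ∏ p ∈ P, (1 - ((omegaSet E p).card : ℝ) / p)| ≤
      2 * H * Real.exp (6 * ∑ p ∈ P, (p : ℝ)⁻¹ - R) + Real.exp 2 * Y ^ R := by
  set c : ℕ → ℝ := fun p => ((omegaSet E p).card : ℝ) with hc
  set g : ℕ → ℝ := fun p => c p / p with hg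
  set cnt : Finset ℕ → ℝ := fun S => (((range H).filter (fun y => ∀ p ∈ S, E p y)).card : ℝ)
    with hcnt
  have hH : (0 : ℝ) ≤ H := Nat.cast_nonneg H
  have hg0 : ∀ p ∈ P, 0 ≤ g p := fun p _ => by positivity
  have hcntS : ∀ S ∈ P.powerset, |cnt S - H * ∏ p ∈ S, g p| ≤ ∏ p ∈ S, c p := by
    intro S hS
    have h := abs_card_crt_sub_le (E := E) H S (fun p hp => hP p (mem_powerset.1 hS hp)) 1 0 le_rfl
      fun p _ => Nat.coprime_one_left p
    simp only [Nat.modEq_one, true_and, Nat.cast_one, div_one] at h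
    exact h
  have hswap : ∀ (q : ℕ → Prop) [DecidablePred q] (s : ℕ → ℝ),
      ∑ y ∈ range H, ∑ S ∈ (P.filter (fun p => E p y)).powerset.filter (fun S => q S.card),
        s S.card = ∑ S ∈ P.powerset.filter (fun S => q S.card), s S.card * cnt S := by
    intro q _ s
    have h1 : ∀ y, (P.filter (fun p => E p y)).powerset.filter (fun S => q S.card) =
        (P.powerset.filter (fun S => q S.card)).filter (fun S => ∀ p ∈ S, E p y) := by
      intro y
      ext S
      simp only [mem_filter, mem_powerset, subset_iff]
      constructor
      · rintro ⟨h1, h2⟩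
        exact ⟨⟨fun p hp => (h1 hp).1, h2⟩, fun p hp => (h1 hp).2⟩
      · rintro ⟨⟨h1, h2⟩, h3⟩
        exact ⟨fun p hp => ⟨h1 hp, h3 p hp⟩, h2⟩
    simp_rw [h1, sum_filter (fun S : Finset ℕ => ∀ p ∈ S, E p _)]
    rw [sum_comm]
    refine sum_congr rfl fun S _ => ?_
    rw [← sum_filter, sum_const, nsmul_eq_mul, mul_comm]
  have h1 : |(((range H).filter (fun y => ∀ p ∈ P, ¬ E p y)).card : ℝ) -
      ∑ S ∈ P.powerset.filter (fun S => S.card < R), (-1 : ℝ) ^ S.card * cnt S| ≤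
      ∑ S ∈ P.powerset.filter (fun S => S.card = R), cnt S := by
    have e1 : (((range H).filter (fun y => ∀ p ∈ P, ¬ E p y)).card : ℝ) =
        ∑ y ∈ range H, if P.filter (fun p => E p y) = ∅ then (1 : ℝ) else 0 := by
      rw [card_eq_sum_ones, sum_filter]
      push_cast
      exact sum_congr rfl fun y _ => by simp only [filter_eq_empty_iff]
    have e2 := hswap (fun i => i < R) (fun i => (-1 : ℝ) ^ i)
    have e3 := hswap (fun i => i = R) (fun _ => (1 : ℝ))
    simp only [one_mul] at e3
    rw [e1, ← e2, ← e3, ← sum_sub_distrib]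
    refine (abs_sum_le_sum_abs _ _).trans (sum_le_sum fun y _ => ?_)
    refine (abs_bonferroni_le _ hR).trans (le_of_eq ?_)
    rw [sum_const, nsmul_one]
  have h2 : |∑ S ∈ P.powerset.filter (fun S => S.card < R), (-1 : ℝ) ^ S.card * cnt S -
      ∑ S ∈ P.powerset.filter (fun S => S.card < R), (-1 : ℝ) ^ S.card * (H * ∏ p ∈ S, g p)| ≤
      ∑ S ∈ P.powerset.filter (fun S => S.card < R), ∏ p ∈ S, c p := by
    rw [← sum_sub_distrib]
    refine (abs_sum_le_sum_abs _ _).trans (sum_le_sum fun S hS => ?_)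
    rw [← mul_sub, abs_mul, abs_pow, abs_neg, abs_one, one_pow, one_mul]
    exact hcntS S (mem_filter.1 hS).1
  have h3 : |∑ S ∈ P.powerset.filter (fun S => S.card < R), (-1 : ℝ) ^ S.card *
      (H * ∏ p ∈ S, g p) - H * ∏ p ∈ P, (1 - g p)| ≤
      H * ∑ S ∈ P.powerset.filter (fun S => R ≤ S.card), ∏ p ∈ S, g p := by
    have e1 : H * ∏ p ∈ P, (1 - g p) =
        ∑ S ∈ P.powerset, (-1 : ℝ) ^ S.card * (H * ∏ p ∈ S, g p) := by
      simp_rw [sub_eq_add_neg]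
      rw [prod_one_add, mul_sum]
      refine sum_congr rfl fun S _ => ?_
      rw [prod_neg]
      ring
    rw [e1, ← sum_filter_add_sum_filter_not P.powerset (fun S => S.card < R), sub_add_cancel_left,
      abs_neg, mul_sum]
    simp only [not_lt]
    refine (abs_sum_le_sum_abs _ _).trans (sum_le_sum fun S hS => ?_)
    rw [abs_mul, abs_pow, abs_neg, abs_one, one_pow, one_mul, abs_of_nonneg]
    exact mul_nonneg hH (prod_nonneg fun p hp =>
      hg0 p (mem_powerset.1 (mem_filter.1 hS).1 hp))
  have h4 : ∑ S ∈ P.powerset.filter (fun S => S.card = R), cnt S ≤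
      H * ∑ S ∈ P.powerset.filter (fun S => R ≤ S.card), ∏ p ∈ S, g p +
      ∑ S ∈ P.powerset.filter (fun S => S.card = R), ∏ p ∈ S, c p := by
    have e1 : ∑ S ∈ P.powerset.filter (fun S => S.card = R), ∏ p ∈ S, g p ≤
        ∑ S ∈ P.powerset.filter (fun S => R ≤ S.card), ∏ p ∈ S, g p := by
      refine sum_le_sum_of_subset_of_nonneg (fun S hS => ?_) fun S hS _ =>
        prod_nonneg fun p hp => hg0 p (mem_powerset.1 (mem_filter.1 hS).1 hp)
      exact mem_filter.2 ⟨(mem_filter.1 hS).1, (mem_filter.1 hS).2.ge⟩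
    refine le_trans ?_ (add_le_add_left (mul_le_mul_of_nonneg_left e1 hH) _)
    rw [mul_sum, ← sum_add_distrib]
    refine sum_le_sum fun S hS => ?_
    have := (abs_le.1 (hcntS S (mem_filter.1 hS).1)).2
    linarith
  have h5 : ∑ S ∈ P.powerset.filter (fun S => S.card < R), ∏ p ∈ S, c p +
      ∑ S ∈ P.powerset.filter (fun S => S.card = R), ∏ p ∈ S, c p =
      ∑ S ∈ P.powerset.filter (fun S => S.card ≤ R), ∏ p ∈ S, c p := by
    rw [← sum_union]
    · congr 1
      ext S
      simp only [mem_union, mem_filter, le_iff_lt_or_eq]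
      tauto
    · rw [disjoint_left]
      intro S hS hS'
      have h1 := (mem_filter.1 hS).2
      have h2 := (mem_filter.1 hS').2
      omega
  have h6 := sum_prod_card_le_le (P := P) (c := c)
    (fun p hp => ⟨Nat.cast_nonneg _, Nat.cast_le_ofNat.2 (hΩ p hp)⟩) R hY hPY
  have h7 : ∑ S ∈ P.powerset.filter (fun S => R ≤ S.card), ∏ p ∈ S, g p ≤
      Real.exp (6 * ∑ p ∈ P, (p : ℝ)⁻¹ - R) := by
    refine (sum_prod_card_ge_le hg0 R).trans (Real.exp_le_exp.2 (sub_le_sub_right ?_ _))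
    have : ∑ p ∈ P, g p ≤ ∑ p ∈ P, 2 * (p : ℝ)⁻¹ := by
      refine sum_le_sum fun p hp => ?_
      rw [← div_eq_mul_inv]
      exact div_le_div_of_nonneg_right (Nat.cast_le_ofNat.2 (hΩ p hp)) (Nat.cast_nonneg p)
    rw [← mul_sum] at this
    linarith
  have h8 := mul_le_mul_of_nonneg_left h7 hH
  have t := abs_le.1 h1
  have t2 := abs_le.1 h2
  have t3 := abs_le.1 h3
  rw [abs_le]
  constructor <;> linarith [t.1, t.2, t2.1, t2.2, t3.1, t3.2]

/-- The primes up to `w`. -/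
def primesTo (w : ℕ) : Finset ℕ := (Icc 1 w).filter Nat.Prime

theorem mem_primesTo {w p : ℕ} : p ∈ primesTo w ↔ p.Prime ∧ p ≤ w := by
  rw [primesTo, mem_filter, mem_Icc]
  exact ⟨fun h => ⟨h.2, h.1.2⟩, fun h => ⟨⟨h.1.pos, h.2⟩, h.1⟩⟩

theorem sum_inv_primesTo_le (w : ℕ) :
    ∑ p ∈ primesTo w, (p : ℝ)⁻¹ ≤ 6 + 6 * Real.log (1 + 2 * Real.log w) := by
  have hdy : ∀ J : ℕ, ∑ p ∈ primesTo (2 ^ (J + 1) - 1), (p : ℝ)⁻¹ ≤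
      6 * ∑ j ∈ Icc 1 J, (j : ℝ)⁻¹ := by
    intro J
    induction J with
    | zero => simp [primesTo, Nat.not_prime_one, filter_singleton]
    | succ J ih =>
      have hsub : primesTo (2 ^ (J + 1) - 1) ⊆ primesTo (2 ^ (J + 1 + 1) - 1) := by
        intro p
        rw [mem_primesTo, mem_primesTo]
        exact fun h => ⟨h.1, h.2.trans
          (Nat.sub_le_sub_right (Nat.pow_le_pow_right two_pos (Nat.le_succ _)) 1)⟩
      rw [← sum_sdiff hsub, sum_Icc_succ_top (by omega), mul_add, add_comm]
      refine add_le_add ih ?_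
      have hc0 : (0 : ℝ) < (J + 1 : ℕ) * Real.log 2 * 2 ^ (J + 1) := by
        have := Real.log_pos one_lt_two
        positivity
      have h1 : ∀ p ∈ primesTo (2 ^ (J + 1 + 1) - 1) \ primesTo (2 ^ (J + 1) - 1),
          (p : ℝ)⁻¹ ≤ primeLog p / ((J + 1 : ℕ) * Real.log 2 * 2 ^ (J + 1)) := by
        intro p hp
        rw [mem_sdiff, mem_primesTo, mem_primesTo] at hp
        have hp2 : 2 ^ (J + 1) ≤ p := by
          by_contra h
          exact hp.2 ⟨hp.1.1, by omega⟩
        have hp2' : (2 : ℝ) ^ (J + 1) ≤ p := by exact_mod_cast hp2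
        have h2 : ((J + 1 : ℕ) : ℝ) * Real.log 2 ≤ Real.log p := by
          rw [← Real.log_pow]
          exact Real.log_le_log (by positivity) hp2'
        have hp0 : (0 : ℝ) < p := by exact_mod_cast hp.1.1.pos
        rw [primeLog, if_pos hp.1.1, le_div_iff₀ hc0, inv_mul_le_iff₀ hp0, mul_comm]
        exact mul_le_mul hp2' h2 (by positivity) hp0.le
      refine (sum_le_sum h1).trans ?_
      rw [← sum_div, div_le_iff₀ hc0]
      have h2 : ∑ p ∈ primesTo (2 ^ (J + 1 + 1) - 1) \ primesTo (2 ^ (J + 1) - 1), primeLog p ≤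
          2 * ((2 ^ (J + 1 + 1) : ℕ) : ℝ) := by
        refine le_trans (sum_le_sum_of_subset_of_nonneg (fun p hp => ?_)
          fun p _ _ => primeLog_nonneg p) (sum_primeLog_le _)
        rw [mem_sdiff, mem_primesTo] at hp
        exact mem_Icc.2 ⟨hp.1.1.pos, hp.1.2.trans (Nat.sub_le _ _)⟩
      refine h2.trans ?_
      have h3 := Real.log_two_gt_d9
      have h4 : (0 : ℝ) < (J + 1 : ℕ) := by positivity
      have h5 : (0 : ℝ) < 2 ^ (J + 1) := by positivity
      calc 2 * ((2 ^ (J + 1 + 1) : ℕ) : ℝ) = 4 * 2 ^ (J + 1) := by push_cast; ring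
        _ ≤ 6 * Real.log 2 * 2 ^ (J + 1) := by gcongr; linarith
        _ = _ := by field_simp
  rcases Nat.eq_zero_or_pos w with rfl | hw
  · simp [primesTo]
  set J := Nat.log 2 w with hJ
  have hwJ : w < 2 ^ (J + 1) := Nat.lt_pow_succ_log_self one_lt_two w
  have hJw : (J : ℝ) * Real.log 2 ≤ Real.log w := by
    rw [← Real.log_pow]
    refine Real.log_le_log (by positivity) ?_
    exact_mod_cast Nat.pow_log_le_self 2 (by omega)
  have hlogw := Real.log_natCast_nonneg w
  calc ∑ p ∈ primesTo w, (p : ℝ)⁻¹ ≤ ∑ p ∈ primesTo (2 ^ (J + 1) - 1), (p : ℝ)⁻¹ := by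
        refine sum_le_sum_of_subset_of_nonneg (fun p hp => ?_) fun _ _ _ => by positivity
        rw [mem_primesTo] at *
        exact ⟨hp.1, by omega⟩
    _ ≤ 6 * (1 + Real.log J) := (hdy J).trans (by linarith [sum_inv_le_one_add_log J])
    _ ≤ _ := by
        have : Real.log J ≤ Real.log (1 + 2 * Real.log w) := by
          rcases Nat.eq_zero_or_pos J with h0 | h0
          · rw [h0, Nat.cast_zero, Real.log_zero]
            exact Real.log_nonneg (by linarith)
          · refine Real.log_le_log (by exact_mod_cast h0) ?_
            have := Real.log_two_gt_d9
            nlinarith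
        linarith

/-- The sifting level. -/
def level (B n : ℕ) : ℕ := ⌊Real.log n ^ B⌋₊

theorem level_le (B n : ℕ) : (level B n : ℝ) ≤ Real.log n ^ B :=
  Nat.floor_le (pow_nonneg (Real.log_natCast_nonneg n) B)

open Filter in
theorem sieve_params (A B : ℕ) : ∃ N : ℕ, ∀ n ≥ N, 4 ≤ Real.log n ∧
    Real.exp (6 * ∑ p ∈ primesTo (level B n), (p : ℝ)⁻¹) ≤ Real.log n ∧
    ∃ R : ℕ, 1 ≤ R ∧
      2 * Real.exp (6 * ∑ p ∈ primesTo (level B n), (p : ℝ)⁻¹ - R) * Real.log n ^ A ≤ 1 ∧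
      Real.exp 2 * (Real.log n ^ B) ^ R ≤ (n : ℝ) ^ (1 / 10 : ℝ) := by
  have t1 : Tendsto (fun n : ℕ => Real.log n) atTop atTop :=
    Real.tendsto_log_atTop.comp tendsto_natCast_atTop_atTop
  have t2 : Tendsto (fun n : ℕ => Real.log (Real.log n)) atTop atTop :=
    Real.tendsto_log_atTop.comp t1
  have e1 : ∀ᶠ y : ℝ in atTop, 36 + 36 * Real.log (1 + 2 * (B * y)) ≤ y := by
    have h1 : Tendsto (fun y : ℝ => 1 + 2 * ((B + 1 : ℝ) * y)) atTop atTop :=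
      tendsto_atTop_add_const_left _ _ ((tendsto_id.const_mul_atTop (by positivity)).const_mul_atTop
        two_pos)
    have h2 := (Real.isLittleO_log_id_atTop.comp_tendsto h1).bound
      (c := 1 / (36 * 8 * (B + 1))) (by positivity)
    filter_upwards [h2, eventually_ge_atTop (72 : ℝ)] with y hy hy1
    simp only [Function.comp_apply, id, Real.norm_eq_abs] at hy
    have hB : (0 : ℝ) ≤ B := Nat.cast_nonneg B
    have h3 := (le_abs_self _).trans hy
    rw [abs_of_nonneg (by positivity), one_div_mul_eq_div, le_div_iff₀ (by positivity)] at h3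
    have h4 : Real.log (1 + 2 * (B * y)) ≤ Real.log (1 + 2 * ((B + 1) * y)) := by
      apply Real.log_le_log (by positivity)
      gcongr
      linarith
    have h5 : 0 ≤ Real.log (1 + 2 * ((B + 1) * y)) := Real.log_nonneg (by
      have : 0 ≤ (B + 1) * y := by positivity
      linarith)
    have h6 : 36 * 8 * Real.log (1 + 2 * ((B + 1) * y)) * (B + 1) ≤ (4 * y) * (B + 1) := by
      nlinarith
    have h7 := le_of_mul_le_mul_right h6 (by positivity)
    linarith
  have e2 : ∀ᶠ y : ℝ in atTop, 2 + ((A + 2) * y + 1) * (B * y) ≤ Real.exp y / 10 := by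
    have h1 := (Real.isLittleO_pow_exp_atTop (n := 2)).bound
      (c := 1 / (10 * (2 + (A + 3) * B))) (by positivity)
    filter_upwards [h1, eventually_ge_atTop (1 : ℝ)] with y hy hy1
    rw [Real.norm_of_nonneg (by positivity), Real.norm_of_nonneg (by positivity),
      one_div_mul_eq_div, le_div_iff₀ (by positivity)] at hy
    have hB : (0 : ℝ) ≤ B := Nat.cast_nonneg B
    have hA : (0 : ℝ) ≤ A := Nat.cast_nonneg A
    have h2 : (2 : ℝ) ≤ 2 * y ^ 2 := by nlinarith
    have h3 : ((A + 2) * y + 1) * (B * y) ≤ ((A + 3) * y) * (B * y) := by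
      gcongr
      linarith
    have : (10 : ℝ) * (2 * y ^ 2 + ((A + 3) * y) * (B * y)) ≤ Real.exp y := by
      linarith
    linarith
  obtain ⟨N, hN⟩ := eventually_atTop.1 (((t2.eventually e1).and (t2.eventually e2)).and
    ((t1.eventually (eventually_ge_atTop 4)).and (t2.eventually (eventually_ge_atTop 1))))
  refine ⟨N, fun n hn => ?_⟩
  obtain ⟨⟨h1, h2⟩, h4, h3⟩ := hN n hn
  set x := Real.log n with hx
  set y := Real.log x with hy
  have hx0 : 0 < x := by linarith
  have hexp : Real.exp y = x := Real.exp_log hx0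
  have hxB : x ^ B = Real.exp (B * y) := by rw [Real.exp_nat_mul, hexp]
  have hn0 : (0 : ℝ) < n := by
    rcases Nat.eq_zero_or_pos n with h0 | h0
    · rw [hx, h0, Nat.cast_zero, Real.log_zero] at hx0
      exact absurd hx0 (lt_irrefl _)
    · exact_mod_cast h0
  have hlogw : Real.log (level B n) ≤ B * y := by
    rcases Nat.eq_zero_or_pos (level B n) with h0 | h0
    · rw [h0, Nat.cast_zero, Real.log_zero]
      positivity
    · rw [hy, ← Real.log_pow]
      exact Real.log_le_log (by exact_mod_cast h0) (level_le B n)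
  have hsum : 6 * ∑ p ∈ primesTo (level B n), (p : ℝ)⁻¹ ≤ y := by
    have := sum_inv_primesTo_le (level B n)
    have h5 : Real.log (1 + 2 * Real.log (level B n)) ≤ Real.log (1 + 2 * (B * y)) := by
      apply Real.log_le_log
      · have := Real.log_natCast_nonneg (level B n)
        linarith
      · linarith
    linarith
  refine ⟨h4, (Real.exp_le_exp.2 hsum).trans_eq hexp, ⌈(A + 2) * y⌉₊, ?_, ?_, ?_⟩
  · exact Nat.one_le_ceil_iff.2 (by positivity)
  · have hR : (A + 2) * y ≤ ⌈(A + 2) * y⌉₊ := Nat.le_ceil _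
    calc _ ≤ 2 * Real.exp (y - (A + 2) * y) * x ^ A := by
          gcongr
      _ = 2 * Real.exp (-y) := by
          rw [← hexp, ← Real.exp_nat_mul, mul_assoc, ← Real.exp_add]
          ring_nf
      _ ≤ 1 := by
          rw [Real.exp_neg, hexp, ← div_eq_mul_inv, div_le_one hx0]
          linarith
  · rw [hxB, ← Real.exp_nat_mul, ← Real.exp_add, Real.rpow_def_of_pos hn0, Real.exp_le_exp]
    have hR : (⌈(A + 2) * y⌉₊ : ℝ) ≤ (A + 2) * y + 1 := (Nat.ceil_lt_add_one (by positivity)).le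
    calc _ ≤ 2 + ((A + 2) * y + 1) * (B * y) := by gcongr
      _ ≤ _ := h2.trans (by rw [hexp, ← hx]; linarith)

theorem card_primesTo_le (w : ℕ) : (primesTo w).card ≤ w := by
  refine (card_filter_le _ _).trans ?_
  simp

open scoped Classical in
theorem sieve_count (A B : ℕ) : ∃ N : ℕ, ∀ n ≥ N, ∀ (E : ℕ → ℕ → Prop) (P : Finset ℕ),
    P ⊆ primesTo (level B n) → (∀ p ∈ P, ∀ y, E p y ↔ E p (y % p)) →
    (∀ p ∈ P, (omegaSet E p).card ≤ 2) → ∀ H : ℕ,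
    |(((range H).filter (fun y => ∀ p ∈ P, ¬ E p y)).card : ℝ) -
      H * ∏ p ∈ P, (1 - ((omegaSet E p).card : ℝ) / p)| ≤
      H / Real.log n ^ A + (n : ℝ) ^ (1 / 10 : ℝ) := by
  obtain ⟨N, hN⟩ := sieve_params A B
  refine ⟨N, fun n hn E P hP hper hΩ H => ?_⟩
  obtain ⟨h4, -, R, hR, h1, h2⟩ := hN n hn
  have hY : 1 ≤ Real.log n ^ B := one_le_pow₀ (by linarith)
  have hcard : (P.card : ℝ) ≤ Real.log n ^ B := by
    refine le_trans ?_ (level_le B n)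
    exact_mod_cast (card_le_card hP).trans (card_primesTo_le _)
  refine (abs_sieve_sub_le H (fun p hp => ⟨(mem_primesTo.1 (hP hp)).1, hper p hp⟩) hΩ hR hY
    hcard).trans (add_le_add ?_ h2)
  have hL : 0 < Real.log n ^ A := by positivity
  rw [le_div_iff₀ hL]
  have h3 : ∑ p ∈ P, (p : ℝ)⁻¹ ≤ ∑ p ∈ primesTo (level B n), (p : ℝ)⁻¹ :=
    sum_le_sum_of_subset_of_nonneg hP fun _ _ _ => by positivity
  calc _ ≤ 2 * H * Real.exp (6 * ∑ p ∈ primesTo (level B n), (p : ℝ)⁻¹ - R) * Real.log n ^ A := by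
        gcongr
    _ = H * (2 * Real.exp (6 * ∑ p ∈ primesTo (level B n), (p : ℝ)⁻¹ - R) * Real.log n ^ A) := by
        ring
    _ ≤ H * 1 := by gcongr
    _ = H := mul_one _

theorem prod_one_sub_ge_exp {P : Finset ℕ} (hP : ∀ p ∈ P, p.Prime) {c : ℕ → ℕ}
    (hc : ∀ p ∈ P, c p ≤ 2) (hc2 : 2 ∈ P → c 2 ≤ 1) :
    Real.exp (-(6 * ∑ p ∈ P, (p : ℝ)⁻¹)) ≤ ∏ p ∈ P, (1 - (c p : ℝ) / p) := by
  rw [mul_sum, ← sum_neg_distrib, Real.exp_sum]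
  refine prod_le_prod (fun _ _ => (Real.exp_pos _).le) fun p hp => ?_
  have hp2 := (hP p hp).two_le
  have hcp : (c p : ℝ) * p ≤ 6 * (p - c p) ∧ (c p : ℝ) < p := by
    rcases hp2.eq_or_lt with h2 | h2
    · have : (c p : ℝ) ≤ 1 := by
        rw [← h2]
        exact_mod_cast hc2 (h2 ▸ hp)
      rw [← h2] at this ⊢
      constructor <;> push_cast <;> linarith
    · have h3 : (3 : ℝ) ≤ p := by exact_mod_cast h2
      have : (c p : ℝ) ≤ 2 := by exact_mod_cast hc p hp
      constructor
      · nlinarith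
      · linarith
  have hp0 : (0 : ℝ) < p := by exact_mod_cast (hP p hp).pos
  have hu : 0 < 1 - (c p : ℝ) / p := by
    rw [sub_pos, div_lt_one hp0]
    exact hcp.2
  rw [← Real.le_log_iff_exp_le hu]
  refine le_trans ?_ (Real.one_sub_inv_le_log_of_pos hu)
  have h4 : 0 < (p : ℝ) - c p := by linarith [hcp.2]
  have h5 : 1 - (1 - (c p : ℝ) / p)⁻¹ = -(c p / (p - c p)) := by
    rw [one_sub_div hp0.ne', inv_div]
    field_simp
    ring
  rw [h5, neg_le_neg_iff, div_le_iff₀ h4, ← div_eq_mul_inv, div_mul_eq_mul_div, le_div_iff₀ hp0]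
  exact hcp.1

theorem card_omegaSet_linear {p k : ℕ} (hp : p.Prime) (hk : ¬ p ∣ k) (c : ℕ) :
    (omegaSet (fun p x => p ∣ c + k * x) p).card = 1 := by
  have := Fact.mk hp
  have hk' : (k : ZMod p) ≠ 0 := by rwa [Ne, ZMod.natCast_eq_zero_iff]
  refine card_eq_one.2 ⟨(-(c : ZMod p) * (k : ZMod p)⁻¹).val, ?_⟩
  ext x
  simp only [omegaSet, mem_filter, mem_range, mem_singleton, ← ZMod.natCast_eq_zero_iff]
  push_cast
  constructor
  · rintro ⟨hx, h⟩
    have : (x : ZMod p) = -c * (k : ZMod p)⁻¹ := by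
      field_simp
      linear_combination h
    rw [← this, ZMod.val_cast_of_lt hx]
  · rintro rfl
    refine ⟨ZMod.val_lt _, ?_⟩
    rw [ZMod.natCast_zmod_val]
    field_simp
    ring

theorem card_omegaSet_linear_eq_zero {p k c : ℕ} (hk : p ∣ k) (hc : ¬ p ∣ c) :
    (omegaSet (fun p x => p ∣ c + k * x) p).card = 0 := by
  refine card_eq_zero.2 (eq_empty_of_forall_notMem fun x h => ?_)
  simp only [omegaSet, mem_filter] at h
  replace h := h.2
  exact hc ((Nat.dvd_add_left (hk.mul_right x)).1 h)

theorem dvd_linear_iff_mod (c k p y : ℕ) : p ∣ c + k * y ↔ p ∣ c + k * (y % p) := by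
  rw [← Nat.modEq_zero_iff_dvd, ← Nat.modEq_zero_iff_dvd]
  have h : c + k * y ≡ c + k * (y % p) [MOD p] :=
    (Nat.ModEq.rfl).add ((Nat.ModEq.rfl).mul (Nat.mod_modEq y p).symm)
  exact ⟨h.symm.trans, h.trans⟩

theorem exists_le_log (C : ℝ) : ∃ N : ℕ, ∀ n ≥ N, C ≤ Real.log n :=
  Filter.eventually_atTop.1
    ((Real.tendsto_log_atTop.comp tendsto_natCast_atTop_atTop).eventually_ge_atTop C)

theorem log_pow_mul_rpow_le (j : ℕ) {δ : ℝ} (hδ : δ < 1) :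
    ∃ N : ℕ, ∀ n ≥ N, Real.log n ^ j * (n : ℝ) ^ δ ≤ n := by
  obtain ⟨C, hC, h⟩ := log_pow_le_mul_rpow (j + 1) (sub_pos.2 hδ)
  obtain ⟨N, hN⟩ := exists_le_log C
  refine ⟨max N 1, fun n hn => ?_⟩
  have hn1 : (1 : ℝ) ≤ n := by exact_mod_cast (le_max_right _ _).trans hn
  have hL := hN n ((le_max_left _ _).trans hn)
  have h1 := h n hn1
  have h2 : Real.log n ^ j ≤ (n : ℝ) ^ (1 - δ) := by
    refine le_of_mul_le_mul_left ?_ (by linarith : 0 < C)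
    refine le_trans ?_ h1
    rw [pow_succ']
    have : 0 ≤ Real.log n := by linarith
    gcongr
  calc _ ≤ (n : ℝ) ^ (1 - δ) * (n : ℝ) ^ δ := by gcongr
    _ = n := by rw [← Real.rpow_add (by linarith), sub_add_cancel, Real.rpow_one]

/-- The density of the integers free of prime factors up to `w`. -/
def sieveProd (w : ℕ) : ℝ := ∏ p ∈ primesTo w, (1 - (p : ℝ)⁻¹)

/-- The sieve model of the weighted indicator of the primes. -/
def model (w m : ℕ) : ℝ := if ∀ p ∈ primesTo w, ¬ p ∣ m then (sieveProd w)⁻¹ else 0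

theorem exp_le_sieveProd (w : ℕ) :
    Real.exp (-(6 * ∑ p ∈ primesTo w, (p : ℝ)⁻¹)) ≤ sieveProd w := by
  have := prod_one_sub_ge_exp (P := primesTo w) (fun p hp => (mem_primesTo.1 hp).1)
    (c := fun _ => 1) (fun _ _ => one_le_two) (fun _ => le_rfl)
  simpa [sieveProd] using this

theorem sieveProd_pos (w : ℕ) : 0 < sieveProd w := (Real.exp_pos _).trans_le (exp_le_sieveProd w)

theorem inv_sieveProd_le {w : ℕ} {L : ℝ}
    (h : Real.exp (6 * ∑ p ∈ primesTo w, (p : ℝ)⁻¹) ≤ L) : (sieveProd w)⁻¹ ≤ L := by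
  refine le_trans ?_ h
  rw [← inv_inv (Real.exp _), ← Real.exp_neg]
  exact inv_anti₀ (Real.exp_pos _) (exp_le_sieveProd w)

theorem model_nonneg (w m : ℕ) : 0 ≤ model w m := by
  have := sieveProd_pos w
  unfold model
  split_ifs <;> positivity

theorem model_le (w m : ℕ) : model w m ≤ (sieveProd w)⁻¹ := by
  have := sieveProd_pos w
  unfold model
  split_ifs
  · exact le_rfl
  · positivity

theorem prod_sieve_coprime {w q : ℕ} (hq : q ≠ 0) (hqw : q ≤ w) :
    ∏ p ∈ primesTo w, (1 - (if p ∣ q then (0 : ℝ) else 1) / p) =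
      sieveProd w * (q / q.totient) := by
  have hsub : q.primeFactors ⊆ primesTo w := fun p hp =>
    mem_primesTo.2 ⟨Nat.prime_of_mem_primeFactors hp,
      (Nat.le_of_mem_primeFactors hp).trans hqw⟩
  have hφ : (q.totient : ℝ) = q * ∏ p ∈ q.primeFactors, (1 - (p : ℝ)⁻¹) := by
    have := Nat.totient_eq_mul_prod_factors q
    have h2 := congrArg (fun x : ℚ => (x : ℝ)) this
    push_cast at h2
    exact h2
  have hprod : 0 < ∏ p ∈ q.primeFactors, (1 - (p : ℝ)⁻¹) := by
    refine prod_pos fun p hp => ?_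
    have : (1 : ℝ) < p := by exact_mod_cast (Nat.prime_of_mem_primeFactors hp).one_lt
    rw [sub_pos]
    exact inv_lt_one_of_one_lt₀ this
  have hq0 : (q : ℝ) ≠ 0 := by exact_mod_cast hq
  rw [sieveProd, ← prod_sdiff hsub, ← prod_sdiff hsub, hφ]
  have h1 : ∏ p ∈ q.primeFactors, (1 - (if p ∣ q then (0 : ℝ) else 1) / p) = 1 :=
    prod_eq_one fun p hp => by rw [if_pos (Nat.dvd_of_mem_primeFactors hp), zero_div, sub_zero]
  have h2 : ∏ p ∈ primesTo w \ q.primeFactors, (1 - (if p ∣ q then (0 : ℝ) else 1) / p) =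
      ∏ p ∈ primesTo w \ q.primeFactors, (1 - (p : ℝ)⁻¹) := by
    refine prod_congr rfl fun p hp => ?_
    rw [mem_sdiff, mem_primesTo] at hp
    rw [if_neg fun h => hp.2 (Nat.mem_primeFactors.2 ⟨hp.1.1, h, hq⟩), one_div]
  rw [h1, h2]
  generalize ∏ p ∈ q.primeFactors, (1 - (p : ℝ)⁻¹) = X at *
  field_simp

theorem sum_model_residue_eq {w q a y : ℕ} (hw : 2 ≤ w) (hq : q ≠ 0) :
    ∑ m ∈ Icc 1 y with m % q = a % q, model w m =
      (sieveProd w)⁻¹ * (((range ((y + q - a % q) / q)).filter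
        (fun x => ∀ p ∈ primesTo w, ¬ p ∣ a % q + q * x)).card : ℝ) := by
  have hlt : a % q < q := Nat.mod_lt _ (Nat.pos_of_ne_zero hq)
  simp only [model]
  rw [← sum_filter, sum_const, nsmul_eq_mul, mul_comm]
  congr 2
  symm
  refine card_nbij' (fun x => a % q + q * x) (fun m => m / q) ?_ ?_ ?_ ?_
  · intro x hx
    simp only [coe_filter, mem_range, Set.mem_ofPred_eq, mem_filter, mem_Icc] at hx ⊢
    refine ⟨⟨⟨?_, ?_⟩, ?_⟩, hx.2⟩
    · rcases Nat.eq_zero_or_pos (a % q + q * x) with h | h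
      · exact absurd (h ▸ dvd_zero 2) (hx.2 2 (mem_primesTo.2 ⟨Nat.prime_two, hw⟩))
      · exact h
    · have h1 := (Nat.le_div_iff_mul_le (Nat.pos_of_ne_zero hq)).1 (Nat.succ_le_of_lt hx.1)
      have : (x + 1) * q = q * x + q := by ring
      rw [Nat.succ_eq_add_one, this] at h1
      omega
    · rw [Nat.add_mul_mod_self_left, Nat.mod_mod]
  · intro m hm
    simp only [coe_filter, mem_range, Set.mem_ofPred_eq, mem_filter, mem_Icc] at hm ⊢
    have h1 : a % q + q * (m / q) = m := by rw [← hm.1.2, Nat.mod_add_div]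
    refine ⟨?_, by rw [h1]; exact hm.2⟩
    rw [Nat.lt_iff_add_one_le, Nat.le_div_iff_mul_le (Nat.pos_of_ne_zero hq)]
    have : (m / q + 1) * q = q * (m / q) + q := by ring
    omega
  · intro x _
    simp only
    rw [Nat.add_mul_div_left _ _ (Nat.pos_of_ne_zero hq), Nat.div_eq_of_lt hlt, zero_add]
  · intro m hm
    simp only [coe_filter, Set.mem_ofPred_eq, mem_filter] at hm
    simp only
    rw [← hm.1.2, Nat.mod_add_div]

theorem le_level {B n q : ℕ} (h : (q : ℝ) ≤ Real.log n ^ B) : q ≤ level B n := Nat.le_floor h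

theorem two_le_level {B n : ℕ} (hB : 1 ≤ B) (hL : 4 ≤ Real.log n) : 2 ≤ level B n := by
  refine le_level ?_
  have : Real.log n ^ 1 ≤ Real.log n ^ B := pow_le_pow_right₀ (by linarith) hB
  push_cast
  linarith

theorem model_residue (j B : ℕ) (hB : 1 ≤ B) : ∃ N : ℕ, ∀ n ≥ N, ∀ q : ℕ, q ≠ 0 →
    (q : ℝ) ≤ Real.log n ^ B → ∀ a : ℕ, a.Coprime q → ∀ y ≤ n,
      |∑ m ∈ Icc 1 y with m % q = a % q, model (level B n) m - y / q.totient| * Real.log n ^ j ≤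
        n := by
  obtain ⟨N1, h1⟩ := sieve_count (j + 2) B
  obtain ⟨N2, h2⟩ := sieve_params 0 B
  obtain ⟨N3, h3⟩ := log_pow_mul_rpow_le (j + 2) (δ := 1 / 10) (by norm_num)
  obtain ⟨N4, h4⟩ := log_pow_mul_rpow_le (j + B + 1) (δ := 0) (by norm_num)
  refine ⟨max (max N1 N2) (max N3 N4), fun n hn q hq hqB a ha y hy => ?_⟩
  simp only [ge_iff_le, max_le_iff] at hn
  obtain ⟨hL, hV, -⟩ := h2 n hn.1.2
  replace h3 := h3 n hn.2.1
  replace h4 := h4 n hn.2.2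
  rw [Real.rpow_zero, mul_one] at h4
  have hVinv := inv_sieveProd_le hV
  have hq0 : 0 < q := Nat.pos_of_ne_zero hq
  have hqw := le_level hqB
  have hlt : a % q < q := Nat.mod_lt _ hq0
  have hac : (a % q).Coprime q := by rwa [Nat.Coprime, ← Nat.gcd_rec, Nat.gcd_comm]
  have hω : ∀ p ∈ primesTo (level B n),
      (((omegaSet (fun p x => p ∣ a % q + q * x) p).card : ℕ) : ℝ) = if p ∣ q then 0 else 1 := by
    intro p hp
    split_ifs with hpq
    · rw [card_omegaSet_linear_eq_zero hpq, Nat.cast_zero]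
      exact fun h => (mem_primesTo.1 hp).1.one_lt.ne' (Nat.dvd_one.1 (hac ▸ Nat.dvd_gcd h hpq))
    · rw [card_omegaSet_linear (mem_primesTo.1 hp).1 hpq, Nat.cast_one]
  have key := h1 n hn.1.1 (fun p x => p ∣ a % q + q * x) (primesTo (level B n)) subset_rfl
    (fun p _ y => dvd_linear_iff_mod _ _ _ _) (fun p hp => by
      have := hω p hp
      have h5 : (((omegaSet (fun p x => p ∣ a % q + q * x) p).card : ℕ) : ℝ) ≤ 2 := by
        rw [this]
        split_ifs <;> norm_num
      exact_mod_cast h5) ((y + q - a % q) / q)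
  rw [prod_congr rfl fun p hp => by rw [hω p hp], prod_sieve_coprime hq hqw] at key
  rw [sum_model_residue_eq (two_le_level hB hL) hq]
  have hH : |(((y + q - a % q) / q : ℕ) : ℝ) - y / q| ≤ 1 := by
    have e1 := Nat.div_add_mod (y + q - a % q) q
    have e2 := Nat.mod_lt (y + q - a % q) hq0
    have hq' : (0 : ℝ) < q := by exact_mod_cast hq0
    rw [abs_le, neg_le_sub_iff_le_add, sub_le_iff_le_add, div_le_iff₀ hq', ← sub_le_iff_le_add',
      le_div_iff₀ hq', sub_mul, add_mul, sub_le_iff_le_add]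
    generalize (y + q - a % q) / q = H at *
    have e3 : q * H = H * q := mul_comm _ _
    constructor
    · exact_mod_cast (by omega : y ≤ H * q + 1 * q)
    · exact_mod_cast (by omega : H * q ≤ y + 1 * q)
  generalize hX : ((filter (fun x => ∀ p ∈ primesTo (level B n), ¬ p ∣ a % q + q * x)
      (range ((y + q - a % q) / q))).card : ℝ) = X
  replace key : |X - ((y + q - a % q) / q : ℕ) * (sieveProd (level B n) * (q / q.totient))| ≤
      ((y + q - a % q) / q : ℕ) / Real.log n ^ (j + 2) + (n : ℝ) ^ (1 / 10 : ℝ) := by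
    rw [← hX]
    convert key
  clear hX
  generalize (((y + q - a % q) / q : ℕ) : ℝ) = H at key hH
  have hVpos := sieveProd_pos (level B n)
  generalize sieveProd (level B n) = V at *
  set L := Real.log n with hLdef
  have hφ : (1 : ℝ) ≤ q.totient := by exact_mod_cast Nat.totient_pos.2 hq0
  have hqr : (1 : ℝ) ≤ q := by exact_mod_cast hq0
  have hyn : (y : ℝ) ≤ n := by exact_mod_cast hy
  have hHle : H ≤ 2 * n := by
    have : (y : ℝ) / q ≤ y := div_le_self (by positivity) hqr
    have : (1 : ℝ) ≤ n := by
      by_contra h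
      have h0 : n = 0 := by
        have : (n : ℝ) < 1 := by linarith
        exact_mod_cast Nat.lt_one_iff.1 (by exact_mod_cast this)
      rw [hLdef, h0, Nat.cast_zero, Real.log_zero] at hL
      linarith
    linarith [(abs_le.1 hH).2]
  have e1 : V⁻¹ * X - y / q.totient =
      V⁻¹ * (X - H * (V * (q / q.totient))) + (H - y / q) * (q / q.totient) := by
    field_simp
    ring
  have hL0 : 0 < L := by linarith
  have e2 : |V⁻¹ * X - y / q.totient| ≤ L * (2 * n / L ^ (j + 2) + n ^ (1 / 10 : ℝ)) + L ^ B := by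
    rw [e1]
    refine (abs_add_le _ _).trans (add_le_add ?_ ?_)
    · rw [abs_mul, abs_of_pos (inv_pos.2 hVpos)]
      refine mul_le_mul hVinv (key.trans ?_) (abs_nonneg _) hL0.le
      gcongr
    · rw [abs_mul, abs_of_nonneg (by positivity : (0 : ℝ) ≤ q / q.totient)]
      calc _ ≤ 1 * (q : ℝ) := by
            gcongr
            exact div_le_self (by positivity) hφ
        _ ≤ _ := by linarith
  calc _ ≤ (L * (2 * n / L ^ (j + 2) + n ^ (1 / 10 : ℝ)) + L ^ B) * L ^ j := by gcongr
    _ = (2 * n + L ^ (j + 2) * (n : ℝ) ^ (1 / 10 : ℝ) + L ^ (j + B + 1)) / L := by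
        field_simp
        ring
    _ ≤ n := by
        rw [div_le_iff₀ hL0]
        have : (n : ℝ) * 4 ≤ n * L := by gcongr
        linarith

theorem sum_Icc_dvd {M : Type*} [AddCommMonoid M] {d : ℕ} (hd : 0 < d) (n : ℕ) (f : ℕ → M) :
    ∑ m ∈ Icc 1 n, (if d ∣ m then f m else 0) = ∑ k ∈ Icc 1 (n / d), f (d * k) := by
  rw [← sum_filter]
  symm
  refine sum_nbij' (fun k => d * k) (fun m => m / d) ?_ ?_ ?_ ?_ fun _ _ => rfl
  · intro k hk
    rw [mem_Icc, Nat.le_div_iff_mul_le hd] at hk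
    rw [mem_filter, mem_Icc]
    exact ⟨⟨Nat.mul_pos hd hk.1, by rw [mul_comm]; exact hk.2⟩, dvd_mul_right _ _⟩
  · intro m hm
    rw [mem_filter, mem_Icc] at hm
    exact mem_Icc.2 ⟨Nat.div_pos (Nat.le_of_dvd hm.1.1 hm.2) hd, Nat.div_le_div_right hm.1.2⟩
  · intro k _
    exact Nat.mul_div_cancel_left k hd
  · intro m hm
    exact Nat.mul_div_cancel' (mem_filter.1 hm).2

theorem prod_dvd_iff_subset {P S : Finset ℕ} (hP : ∀ p ∈ P, p.Prime) (hS : S ⊆ P) (m : ℕ) :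
    ∏ p ∈ S, p ∣ m ↔ S ⊆ P.filter (· ∣ m) := by
  constructor
  · exact fun h p hp => mem_filter.2 ⟨hS hp, (dvd_prod_of_mem _ hp).trans h⟩
  · exact fun h => prod_primes_dvd m (fun p hp => (hP p (hS hp)).prime)
      fun p hp => (mem_filter.1 (h hp)).2

theorem exists_sieve_coeff {w R K : ℕ} (n : ℕ) (hw : 1 ≤ w) (hR : 1 ≤ R) (hK : w ^ R ≤ K) :
    ∃ c : ℕ → ℂ, (∀ d, ‖c d‖ ≤ 1) ∧ ∀ α : ℝ,
      ‖∑ m ∈ Icc 1 n, (if ∀ p ∈ primesTo w, ¬ p ∣ m then 1 else 0) * e (α * m) -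
        ∑ d ∈ Icc 1 K, c d * ∑ k ∈ Icc 1 (n / d), e (α * (d * k))‖ ≤
      n * Real.exp (3 * ∑ p ∈ primesTo w, (p : ℝ)⁻¹ - R) := by
  set P := primesTo w with hP
  have hPp : ∀ p ∈ P, p.Prime := fun p hp => (mem_primesTo.1 hp).1
  set T := P.powerset.filter (fun S => S.card < R) with hT
  have hTP : ∀ S ∈ T, S ⊆ P := fun S hS => mem_powerset.1 (mem_filter.1 hS).1
  have hpos : ∀ S ⊆ P, 0 < ∏ p ∈ S, p := fun S hS => prod_pos fun p hp => (hPp p (hS hp)).pos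
  refine ⟨fun d => ∑ S ∈ T with ∏ p ∈ S, p = d, (-1) ^ S.card, fun d => ?_, fun α => ?_⟩
  · refine (norm_sum_le _ _).trans ?_
    simp only [norm_pow, norm_neg, norm_one, one_pow, sum_const, nsmul_eq_mul, mul_one]
    have : (T.filter (fun S => ∏ p ∈ S, p = d)).card ≤ 1 := by
      refine card_le_one.2 fun S hS S' hS' => ?_
      rw [mem_filter] at hS hS'
      rw [← Nat.primeFactors_prod fun p hp => hPp p (hTP S hS.1 hp),
        ← Nat.primeFactors_prod fun p hp => hPp p (hTP S' hS'.1 hp), hS.2, hS'.2]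
    exact_mod_cast this
  have hmaps : ∀ S ∈ T, ∏ p ∈ S, p ∈ Icc 1 K := by
    intro S hS
    refine mem_Icc.2 ⟨hpos S (hTP S hS), le_trans ?_ hK⟩
    calc ∏ p ∈ S, p ≤ w ^ S.card := prod_le_pow_card _ _ _ fun p hp =>
          (mem_primesTo.1 (hTP S hS hp)).2
      _ ≤ w ^ R := Nat.pow_le_pow_right hw (mem_filter.1 hS).2.le
  have h1 : ∑ d ∈ Icc 1 K, (∑ S ∈ T with ∏ p ∈ S, p = d, (-1 : ℂ) ^ S.card) *
      ∑ k ∈ Icc 1 (n / d), e (α * (d * k)) =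
      ∑ m ∈ Icc 1 n, (∑ S ∈ T, if ∏ p ∈ S, p ∣ m then (-1 : ℂ) ^ S.card else 0) * e (α * m) := by
    calc _ = ∑ d ∈ Icc 1 K, ∑ S ∈ T with ∏ p ∈ S, p = d, (-1 : ℂ) ^ S.card *
          ∑ m ∈ Icc 1 n, (if ∏ p ∈ S, p ∣ m then e (α * m) else 0) := by
          refine sum_congr rfl fun d hd => ?_
          rw [sum_mul]
          refine sum_congr rfl fun S hS => ?_
          rw [(mem_filter.1 hS).2, sum_Icc_dvd (mem_Icc.1 hd).1 n fun m : ℕ => e (α * m)]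
          push_cast
          rfl
      _ = _ := by
          rw [sum_fiberwise_of_maps_to hmaps]
          simp only [mul_sum, sum_mul]
          rw [sum_comm]
          refine sum_congr rfl fun m _ => sum_congr rfl fun S _ => ?_
          split_ifs <;> simp
  rw [h1, ← sum_sub_distrib]
  refine (norm_sum_le _ _).trans ?_
  have h2 : ∀ m ∈ Icc 1 n, ‖(if ∀ p ∈ P, ¬ p ∣ m then 1 else 0) * e (α * m) -
      (∑ S ∈ T, if ∏ p ∈ S, p ∣ m then (-1 : ℂ) ^ S.card else 0) * e (α * m)‖ ≤
      ∑ S ∈ P.powerset.filter (fun S => S.card = R), if ∏ p ∈ S, p ∣ m then (1 : ℝ) else 0 := by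
    intro m _
    have hsub : ∀ Q : Finset ℕ → Prop, ∀ [DecidablePred Q],
        ((P.powerset.filter Q).filter fun S => ∏ p ∈ S, p ∣ m) =
          (P.filter (· ∣ m)).powerset.filter Q := by
      intro Q _
      ext S
      simp only [mem_filter, mem_powerset]
      constructor
      · exact fun h => ⟨(prod_dvd_iff_subset hPp h.1.1 m).1 h.2, h.1.2⟩
      · exact fun h => ⟨⟨h.1.trans (filter_subset _ _), h.2⟩,
          (prod_dvd_iff_subset hPp (h.1.trans (filter_subset _ _)) m).2 h.1⟩
    rw [← sub_mul, norm_mul, norm_e, mul_one, ← sum_filter, ← sum_filter, hsub, hsub, sum_const,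
      nsmul_eq_mul, mul_one]
    refine le_trans (le_of_eq ?_) (abs_bonferroni_le (P.filter (· ∣ m)) hR)
    rw [← Real.norm_eq_abs, ← Complex.norm_real]
    push_cast
    simp only [filter_eq_empty_iff]
    congr 2
    split_ifs <;> simp
  refine (sum_le_sum h2).trans ?_
  rw [sum_comm]
  calc _ ≤ ∑ S ∈ P.powerset.filter (fun S => S.card = R), n * ∏ p ∈ S, (p : ℝ)⁻¹ := by
        refine sum_le_sum fun S hS => ?_
        have hS' := mem_powerset.1 (mem_filter.1 hS).1
        rw [sum_Icc_dvd (hpos S hS') n fun _ => (1 : ℝ), sum_const, Nat.card_Icc, nsmul_eq_mul,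
          mul_one, Nat.add_sub_cancel, prod_inv_distrib, ← div_eq_mul_inv, ← Nat.cast_prod]
        exact Nat.cast_div_le
    _ ≤ _ := by
        rw [← mul_sum]
        refine mul_le_mul_of_nonneg_left (le_trans ?_ (sum_prod_card_ge_le
          (fun p _ => by positivity) R)) (Nat.cast_nonneg n)
        refine sum_le_sum_of_subset_of_nonneg (fun S hS => ?_) fun S _ _ => by positivity
        rw [mem_filter] at hS ⊢
        exact ⟨hS.1, hS.2.ge⟩

theorem model_minor (A B : ℕ) : ∃ N : ℕ, ∀ n ≥ N, ∀ (α : ℝ) (a : ℤ) (q : ℕ),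
    IsCoprime a (q : ℤ) → |α - a / q| ≤ 1 / (q : ℝ) ^ 2 → Real.log n ^ B ≤ q →
    q * Real.log n ^ B ≤ n → Real.log n ^ (A + 2) ≤ Real.log n ^ B → 
    ‖∑ m ∈ Icc 1 n, (model (level B n) m : ℂ) * e (α * m)‖ * Real.log n ^ A ≤ 109 * n := by
  obtain ⟨N1, h1⟩ := sieve_params (A + 1) B
  obtain ⟨N2, h2⟩ := log_pow_mul_rpow_le (2 * B) (δ := 0) (by norm_num)
  refine ⟨max N1 (max N2 1), fun n hn α a q ha hα hq hqn hAB => ?_⟩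
  simp only [ge_iff_le, max_le_iff] at hn
  obtain ⟨hL, hV, R, hR, hR1, hR2⟩ := h1 n hn.1
  replace h2 := h2 n hn.2.1
  have hn1 : (1 : ℝ) ≤ n := by exact_mod_cast hn.2.2
  rw [Real.rpow_zero, mul_one, mul_comm, pow_mul] at h2
  have hVinv := inv_sieveProd_le hV
  have hVpos := sieveProd_pos (level B n)
  have hLB : 1 ≤ Real.log n ^ B := one_le_pow₀ (by linarith)
  have hw1 : 1 ≤ level B n := le_level (by exact_mod_cast hLB)
  have hK : (((level B n) ^ R : ℕ) : ℝ) ≤ (n : ℝ) ^ (1 / 10 : ℝ) := by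
    push_cast
    calc _ ≤ (Real.log n ^ B) ^ R := by
          gcongr
          exact level_le B n
      _ ≤ Real.exp 2 * (Real.log n ^ B) ^ R :=
          le_mul_of_one_le_left (by positivity) (Real.one_le_exp (by norm_num))
      _ ≤ _ := hR2
  have hK2 : ((level B n) ^ R) ^ 2 ≤ n := by
    have : ((((level B n) ^ R) ^ 2 : ℕ) : ℝ) ≤ n := by
      rw [Nat.cast_pow]
      calc _ ≤ ((n : ℝ) ^ (1 / 10 : ℝ)) ^ 2 := by gcongr
        _ = (n : ℝ) ^ (1 / 5 : ℝ) := by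
            rw [← Real.rpow_natCast, ← Real.rpow_mul (by positivity)]
            norm_num
        _ ≤ (n : ℝ) ^ (1 : ℝ) := Real.rpow_le_rpow_of_exponent_le hn1 (by norm_num)
        _ = n := Real.rpow_one _
    exact_mod_cast this
  obtain ⟨c, hc, hsum⟩ := exists_sieve_coeff n hw1 hR le_rfl
  have hq1 : 1 ≤ q := by
    have : (1 : ℝ) ≤ q := hLB.trans hq
    exact_mod_cast this
  have hI := norm_typeI_le hq1 ha hα (c := c) (K := (level B n) ^ R) zero_le_one
    (fun d _ => hc d) n
  rw [one_mul] at hI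
  replace hI := hI.trans (typeI_factor_le (by linarith) hLB hq hqn h2 hK2)
  have heq : ∑ m ∈ Icc 1 n, (model (level B n) m : ℂ) * e (α * m) = ((sieveProd (level B n))⁻¹ : ℝ) *
      ∑ m ∈ Icc 1 n, (if ∀ p ∈ primesTo (level B n), ¬ p ∣ m then 1 else 0) * e (α * m) := by
    rw [mul_sum]
    refine sum_congr rfl fun m _ => ?_
    unfold model
    split_ifs <;> simp
  replace hsum := hsum α
  generalize ∑ m ∈ Icc 1 n, (if ∀ p ∈ primesTo (level B n), ¬ p ∣ m then 1 else 0) * e (α * m) = X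
    at heq hsum
  generalize ∑ d ∈ Icc 1 (level B n ^ R), c d * ∑ k ∈ Icc 1 (n / d), e (α * (d * k)) = Y at hI hsum
  rw [heq, norm_mul, Complex.norm_real, Real.norm_of_nonneg (inv_pos.2 hVpos).le]
  have hXY : ‖X‖ ≤ n * Real.exp (6 * ∑ p ∈ primesTo (level B n), (p : ℝ)⁻¹ - R) +
      108 * Real.log n * (n / Real.log n ^ B) := by
    calc ‖X‖ = ‖(X - Y) + Y‖ := by rw [sub_add_cancel]
      _ ≤ _ := (norm_add_le _ _).trans (add_le_add (hsum.trans ?_) hI)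
    refine mul_le_mul_of_nonneg_left (Real.exp_le_exp.2 ?_) (by positivity)
    have : 0 ≤ ∑ p ∈ primesTo (level B n), (p : ℝ)⁻¹ := sum_nonneg fun _ _ => by positivity
    linarith
  generalize Real.exp (6 * ∑ p ∈ primesTo (level B n), (p : ℝ)⁻¹ - R) = E at *
  generalize (sieveProd (level B n))⁻¹ = W at *
  set L := Real.log n
  have hL0 : 0 < L := by linarith
  calc W * ‖X‖ * L ^ A ≤ L * (n * E + 108 * L * (n / L ^ B)) * L ^ A := by gcongr
    _ = n * (E * L ^ (A + 1)) + 108 * n * (L ^ (A + 2) / L ^ B) := by ring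
    _ ≤ n * 1 + 108 * n * 1 := by
        gcongr
        · nlinarith
        · exact div_le_one_of_le₀ hAB (by positivity)
    _ = 109 * n := by ring

/-- The difference between the weighted indicator of the primes and its sieve model. -/
def deviation (w m : ℕ) : ℝ := primeLog m - model w m

theorem norm_e_sub_one_le (x : ℝ) : ‖e x - 1‖ ≤ 2 * Real.pi * |x| := by
  rw [e_eq_exp_I_mul]
  refine Real.norm_exp_I_mul_ofReal_sub_one_le.trans ?_
  rw [Real.norm_eq_abs, abs_mul, abs_of_pos Real.two_pi_pos]

theorem norm_sum_mul_e_le {c : ℕ → ℂ} {n : ℕ} {G : ℝ} (hG : ∀ y ≤ n, ‖∑ m ∈ Icc 1 y, c m‖ ≤ G)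
    (β : ℝ) : ‖∑ m ∈ Icc 1 n, c m * e (β * m)‖ ≤ G * (1 + 2 * Real.pi * |β| * n) := by
  have h1 : ∀ y : ℕ, ∑ m ∈ Icc 1 y, c m * e (β * m) = (∑ m ∈ Icc 1 y, c m) * e (β * (y + 1)) +
      ∑ x ∈ Icc 1 y, (∑ m ∈ Icc 1 x, c m) * (e (β * x) - e (β * (x + 1))) := by
    intro y
    induction y with
    | zero => simp
    | succ y ih =>
      simp only [sum_Icc_succ_top (show 1 ≤ y + 1 by omega), ih]
      push_cast
      ring
  have h2 : ∀ x : ℕ, ‖e (β * x) - e (β * (x + 1))‖ ≤ 2 * Real.pi * |β| := by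
    intro x
    rw [mul_add, mul_one, e_add, ← mul_one_sub, norm_mul, norm_e, one_mul, norm_sub_rev]
    exact norm_e_sub_one_le β
  have hG0 : 0 ≤ G := (norm_nonneg _).trans (hG 0 (Nat.zero_le _))
  rw [h1]
  calc _ ≤ G + ∑ x ∈ Icc 1 n, G * (2 * Real.pi * |β|) := by
        refine (norm_add_le _ _).trans (add_le_add ?_ ((norm_sum_le _ _).trans
          (sum_le_sum fun x hx => ?_)))
        · rw [norm_mul, norm_e, mul_one]
          exact hG n le_rfl
        · rw [norm_mul]
          exact mul_le_mul (hG x (mem_Icc.1 hx).2) (h2 x) (norm_nonneg _) hG0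
    _ = _ := by
        rw [sum_const, Nat.card_Icc, Nat.add_sub_cancel, nsmul_eq_mul]
        ring

theorem sum_deviation_residue_le (j B : ℕ) (hB : 1 ≤ B) : ∃ N : ℕ, ∀ n ≥ N, ∀ q : ℕ, q ≠ 0 →
    (q : ℝ) ≤ Real.log n ^ B → ∀ r < q, ∀ y ≤ n,
      |∑ m ∈ Icc 1 y with m % q = r, deviation (level B n) m| * Real.log n ^ j ≤ 2 * n := by
  obtain ⟨C, -, h1⟩ := primes_residue (j + 1) B
  obtain ⟨N1, h2⟩ := model_residue j B hB
  obtain ⟨N2, h3⟩ := exists_le_log (max C 4)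
  obtain ⟨N3, h4⟩ := log_pow_mul_rpow_le (B + j) (δ := 0) (by norm_num)
  refine ⟨max (max N1 N2) (max N3 4096), fun n hn q hq hqB r hr y hy => ?_⟩
  simp only [ge_iff_le, max_le_iff] at hn
  replace h3 := max_le_iff.1 (h3 n hn.1.2)
  replace h4 := h4 n hn.2.1
  rw [Real.rpow_zero, mul_one] at h4
  have hL0 : 0 < Real.log n := by linarith [h3.2]
  have hrq : r % q = r := Nat.mod_eq_of_lt hr
  simp only [deviation]
  rw [sum_sub_distrib]
  by_cases hc : r.Coprime q
  · have e1 := h1 n hn.2.2 q hq hqB r hc y hy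
    have e2 := h2 n hn.1.1 q hq hqB r hc y hy
    rw [hrq] at e1 e2
    have e3 : |∑ m ∈ Icc 1 y with m % q = r, primeLog m - y / q.totient| * Real.log n ^ j ≤ n := by
      refine le_of_mul_le_mul_right ?_ hL0
      rw [mul_assoc, ← pow_succ]
      exact e1.trans (by rw [mul_comm]; exact mul_le_mul_of_nonneg_left h3.1 (Nat.cast_nonneg n))
    have e4 : |∑ m ∈ Icc 1 y with m % q = r, primeLog m -
        ∑ m ∈ Icc 1 y with m % q = r, model (level B n) m| ≤
        |∑ m ∈ Icc 1 y with m % q = r, primeLog m - y / q.totient| +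
        |∑ m ∈ Icc 1 y with m % q = r, model (level B n) m - y / q.totient| := by
      rw [← sub_sub_sub_cancel_right _ _ ((y : ℝ) / q.totient)]
      exact abs_sub _ _
    calc _ ≤ _ := mul_le_mul_of_nonneg_right e4 (by positivity)
      _ ≤ 2 * n := by linarith
  · obtain ⟨p, hp, hpr, hpq⟩ := Nat.Prime.not_coprime_iff_dvd.1 hc
    have hdvd : ∀ m, m % q = r → p ∣ m := by
      rintro m rfl
      exact (Nat.dvd_mod_iff hpq).1 hpr
    have e1 : ∑ m ∈ Icc 1 y with m % q = r, model (level B n) m = 0 := by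
      refine sum_eq_zero fun m hm => ?_
      rw [model, if_neg]
      exact fun h => h p (mem_primesTo.2 ⟨hp, (Nat.le_of_dvd (Nat.pos_of_ne_zero hq) hpq).trans
        (le_level hqB)⟩) (hdvd m (mem_filter.1 hm).2)
    have e2 : ∑ m ∈ Icc 1 y with m % q = r, primeLog m ≤ 2 * q := by
      refine le_trans ?_ (sum_primeLog_le q)
      rw [← sum_filter_ne_zero]
      refine sum_le_sum_of_subset_of_nonneg (fun m hm => ?_) fun m _ _ => primeLog_nonneg m
      rw [mem_filter, mem_filter, mem_Icc] at hm
      refine mem_Icc.2 ⟨hm.1.1.1, ?_⟩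
      have hmp : m.Prime := by
        by_contra h
        exact hm.2 (by rw [primeLog, if_neg h])
      rw [← (Nat.prime_dvd_prime_iff_eq hp hmp).1 (hdvd m hm.1.2)]
      exact Nat.le_of_dvd (Nat.pos_of_ne_zero hq) hpq
    have e3 : 0 ≤ ∑ m ∈ Icc 1 y with m % q = r, primeLog m :=
      sum_nonneg fun m _ => primeLog_nonneg m
    rw [e1, sub_zero, abs_of_nonneg e3]
    calc _ ≤ 2 * Real.log n ^ B * Real.log n ^ j := by gcongr; linarith
      _ ≤ 2 * n := by rw [mul_assoc, ← pow_add]; linarith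

theorem norm_sum_deviation_rational_le {w q y : ℕ} (hq : 0 < q) (a : ℤ) {G : ℝ}
    (hG : ∀ r < q, |∑ m ∈ Icc 1 y with m % q = r, deviation w m| ≤ G) :
    ‖∑ m ∈ Icc 1 y, (deviation w m : ℂ) * e (a / q * m)‖ ≤ q * G := by
  have hq' : (q : ℝ) ≠ 0 := by exact_mod_cast hq.ne'
  have he : ∀ m : ℕ, e (a / q * m) = e (a / q * (m % q : ℕ)) := by
    intro m
    have : (a : ℝ) / q * m = a / q * (m % q : ℕ) + ((a * (m / q : ℕ) : ℤ) : ℝ) := by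
      conv_lhs => rw [← Nat.mod_add_div m q]
      rw [Int.cast_mul, Int.cast_natCast, Nat.cast_add, Nat.cast_mul]
      field_simp
    rw [this, e_add_intCast]
  rw [← sum_fiberwise_of_maps_to (t := range q) (g := fun m => m % q)
    fun m _ => mem_range.2 (Nat.mod_lt m hq)]
  refine (norm_sum_le _ _).trans ?_
  rw [← nsmul_eq_mul, ← card_range q, ← sum_const, card_range]
  refine sum_le_sum fun r hr => ?_
  refine le_trans (le_of_eq ?_) (hG r (mem_range.1 hr))
  rw [← Real.norm_eq_abs, ← Complex.norm_real, ← mul_one ‖((_ : ℝ) : ℂ)‖, ← norm_e (a / q * r),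
    ← norm_mul, Complex.ofReal_sum, sum_mul]
  congr 1
  refine sum_congr rfl fun m hm => ?_
  rw [he m, (mem_filter.1 hm).2]

/-- The exponential sum of the deviation is uniformly small. -/
theorem norm_expSum_deviation_le (A : ℕ) : ∃ N : ℕ, ∀ n ≥ N, ∀ α : ℝ,
    ‖∑ m ∈ Icc 1 n, (deviation (level (2 * (A + 5)) n) m : ℂ) * e (α * m)‖ * Real.log n ^ A ≤
      n := by
  set B := 2 * (A + 5) with hB
  obtain ⟨N1, h1⟩ := sum_deviation_residue_le (A + B + 1) B (by omega)
  obtain ⟨N2, h2⟩ := model_minor (A + 1) B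
  obtain ⟨N3, h3⟩ := exists_le_log 700
  obtain ⟨N4, h4⟩ := log_pow_mul_rpow_le (4 * B) (δ := 0) (by norm_num)
  refine ⟨max (max N1 N2) (max N3 N4), fun n hn α => ?_⟩
  simp only [ge_iff_le, max_le_iff] at hn
  replace h1 := h1 n hn.1.1
  replace h2 := h2 n hn.1.2
  replace h3 := h3 n hn.2.1
  replace h4 := h4 n hn.2.2
  rw [Real.rpow_zero, mul_one, mul_comm 4 B, pow_mul] at h4
  have hn1 : (1 : ℝ) ≤ n := by
    rcases Nat.eq_zero_or_pos n with h | h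
    · rw [h, Nat.cast_zero, Real.log_zero] at h3
      linarith
    · exact_mod_cast h
  have hLB : 1 ≤ Real.log n ^ B := one_le_pow₀ (by linarith)
  have hLBn : Real.log n ^ B ≤ n := le_trans (le_self_pow₀ hLB (by norm_num)) h4
  have hL0 : 0 < Real.log n := by linarith
  set Q := ⌊n / Real.log n ^ B⌋₊ with hQ
  have hQ0 : 0 < Q := Nat.floor_pos.2 ((one_le_div (by positivity)).2 hLBn)
  have hQn : Q * Real.log n ^ B ≤ n := by
    rw [← le_div_iff₀ (by positivity)]
    exact Nat.floor_le (by positivity)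
  have hQn' : (n : ℝ) ≤ (Q + 1) * Real.log n ^ B := by
    rw [← div_le_iff₀ (by positivity)]
    exact (Nat.lt_floor_add_one _).le
  obtain ⟨x, hx, hxQ⟩ := Real.exists_rat_abs_sub_le_and_den_le α hQ0
  have hcop : IsCoprime x.num (x.den : ℤ) := Int.isCoprime_iff_nat_coprime.2 (by
    simpa using x.reduced)
  have hxdef : (x : ℝ) = x.num / x.den := by exact_mod_cast (Rat.num_div_den x).symm
  rw [hxdef] at hx
  have hq0 : 0 < x.den := x.pos
  generalize x.num = a at *
  generalize x.den = q at *
  have hq1 : (1 : ℝ) ≤ q := by exact_mod_cast hq0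
  have hqQ : (q : ℝ) ≤ Q := by exact_mod_cast hxQ
  have hx2 : |α - a / q| ≤ 1 / (q : ℝ) ^ 2 := by
    refine hx.trans (one_div_le_one_div_of_le (by positivity) ?_)
    nlinarith
  have hqn : q * Real.log n ^ B ≤ n :=
    (mul_le_mul_of_nonneg_right hqQ (by positivity)).trans hQn
  suffices h : ‖∑ m ∈ Icc 1 n, (deviation (level B n) m : ℂ) * e (α * m)‖ *
      Real.log n ^ (A + 1) ≤ 700 * n by
    refine le_of_mul_le_mul_right ?_ hL0
    rw [mul_assoc, ← pow_succ]
    refine h.trans ?_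
    rw [mul_comm]
    exact mul_le_mul_of_nonneg_left h3 (Nat.cast_nonneg n)
  rcases le_total (Real.log n ^ B) q with hqL | hqL
  · have e1 := norm_expSum_primeLog_le hcop hx2 (by linarith) hLB hqL hqn h4
    have e2 := h2 α a q hcop hx2 hqL hqn (pow_le_pow_right₀ (by linarith) (by omega))
    rw [hB, pow_mul', Real.sqrt_sq (by positivity), pow_add _ A 5, pow_succ _ 4] at e1
    have e3 : ‖∑ m ∈ Icc 1 n, (primeLog m : ℂ) * e (α * m)‖ * Real.log n ^ (A + 1) ≤ 500 * n := by
      refine le_of_mul_le_mul_right ?_ (by positivity : 0 < Real.log n ^ 4)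
      refine le_trans (le_of_eq ?_) e1
      ring
    have e4 : ∑ m ∈ Icc 1 n, (deviation (level B n) m : ℂ) * e (α * m) =
        ∑ m ∈ Icc 1 n, (primeLog m : ℂ) * e (α * m) -
          ∑ m ∈ Icc 1 n, (model (level B n) m : ℂ) * e (α * m) := by
      rw [← sum_sub_distrib]
      refine sum_congr rfl fun m _ => ?_
      rw [deviation]
      push_cast
      ring
    rw [e4]
    calc _ ≤ (‖∑ m ∈ Icc 1 n, (primeLog m : ℂ) * e (α * m)‖ +
          ‖∑ m ∈ Icc 1 n, (model (level B n) m : ℂ) * e (α * m)‖) * Real.log n ^ (A + 1) := by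
          gcongr
          exact norm_sub_le _ _
      _ ≤ 700 * n := by linarith
  · have hG : ∀ y ≤ n, ‖∑ m ∈ Icc 1 y, (deviation (level B n) m : ℂ) * e (a / q * m)‖ ≤
        q * (2 * n / Real.log n ^ (A + B + 1)) := fun y hy =>
      norm_sum_deviation_rational_le hq0 a fun r hr =>
        (le_div_iff₀ (by positivity)).2 (h1 q hq0.ne' hqL r hr y hy)
    have e1 := norm_sum_mul_e_le hG (α - a / q)
    have e2 : ∀ m : ℕ, (deviation (level B n) m : ℂ) * e (a / q * m) * e ((α - a / q) * m) =
        deviation (level B n) m * e (α * m) := by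
      intro m
      rw [mul_assoc, ← e_add]
      congr 2
      ring
    simp only [e2] at e1
    have e3 : q * (|α - a / q| * n) ≤ Real.log n ^ B := by
      have : q * |α - a / q| ≤ 1 / (Q + 1) := by
        calc q * |α - a / q| ≤ q * (1 / ((Q + 1) * q)) := by gcongr
          _ = _ := by field_simp
      calc q * (|α - a / q| * n) = q * |α - a / q| * n := by ring
        _ ≤ 1 / (Q + 1) * ((Q + 1) * Real.log n ^ B) := by gcongr
        _ = _ := by field_simp
    calc _ ≤ q * (2 * n / Real.log n ^ (A + B + 1)) *
          (1 + 2 * Real.pi * |α - a / q| * n) * Real.log n ^ (A + 1) := by gcongr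
      _ = 2 * n / Real.log n ^ B * (q + 2 * Real.pi * (q * (|α - a / q| * n))) := by
          rw [show A + B + 1 = B + (A + 1) by ring, pow_add _ B]
          field_simp
      _ ≤ 2 * n / Real.log n ^ B * (Real.log n ^ B + 2 * 4 * Real.log n ^ B) := by
          gcongr
          exact Real.pi_le_four
      _ = 18 * n := by field_simp; ring
      _ ≤ 700 * n := by linarith

theorem sum_e_div (N : ℕ) (hN : 0 < N) (t : ℤ) :
    ∑ j ∈ range N, e (t * j / N) = if (N : ℤ) ∣ t then (N : ℂ) else 0 := by
  have hN' : (N : ℝ) ≠ 0 := by exact_mod_cast hN.ne'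
  have hpow : ∀ j : ℕ, e (t * j / N) = e (t / N) ^ j := by
    intro j
    induction j with
    | zero => simp [e_zero]
    | succ j ih =>
      rw [pow_succ, ← ih, ← e_add]
      congr 1
      push_cast
      ring
  split_ifs with h
  · obtain ⟨z, rfl⟩ := h
    have h1 : ∀ j ∈ range N, e (((N * z : ℤ) : ℝ) * j / N) = 1 := by
      intro j _
      rw [← e_intCast (z * j)]
      congr 1
      push_cast
      field_simp
    rw [sum_congr rfl h1]
    simp
  · have h1 : e (t / N) ≠ 1 := by
      intro h1
      have h2 := four_mul_nd_le ((t : ℝ) / N)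
      rw [h1, sub_self, norm_zero] at h2
      have h3 : (t : ℝ) / N - round ((t : ℝ) / N) = 0 :=
        abs_eq_zero.1 (le_antisymm (by unfold nd at h2; linarith) (abs_nonneg _))
      rw [sub_eq_zero, div_eq_iff hN'] at h3
      exact h ⟨round ((t : ℝ) / N), by rw [mul_comm]; exact_mod_cast h3⟩
    have h2 := mul_neg_geom_sum (e ((t : ℝ) / N)) N
    rw [← hpow, mul_div_assoc, div_self hN', mul_one, e_intCast, sub_self, mul_eq_zero] at h2
    simp only [hpow]
    exact h2.resolve_left (sub_ne_zero.2 h1.symm)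

theorem sum_norm_sq_expSum {ι : Type*} [DecidableEq ι] {N : ℕ} (hN : 0 < N) (s : Finset ι)
    (φ : ι → ℤ) (hφ : ∀ x ∈ s, ∀ y ∈ s, (N : ℤ) ∣ φ x - φ y → x = y) (a : ι → ℝ) :
    ∑ j ∈ range N, ‖∑ x ∈ s, (a x : ℂ) * e (j / N * φ x)‖ ^ 2 = N * ∑ x ∈ s, a x ^ 2 := by
  have h : ((∑ j ∈ range N, ‖∑ x ∈ s, (a x : ℂ) * e (j / N * φ x)‖ ^ 2 : ℝ) : ℂ) =
      ∑ x ∈ s, ∑ y ∈ s, (a x * a y : ℂ) * ∑ j ∈ range N, e ((φ x - φ y : ℤ) * j / N) := by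
    push_cast
    simp only [← Complex.mul_conj', map_sum, map_mul, Complex.conj_ofReal, sum_mul_sum, ← e_neg]
    rw [sum_comm]
    refine sum_congr rfl fun x _ => ?_
    rw [sum_comm]
    refine sum_congr rfl fun y _ => ?_
    rw [mul_sum]
    refine sum_congr rfl fun j _ => ?_
    rw [mul_mul_mul_comm, ← e_add]
    congr 2
    ring
  have h2 : ∀ x ∈ s, ∀ y ∈ s, (a x * a y : ℂ) * ∑ j ∈ range N, e ((φ x - φ y : ℤ) * j / N) =
      if x = y then (a x : ℂ) ^ 2 * N else 0 := by
    intro x hx y hy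
    rw [sum_e_div N hN]
    by_cases hxy : x = y
    · subst hxy
      simp [sq]
    · rw [if_neg fun hd => hxy (hφ x hx y hy hd), if_neg hxy, mul_zero]
  rw [sum_congr rfl fun x hx => sum_congr rfl fun y hy => h2 x hx y hy] at h
  simp only [sum_ite_eq] at h
  rw [sum_congr rfl fun x hx => if_pos hx, ← sum_mul, mul_comm] at h
  exact_mod_cast h

theorem sum_fiber_mul {ι κ : Type*} [DecidableEq κ] (I : Finset κ) (Q : Finset ι) (φ ψ : ι → κ)
    (a b : ι → ℝ) :
    ∑ i ∈ I, (∑ x ∈ Q, if φ x = i then a x else 0) * (∑ y ∈ Q, if ψ y = i then b y else 0) =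
      ∑ x ∈ Q, ∑ y ∈ Q, if φ x = ψ y ∧ φ x ∈ I then a x * b y else 0 := by
  simp only [sum_mul_sum]
  rw [sum_comm]
  refine sum_congr rfl fun x _ => ?_
  rw [sum_comm]
  refine sum_congr rfl fun y _ => ?_
  simp only [ite_mul, zero_mul, mul_ite, mul_zero, sum_ite_eq]
  by_cases h1 : φ x ∈ I <;> by_cases h2 : φ x = ψ y <;> simp [h1, h2]

/-- The pairs of positive integers up to `n`. -/
def box (n : ℕ) : Finset (ℕ × ℕ) := Icc 1 n ×ˢ Icc 1 n

theorem mem_box {n : ℕ} {x : ℕ × ℕ} :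
    x ∈ box n ↔ (1 ≤ x.1 ∧ x.1 ≤ n) ∧ (1 ≤ x.2 ∧ x.2 ≤ n) := by
  rw [box, mem_product, mem_Icc, mem_Icc]

/-- The autocorrelation of `u`. -/
def corr (n : ℕ) (u : ℕ → ℝ) (d : ℤ) : ℝ :=
  ∑ x ∈ box n, if (x.1 : ℤ) - x.2 = d then u x.1 * u x.2 else 0

theorem abs_corr_le {n : ℕ} {u : ℕ → ℝ} {G : ℝ} (hu : ∀ m ∈ Icc 1 n, |u m| ≤ G) (d : ℤ) :
    |corr n u d| ≤ n * G ^ 2 := by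
  have h1 : ∀ x ∈ box n, |if (x.1 : ℤ) - x.2 = d then u x.1 * u x.2 else 0| ≤
      if (x.1 : ℤ) - x.2 = d then G ^ 2 else 0 := by
    intro x hx
    have hx := mem_product.1 hx
    split_ifs
    · rw [abs_mul, sq]
      exact mul_le_mul (hu _ hx.1) (hu _ hx.2) (abs_nonneg _) ((abs_nonneg _).trans (hu _ hx.1))
    · simp
  refine (abs_sum_le_sum_abs _ _).trans ((sum_le_sum h1).trans ?_)
  rw [← sum_filter, sum_const, nsmul_eq_mul]
  refine mul_le_mul_of_nonneg_right ?_ (sq_nonneg G)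
  have : ((box n).filter fun x => (x.1 : ℤ) - x.2 = d).card ≤ (Icc 1 n).card := by
    refine card_le_card_of_injOn Prod.fst (fun x hx => ?_) fun x hx y hy hxy => ?_
    · exact (mem_product.1 (mem_filter.1 hx).1).1
    · have h2 := (mem_filter.1 hx).2
      have h3 := (mem_filter.1 hy).2
      exact Prod.ext hxy (by omega)
  rw [Nat.card_Icc, Nat.add_sub_cancel] at this
  exact_mod_cast this

theorem sum_corr_sq_le {n : ℕ} {u : ℕ → ℝ} {G S : ℝ} (hu : ∀ m ∈ Icc 1 n, |u m| ≤ G)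
    (hS : ∀ α : ℝ, ‖∑ m ∈ Icc 1 n, (u m : ℂ) * e (α * m)‖ ≤ S) :
    ∑ d ∈ Icc (-n : ℤ) n, corr n u d ^ 2 ≤ S ^ 2 * (n * G ^ 2) := by
  set N := 2 * n + 1 with hN
  have hN0 : 0 < N := by omega
  have hNr : (0 : ℝ) < N := by exact_mod_cast hN0
  have small : ∀ t : ℤ, (N : ℤ) ∣ t → |t| ≤ 2 * n → t = 0 := fun t h1 h2 =>
    Int.eq_zero_of_abs_lt_dvd h1 (by omega)
  have h1 := sum_norm_sq_expSum hN0 (Icc (-n : ℤ) n) (fun d => d) (fun x hx y hy h => by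
    rw [mem_Icc] at hx hy
    exact sub_eq_zero.1 (small _ h (abs_le.2 (by omega)))) (corr n u)
  have h2 := sum_norm_sq_expSum hN0 (Icc 1 n) (fun m : ℕ => (m : ℤ)) (fun x hx y hy h => by
    rw [mem_Icc] at hx hy
    have := small _ h (abs_le.2 (by omega))
    omega) u
  have h3 : ∀ α : ℝ, ‖∑ d ∈ Icc (-n : ℤ) n, (corr n u d : ℂ) * e (α * (d : ℤ))‖ =
      ‖∑ m ∈ Icc 1 n, (u m : ℂ) * e (α * (m : ℤ))‖ ^ 2 := by
    intro α
    rw [sq]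
    conv_rhs => rw [← Complex.norm_conj, Complex.norm_conj]; arg 2; rw [← Complex.norm_conj]
    rw [← norm_mul, map_sum, sum_mul_sum, ← sum_product']
    congr 1
    simp only [corr, Complex.ofReal_sum, sum_mul]
    rw [sum_comm]
    refine sum_congr rfl fun x hx => ?_
    have hx := mem_box.1 hx
    rw [sum_eq_single_of_mem ((x.1 : ℤ) - x.2) (mem_Icc.2 (by omega)) fun d _ hd => by
      rw [if_neg hd.symm, Complex.ofReal_zero, zero_mul]]
    rw [if_pos rfl, map_mul, Complex.conj_ofReal, ← e_neg, mul_mul_mul_comm, ← e_add]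
    push_cast
    ring_nf
  refine le_of_mul_le_mul_left ?_ hNr
  rw [← h1]
  calc _ ≤ ∑ j ∈ range N, S ^ 2 * ‖∑ m ∈ Icc 1 n, (u m : ℂ) * e (j / N * (m : ℤ))‖ ^ 2 := by
        refine sum_le_sum fun j _ => ?_
        rw [h3, sq]
        refine mul_le_mul_of_nonneg_right (pow_le_pow_left₀ (norm_nonneg _) ?_ 2) (sq_nonneg _)
        exact_mod_cast hS (j / N)
    _ = N * (S ^ 2 * ∑ m ∈ Icc 1 n, u m ^ 2) := by
        rw [← mul_sum, h2]
        ring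
    _ ≤ N * (S ^ 2 * (n * G ^ 2)) := by
        gcongr
        calc _ ≤ ∑ m ∈ Icc 1 n, G ^ 2 := sum_le_sum fun m hm => sq_le_sq' (abs_le.1 (hu m hm)).1
              (abs_le.1 (hu m hm)).2
          _ = _ := by simp

/-- The convolution of `u` and `v`, the first variable restricted to a residue class mod `k`. -/
def conv (n k : ℕ) (u v : ℕ → ℝ) (i : ℕ × ℕ) : ℝ :=
  ∑ x ∈ box n, if (x.1 % k, x.1 + x.2) = i then u x.1 * v x.2 else 0

theorem sum_conv_sq_eq {n k : ℕ} (hk : 0 < k) (u v : ℕ → ℝ) :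
    ∑ i ∈ range k ×ˢ range (2 * n + 1), conv n k u v i ^ 2 =
      ∑ d ∈ (Icc (-n : ℤ) n).filter (fun d => (k : ℤ) ∣ d), corr n u d * corr n v d := by
  simp only [sq, conv, corr]
  rw [sum_fiber_mul, sum_fiber_mul]
  simp only [box, sum_product]
  refine sum_congr rfl fun x₁ hx₁ => ?_
  rw [sum_comm]
  refine sum_congr rfl fun y₁ hy₁ => ?_
  rw [sum_comm]
  refine sum_congr rfl fun y₂ hy₂ => sum_congr rfl fun x₂ hx₂ => ?_
  rw [mem_Icc] at hx₁ hy₁ hx₂ hy₂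
  have h : ((x₁ % k, x₁ + x₂) = (y₁ % k, y₁ + y₂) ∧
      (x₁ % k, x₁ + x₂) ∈ range k ×ˢ range (2 * n + 1)) ↔
      ((x₁ : ℤ) - y₁ = y₂ - x₂ ∧
        (x₁ : ℤ) - y₁ ∈ (Icc (-n : ℤ) n).filter (fun d => (k : ℤ) ∣ d)) := by
    have h1 : x₁ % k = y₁ % k ↔ (k : ℤ) ∣ (x₁ : ℤ) - y₁ := by
      rw [← Nat.modEq_iff_dvd]
      exact ⟨Eq.symm, Eq.symm⟩
    have h2 := Nat.mod_lt x₁ hk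
    simp only [Prod.mk.injEq, mem_product, mem_range, mem_filter, mem_Icc, h1]
    omega
  simp only [h]
  split_ifs <;> ring

/-- The sum of `u m₁ v m₂ w m₃` over `m₁ + m₂ + m₃ = n` with `mᵢ` in residue classes mod `k`. -/
def trip (n k b₁ b₂ b₃ : ℕ) (u v w : ℕ → ℝ) : ℝ :=
  ∑ m₁ ∈ Icc 1 n, ∑ m₂ ∈ Icc 1 n, ∑ m₃ ∈ Icc 1 n,
    if m₁ + m₂ + m₃ = n ∧ m₁ % k = b₁ % k ∧ m₂ % k = b₂ % k ∧ m₃ % k = b₃ % k then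
      u m₁ * v m₂ * w m₃ else 0

theorem trip_swap₁₂ (n k b₁ b₂ b₃ : ℕ) (u v w : ℕ → ℝ) :
    trip n k b₁ b₂ b₃ u v w = trip n k b₂ b₁ b₃ v u w := by
  unfold trip
  rw [sum_comm]
  refine sum_congr rfl fun x _ => sum_congr rfl fun y _ => sum_congr rfl fun z _ => ?_
  rw [mul_comm (u y), add_comm y]
  exact if_congr (by tauto) rfl rfl

theorem trip_swap₂₃ (n k b₁ b₂ b₃ : ℕ) (u v w : ℕ → ℝ) :
    trip n k b₁ b₂ b₃ u v w = trip n k b₁ b₃ b₂ u w v := by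
  unfold trip
  refine sum_congr rfl fun x _ => ?_
  rw [sum_comm]
  refine sum_congr rfl fun y _ => sum_congr rfl fun z _ => ?_
  rw [mul_right_comm, add_right_comm]
  exact if_congr (by tauto) rfl rfl

theorem trip_sub (n k b₁ b₂ b₃ : ℕ) (f g : ℕ → ℝ) :
    trip n k b₁ b₂ b₃ f f f - trip n k b₁ b₂ b₃ g g g =
      trip n k b₁ b₂ b₃ (f - g) f f + trip n k b₁ b₂ b₃ g (f - g) f +
        trip n k b₁ b₂ b₃ g g (f - g) := by
  simp only [trip, ← sum_sub_distrib, ← sum_add_distrib, Pi.sub_apply]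
  refine sum_congr rfl fun x _ => sum_congr rfl fun y _ => sum_congr rfl fun z _ => ?_
  split_ifs <;> ring

/-- The sum of `|trip|` over all residue classes mod `k`. -/
def tripSum (n k : ℕ) (u v w : ℕ → ℝ) : ℝ :=
  ∑ b₁ ∈ range k, ∑ b₂ ∈ range k, ∑ b₃ ∈ range k, |trip n k b₁ b₂ b₃ u v w|

theorem tripSum_swap₁₂ (n k : ℕ) (u v w : ℕ → ℝ) : tripSum n k u v w = tripSum n k v u w := by
  unfold tripSum
  rw [sum_comm]
  simp only [trip_swap₁₂ n k _ _ _ u v w]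

theorem tripSum_swap₂₃ (n k : ℕ) (u v w : ℕ → ℝ) : tripSum n k u v w = tripSum n k u w v := by
  unfold tripSum
  refine sum_congr rfl fun _ _ => ?_
  rw [sum_comm]
  simp only [trip_swap₂₃ n k _ _ _ u v w]

theorem tripSum_nonneg (n k : ℕ) (u v w : ℕ → ℝ) : 0 ≤ tripSum n k u v w :=
  sum_nonneg fun _ _ => sum_nonneg fun _ _ => sum_nonneg fun _ _ => abs_nonneg _

theorem sum_abs_conv_residue_le {n k m b : ℕ} (hb : b < k) (hm : m ≤ n) (u v : ℕ → ℝ) :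
    ∑ b₂ ∈ range k, |∑ x ∈ box n,
      if x.1 + x.2 + m = n ∧ x.1 % k = b ∧ x.2 % k = b₂ then u x.1 * v x.2 else 0| ≤
      |conv n k u v (b, n - m)| := by
  by_cases h : ∃ x : ℕ × ℕ, x.1 + x.2 + m = n ∧ x.1 % k = b
  · obtain ⟨y, hy, hyb⟩ := h
    have hmod : ∀ x : ℕ × ℕ, x.1 + x.2 + m = n → x.1 % k = b → x.2 % k = y.2 % k := by
      intro x hx hxb
      have h1 : x.1 ≡ y.1 [MOD k] := hxb.trans hyb.symm
      exact h1.add_left_cancel (by rw [show x.1 + x.2 = y.1 + y.2 by omega])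
    rw [sum_eq_single_of_mem (y.2 % k) (mem_range.2 (Nat.mod_lt _ (by omega))) fun b₂ _ hb₂ => by
      rw [abs_eq_zero]
      refine sum_eq_zero fun x _ => if_neg fun hx => hb₂ ?_
      rw [← hx.2.2, hmod x hx.1 hx.2.1]]
    refine le_of_eq (congrArg _ (sum_congr rfl fun x _ => if_congr ?_ rfl rfl))
    rw [Prod.mk.injEq]
    exact ⟨fun hx => ⟨hx.2.1, by omega⟩, fun hx => ⟨by omega, hx.1, hmod x (by omega) hx.1⟩⟩
  · push Not at h
    rw [sum_eq_zero fun b₂ _ => ?_]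
    · exact abs_nonneg _
    · rw [abs_eq_zero]
      exact sum_eq_zero fun x _ => if_neg fun hx => h x hx.1 hx.2.1

theorem tripSum_le {n k : ℕ} (u v w : ℕ → ℝ) :
    tripSum n k u v w ≤
      ∑ b ∈ range k, ∑ m ∈ Icc 1 n, |w m| * |conv n k u v (b, n - m)| := by
  refine sum_le_sum fun b hb => ?_
  have hb := mem_range.1 hb
  have h1 : ∀ b₂ ∈ range k, ∑ b₃ ∈ range k, |trip n k b b₂ b₃ u v w| ≤
      ∑ m ∈ Icc 1 n, |w m| * |∑ x ∈ box n,
        if x.1 + x.2 + m = n ∧ x.1 % k = b ∧ x.2 % k = b₂ then u x.1 * v x.2 else 0| := by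
    intro b₂ hb₂
    have hb₂ := mem_range.1 hb₂
    calc _ ≤ ∑ b₃ ∈ range k, ∑ m ∈ Icc 1 n, if m % k = b₃ then |w m| * |∑ x ∈ box n,
          if x.1 + x.2 + m = n ∧ x.1 % k = b ∧ x.2 % k = b₂ then u x.1 * v x.2 else 0|
          else 0 := by
          refine sum_le_sum fun b₃ hb₃ => ?_
          have hb₃ := mem_range.1 hb₃
          have h2 : trip n k b b₂ b₃ u v w = ∑ m ∈ Icc 1 n, if m % k = b₃ then w m * ∑ x ∈ box n,
              (if x.1 + x.2 + m = n ∧ x.1 % k = b ∧ x.2 % k = b₂ then u x.1 * v x.2 else 0)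
              else 0 := by
            simp only [trip, box, sum_product]
            rw [sum_congr rfl fun m₁ _ => sum_comm, sum_comm]
            refine sum_congr rfl fun m _ => ?_
            simp only [Nat.mod_eq_of_lt hb, Nat.mod_eq_of_lt hb₂, Nat.mod_eq_of_lt hb₃]
            by_cases h : m % k = b₃
            · simp only [h, and_true, if_true, mul_comm (w m), sum_mul, ite_mul, zero_mul]
            · simp [h]
          rw [h2]
          refine (abs_sum_le_sum_abs _ _).trans (sum_le_sum fun m _ => ?_)
          split_ifs
          · rw [abs_mul]
          · simp
      _ = _ := by
          rw [sum_comm]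
          refine sum_congr rfl fun m _ => ?_
          rw [sum_ite_eq, if_pos (mem_range.2 (Nat.mod_lt _ (by omega)))]
  refine (sum_le_sum h1).trans ?_
  rw [sum_comm]
  refine sum_le_sum fun m hm => ?_
  rw [← mul_sum]
  exact mul_le_mul_of_nonneg_left (sum_abs_conv_residue_le hb (mem_Icc.1 hm).2 u v) (abs_nonneg _)

theorem tripSum_sq_le {n k : ℕ} {u v w : ℕ → ℝ} {G : ℝ} (hw : ∀ m ∈ Icc 1 n, |w m| ≤ G) :
    tripSum n k u v w ^ 2 ≤ k * n * G ^ 2 *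
      ∑ i ∈ range k ×ˢ range (2 * n + 1), conv n k u v i ^ 2 := by
  refine (pow_le_pow_left₀ (tripSum_nonneg n k u v w) (tripSum_le u v w) 2).trans ?_
  rw [← sum_product']
  refine (sum_mul_sq_le_sq_mul_sq _ _ _).trans ?_
  have h1 : ∑ i ∈ range k ×ˢ Icc 1 n, |w i.2| ^ 2 ≤ k * n * G ^ 2 := by
    calc _ ≤ ∑ i ∈ range k ×ˢ Icc 1 n, G ^ 2 := sum_le_sum fun i hi =>
          pow_le_pow_left₀ (abs_nonneg _) (hw _ (mem_product.1 hi).2) 2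
      _ = _ := by simp
  refine mul_le_mul h1 ?_ (sum_nonneg fun _ _ => sq_nonneg _) (by positivity)
  have hinj : Set.InjOn (fun i : ℕ × ℕ => (i.1, n - i.2)) (range k ×ˢ Icc 1 n : Finset _) := by
    intro x hx y hy h
    have hx := mem_Icc.1 (mem_product.1 hx).2
    have hy := mem_Icc.1 (mem_product.1 hy).2
    rw [Prod.mk.injEq] at h
    exact Prod.ext h.1 (by omega)
  simp only [sq_abs]
  rw [← sum_image (f := fun i => conv n k u v i ^ 2) hinj]
  refine sum_le_sum_of_subset_of_nonneg (fun x hx => ?_) fun _ _ _ => sq_nonneg _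
  obtain ⟨y, hy, rfl⟩ := mem_image.1 hx
  rw [mem_product, mem_range] at hy ⊢
  exact ⟨hy.1, mem_range.2 (by dsimp only; omega)⟩

theorem sum_card_dvd_sq_le {K : Finset ℕ} {M : ℝ} (hM : (K.card : ℝ) ≤ M) (n : ℕ) :
    ∑ d ∈ Icc (-n : ℤ) n, ((K.filter fun k : ℕ => (k : ℤ) ∣ d).card : ℝ) ^ 2 ≤
      M ^ 2 + 2 * (n * (1 + Real.log n) ^ 3) := by
  set ν : ℤ → ℝ := fun d => ((K.filter fun k : ℕ => (k : ℤ) ∣ d).card : ℝ) with hν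
  have heven : Function.Even fun d => ν d ^ 2 := fun d => by simp only [hν, Int.dvd_neg]
  have h0 : ν 0 ^ 2 ≤ M ^ 2 := by
    simpa [hν] using pow_le_pow_left₀ (Nat.cast_nonneg _) hM 2
  have h1 : ∀ m ∈ Icc 1 n, ν m ^ 2 ≤ (m.divisors.card : ℝ) ^ 2 := fun m hm => by
    refine pow_le_pow_left₀ (Nat.cast_nonneg _) (Nat.cast_le.2 (card_le_card fun k hk => ?_)) 2
    have hm := mem_Icc.1 hm
    exact Nat.mem_divisors.2 ⟨Int.natCast_dvd_natCast.1 (mem_filter.1 hk).2, by omega⟩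
  have h2 := (sum_le_sum h1).trans (sum_card_divisors_sq_le n)
  have h3 : ∑ m ∈ range (n + 1), ν m ^ 2 = ∑ m ∈ Icc 1 n, ν m ^ 2 + ν 0 ^ 2 := by
    rw [range_eq_Ico, sum_eq_sum_Ico_succ_bot (Nat.succ_pos n), add_comm]
    rfl
  rw [sum_Icc_of_even_eq_range heven, nsmul_eq_mul, h3]
  push_cast
  linarith

theorem sum_tripSum_pow_le {n : ℕ} {u v w : ℕ → ℝ} {G S M : ℝ} {K : Finset ℕ}
    (hu : ∀ m ∈ Icc 1 n, |u m| ≤ G) (hv : ∀ m ∈ Icc 1 n, |v m| ≤ G)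
    (hw : ∀ m ∈ Icc 1 n, |w m| ≤ G)
    (hS : ∀ α : ℝ, ‖∑ m ∈ Icc 1 n, (u m : ℂ) * e (α * m)‖ ≤ S)
    (hK : ∀ k ∈ K, 0 < k ∧ (k : ℝ) ≤ M) (hM : (K.card : ℝ) ≤ M) :
    (∑ k ∈ K, tripSum n k u v w) ^ 4 ≤ (M ^ 2 * n ^ 2 * G ^ 4) ^ 2 *
      ((M ^ 2 + 2 * (n * (1 + Real.log n) ^ 3)) * (S ^ 2 * (n * G ^ 2))) := by
  have hM0 : 0 ≤ M := (Nat.cast_nonneg _).trans hM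
  set T := ∑ d ∈ Icc (-n : ℤ) n, ((K.filter fun k : ℕ => (k : ℤ) ∣ d).card : ℝ) * |corr n u d| with hT
  have hT0 : 0 ≤ T := sum_nonneg fun _ _ => by positivity
  have hT2 : T ^ 2 ≤ (M ^ 2 + 2 * (n * (1 + Real.log n) ^ 3)) * (S ^ 2 * (n * G ^ 2)) := by
    refine (sum_mul_sq_le_sq_mul_sq _ _ _).trans ?_
    simp only [sq_abs]
    have h1 := sum_card_dvd_sq_le hM n
    exact mul_le_mul h1 (sum_corr_sq_le hu hS) (sum_nonneg fun _ _ => sq_nonneg _)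
      (by have := Real.log_natCast_nonneg n; positivity)
  have hE : ∑ k ∈ K, ∑ i ∈ range k ×ˢ range (2 * n + 1), conv n k u v i ^ 2 ≤ n * G ^ 2 * T := by
    rw [sum_congr rfl fun k hk => sum_conv_sq_eq (hK k hk).1 u v]
    simp only [sum_filter]
    rw [sum_comm, mul_sum]
    refine sum_le_sum fun d _ => ?_
    rw [← sum_filter, sum_const, nsmul_eq_mul, mul_left_comm (n * G ^ 2)]
    refine mul_le_mul_of_nonneg_left ?_ (Nat.cast_nonneg _)
    refine (le_abs_self (corr n u d * corr n v d)).trans ?_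
    rw [abs_mul, mul_comm]
    exact mul_le_mul_of_nonneg_right (abs_corr_le hv d) (abs_nonneg _)
  have hX : (∑ k ∈ K, tripSum n k u v w) ^ 2 ≤ M ^ 2 * n ^ 2 * G ^ 4 * T := by
    calc _ ≤ (K.card : ℝ) * ∑ k ∈ K, tripSum n k u v w ^ 2 := sq_sum_le_card_mul_sum_sq
      _ ≤ M * ∑ k ∈ K, M * n * G ^ 2 *
          ∑ i ∈ range k ×ˢ range (2 * n + 1), conv n k u v i ^ 2 := by
        refine mul_le_mul hM (sum_le_sum fun k hk => (tripSum_sq_le hw).trans ?_)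
          (sum_nonneg fun _ _ => sq_nonneg _) hM0
        refine mul_le_mul_of_nonneg_right ?_ (sum_nonneg fun _ _ => sq_nonneg _)
        have := (hK k hk).2
        gcongr
      _ ≤ M * (M * n * G ^ 2 * (n * G ^ 2 * T)) := by
        rw [← mul_sum]
        gcongr
      _ = _ := by ring
  calc _ = ((∑ k ∈ K, tripSum n k u v w) ^ 2) ^ 2 := by ring
    _ ≤ (M ^ 2 * n ^ 2 * G ^ 4 * T) ^ 2 := pow_le_pow_left₀ (sq_nonneg _) hX 2
    _ = (M ^ 2 * n ^ 2 * G ^ 4) ^ 2 * T ^ 2 := by ring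
    _ ≤ _ := by gcongr

/-- On average over moduli, the primes may be replaced by the sifted model. -/
theorem sum_tripSum_le (A : ℕ) : ∃ B ≥ 1, ∃ N : ℕ, ∀ n ≥ N, ∀ D : ℝ, 1 ≤ D →
    D ≤ (n : ℝ) ^ (1 / 5 : ℝ) → ∀ K : Finset ℕ, (∀ k ∈ K, 0 < k ∧ (k : ℝ) ≤ 2 * D) →
    (∑ k ∈ K, ∑ b₁ ∈ range k, ∑ b₂ ∈ range k, ∑ b₃ ∈ range k,
      |trip n k b₁ b₂ b₃ primeLog primeLog primeLog - trip n k b₁ b₂ b₃ (model (level B n))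
        (model (level B n)) (model (level B n))|) * Real.log n ^ A ≤ D * n ^ 2 := by
  set a := 2 * A + 10 with ha
  set B := 2 * (a + 5) with hB
  obtain ⟨N1, h1⟩ := norm_expSum_deviation_le a
  obtain ⟨N2, h2⟩ := sieve_params 0 B
  obtain ⟨N3, h3⟩ := exists_le_log 320
  refine ⟨B, by omega, max N1 (max N2 (max N3 1)), fun n hn D hD hDn K hK => ?_⟩
  simp only [ge_iff_le, max_le_iff] at hn
  obtain ⟨hn1, hn2, hn3, hn4⟩ := hn
  have hL := h3 n hn3
  have hn4' : (1 : ℝ) ≤ n := by exact_mod_cast hn4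
  set L := Real.log n with hLdef
  have hL0 : 0 < L := by linarith
  set f := primeLog
  set g := model (level B n)
  have hf : ∀ m ∈ Icc 1 n, |primeLog m| ≤ L := fun m hm => by
    have hm := mem_Icc.1 hm
    rw [abs_of_nonneg (primeLog_nonneg m)]
    exact (primeLog_le_log m).trans (Real.log_le_log (by exact_mod_cast hm.1)
      (by exact_mod_cast hm.2))
  have hg' : ∀ m, model (level B n) m ≤ L := fun m =>
    (model_le _ m).trans (inv_sieveProd_le (h2 n hn2).2.1)
  have hg : ∀ m ∈ Icc 1 n, |model (level B n) m| ≤ L := fun m _ => by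
    rw [abs_of_nonneg (model_nonneg _ m)]
    exact hg' m
  have hd : ∀ m ∈ Icc 1 n, |(f - g) m| ≤ L := fun m hm => abs_sub_le_iff.2
    ⟨by linarith [(abs_le.1 (hf m hm)).2, model_nonneg (level B n) m],
      by linarith [primeLog_nonneg m, hg' m]⟩
  have hS : ∀ α : ℝ, ‖∑ m ∈ Icc 1 n, ((f - g) m : ℂ) * e (α * m)‖ ≤ n / L ^ a := fun α => by
    rw [le_div_iff₀ (by positivity)]
    exact h1 n hn1 α
  have hcard : (K.card : ℝ) ≤ 2 * D := by
    have : K ⊆ Icc 1 ⌊2 * D⌋₊ := fun k hk => mem_Icc.2 ⟨(hK k hk).1, Nat.le_floor (hK k hk).2⟩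
    have := card_le_card this
    rw [Nat.card_Icc, Nat.add_sub_cancel] at this
    exact (Nat.cast_le.2 this).trans (Nat.floor_le (by linarith))
  have hD2 : D ^ 2 ≤ n := by
    calc D ^ 2 ≤ ((n : ℝ) ^ (1 / 5 : ℝ)) ^ 2 := by gcongr
      _ = (n : ℝ) ^ (2 / 5 : ℝ) := by rw [← Real.rpow_natCast, ← Real.rpow_mul] <;> norm_num
      _ ≤ (n : ℝ) ^ (1 : ℝ) := Real.rpow_le_rpow_of_exponent_le hn4' (by norm_num)
      _ = n := Real.rpow_one _
  have key : ∀ v w : ℕ → ℝ, (∀ m ∈ Icc 1 n, |v m| ≤ L) → (∀ m ∈ Icc 1 n, |w m| ≤ L) →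
      (∑ k ∈ K, tripSum n k (f - g) v w) * (3 * L ^ A) ≤ D * n ^ 2 := by
    intro v w hv hw
    have h := sum_tripSum_pow_le hd hv hw hS hK hcard
    refine le_of_pow_le_pow_left₀ (n := 4) (by norm_num) (by positivity) ?_
    have hV : (2 * D) ^ 2 + 2 * (n * (1 + L) ^ 3) ≤ 20 * (n * L ^ 3) := by
      have e1 : (1 + L) ^ 3 ≤ (2 * L) ^ 3 := by gcongr; linarith
      have e2 : (1 : ℝ) ≤ L ^ 3 := one_le_pow₀ (by linarith)
      have e3 := mul_le_mul_of_nonneg_left e1 (Nat.cast_nonneg (α := ℝ) n)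
      have e4 := mul_le_mul_of_nonneg_left e2 (Nat.cast_nonneg (α := ℝ) n)
      nlinarith
    have hL7 : (81 * 320 : ℝ) ≤ L ^ 7 := by
      calc (81 * 320 : ℝ) ≤ 320 ^ 7 := by norm_num
        _ ≤ L ^ 7 := by gcongr
    calc _ = 81 * L ^ (4 * A) * (∑ k ∈ K, tripSum n k (f - g) v w) ^ 4 := by ring
      _ ≤ 81 * L ^ (4 * A) * (((2 * D) ^ 2 * n ^ 2 * L ^ 4) ^ 2 *
          (20 * (n * L ^ 3) * ((n / L ^ a) ^ 2 * (n * L ^ 2)))) := by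
        refine mul_le_mul_of_nonneg_left (h.trans ?_) (by positivity)
        exact mul_le_mul_of_nonneg_left (mul_le_mul_of_nonneg_right hV (by positivity))
          (by positivity)
      _ = 81 * 320 / L ^ 7 * (D * n ^ 2) ^ 4 := by
        rw [ha]
        field_simp
        ring
      _ ≤ 1 * (D * n ^ 2) ^ 4 := by
        refine mul_le_mul_of_nonneg_right ?_ (by positivity)
        rwa [div_le_one (by positivity)]
      _ = _ := one_mul _
  have hsum : ∑ k ∈ K, ∑ b₁ ∈ range k, ∑ b₂ ∈ range k, ∑ b₃ ∈ range k,
      |trip n k b₁ b₂ b₃ f f f - trip n k b₁ b₂ b₃ g g g| ≤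
      ∑ k ∈ K, tripSum n k (f - g) f f + ∑ k ∈ K, tripSum n k (f - g) g f +
        ∑ k ∈ K, tripSum n k (f - g) g g := by
    rw [← sum_add_distrib, ← sum_add_distrib]
    refine sum_le_sum fun k _ => ?_
    rw [tripSum_swap₁₂ n k (f - g) g f, tripSum_swap₁₂ n k (f - g) g g,
      tripSum_swap₂₃ n k g (f - g) g]
    simp only [tripSum, ← sum_add_distrib]
    refine sum_le_sum fun b₁ _ => sum_le_sum fun b₂ _ => sum_le_sum fun b₃ _ => ?_
    rw [trip_sub]
    exact abs_add_three _ _ _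
  have k1 := key f f hf hf
  have k2 := key g f hg hf
  have k3 := key g g hg hg
  have := mul_le_mul_of_nonneg_right hsum (pow_pos hL0 A).le
  linarith

theorem sieve_count_ge (B : ℕ) : ∃ N : ℕ, ∀ n ≥ N, ∀ k : ℕ, 0 < k → (k : ℝ) ≤ 2 * n ^ (1 / 5 : ℝ) →
    ∀ E : ℕ → ℕ → Prop, (∀ p ∈ primesTo (level B n), (∀ y, E p y ↔ E p (y % p)) ∧
      (omegaSet E p).card ≤ 2 ∧ (p = 2 → (omegaSet E p).card ≤ 1)) →
    ∃ Y ⊆ range (n / (4 * k)), (n : ℝ) ≤ 16 * k * Real.log n * Y.card ∧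
      ∀ y ∈ Y, ∀ p ∈ primesTo (level B n), ¬ E p y := by
  classical
  obtain ⟨N1, h1⟩ := sieve_params 0 B
  obtain ⟨N2, h2⟩ := sieve_count 2 B
  obtain ⟨N3, h3⟩ := exists_le_log 64
  obtain ⟨N4, h4⟩ := log_pow_mul_rpow_le 2 (δ := 3 / 10) (by norm_num)
  refine ⟨max N1 (max N2 (max N3 (max N4 1))), fun n hn k hk hkn E hE => ?_⟩
  simp only [ge_iff_le, max_le_iff] at hn
  obtain ⟨hn1, hn2, hn3, hn4, hn5⟩ := hn
  have hP : ∀ p ∈ primesTo (level B n), p.Prime := fun p hp => (mem_primesTo.1 hp).1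
  have key := h2 n hn2 E _ subset_rfl (fun p hp => (hE p hp).1) (fun p hp => (hE p hp).2.1)
    (n / (4 * k))
  have hprod := prod_one_sub_ge_exp (c := fun p => (omegaSet E p).card) hP
    (fun p hp => (hE p hp).2.1) (fun hp => (hE 2 hp).2.2 rfl)
  set X := (range (n / (4 * k))).filter (fun y => ∀ p ∈ primesTo (level B n), ¬ E p y)
  have hexp : (Real.log n)⁻¹ ≤ Real.exp (-(6 * ∑ p ∈ primesTo (level B n), (p : ℝ)⁻¹)) := by
    rw [Real.exp_neg]
    exact inv_anti₀ (Real.exp_pos _) (h1 n hn1).2.1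
  have hL := h3 n hn3
  have hpow := h4 n hn4
  set L := Real.log n with hLdef
  have hL0 : 0 < L := by linarith
  have hk0 : (0 : ℝ) < k := by exact_mod_cast hk
  have hn0 : (1 : ℝ) ≤ n := by exact_mod_cast hn5
  have hn0' : (0 : ℝ) < n := by linarith
  set t := (n : ℝ) ^ (1 / 10 : ℝ) with ht
  have ht1 : 1 ≤ t := Real.one_le_rpow hn0 (by norm_num)
  have ht5 : (n : ℝ) ^ (1 / 5 : ℝ) = t ^ 2 := by
    rw [ht, ← Real.rpow_natCast, ← Real.rpow_mul hn0'.le]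
    norm_num
  have ht3 : (n : ℝ) ^ (3 / 10 : ℝ) = t ^ 3 := by
    rw [ht, ← Real.rpow_natCast, ← Real.rpow_mul hn0'.le]
    norm_num
  rw [ht3] at hpow
  rw [ht5] at hkn
  have hsmall : 32 * L * k * t ≤ n := by
    refine le_trans ?_ hpow
    calc 32 * L * k * t ≤ 32 * L * (2 * t ^ 2) * t := by gcongr
      _ = 64 * L * t ^ 3 := by ring
      _ ≤ L * L * t ^ 3 := by gcongr
      _ = _ := by ring
  have hH : (n : ℝ) < 4 * k * ((n / (4 * k) : ℕ) + 1) := by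
    have := Nat.lt_mul_div_succ n (show 0 < 4 * k by omega)
    exact_mod_cast this
  set H : ℝ := ((n / (4 * k) : ℕ) : ℝ) with hHdef
  have hH0 : 0 ≤ H := Nat.cast_nonneg _
  have hLkt : 64 * k ≤ L * k * t := by
    have e1 : 64 * k * 1 ≤ L * k * t := by gcongr
    linarith
  have hH8 : (n : ℝ) ≤ 8 * k * H := by nlinarith
  have hlow : H / L ≤ H * ∏ p ∈ primesTo (level B n), (1 - ((omegaSet E p).card : ℝ) / p) := by
    rw [div_eq_mul_inv]
    exact mul_le_mul_of_nonneg_left (hexp.trans hprod) hH0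
  have hk2 := (abs_le.1 key).1
  have hLsq : H / L ^ 2 ≤ H / L / 4 := by
    rw [sq, ← div_div]
    gcongr
    linarith
  have ht4 : t ≤ H / L / 4 := by
    rw [div_div, le_div_iff₀ (by positivity)]
    have : k * (t * (L * 4)) ≤ k * H := by nlinarith
    exact le_of_mul_le_mul_left this hk0
  have hcount : H / L / 2 ≤ (X.card : ℝ) := by
    have : H / L - H / L ^ 2 - t ≤ (X.card : ℝ) := by linarith
    linarith
  have : H ≤ 2 * L * X.card := by
    rw [div_div, div_le_iff₀ (by positivity)] at hcount
    linarith
  have := mul_le_mul_of_nonneg_left this (show 0 ≤ 8 * (k : ℝ) by positivity)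
  exact ⟨X, filter_subset _ _, by linarith, fun y hy => (mem_filter.1 hy).2⟩

theorem sum_linear_le {k b n : ℕ} (hk : 0 < k) {F : ℕ → ℝ} (hF : ∀ m, 0 ≤ F m) (X : Finset ℕ)
    (hX : ∀ x ∈ X, 1 ≤ b + k * x ∧ b + k * x ≤ n) :
    ∑ x ∈ X, F (b + k * x) ≤ ∑ m ∈ Icc 1 n, F m := by
  rw [← sum_image (g := fun x => b + k * x) fun x _ y _ h =>
    Nat.eq_of_mul_eq_mul_left hk (Nat.add_left_cancel h)]
  refine sum_le_sum_of_subset_of_nonneg (fun m hm => ?_) fun _ _ _ => hF _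
  obtain ⟨x, hx, rfl⟩ := mem_image.1 hm
  exact mem_Icc.2 (hX x hx)

theorem one_le_model {w m : ℕ} (h : ∀ p ∈ primesTo w, ¬ p ∣ m) : 1 ≤ model w m := by
  rw [model, if_pos h]
  refine (one_le_inv₀ (sieveProd_pos w)).2 (prod_le_one (fun p _ => ?_) fun p _ => ?_)
  · exact sub_nonneg.2 (Nat.cast_inv_le_one p)
  · exact sub_le_self _ (by positivity)

theorem trip_model_ge (B : ℕ) (hB : 1 ≤ B) : ∃ N : ℕ, ∀ n ≥ N, Odd n → ∀ k : ℕ, 0 < k →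
    (k : ℝ) ≤ 2 * n ^ (1 / 5 : ℝ) → ∀ b₁ < k, ∀ b₂ < k, ∀ b₃ < k, b₁.Coprime k → b₂.Coprime k →
    b₃.Coprime k → (b₁ + b₂ + b₃) % k = n % k →
    (n : ℝ) ^ 2 ≤ (16 * k * Real.log n) ^ 2 * trip n k b₁ b₂ b₃ (model (level B n))
      (model (level B n)) (model (level B n)) := by
  obtain ⟨N1, h1⟩ := sieve_count_ge B
  obtain ⟨N2, h2⟩ := exists_le_log 4
  refine ⟨max N1 N2, fun n hn hodd k hk hkn b₁ hb₁ b₂ hb₂ b₃ hb₃ hc₁ hc₂ hc₃ hb => ?_⟩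
  simp only [ge_iff_le, max_le_iff] at hn
  have hL := h2 n hn.2
  have hw := two_le_level hB hL
  set w := level B n
  have h2w : 2 ∈ primesTo w := mem_primesTo.2 ⟨Nat.prime_two, hw⟩
  have hH := Nat.mul_div_le n (4 * k)
  set H := n / (4 * k)
  have hndvd : ∀ {p b : ℕ}, p ∈ primesTo w → b.Coprime k → p ∣ k → ¬ p ∣ b := fun hp hbk hpk hpb =>
    (mem_primesTo.1 hp).1.one_lt.ne' (Nat.eq_one_of_dvd_coprimes hbk hpb hpk)
  have hle1 : ∀ {p b : ℕ}, p ∈ primesTo w → (p ∣ k → ¬ p ∣ b) →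
      (omegaSet (fun p x => p ∣ b + k * x) p).card ≤ 1 := fun {p b} hp h => by
    by_cases hpk : p ∣ k
    · rw [card_omegaSet_linear_eq_zero hpk (h hpk)]
      exact zero_le_one
    · rw [card_omegaSet_linear (mem_primesTo.1 hp).1 hpk]
  obtain ⟨X, hXH, hX, hXr⟩ := h1 n hn.1 k hk hkn (fun p x => p ∣ b₁ + k * x) fun p hp =>
    ⟨dvd_linear_iff_mod b₁ k p, (hle1 hp (hndvd hp hc₁)).trans one_le_two,
      fun _ => hle1 hp (hndvd hp hc₁)⟩
  have hlt : ∀ {b x : ℕ}, b < k → x ∈ range H → 4 * (b + k * x) < n := fun {b x} hb hx => by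
    have hx := mem_range.1 hx
    have : k * (x + 1) ≤ k * H := Nat.mul_le_mul_left k hx
    nlinarith
  have hpos : ∀ {m : ℕ}, (∀ p ∈ primesTo w, ¬ p ∣ m) → 1 ≤ m := fun h =>
    Nat.one_le_iff_ne_zero.2 fun h0 => h 2 h2w (h0 ▸ dvd_zero 2)
  have hY : ∀ x ∈ X, ∃ Y ⊆ range H, (n : ℝ) ≤ 16 * k * Real.log n * Y.card ∧ ∀ y ∈ Y,
      (∀ p ∈ primesTo w, ¬ p ∣ b₂ + k * y) ∧
      ∀ p ∈ primesTo w, ¬ p ∣ n - (b₁ + k * x) - (b₂ + k * y) := by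
    intro x hx
    have hxH := hXH hx
    have hxr := hXr x hx
    have hm₁ := hlt hb₁ hxH
    set m₁ := b₁ + k * x with hm₁def
    set c := n - m₁ - b₂ with hc
    have hn4 := hlt hb₂ hxH
    have hnc : n = b₁ + b₂ + c + k * x := by
      have : b₂ ≤ b₂ + k * x := Nat.le_add_right _ _
      omega
    have hcmod : c ≡ b₃ [MOD k] := Nat.ModEq.add_left_cancel' (b₁ + b₂) (by
      rw [Nat.ModEq, hb]
      conv_rhs => rw [hnc]
      rw [Nat.add_mul_mod_self_left])
    have hcc : c.Coprime k := hcmod.gcd_eq.trans hc₃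
    have hcp : ∀ {p}, p ∈ primesTo w → p ∣ k → ¬ p ∣ c * (p - 1) := fun {p} hp hpk hd => by
      have hpp := (mem_primesTo.1 hp).1
      rcases hpp.dvd_mul.1 hd with h | h
      · exact hndvd hp hcc hpk h
      · have := Nat.le_of_dvd (by have := hpp.two_le; omega) h
        have := hpp.two_le
        omega
    obtain ⟨Y, hYH, hYc, hYr⟩ := h1 n hn.1 k hk hkn (fun p y => p ∣ b₂ + k * y ∨ p ∣ c * (p - 1) + k * y) fun p hp => by
      refine ⟨fun y => or_congr (dvd_linear_iff_mod _ _ _ _) (dvd_linear_iff_mod _ _ _ _), ?_, ?_⟩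
      · refine (card_le_card (t := omegaSet (fun q y => q ∣ b₂ + k * y) p ∪
          omegaSet (fun q y => q ∣ c * (p - 1) + k * y) p) fun y hy => ?_).trans
          ((card_union_le _ _).trans (add_le_add (hle1 hp (hndvd hp hc₂)) (hle1 hp (hcp hp))))
        simpa only [omegaSet, mem_union, mem_filter, ← and_or_left] using hy
      · rintro rfl
        refine (card_le_card (t := omegaSet (fun q y => q ∣ b₂ + k * y) 2) fun y hy => ?_).trans
          (hle1 hp (hndvd hp hc₂))
        simp only [omegaSet, mem_filter] at hy ⊢
        refine ⟨hy.1, hy.2.elim id fun h => ?_⟩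
        have h1 := hxr 2 hp
        have h2 := hodd.not_two_dvd_nat
        generalize k * y = z at h ⊢
        omega
    refine ⟨Y, hYH, hYc, fun y hy => ?_⟩
    have hyH := hYH hy
    replace hy := hYr y hy
    have hm₂ := hlt hb₂ hyH
    refine ⟨fun p hp h => hy p hp (Or.inl h), fun p hp h => hy p hp (Or.inr ?_)⟩
    obtain ⟨q, rfl⟩ := Nat.exists_eq_add_of_le' (mem_primesTo.1 hp).1.one_lt.le
    have h3 : c = n - m₁ - (b₂ + k * y) + k * y := by omega
    rw [Nat.add_sub_cancel, h3, show ∀ a z : ℕ, (a + z) * q + z = a * q + (q + 1) * z from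
      fun a z => by ring]
    exact (h.mul_right q).add (dvd_mul_right _ _)
  choose! Y hYH hYc hYr using hY
  have hg : ∀ m₁ m₂ m₃ : ℕ, 0 ≤ model w m₁ * model w m₂ * model w m₃ := fun m₁ m₂ m₃ =>
    mul_nonneg (mul_nonneg (model_nonneg _ _) (model_nonneg _ _)) (model_nonneg _ _)
  have hg' : ∀ (p : Prop) [Decidable p] (m₁ m₂ m₃ : ℕ),
      0 ≤ if p then model w m₁ * model w m₂ * model w m₃ else 0 := fun p _ m₁ m₂ m₃ => by
    split_ifs
    exacts [hg _ _ _, le_rfl]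
  have htrip : ∑ x ∈ X, ((Y x).card : ℝ) ≤
      trip n k b₁ b₂ b₃ (model w) (model w) (model w) := by
    refine le_trans (sum_le_sum fun x hx => ?_) (sum_linear_le hk (b := b₁)
      (fun _ => sum_nonneg fun _ _ => sum_nonneg fun _ _ => hg' _ _ _ _) X fun x hx => ?_)
    swap
    · have := hlt hb₁ (hXH hx)
      exact ⟨hpos (hXr x hx), by omega⟩
    have hm₁ := hlt hb₁ (hXH hx)
    rw [card_eq_sum_ones, Nat.cast_sum]
    refine le_trans (sum_le_sum fun y hy => ?_) (sum_linear_le hk (b := b₂)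
      (fun _ => sum_nonneg fun _ _ => hg' _ _ _ _) (Y x) fun y hy => ?_)
    swap
    · have := hlt hb₂ (hYH x hx hy)
      exact ⟨hpos (hYr x hx y hy).1, by omega⟩
    have hm₂ := hlt hb₂ (hYH x hx hy)
    obtain ⟨hr₂, hr₃⟩ := hYr x hx y hy
    set m₃ := n - (b₁ + k * x) - (b₂ + k * y) with hm₃
    have hn3 : b₁ + k * x + (b₂ + k * y) + m₃ = n := by omega
    have hb3 : m₃ % k = b₃ % k := Nat.ModEq.add_left_cancel' (b₁ + b₂) (by
      rw [Nat.ModEq, hb]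
      conv_rhs => rw [← hn3, show b₁ + k * x + (b₂ + k * y) + m₃ = b₁ + b₂ + m₃ + k * (x + y) by
        ring]
      rw [Nat.add_mul_mod_self_left])
    refine le_trans ?_ (single_le_sum (fun _ _ => hg' _ _ _ _) (mem_Icc.2 ⟨hpos hr₃,
      show m₃ ≤ n by omega⟩))
    rw [if_pos ⟨hn3, Nat.add_mul_mod_self_left _ _ _, Nat.add_mul_mod_self_left _ _ _, hb3⟩,
      Nat.cast_one]
    exact one_le_mul_of_one_le_of_one_le (one_le_mul_of_one_le_of_one_le
      (one_le_model (hXr x hx)) (one_le_model hr₂)) (one_le_model hr₃)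
  have hkL : 0 ≤ 16 * k * Real.log n := by positivity
  calc (n : ℝ) ^ 2 = n * n := sq _
    _ ≤ 16 * k * Real.log n * X.card * n := mul_le_mul_of_nonneg_right hX (Nat.cast_nonneg n)
    _ = 16 * k * Real.log n * ∑ x ∈ X, (n : ℝ) := by rw [sum_const, nsmul_eq_mul, mul_assoc]
    _ ≤ 16 * k * Real.log n * ∑ x ∈ X, 16 * k * Real.log n * (Y x).card :=
      mul_le_mul_of_nonneg_left (sum_le_sum fun x hx => hYc x hx) hkL
    _ = (16 * k * Real.log n) ^ 2 * ∑ x ∈ X, ((Y x).card : ℝ) := by rw [← mul_sum]; ring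
    _ ≤ _ := mul_le_mul_of_nonneg_left htrip (sq_nonneg _)

theorem le_of_forall_natCast_mul_le {x y C : ℝ} (h : ∀ M : ℕ, 1 ≤ M → M * x ≤ M * y + C) :
    x ≤ y := by
  by_contra! hxy
  obtain ⟨M, hM⟩ := exists_nat_gt (max C 0 / (x - y))
  rw [div_lt_iff₀ (sub_pos.2 hxy)] at hM
  have h1 := h (M + 1) (by omega)
  push_cast at h1
  linarith [le_max_left C 0]

open scoped Classical in
/-- The sieve over a complete residue system loses nothing. -/
theorem mul_prod_le_card {k : ℕ} (hk : k ≠ 0) {E : ℕ → ℕ → Prop}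
    (hE : ∀ p ∈ k.primeFactors, (∀ y, E p y ↔ E p (y % p)) ∧ (omegaSet E p).card ≤ 2) :
    k * ∏ p ∈ k.primeFactors, (1 - ((omegaSet E p).card : ℝ) / p) ≤
      ((range k).filter fun y => ∀ p ∈ k.primeFactors, ¬ E p y).card := by
  set P := k.primeFactors with hPdef
  set Z := (range k).filter fun y => ∀ p ∈ P, ¬ E p y with hZ
  set s := 6 * ∑ p ∈ P, (p : ℝ)⁻¹ with hs
  have hper : ∀ p ∈ P, ∀ y, E p y ↔ E p (y % k) := fun p hp y => by
    rw [(hE p hp).1 y, (hE p hp).1 (y % k), Nat.mod_mod_of_dvd _ (Nat.dvd_of_mem_primeFactors hp)]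
  have hcount : ∀ M : ℕ, ((range (k * M)).filter fun y => ∀ p ∈ P, ¬ E p y).card ≤ M * Z.card := by
    intro M
    rw [mul_comm M]
    conv_rhs => rw [← card_range M, ← card_product]
    refine card_le_card_of_injOn (fun y => (y % k, y / k)) (fun y hy => ?_) fun x _ y _ h => ?_
    · obtain ⟨h1, h2⟩ := mem_filter.1 hy
      refine mem_product.2 ⟨mem_filter.2 ⟨mem_range.2 (Nat.mod_lt _ (Nat.pos_of_ne_zero hk)),
        fun p hp => (hper p hp y).not.1 (h2 p hp)⟩,
        mem_range.2 (Nat.div_lt_of_lt_mul (mem_range.1 h1))⟩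
    · rw [Prod.mk.injEq] at h
      rw [← Nat.mod_add_div x k, ← Nat.mod_add_div y k, h.1, h.2]
  refine le_of_forall_natCast_mul_le (C := 2 * k * Real.exp s) fun R hR => ?_
  have h1 : k * ∏ p ∈ P, (1 - ((omegaSet E p).card : ℝ) / p) ≤
      Z.card + 2 * k * Real.exp (s - R) := by
    refine le_of_forall_natCast_mul_le (C := Real.exp 2 * ((P.card : ℝ) + 1) ^ R) fun M _ => ?_
    have h := abs_sieve_sub_le (k * M) (fun p hp => ⟨Nat.prime_of_mem_primeFactors hp,
      (hE p hp).1⟩) (fun p hp => (hE p hp).2) hR (Y := (P.card : ℝ) + 1) (by simp) (by linarith)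
    have h2 : (((range (k * M)).filter fun y => ∀ p ∈ P, ¬ E p y).card : ℝ) ≤ M * Z.card := by
      exact_mod_cast hcount M
    have h3 := (abs_le.1 h).1
    push_cast at h3
    linarith
  have h2 : R * Real.exp (s - R) ≤ Real.exp s := by
    rw [Real.exp_sub, mul_div_assoc', div_le_iff₀ (Real.exp_pos _), mul_comm]
    gcongr
    linarith [Real.add_one_le_exp (R : ℝ)]
  have h3 := mul_le_mul_of_nonneg_left h1 (Nat.cast_nonneg (α := ℝ) R)
  have h4 := mul_le_mul_of_nonneg_left h2 (show 0 ≤ 2 * (k : ℝ) by positivity)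
  linarith

theorem mul_exp_sq_le_card_admPairs {n k : ℕ} (hodd : Odd n) (hk : k ≠ 0) :
    (k * Real.exp (-(6 * ∑ p ∈ k.primeFactors, (p : ℝ)⁻¹))) ^ 2 ≤ (admPairs n k).card := by
  classical
  have hcop : ∀ b : ℕ, (∀ p ∈ k.primeFactors, ¬ p ∣ b) → b.Coprime k := fun b h =>
    Nat.coprime_of_dvd fun p hp hpb hpk => h p (Nat.mem_primeFactors.2 ⟨hp, hpk, hk⟩) hpb
  have hP : ∀ p ∈ k.primeFactors, p.Prime := fun p => Nat.prime_of_mem_primeFactors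
  have gen : ∀ E : ℕ → ℕ → Prop, (∀ p ∈ k.primeFactors, (∀ y, E p y ↔ E p (y % p)) ∧
      (omegaSet E p).card ≤ 2 ∧ (p = 2 → (omegaSet E p).card ≤ 1)) →
      ∃ Z ⊆ range k, k * Real.exp (-(6 * ∑ p ∈ k.primeFactors, (p : ℝ)⁻¹)) ≤ Z.card ∧
        ∀ y ∈ Z, ∀ p ∈ k.primeFactors, ¬ E p y := fun E hE =>
    ⟨_, filter_subset _ _, (mul_le_mul_of_nonneg_left (prod_one_sub_ge_exp
      (c := fun p => (omegaSet E p).card) hP (fun p hp => (hE p hp).2.1)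
      (fun hp => (hE 2 hp).2.2 rfl)) (Nat.cast_nonneg k)).trans
      (mul_prod_le_card hk fun p hp => ⟨(hE p hp).1, (hE p hp).2.1⟩),
      fun y hy => (mem_filter.1 hy).2⟩
  have hmod : ∀ (a : ℤ) (p y : ℕ), (p : ℤ) ∣ a - y ↔ (p : ℤ) ∣ a - (y % p : ℕ) := fun a p y => by
    conv_lhs => rw [← Nat.mod_add_div y p, Nat.cast_add, Nat.cast_mul, ← sub_sub]
    exact dvd_sub_left (dvd_mul_right _ _)
  have hone : ∀ (a : ℤ) (p : ℕ), (omegaSet (fun p y => (p : ℤ) ∣ a - y) p).card ≤ 1 :=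
    fun a p => card_le_one.2 fun x hx y hy => by
      simp only [omegaSet, mem_filter, mem_range] at hx hy
      have h := dvd_sub hy.2 hx.2
      have := Int.eq_zero_of_abs_lt_dvd h (abs_lt.2 (by omega))
      omega
  set δ := k * Real.exp (-(6 * ∑ p ∈ k.primeFactors, (p : ℝ)⁻¹)) with hδ
  have hδ0 : 0 ≤ δ := by positivity
  obtain ⟨Z, hZk, hZ, hZr⟩ := gen (fun p y => (p : ℤ) ∣ 0 - y) fun p _ =>
    ⟨hmod 0 p, (hone 0 p).trans one_le_two, fun _ => hone 0 p⟩
  have h2 : ∀ b ∈ Z, ∃ Y ⊆ range k, δ ≤ Y.card ∧ ∀ y ∈ Y, ∀ p ∈ k.primeFactors,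
      ¬ ((p : ℤ) ∣ 0 - (y : ℤ) ∨ (p : ℤ) ∣ (n : ℤ) - b - (y : ℤ)) := by
    intro b hb
    have hb := hZr b hb
    refine gen (fun p y => (p : ℤ) ∣ 0 - y ∨ (p : ℤ) ∣ (n : ℤ) - b - y) fun p hp =>
      ⟨fun y => or_congr (hmod _ _ _) (hmod _ _ _), ?_, ?_⟩
    · refine (card_le_card (t := omegaSet (fun p y => (p : ℤ) ∣ 0 - y) p ∪
        omegaSet (fun p y => (p : ℤ) ∣ (n : ℤ) - b - y) p) fun y hy => ?_).trans
        ((card_union_le _ _).trans (add_le_add (hone _ p) (hone _ p)))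
      simpa only [omegaSet, mem_union, mem_filter, ← and_or_left] using hy
    · rintro rfl
      refine (card_le_card (t := omegaSet (fun p y => (p : ℤ) ∣ 0 - y) 2) fun y hy => ?_).trans
        (hone 0 2)
      simp only [omegaSet, mem_filter] at hy ⊢
      have h1 := hb 2 hp
      have h2 := hodd.not_two_dvd_nat
      refine ⟨hy.1, hy.2.elim id fun h => ?_⟩
      push_cast at h1 h ⊢
      omega
  choose! Y hYk hY hYr using h2
  have h3 : (Z.sigma Y).card ≤ (admPairs n k).card := by
    refine card_le_card_of_injOn (fun x => (x.1, x.2)) (fun x hx => ?_) fun x _ y _ h => ?_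
    · obtain ⟨hx1, hx2⟩ := mem_sigma.1 hx
      have h1 := hZr _ hx1
      have h2 := hYr _ hx1 _ hx2
      simp only [not_or, zero_sub, dvd_neg, Int.natCast_dvd] at h1 h2
      simp only [admPairs, redRes, coe_filter, Set.mem_ofPred_eq, mem_product, mem_filter]
      exact ⟨⟨⟨hZk hx1, hcop _ h1⟩, ⟨hYk _ hx1 hx2, hcop _ fun p hp => (h2 p hp).1⟩⟩,
        hcop _ fun p hp => (h2 p hp).2⟩
    · rw [Prod.mk.injEq] at h
      exact Sigma.ext h.1 (heq_of_eq h.2)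
  calc δ ^ 2 = δ * δ := sq _
    _ ≤ Z.card * δ := mul_le_mul_of_nonneg_right hZ hδ0
    _ = ∑ b ∈ Z, δ := by rw [sum_const, nsmul_eq_mul]
    _ ≤ ∑ b ∈ Z, ((Y b).card : ℝ) := sum_le_sum fun b hb => hY b hb
    _ ≤ _ := by
      rw [card_sigma] at h3
      exact_mod_cast h3

theorem sq_le_card_admPairs : ∃ N : ℕ, ∀ n ≥ N, Odd n → ∀ k : ℕ, k ≠ 0 → k ≤ n →
    (k : ℝ) ^ 2 ≤ Real.log n ^ 4 * (admPairs n k).card := by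
  obtain ⟨N1, h1⟩ := sieve_params 0 1
  obtain ⟨N2, h2⟩ := exists_le_log (Real.exp 12)
  refine ⟨max N1 N2, fun n hn hodd k hk hkn => ?_⟩
  simp only [ge_iff_le, max_le_iff] at hn
  have hL := h2 n hn.2
  have h0 := (h1 n hn.1).2.1
  set L := Real.log n with hLdef
  set w := level 1 n with hw
  have hL0 : 0 < L := (Real.exp_pos _).trans_le hL
  have hsum : ∑ p ∈ k.primeFactors, (p : ℝ)⁻¹ ≤ ∑ p ∈ primesTo w, (p : ℝ)⁻¹ + 2 := by
    rw [← sum_filter_add_sum_filter_not k.primeFactors (fun p => p ≤ w)]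
    refine add_le_add (sum_le_sum_of_subset_of_nonneg (fun p hp => ?_) fun _ _ _ => by
      positivity) ?_
    · have hp := mem_filter.1 hp
      exact mem_primesTo.2 ⟨Nat.prime_of_mem_primeFactors hp.1, hp.2⟩
    · calc _ ≤ ∑ p ∈ k.primeFactors.filter (fun p => ¬ p ≤ w), L⁻¹ := by
            refine sum_le_sum fun p hp => inv_anti₀ hL0 ?_
            have := Nat.lt_of_floor_lt (not_le.1 (mem_filter.1 hp).2)
            rw [pow_one] at this
            exact this.le
        _ ≤ k.primeFactors.card * L⁻¹ := by
            rw [sum_const, nsmul_eq_mul]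
            gcongr
            exact filter_subset _ _
        _ ≤ 2 * L * L⁻¹ := by
            refine mul_le_mul_of_nonneg_right ((card_primeFactors_le_log hk).trans ?_)
              (inv_pos.2 hL0).le
            have : Real.log k ≤ L := Real.log_le_log (by positivity) (by exact_mod_cast hkn)
            linarith
        _ = 2 := by field_simp
  refine le_trans ?_ (mul_le_mul_of_nonneg_left (mul_exp_sq_le_card_admPairs hodd hk)
    (pow_nonneg hL0.le 4))
  have h1 : Real.exp (6 * ∑ p ∈ k.primeFactors, (p : ℝ)⁻¹) ≤ L ^ 2 := by
    calc _ ≤ Real.exp (6 * ∑ p ∈ primesTo w, (p : ℝ)⁻¹ + 12) :=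
          Real.exp_le_exp.2 (by linarith)
      _ ≤ L * L := by
          rw [Real.exp_add]
          exact mul_le_mul h0 hL (Real.exp_pos _).le hL0.le
      _ = _ := (sq L).symm
  rw [mul_pow, mul_left_comm, Real.exp_neg]
  refine le_mul_of_one_le_right (sq_nonneg _) ?_
  rw [show L ^ 4 = (L ^ 2) ^ 2 by ring, ← mul_pow]
  exact one_le_pow₀ (by rwa [← div_eq_mul_inv, one_le_div (Real.exp_pos _)])

theorem R3_eq_trip (n k b₁ b₂ b₃ : ℕ) :
    R3 n k b₁ b₂ b₃ = trip n k b₁ b₂ b₃ primeLog primeLog primeLog := by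
  refine sum_congr rfl fun x _ => sum_congr rfl fun y _ => sum_congr rfl fun z _ => ?_
  unfold primeLog
  by_cases hx : x.Prime <;> by_cases hy : y.Prime <;> by_cases hz : z.Prime <;> simp [hx, hy, hz]

theorem bthree_spec {n k b₁ b₂ : ℕ} (hk : 0 < k) (h : Int.gcd ((n : ℤ) - b₁ - b₂) k = 1) :
    bthree n k b₁ b₂ < k ∧ (bthree n k b₁ b₂).Coprime k ∧
      (b₁ + b₂ + bthree n k b₁ b₂) % k = n % k := by
  have hk' : (0 : ℤ) < k := by exact_mod_cast hk
  have hb : (bthree n k b₁ b₂ : ℤ) = ((n : ℤ) - b₁ - b₂) % k :=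
    Int.toNat_of_nonneg (Int.emod_nonneg _ hk'.ne')
  refine ⟨?_, ?_, ?_⟩
  · have := Int.emod_lt_of_pos ((n : ℤ) - b₁ - b₂) hk'
    omega
  · rw [← Nat.isCoprime_iff_coprime, hb, Int.emod_def, sub_eq_add_neg, ← mul_neg,
      IsCoprime.add_mul_left_left_iff, Int.isCoprime_iff_gcd_eq_one]
    exact h
  · refine (Int.natCast_modEq_iff (n := k)).1 ?_
    push_cast
    rw [hb]
    refine ((Int.mod_modEq _ _).add_left _).trans ?_
    rw [show (b₁ : ℤ) + b₂ + (n - b₁ - b₂) = n by ring]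

/-- A modulus with many unrepresented pairs contributes to the average deviation. -/
theorem card_le_sum_abs_trip {n k : ℕ} {c : ℝ} {g : ℕ → ℝ} (hk : 0 < k)
    (hg : ∀ b₁ < k, ∀ b₂ < k, ∀ b₃ < k, b₁.Coprime k → b₂.Coprime k → b₃.Coprime k →
      (b₁ + b₂ + b₃) % k = n % k → c ≤ trip n k b₁ b₂ b₃ g g g) :
    Tcount n k * c ≤ ∑ b₁ ∈ range k, ∑ b₂ ∈ range k, ∑ b₃ ∈ range k,
      |trip n k b₁ b₂ b₃ primeLog primeLog primeLog - trip n k b₁ b₂ b₃ g g g| := by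
  classical
  rw [← sum_product', Tcount, ← nsmul_eq_mul, ← sum_const]
  refine (sum_le_sum fun b hb => ?_).trans (sum_le_sum_of_subset_of_nonneg (f := fun b : ℕ × ℕ =>
    ∑ b₃ ∈ range k, |trip n k b.1 b.2 b₃ primeLog primeLog primeLog - trip n k b.1 b.2 b₃ g g g|)
    (fun b hb => ?_) fun _ _ _ => sum_nonneg fun _ _ => abs_nonneg _)
  · obtain ⟨hb, hR⟩ := mem_filter.1 hb
    simp only [admPairs, redRes, mem_filter, mem_product, mem_range] at hb
    obtain ⟨h1, h2, h3⟩ := bthree_spec hk hb.2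
    refine le_trans ?_ (single_le_sum (fun _ _ => abs_nonneg _) (mem_range.2 h1))
    rw [← R3_eq_trip, hR, zero_sub, abs_neg]
    exact (hg _ hb.1.1.1 _ hb.1.2.1 _ h1 hb.1.1.2 hb.1.2.2 h2 h3).trans (le_abs_self _)
  · have hb := (mem_filter.1 hb).1
    simp only [admPairs, redRes, mem_filter, mem_product] at hb ⊢
    exact ⟨hb.1.1.1, hb.1.2.1⟩

end TG

theorem stmt17 (A ε : ℝ) (hA : 0 < A) (hε : 0 < ε) :
    ∃ C > (0:ℝ), ∃ N : ℕ, ∀ n : ℕ, N ≤ n → Odd n →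
      ∀ D : ℝ, 1 ≤ D → D ≤ (n : ℝ) ^ ((1:ℝ)/5 - ε) →
      (((kRange D).filter (fun k =>
          (admPairs n k).card * Real.log n ^ (-A) ≤ (Tcount n k : ℝ))).card : ℝ)
        ≤ C * D * Real.log n ^ (-A) := by
  set a : ℕ := ⌈2 * A⌉₊ + 6 with ha
  obtain ⟨B, hB, N1, h1⟩ := TG.sum_tripSum_le a
  obtain ⟨N2, h2⟩ := TG.trip_model_ge B hB
  obtain ⟨N3, h3⟩ := TG.sq_le_card_admPairs
  obtain ⟨N4, h4⟩ := TG.exists_le_log 2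
  obtain ⟨N5, h5⟩ := TG.log_pow_mul_rpow_le 1 (δ := 1 / 5) (by norm_num)
  refine ⟨256, by norm_num, N1 + N2 + N3 + N4 + N5 + 1, fun n hn hodd D hD hDn => ?_⟩
  have hn1 : (1 : ℝ) ≤ n := by exact_mod_cast (show 1 ≤ n by omega)
  have hD5 : D ≤ (n : ℝ) ^ (1 / 5 : ℝ) :=
    hDn.trans (Real.rpow_le_rpow_of_exponent_le hn1 (by linarith))
  set K := (kRange D).filter (fun k =>
    (admPairs n k).card * Real.log n ^ (-A) ≤ (Tcount n k : ℝ)) with hK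
  have hKk : ∀ k ∈ K, 0 < k ∧ (k : ℝ) ≤ 2 * D := fun k hk => by
    have := (mem_filter.1 (mem_filter.1 hk).1).2
    exact ⟨by exact_mod_cast (by linarith [this.1] : (0 : ℝ) < k), this.2⟩
  have key := h1 n (by omega) D hD hD5 K hKk
  have hL := h4 n (by omega)
  have hLn := h5 n (by omega)
  set L := Real.log n with hLdef
  have hL0 : 0 < L := by linarith
  set g := TG.model (TG.level B n) with hg
  have hbad : ∀ k ∈ K, (n : ℝ) ^ 2 * L ^ (-A) / (256 * L ^ 6) ≤
      ∑ b₁ ∈ range k, ∑ b₂ ∈ range k, ∑ b₃ ∈ range k,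
        |TG.trip n k b₁ b₂ b₃ TG.primeLog TG.primeLog TG.primeLog -
          TG.trip n k b₁ b₂ b₃ g g g| := by
    intro k hk
    obtain ⟨hk0, hk2⟩ := hKk k hk
    have hk5 : (k : ℝ) ≤ 2 * n ^ (1 / 5 : ℝ) := by linarith
    have hk0' : (0 : ℝ) < k := by exact_mod_cast hk0
    have hkn : k ≤ n := by
      have : (k : ℝ) ≤ n := by
        rw [pow_one] at hLn
        refine (hk5.trans ?_).trans hLn
        gcongr
      exact_mod_cast this
    refine le_trans ?_ (TG.card_le_sum_abs_trip (c := (n : ℝ) ^ 2 / (16 * k * L) ^ 2) hk0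
      fun b₁ hb₁ b₂ hb₂ b₃ hb₃ hc₁ hc₂ hc₃ hb => ?_)
    · have e1 := h3 n (by omega) hodd k hk0.ne' hkn
      have e2 := (mem_filter.1 hk).2
      have e3 : 0 < L ^ (-A) := Real.rpow_pos_of_pos hL0 _
      calc (n : ℝ) ^ 2 * L ^ (-A) / (256 * L ^ 6) =
          k ^ 2 / L ^ 4 * L ^ (-A) * (n ^ 2 / (16 * k * L) ^ 2) := by
            generalize L ^ (-A) = z
            field_simp
            ring
        _ ≤ (admPairs n k).card * L ^ (-A) * (n ^ 2 / (16 * k * L) ^ 2) := by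
            gcongr
            rwa [div_le_iff₀' (by positivity)]
        _ ≤ _ := by gcongr
    · rw [div_le_iff₀' (by positivity)]
      exact h2 n (by omega) hodd k hk0 hk5 b₁ hb₁ b₂ hb₂ b₃ hb₃ hc₁ hc₂ hc₃ hb
  have hsum := sum_le_sum hbad
  rw [sum_const, nsmul_eq_mul] at hsum
  have hfin := (mul_le_mul_of_nonneg_right hsum (pow_pos hL0 a).le).trans key
  have hpow : L ^ 6 ≤ L ^ (-A) * L ^ (-A) * L ^ a := by
    rw [← Real.rpow_natCast L a, ← Real.rpow_add hL0, ← Real.rpow_add hL0, ← Real.rpow_natCast]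
    refine Real.rpow_le_rpow_of_exponent_le (by linarith) ?_
    have := Nat.le_ceil (2 * A)
    rw [ha]
    push_cast
    linarith
  have hz : 0 < L ^ (-A) := Real.rpow_pos_of_pos hL0 _
  generalize L ^ (-A) = z at hz hpow hfin ⊢
  have hn2 : (0 : ℝ) < n ^ 2 := by positivity
  have h6 : (K.card : ℝ) * z * L ^ a ≤ 256 * D * L ^ 6 := by
    have e : (K.card : ℝ) * (n ^ 2 * z / (256 * L ^ 6)) * L ^ a =
        n ^ 2 * (K.card * z * L ^ a / (256 * L ^ 6)) := by ring
    rw [e, mul_comm D] at hfin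
    have := le_of_mul_le_mul_left hfin hn2
    rw [div_le_iff₀ (by positivity)] at this
    linarith
  have h7 : (K.card : ℝ) * z * L ^ a ≤ 256 * D * z * (z * L ^ a) := by
    refine h6.trans ?_
    rw [mul_assoc _ z, ← mul_assoc z]
    exact mul_le_mul_of_nonneg_left hpow (by linarith)
  rw [mul_assoc] at h7
  exact le_of_mul_le_mul_right h7 (by positivity)

end
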